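/- There exist a₀ ∈ (0,1), λ₀ ≥ 8 and a constant C, depending only on the cutoffs, such that for all 0 < h ≤ 1 and 0 < a ≤ a₀ with λ = a^{3/2}/h ≥ λ₀, all X ≥ 0, Y ∈ ℝ and all T with |T| ≤ 2a^{−1/2}: (i) for every integer N with λ^{1/3} ≤ |N| ≤ λ, |W_{N,a}(T,X,Y)| ≤ C h^{1/3} h^{−2} / ((|N|/λ^{1/3})^{1/2} + (|N|·|T−4N|)^{1/4}); (ii) for every integer N with λ ≤ |N| ≤ 2a^{−1/2}, |W_{N,a}(T,X,Y)| ≤ C h^{1/3} λ^{2/3} / (h² |N|). -/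

import Mathlib

open Real Complex Filter MeasureTheory

/-- `A₊(z) = e^{-iπ/3} Ai(e^{-iπ/3} z)`. -/
noncomputable def Aplus (Ai : ℂ → ℂ) (z : ℂ) : ℂ :=
  Complex.exp (-(Real.pi / 3 : ℂ) * Complex.I) * Ai (Complex.exp (-(Real.pi / 3 : ℂ) * Complex.I) * z)

/-- `A₋(z) = e^{iπ/3} Ai(e^{iπ/3} z)`. -/
noncomputable def Aminus (Ai : ℂ → ℂ) (z : ℂ) : ℂ :=
  Complex.exp ((Real.pi / 3 : ℂ) * Complex.I) * Ai (Complex.exp ((Real.pi / 3 : ℂ) * Complex.I) * z)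

/-- `B(u) = (4/3)u + π/2 − L(u^{2/3})`. -/
noncomputable def Bfun (L : ℝ → ℝ) (u : ℝ) : ℝ :=
  (4/3) * u + Real.pi / 2 - L (u ^ ((2 : ℝ)/3))

/-- The phase `Ψ_{N,a}(T,X,Y,Υ,S,A,η)` of the tangential reflected waves, with `λ = a^{3/2}/h`. -/
noncomputable def PsiTan (L : ℝ → ℝ) (h a : ℝ) (N : ℤ) (T X Y Υ S A η : ℝ) : ℝ :=
  η * (Y + Υ ^ 3 / 3 + Υ * (X - A) + S ^ 3 / 3 + S * (1 - A)
      + T * Real.sqrt (1 + a) * (A - 1) / (Real.sqrt (1 + a * A) + Real.sqrt (1 + a))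
      - (4/3) * (N : ℝ) * A ^ ((3:ℝ)/2))
    + ((N : ℝ) / (a ^ ((3:ℝ)/2) / h)) * Bfun L (η * (a ^ ((3:ℝ)/2) / h) * A ^ ((3:ℝ)/2))

/-- The `N`-th tangential reflected wave `W_{N,a}(T,X,Y)`; the integration variables are
`S = v.1`, `Υ = v.2.1`, `A = v.2.2.1`, `η = v.2.2.2`. -/
noncomputable def Wtan (L : ℝ → ℝ) (ψ : ℝ → ℝ) (χ₂ : ℝ × ℝ → ℝ) (ψ₃ : ℝ → ℝ)
    (h a : ℝ) (N : ℤ) (T X Y : ℝ) : ℂ :=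
  ((a ^ 2 / (2 * Real.pi * h) ^ 3 : ℝ) : ℂ) * ∫ v : ℝ × ℝ × ℝ × ℝ,
    Complex.exp (Complex.I *
      (((a ^ ((3:ℝ)/2) / h) * PsiTan L h a N T X Y v.2.1 v.1 v.2.2.1 v.2.2.2 : ℝ) : ℂ)) *
    ((v.2.2.2 ^ 2 * ψ v.2.2.2 * χ₂ (v.1, v.2.1) * ψ₃ v.2.2.1 : ℝ) : ℂ)

/-- `G^♯(T,X,Y) = Σ_{|N| ≤ 2a^{−1/2}} W_{N,a}(T,X,Y)`. -/
noncomputable def Gsharp (L : ℝ → ℝ) (ψ : ℝ → ℝ) (χ₂ : ℝ × ℝ → ℝ) (ψ₃ : ℝ → ℝ)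
    (h a : ℝ) (T X Y : ℝ) : ℂ :=
  ∑' N : ℤ, Set.indicator {N : ℤ | |(N : ℝ)| ≤ 2 / Real.sqrt a}
    (fun N => Wtan L ψ χ₂ ψ₃ h a N T X Y) N

section Estimates

open Set
open scoped ContDiff
open Function (uncurry)
open intervalIntegral (integral_congr integral_add_adjacent_intervals
  integral_eq_sub_of_hasDerivAt)

/-- Differentiation of an interval integral depending on a parameter. -/
theorem hasDerivAt_intervalIntegral_param {F F' : ℝ → ℝ → ℂ} {U : Set ℝ} (hU : IsOpen U)
    {a b x₀ : ℝ} (hab : a ≤ b) (hx₀ : x₀ ∈ U)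
    (hF : ContinuousOn (uncurry F) (U ×ˢ Icc a b))
    (hF' : ContinuousOn (uncurry F') (U ×ˢ Icc a b))
    (hd : ∀ x ∈ U, ∀ t ∈ Icc a b, HasDerivAt (fun y => F y t) (F' x t) x) :
    HasDerivAt (fun x => ∫ t in a..b, F x t) (∫ t in a..b, F' x₀ t) x₀ := by
  obtain ⟨r, hr, hrU⟩ := Metric.isOpen_iff.1 hU x₀ hx₀
  set V := Metric.closedBall x₀ (r / 2)
  have hVU : V ⊆ U := (Metric.closedBall_subset_ball (by linarith)).trans hrU
  have hVnhds : V ∈ nhds x₀ := Metric.closedBall_mem_nhds x₀ (by linarith)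
  have hsec : ∀ {G : ℝ → ℝ → ℂ}, ContinuousOn (uncurry G) (U ×ˢ Icc a b) →
      ∀ x ∈ U, ContinuousOn (G x) (Icc a b) := by
    intro G hG x hx
    exact hG.comp (f := fun t => (x, t)) (by fun_prop) (fun t ht => ⟨hx, ht⟩)
  have hcpt : IsCompact (V ×ˢ Icc a b) := (isCompact_closedBall x₀ (r/2)).prod isCompact_Icc
  obtain ⟨K, hK⟩ := hcpt.exists_bound_of_continuousOn (hF'.mono (prod_mono hVU le_rfl))
  refine (intervalIntegral.hasDerivAt_integral_of_dominated_loc_of_deriv_le (F := F) (F' := F')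
    (bound := fun _ => K) (s := V) hVnhds ?_ ?_ ?_ ?_ ?_ ?_).2
  · filter_upwards [hVnhds] with x hx
    rw [uIoc_of_le hab]
    exact ((hsec hF x (hVU hx)).mono Ioc_subset_Icc_self).aestronglyMeasurable measurableSet_Ioc
  · exact (hsec hF x₀ hx₀).intervalIntegrable_of_Icc hab
  · rw [uIoc_of_le hab]
    exact ((hsec hF' x₀ hx₀).mono Ioc_subset_Icc_self).aestronglyMeasurable measurableSet_Ioc
  · refine Eventually.of_forall fun t ht x hx => ?_
    rw [uIoc_of_le hab] at ht
    exact hK (x, t) ⟨hx, Ioc_subset_Icc_self ht⟩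
  · exact intervalIntegrable_const
  · refine Eventually.of_forall fun t ht x hx => ?_
    rw [uIoc_of_le hab] at ht
    exact hd x (hVU hx) t (Ioc_subset_Icc_self ht)

/-- Integration by parts against a nonvanishing monotone factor `g`. -/
theorem norm_integral_le_of_ibp {R₀ R₁ R₂ : ℝ → ℂ} {g g' : ℝ → ℝ} {a b m K₁ K₂ : ℝ}
    (hab : a ≤ b) (hm : 0 < m)
    (hR₁ : ∀ x ∈ Icc a b, HasDerivAt R₁ (g x * R₀ x + R₂ x) x)
    (hg : ∀ x ∈ Icc a b, HasDerivAt g (g' x) x)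
    (hR₀c : ContinuousOn R₀ (Icc a b)) (hR₂c : ContinuousOn R₂ (Icc a b))
    (hg'c : ContinuousOn g' (Icc a b))
    (hgm : (∀ x ∈ Icc a b, m ≤ g x) ∨ (∀ x ∈ Icc a b, g x ≤ -m))
    (hg' : (∀ x ∈ Icc a b, 0 ≤ g' x) ∨ (∀ x ∈ Icc a b, g' x ≤ 0))
    (hK₁ : ∀ x ∈ Icc a b, ‖R₁ x‖ ≤ K₁) (hK₂ : ∀ x ∈ Icc a b, ‖R₂ x‖ ≤ K₂) :
    ‖∫ x in a..b, R₀ x‖ ≤ 3 * K₁ / m + K₂ * (b - a) / m := by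
  have ha : a ∈ Icc a b := left_mem_Icc.2 hab
  have hb : b ∈ Icc a b := right_mem_Icc.2 hab
  have hu : uIcc a b = Icc a b := uIcc_of_le hab
  have hgabs : ∀ x ∈ Icc a b, m ≤ |g x| := by
    intro x hx
    rcases hgm with h | h
    · exact (h x hx).trans (le_abs_self _)
    · have := h x hx
      rw [abs_of_neg (by linarith)]; linarith
  have hg0 : ∀ x ∈ Icc a b, g x ≠ 0 := fun x hx => abs_pos.1 (hm.trans_le (hgabs x hx))
  have hgc : ContinuousOn g (Icc a b) := fun x hx => (hg x hx).continuousAt.continuousWithinAt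
  have hR₁c : ContinuousOn R₁ (Icc a b) := fun x hx => (hR₁ x hx).continuousAt.continuousWithinAt
  have hgcC : ContinuousOn (fun x => (g x : ℂ)) (Icc a b) :=
    continuous_ofReal.comp_continuousOn hgc
  have hg'cC : ContinuousOn (fun x => (g' x : ℂ)) (Icc a b) :=
    continuous_ofReal.comp_continuousOn hg'c
  have hg0C : ∀ x ∈ Icc a b, (g x : ℂ) ≠ 0 := fun x hx => by exact_mod_cast hg0 x hx
  have hK₁0 : 0 ≤ K₁ := (norm_nonneg _).trans (hK₁ a ha)
  have hK₂0 : 0 ≤ K₂ := (norm_nonneg _).trans (hK₂ a ha)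
  -- the fundamental theorem applied to `R₁ / g`
  have hFTC : ∫ x in a..b, (R₀ x + (R₂ x / g x - g' x * R₁ x / (g x) ^ 2)) =
      R₁ b / g b - R₁ a / g a := by
    refine integral_eq_sub_of_hasDerivAt (f := fun x => R₁ x / g x) ?_ ?_
    · intro x hx
      rw [hu] at hx
      have h1 := (hR₁ x hx).div (hg x hx).ofReal_comp (hg0C x hx)
      refine h1.congr_deriv ?_
      have := hg0C x hx
      field_simp
      ring
    · apply ContinuousOn.intervalIntegrable
      rw [hu]
      exact hR₀c.add ((hR₂c.div hgcC hg0C).sub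
        ((hg'cC.mul hR₁c).div (hgcC.pow 2) (fun x hx => pow_ne_zero 2 (hg0C x hx))))
  have hi1 : IntervalIntegrable R₀ volume a b := hR₀c.intervalIntegrable_of_Icc hab
  have hi2 : IntervalIntegrable (fun x => R₂ x / g x) volume a b :=
    (hR₂c.div hgcC hg0C).intervalIntegrable_of_Icc hab
  have hi3 : IntervalIntegrable (fun x => g' x * R₁ x / (g x : ℂ) ^ 2) volume a b :=
    ((hg'cC.mul hR₁c).div (hgcC.pow 2)
      (fun x hx => pow_ne_zero 2 (hg0C x hx))).intervalIntegrable_of_Icc hab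
  rw [intervalIntegral.integral_add hi1 (hi2.sub hi3), intervalIntegral.integral_sub hi2 hi3]
    at hFTC
  have hreal : ∫ x in a..b, g' x / (g x) ^ 2 = (g a)⁻¹ - (g b)⁻¹ := by
    rw [integral_eq_sub_of_hasDerivAt (f := fun x => -(g x)⁻¹)]
    · ring
    · intro x hx
      rw [hu] at hx
      exact ((hg x hx).inv (hg0 x hx)).neg.congr_deriv (by ring)
    · exact (hg'c.div (hgc.pow 2)
        (fun x hx => pow_ne_zero 2 (hg0 x hx))).intervalIntegrable_of_Icc hab
  have hinv : ∀ x ∈ Icc a b, |(g x)⁻¹| ≤ 1 / m := by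
    intro x hx
    rw [abs_inv, one_div]
    exact inv_anti₀ hm (hgabs x hx)
  have hdiff : |(g a)⁻¹ - (g b)⁻¹| ≤ 1 / m := by
    have h1 := hinv a ha
    have h2 := hinv b hb
    rcases hgm with h | h
    · have p1 : 0 < (g a)⁻¹ := inv_pos.2 (hm.trans_le (h a ha))
      have p2 : 0 < (g b)⁻¹ := inv_pos.2 (hm.trans_le (h b hb))
      rw [abs_of_pos p1] at h1
      rw [abs_of_pos p2] at h2
      rw [abs_le]; constructor <;> linarith
    · have p1 : (g a)⁻¹ < 0 := inv_lt_zero.2 (by linarith [h a ha])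
      have p2 : (g b)⁻¹ < 0 := inv_lt_zero.2 (by linarith [h b hb])
      rw [abs_of_neg p1] at h1
      rw [abs_of_neg p2] at h2
      rw [abs_le]; constructor <;> linarith
  have hvar : ∫ x in a..b, |g' x| / (g x) ^ 2 ≤ 1 / m := by
    rcases hg' with h | h
    · rw [integral_congr (g := fun x => g' x / (g x) ^ 2), hreal]
      · exact (le_abs_self _).trans hdiff
      · intro x hx
        rw [hu] at hx
        simp only [abs_of_nonneg (h x hx)]
    · rw [integral_congr (g := fun x => -(g' x / (g x) ^ 2)),
        intervalIntegral.integral_neg, hreal]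
      · exact (neg_le_abs _).trans hdiff
      · intro x hx
        rw [hu] at hx
        simp only [abs_of_nonpos (h x hx)]
        ring
  have hb1 : ∀ x ∈ Icc a b, ‖R₁ x / g x‖ ≤ K₁ / m := by
    intro x hx
    rw [norm_div, norm_real, Real.norm_eq_abs]
    exact div_le_div₀ hK₁0 (hK₁ x hx) hm (hgabs x hx)
  have hb2 : ‖∫ x in a..b, R₂ x / g x‖ ≤ K₂ * (b - a) / m := by
    have := intervalIntegral.norm_integral_le_of_norm_le_const (a := a) (b := b)
      (f := fun x => R₂ x / (g x : ℂ)) (C := K₂ / m) ?_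
    · rw [abs_of_nonneg (by linarith)] at this
      calc _ ≤ _ := this
        _ = _ := by ring
    · intro x hx
      rw [uIoc_of_le hab] at hx
      have hx' := Ioc_subset_Icc_self hx
      rw [norm_div, norm_real, Real.norm_eq_abs]
      exact div_le_div₀ hK₂0 (hK₂ x hx') hm (hgabs x hx')
  have hb3 : ‖∫ x in a..b, g' x * R₁ x / (g x : ℂ) ^ 2‖ ≤ K₁ / m := by
    calc ‖∫ x in a..b, g' x * R₁ x / (g x : ℂ) ^ 2‖
        ≤ ∫ x in a..b, K₁ * (|g' x| / (g x) ^ 2) := by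
          refine intervalIntegral.norm_integral_le_of_norm_le hab ?_ ?_
          · refine Eventually.of_forall fun x hx => ?_
            have hx' := Ioc_subset_Icc_self hx
            rw [norm_div, norm_mul, norm_pow, norm_real, norm_real,
              Real.norm_eq_abs, Real.norm_eq_abs, sq_abs]
            rw [mul_comm |g' x|, mul_div_assoc]
            exact mul_le_mul_of_nonneg_right (hK₁ x hx') (by positivity)
          · apply ContinuousOn.intervalIntegrable_of_Icc hab
            exact continuousOn_const.mul (hg'c.abs.div (hgc.pow 2)
              (fun x hx => pow_ne_zero 2 (hg0 x hx)))
      _ = K₁ * ∫ x in a..b, |g' x| / (g x) ^ 2 := by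
          rw [intervalIntegral.integral_const_mul]
      _ ≤ K₁ * (1 / m) := mul_le_mul_of_nonneg_left hvar hK₁0
      _ = K₁ / m := by ring
  have hfin : ∫ x in a..b, R₀ x = R₁ b / g b - R₁ a / g a - (∫ x in a..b, R₂ x / g x)
      + ∫ x in a..b, g' x * R₁ x / (g x : ℂ) ^ 2 := by
    rw [← hFTC]; ring
  rw [hfin]
  calc _ ≤ ‖R₁ b / g b‖ + ‖R₁ a / g a‖ + ‖∫ x in a..b, R₂ x / g x‖ +
        ‖∫ x in a..b, g' x * R₁ x / (g x : ℂ) ^ 2‖ := by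
        refine (norm_add_le _ _).trans ?_
        gcongr
        refine (norm_sub_le _ _).trans ?_
        gcongr
        exact norm_sub_le _ _
    _ ≤ K₁ / m + K₁ / m + K₂ * (b - a) / m + K₁ / m := by
        gcongr
        · exact hb1 b hb
        · exact hb1 a ha
    _ = _ := by ring

/-- Removing a window `|x - c| ≤ δ` from the domain of integration. -/
theorem norm_integral_le_of_window {f : ℝ → ℂ} {a b c δ K M : ℝ} (hab : a ≤ b) (hδ : 0 ≤ δ)
    (hM : 0 ≤ M) (hf : ContinuousOn f (Icc a b)) (hK : ∀ x ∈ Icc a b, ‖f x‖ ≤ K)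
    (hr : ∀ x y, a ≤ x → c + δ ≤ x → x ≤ y → y ≤ b → ‖∫ t in x..y, f t‖ ≤ M)
    (hl : ∀ x y, a ≤ x → x ≤ y → y ≤ c - δ → y ≤ b → ‖∫ t in x..y, f t‖ ≤ M) :
    ‖∫ t in a..b, f t‖ ≤ 2 * M + 2 * δ * K := by
  have hK0 : 0 ≤ K := (norm_nonneg _).trans (hK a (left_mem_Icc.2 hab))
  set p := max a (min b (c - δ))
  set q := max a (min b (c + δ))
  have hap : a ≤ p := le_max_left _ _
  have hpq : p ≤ q := max_le_max le_rfl (min_le_min le_rfl (by linarith))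
  have hqb : q ≤ b := max_le hab (min_le_left _ _)
  have hsplit : ∀ x y, a ≤ x → x ≤ y → y ≤ b → IntervalIntegrable f volume x y := fun x y h1 h2 h3 =>
    (hf.mono (Icc_subset_Icc h1 h3)).intervalIntegrable_of_Icc h2
  rw [← integral_add_adjacent_intervals (hsplit a q le_rfl (hap.trans hpq) hqb)
      (hsplit q b (hap.trans hpq) hqb le_rfl),
    ← integral_add_adjacent_intervals (hsplit a p le_rfl hap (hpq.trans hqb))
      (hsplit p q hap hpq hqb)]
  have h1 : ‖∫ t in a..p, f t‖ ≤ M := by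
    rcases le_total (c - δ) a with h | h
    · have : p = a := by simp only [p]; rw [max_eq_left]; exact (min_le_right _ _).trans h
      rw [this]; simpa using hM
    · refine hl a p le_rfl hap ?_ (hpq.trans hqb)
      exact max_le h (min_le_right _ _)
  have h3 : ‖∫ t in q..b, f t‖ ≤ M := by
    rcases le_total b (c + δ) with h | h
    · have : q = b := by simp only [q]; rw [min_eq_left h, max_eq_right hab]
      rw [this]; simpa using hM
    · refine hr q b (hap.trans hpq) ?_ hqb le_rfl
      simp only [q]
      rw [min_eq_right h]; exact le_max_right _ _
  have h2 : ‖∫ t in p..q, f t‖ ≤ K * |q - p| := by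
    refine intervalIntegral.norm_integral_le_of_norm_le_const fun x hx => ?_
    rw [uIoc_of_le hpq] at hx
    exact hK x ⟨hap.trans hx.1.le, hx.2.trans hqb⟩
  have h4 : |q - p| ≤ 2 * δ := by
    rw [abs_of_nonneg (by linarith)]
    simp only [p, q]
    rcases le_total b (c - δ) with h | h <;> rcases le_total b (c + δ) with h' | h' <;>
    rcases le_total a (c - δ) with h'' | h'' <;> rcases le_total a (c + δ) with h₃ | h₃ <;>
    simp only [min_eq_left, min_eq_right, max_eq_left, max_eq_right, h, h', h'', h₃, hab] <;>
    linarith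
  calc _ ≤ ‖∫ t in a..p, f t‖ + ‖∫ t in p..q, f t‖ + ‖∫ t in q..b, f t‖ := norm_add₃_le
    _ ≤ M + K * (2 * δ) + M := by gcongr; exact h2.trans (by gcongr)
    _ = _ := by ring

/-- A function with derivative at least `m > 0` is comparable with `x - c` for some `c`. -/
theorem exists_center_of_deriv_ge {g g' : ℝ → ℝ} {a b m : ℝ} (hab : a ≤ b)
    (hg : ∀ x ∈ Icc a b, HasDerivAt g (g' x) x) (hg' : ∀ x ∈ Icc a b, m ≤ g' x) :
    ∃ c ∈ Icc a b, (∀ x ∈ Icc a b, c ≤ x → m * (x - c) ≤ g x ∨ x = c) ∧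
      (∀ x ∈ Icc a b, x ≤ c → g x ≤ -(m * (c - x)) ∨ x = c) := by
  have hgc : ContinuousOn g (Icc a b) := fun x hx => (hg x hx).continuousAt.continuousWithinAt
  have hmono : ∀ x ∈ Icc a b, ∀ y ∈ Icc a b, x ≤ y → m * (y - x) ≤ g y - g x := by
    refine (convex_Icc a b).mul_sub_le_image_sub_of_le_deriv hgc ?_ ?_
    · intro x hx
      exact (hg x (interior_subset hx)).differentiableAt.differentiableWithinAt
    · intro x hx
      rw [(hg x (interior_subset hx)).deriv]
      exact hg' x (interior_subset hx)
  have ha : a ∈ Icc a b := left_mem_Icc.2 hab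
  have hb : b ∈ Icc a b := right_mem_Icc.2 hab
  by_cases h0 : 0 ≤ g a
  · refine ⟨a, ha, fun x hx hx' => Or.inl ?_, fun x hx hx' => Or.inr (le_antisymm hx' hx.1)⟩
    have := hmono a ha x hx hx'
    linarith
  by_cases h1 : g b ≤ 0
  · refine ⟨b, hb, fun x hx hx' => Or.inr (le_antisymm hx.2 hx'), fun x hx hx' => Or.inl ?_⟩
    have := hmono x hx b hb hx'
    linarith
  push Not at h0 h1
  obtain ⟨c, hc, hc0⟩ := intermediate_value_Icc hab hgc ⟨h0.le, h1.le⟩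
  refine ⟨c, hc, fun x hx hx' => Or.inl ?_, fun x hx hx' => Or.inl ?_⟩
  · have := hmono c hc x hx hx'
    linarith
  · have := hmono x hx c hc hx'
    linarith

/-- First derivative test. -/
theorem vdC_one {φ φ' φ'' : ℝ → ℝ} {a b m : ℝ} (hab : a ≤ b) (hm : 0 < m)
    (h1 : ∀ x ∈ Icc a b, HasDerivAt φ (φ' x) x) (h2 : ∀ x ∈ Icc a b, HasDerivAt φ' (φ'' x) x)
    (hc : ContinuousOn φ'' (Icc a b))
    (hφ' : (∀ x ∈ Icc a b, m ≤ φ' x) ∨ (∀ x ∈ Icc a b, φ' x ≤ -m))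
    (hφ'' : (∀ x ∈ Icc a b, 0 ≤ φ'' x) ∨ (∀ x ∈ Icc a b, φ'' x ≤ 0)) :
    ‖∫ x in a..b, cexp (I * (φ x : ℂ))‖ ≤ 3 / m := by
  have hφc : ContinuousOn φ (Icc a b) := fun x hx => (h1 x hx).continuousAt.continuousWithinAt
  have := norm_integral_le_of_ibp (R₀ := fun x => cexp (I * (φ x : ℂ)))
    (R₁ := fun x => -I * cexp (I * (φ x : ℂ))) (R₂ := fun _ => 0) (g := φ') (g' := φ'')
    (K₁ := 1) (K₂ := 0) hab hm ?_ h2 ?_ continuousOn_const hc hφ' hφ'' ?_ ?_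
  · simpa using this
  · intro x hx
    have h3 := (((h1 x hx).ofReal_comp.const_mul I).cexp).const_mul (-I)
    refine h3.congr_deriv ?_
    linear_combination (-(φ' x : ℂ) * cexp (I * (φ x : ℂ))) * Complex.I_sq
  · exact (continuousOn_const.mul (continuous_ofReal.comp_continuousOn hφc)).cexp
  · intro x _
    rw [norm_mul, mul_comm I, Complex.norm_exp_ofReal_mul_I]; simp
  · simp

theorem norm_integral_exp_neg (φ : ℝ → ℝ) (a b : ℝ) :
    ‖∫ x in a..b, cexp (I * ((-φ x : ℝ) : ℂ))‖ = ‖∫ x in a..b, cexp (I * (φ x : ℂ))‖ := by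
  rw [intervalIntegral.norm_intervalIntegral_eq, intervalIntegral.norm_intervalIntegral_eq,
    ← Complex.norm_conj (∫ x in uIoc a b, cexp (I * (φ x : ℂ))), ← integral_conj]
  congr 2
  funext x
  rw [← Complex.exp_conj]
  simp

theorem norm_exp_I_mul (x : ℝ) : ‖cexp (I * (x : ℂ))‖ = 1 := by
  rw [mul_comm, Complex.norm_exp_ofReal_mul_I]

/-- Second derivative test. -/
theorem vdC_two {φ φ' φ'' : ℝ → ℝ} {a b m : ℝ} (hab : a ≤ b) (hm : 0 < m)
    (h1 : ∀ x ∈ Icc a b, HasDerivAt φ (φ' x) x) (h2 : ∀ x ∈ Icc a b, HasDerivAt φ' (φ'' x) x)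
    (hc : ContinuousOn φ'' (Icc a b))
    (hφ'' : (∀ x ∈ Icc a b, m ≤ φ'' x) ∨ (∀ x ∈ Icc a b, φ'' x ≤ -m)) :
    ‖∫ x in a..b, cexp (I * (φ x : ℂ))‖ ≤ 8 / √m := by
  wlog hpos : ∀ x ∈ Icc a b, m ≤ φ'' x generalizing φ φ' φ''
  · have hneg := hφ''.resolve_left hpos
    rw [← norm_integral_exp_neg]
    refine this (φ := fun x => -φ x) (φ' := fun x => -φ' x) (φ'' := fun x => -φ'' x)
      (fun x hx => (h1 x hx).neg) (fun x hx => (h2 x hx).neg) hc.neg (Or.inl ?_) ?_ <;>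
    exact fun x hx => by linarith [hneg x hx]
  have hφc : ContinuousOn φ (Icc a b) := fun x hx => (h1 x hx).continuousAt.continuousWithinAt
  obtain ⟨c, hc', hr, hl⟩ := exists_center_of_deriv_ge hab h2 hpos
  have hs : 0 < √m := sqrt_pos.2 hm
  have hs2 : √m * √m = m := Real.mul_self_sqrt hm.le
  have := norm_integral_le_of_window (f := fun x => cexp (I * (φ x : ℂ)))
    (c := c) (δ := 1 / √m) (K := 1) (M := 3 / √m) hab (by positivity) (by positivity)
    ((continuousOn_const.mul (continuous_ofReal.comp_continuousOn hφc)).cexp)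
    (fun x _ => (norm_exp_I_mul _).le) ?_ ?_
  · refine this.trans (le_of_eq ?_); ring
  · intro x y hx hcx hxy hy
    have hsub : Icc x y ⊆ Icc a b := Icc_subset_Icc hx hy
    refine vdC_one hxy hs (fun t ht => h1 t (hsub ht)) (fun t ht => h2 t (hsub ht)) (hc.mono hsub)
      (Or.inl fun t ht => ?_) (Or.inl fun t ht => hm.le.trans (hpos t (hsub ht)))
    have hd : 0 < 1 / √m := by positivity
    rcases hr t (hsub ht) (by linarith [ht.1]) with h | h
    · refine le_trans ?_ h
      have : 1 / √m ≤ t - c := by linarith [ht.1]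
      calc √m = m * (1 / √m) := by rw [mul_one_div, eq_div_iff hs.ne', hs2]
        _ ≤ _ := by gcongr
    · linarith [ht.1]
  · intro x y hx hxy hcy hy
    have hsub : Icc x y ⊆ Icc a b := Icc_subset_Icc hx hy
    refine vdC_one hxy hs (fun t ht => h1 t (hsub ht)) (fun t ht => h2 t (hsub ht)) (hc.mono hsub)
      (Or.inr fun t ht => ?_) (Or.inl fun t ht => hm.le.trans (hpos t (hsub ht)))
    have hd : 0 < 1 / √m := by positivity
    rcases hl t (hsub ht) (by linarith [ht.2]) with h | h
    · refine h.trans (neg_le_neg ?_)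
      have : 1 / √m ≤ c - t := by linarith [ht.2]
      calc √m = m * (1 / √m) := by rw [mul_one_div, eq_div_iff hs.ne', hs2]
        _ ≤ _ := by gcongr
    · linarith [ht.2]

/-- Third derivative test. -/
theorem vdC_three {φ φ' φ'' φ₃ : ℝ → ℝ} {a b m : ℝ} (hab : a ≤ b) (hm : 0 < m)
    (h1 : ∀ x ∈ Icc a b, HasDerivAt φ (φ' x) x) (h2 : ∀ x ∈ Icc a b, HasDerivAt φ' (φ'' x) x)
    (h3 : ∀ x ∈ Icc a b, HasDerivAt φ'' (φ₃ x) x)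
    (hφ₃ : ∀ x ∈ Icc a b, m ^ 3 ≤ φ₃ x) :
    ‖∫ x in a..b, cexp (I * (φ x : ℂ))‖ ≤ 18 / m := by
  have hφc : ContinuousOn φ (Icc a b) := fun x hx => (h1 x hx).continuousAt.continuousWithinAt
  have hc : ContinuousOn φ'' (Icc a b) := fun x hx => (h3 x hx).continuousAt.continuousWithinAt
  obtain ⟨c, hc', hr, hl⟩ := exists_center_of_deriv_ge hab h3 hφ₃
  have hd : 0 < 1 / m := by positivity
  have key : m ^ 2 = m ^ 3 * (1 / m) := by field_simp
  have hsq : 8 / √(m ^ 2) = 8 / m := by rw [Real.sqrt_sq hm.le]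
  have := norm_integral_le_of_window (f := fun x => cexp (I * (φ x : ℂ)))
    (c := c) (δ := 1 / m) (K := 1) (M := 8 / m) hab (by positivity) (by positivity)
    ((continuousOn_const.mul (continuous_ofReal.comp_continuousOn hφc)).cexp)
    (fun x _ => (norm_exp_I_mul _).le) ?_ ?_
  · refine this.trans (le_of_eq ?_); ring
  · intro x y hx hcx hxy hy
    have hsub : Icc x y ⊆ Icc a b := Icc_subset_Icc hx hy
    rw [← hsq]
    refine vdC_two hxy (by positivity) (fun t ht => h1 t (hsub ht)) (fun t ht => h2 t (hsub ht))
      (hc.mono hsub) (Or.inl fun t ht => ?_)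
    rcases hr t (hsub ht) (by linarith [ht.1]) with h | h
    · refine le_trans ?_ h
      have : 1 / m ≤ t - c := by linarith [ht.1]
      rw [key]; gcongr
    · linarith [ht.1]
  · intro x y hx hxy hcy hy
    have hsub : Icc x y ⊆ Icc a b := Icc_subset_Icc hx hy
    rw [← hsq]
    refine vdC_two hxy (by positivity) (fun t ht => h1 t (hsub ht)) (fun t ht => h2 t (hsub ht))
      (hc.mono hsub) (Or.inr fun t ht => ?_)
    rcases hl t (hsub ht) (by linarith [ht.2]) with h | h
    · refine h.trans (neg_le_neg ?_)
      have : 1 / m ≤ c - t := by linarith [ht.2]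
      rw [key]; gcongr
    · linarith [ht.2]

/-- Inserting an amplitude of bounded variation. -/
theorem norm_integral_mul_le {E w w' : ℝ → ℂ} {a b K : ℝ} (hab : a ≤ b)
    (hE : ContinuousOn E (Icc a b)) (hw : ∀ x ∈ Icc a b, HasDerivAt w (w' x) x)
    (hw'c : ContinuousOn w' (Icc a b))
    (hK : ∀ x ∈ Icc a b, ‖∫ t in a..x, E t‖ ≤ K) :
    ‖∫ x in a..b, E x * w x‖ ≤ K * (‖w b‖ + ∫ x in a..b, ‖w' x‖) := by
  set G : ℝ → ℂ := fun x => ∫ t in a..x, E t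
  have hwc : ContinuousOn w (Icc a b) := fun x hx => (hw x hx).continuousAt.continuousWithinAt
  have hEi : IntervalIntegrable E volume a b := hE.intervalIntegrable_of_Icc hab
  have hGc : ContinuousOn G (Icc a b) := by
    have := intervalIntegral.continuousOn_primitive_interval (f := E) (μ := volume) (a := a) (b := b)
      (by rw [uIcc_of_le hab]; exact hE.integrableOn_Icc)
    rwa [uIcc_of_le hab] at this
  have hGd : ∀ x ∈ Ioo (min a b) (max a b), HasDerivAt G (E x) x := by
    intro x hx
    rw [min_eq_left hab, max_eq_right hab] at hx
    have hn : Icc a b ∈ nhds x := Icc_mem_nhds hx.1 hx.2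
    refine intervalIntegral.integral_hasDerivAt_right ?_ ?_ ?_
    · exact (hE.mono (Icc_subset_Icc le_rfl hx.2.le)).intervalIntegrable_of_Icc hx.1.le
    · exact (hE.mono Ioo_subset_Icc_self).stronglyMeasurableAtFilter isOpen_Ioo x hx
    · exact hE.continuousAt hn
  have hibp := intervalIntegral.integral_mul_deriv_eq_deriv_mul_of_hasDerivAt
    (u := w) (v := G) (u' := w') (v' := E) (a := a) (b := b)
    (by rwa [uIcc_of_le hab]) (by rwa [uIcc_of_le hab])
    (fun x hx => hw x (by
      rw [min_eq_left hab, max_eq_right hab] at hx; exact Ioo_subset_Icc_self hx)) hGd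
    (hw'c.intervalIntegrable_of_Icc hab) hEi
  have hGa : G a = 0 := by simp [G]
  have : ∫ x in a..b, E x * w x = w b * G b - ∫ x in a..b, w' x * G x := by
    rw [hGa, mul_zero, sub_zero] at hibp
    rw [← hibp]
    congr 1; funext x; ring
  rw [this]
  have hb : b ∈ Icc a b := right_mem_Icc.2 hab
  calc _ ≤ ‖w b * G b‖ + ‖∫ x in a..b, w' x * G x‖ := norm_sub_le _ _
    _ ≤ ‖w b‖ * K + ∫ x in a..b, K * ‖w' x‖ := by
        gcongr
        · rw [norm_mul]; gcongr; exact hK b hb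
        · refine intervalIntegral.norm_integral_le_of_norm_le hab ?_ ?_
          · refine Eventually.of_forall fun x hx => ?_
            rw [norm_mul, mul_comm]
            gcongr
            exact hK x (Ioc_subset_Icc_self hx)
          · exact (continuousOn_const.mul hw'c.norm).intervalIntegrable_of_Icc hab
    _ = _ := by rw [intervalIntegral.integral_const_mul]; ring

theorem norm_integral_mul_le_const {E w w' : ℝ → ℂ} {a b K W₀ W₁ : ℝ} (hab : a ≤ b)
    (hE : ContinuousOn E (Icc a b)) (hw : ∀ x ∈ Icc a b, HasDerivAt w (w' x) x)
    (hw'c : ContinuousOn w' (Icc a b))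
    (hK : ∀ x ∈ Icc a b, ‖∫ t in a..x, E t‖ ≤ K)
    (hW₀ : ∀ x ∈ Icc a b, ‖w x‖ ≤ W₀) (hW₁ : ∀ x ∈ Icc a b, ‖w' x‖ ≤ W₁) :
    ‖∫ x in a..b, E x * w x‖ ≤ K * (W₀ + W₁ * (b - a)) := by
  refine (norm_integral_mul_le hab hE hw hw'c hK).trans ?_
  have hK0 : 0 ≤ K := (norm_nonneg _).trans (hK a (left_mem_Icc.2 hab))
  gcongr
  · exact hW₀ b (right_mem_Icc.2 hab)
  · calc ∫ x in a..b, ‖w' x‖ ≤ ∫ x in a..b, W₁ :=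
        intervalIntegral.integral_mono_on hab (hw'c.norm.intervalIntegrable_of_Icc hab)
          intervalIntegrable_const (fun x hx => hW₁ x hx)
      _ = _ := by simp [mul_comm]

/-- The moments `∫₀^∞ t^r e^{-xt - t³/12} dt`. -/
noncomputable def airyMoment (r x : ℝ) : ℝ :=
  ∫ t in Ioi (0 : ℝ), t ^ r * Real.exp (-(x * t) - t ^ 3 / 12)

theorem cubic_exponent_le {R x t : ℝ} (hx : |x| ≤ R) (ht : 0 ≤ t) :
    -(x * t) - t ^ 3 / 12 ≤ 12 * (R + 1) ^ 2 - t := by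
  have hR : 0 ≤ R := (abs_nonneg x).trans hx
  have h1 : -(x * t) ≤ R * t := by
    have := neg_abs_le x
    nlinarith
  rcases le_total t (12 * (R + 1)) with h | h
  · have : 0 ≤ t ^ 3 := by positivity
    nlinarith
  · have h2 : 0 ≤ (t - 12 * (R + 1)) * (t + 12 * (R + 1)) := by
      apply mul_nonneg <;> nlinarith
    have h3 : (R + 1) ≤ t ^ 2 / 12 := by nlinarith
    have h4 : (R + 1) * t ≤ t ^ 2 / 12 * t := mul_le_mul_of_nonneg_right h3 ht
    nlinarith [sq_nonneg (R + 1)]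

theorem integrableOn_rpow_mul_exp_neg {r : ℝ} (hr : -1 < r) :
    IntegrableOn (fun t : ℝ => t ^ r * Real.exp (-t)) (Ioi 0) := by
  have := Real.GammaIntegral_convergent (s := r + 1) (by linarith)
  simpa [mul_comm] using this

theorem aestronglyMeasurable_airy (r : ℝ) {f : ℝ → ℝ} (hf : Continuous f) :
    AEStronglyMeasurable (fun t : ℝ => t ^ r * Real.exp (f t)) (volume.restrict (Ioi 0)) := by
  have : Measurable (fun t : ℝ => t ^ r * Real.exp (f t)) :=
    (measurable_id.pow_const r).mul (Real.measurable_exp.comp hf.measurable)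
  exact this.aestronglyMeasurable

theorem airyMoment_bound {r R x t : ℝ} (hx : |x| ≤ R) (ht : 0 < t) :
    ‖t ^ r * Real.exp (-(x * t) - t ^ 3 / 12)‖ ≤
      Real.exp (12 * (R + 1) ^ 2) * (t ^ r * Real.exp (-t)) := by
  rw [Real.norm_of_nonneg (by positivity)]
  have h1 := Real.exp_le_exp.2 (cubic_exponent_le hx ht.le)
  rw [sub_eq_add_neg (12 * (R + 1) ^ 2), Real.exp_add] at h1
  have : 0 ≤ t ^ r := by positivity
  nlinarith

theorem integrableOn_airyMoment {r : ℝ} (hr : -1 < r) (x : ℝ) :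
    IntegrableOn (fun t : ℝ => t ^ r * Real.exp (-(x * t) - t ^ 3 / 12)) (Ioi 0) := by
  refine Integrable.mono' ((integrableOn_rpow_mul_exp_neg hr).const_mul
    (Real.exp (12 * (|x| + 1) ^ 2))) (aestronglyMeasurable_airy r (by fun_prop)) ?_
  filter_upwards [ae_restrict_mem measurableSet_Ioi] with t ht
  exact airyMoment_bound le_rfl ht

theorem hasDerivAt_airyMoment {r : ℝ} (hr : -1 < r) (x : ℝ) :
    HasDerivAt (airyMoment r) (-airyMoment (r + 1) x) x := by
  have key := (hasDerivAt_integral_of_dominated_loc_of_deriv_le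
    (μ := volume.restrict (Ioi (0 : ℝ)))
    (F := fun x t : ℝ => t ^ r * Real.exp (-(x * t) - t ^ 3 / 12))
    (F' := fun x t : ℝ => -(t ^ (r + 1) * Real.exp (-(x * t) - t ^ 3 / 12)))
    (bound := fun t => Real.exp (12 * ((|x| + 1) + 1) ^ 2) * (t ^ (r + 1) * Real.exp (-t)))
    (x₀ := x) (s := Metric.ball x 1) (Metric.ball_mem_nhds x one_pos) ?_ ?_ ?_ ?_ ?_ ?_).2
  · rw [integral_neg] at key
    exact key
  · exact Eventually.of_forall fun y => aestronglyMeasurable_airy r (by fun_prop)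
  · exact integrableOn_airyMoment hr x
  · exact (aestronglyMeasurable_airy (r + 1) (by fun_prop)).neg
  · filter_upwards [ae_restrict_mem measurableSet_Ioi] with t ht y hy
    rw [norm_neg]
    refine airyMoment_bound ?_ ht
    rw [Metric.mem_ball, Real.dist_eq] at hy
    have := abs_sub_abs_le_abs_sub y x
    linarith
  · exact (integrableOn_rpow_mul_exp_neg (by linarith)).const_mul _
  · filter_upwards [ae_restrict_mem measurableSet_Ioi] with t ht y hy
    have h1 : HasDerivAt (fun y : ℝ => -(y * t) - t ^ 3 / 12) (-t) y := by
      simpa using (((hasDerivAt_id y).mul_const t).neg).sub_const (t ^ 3 / 12)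
    refine (h1.exp.const_mul (t ^ r)).congr_deriv ?_
    rw [Real.rpow_add_one (ne_of_gt ht)]
    ring

theorem airyMoment_recurrence (x : ℝ) :
    2 * airyMoment (-1/2) x - 4 * x * airyMoment (1/2) x - airyMoment (5/2) x = 0 := by
  have hi1 := integrableOn_airyMoment (r := -1/2) (by norm_num) x
  have hi2 := integrableOn_airyMoment (r := 1/2) (by norm_num) x
  have hi3 := integrableOn_airyMoment (r := 5/2) (by norm_num) x
  have hsplit := ((hi1.const_mul 2).sub (hi2.const_mul (4 * x))).sub hi3
  have hcont : ContinuousWithinAt (fun t : ℝ => 4 * t ^ (1/2 : ℝ) * Real.exp (-(x * t) - t ^ 3 / 12))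
      (Ici 0) 0 := by
    have : Continuous (fun t : ℝ => 4 * t ^ (1/2 : ℝ) * Real.exp (-(x * t) - t ^ 3 / 12)) :=
      (continuous_const.mul (Real.continuous_rpow_const (by norm_num))).mul
        (Real.continuous_exp.comp (by fun_prop))
    exact this.continuousWithinAt
  have htend : Tendsto (fun t : ℝ => 4 * t ^ (1/2 : ℝ) * Real.exp (-(x * t) - t ^ 3 / 12)) atTop
      (nhds 0) := by
    have h0 := (tendsto_rpow_mul_exp_neg_mul_atTop_nhds_zero (1/2) 1 one_pos).const_mul
      (4 * Real.exp (12 * (|x| + 1) ^ 2))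
    rw [mul_zero] at h0
    refine squeeze_zero' ?_ ?_ h0
    · filter_upwards [eventually_gt_atTop 0] with t ht
      positivity
    · filter_upwards [eventually_gt_atTop 0] with t ht
      have := airyMoment_bound (r := 1/2) (le_refl |x|) ht
      rw [Real.norm_of_nonneg (by positivity)] at this
      simp only [neg_mul, one_mul] at this ⊢
      linarith
  have := integral_Ioi_of_hasDerivAt_of_tendsto hcont
    (f' := fun t => 2 * (t ^ (-1/2 : ℝ) * Real.exp (-(x * t) - t ^ 3 / 12))
      - 4 * x * (t ^ (1/2 : ℝ) * Real.exp (-(x * t) - t ^ 3 / 12))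
      - t ^ (5/2 : ℝ) * Real.exp (-(x * t) - t ^ 3 / 12)) ?_ hsplit htend
  · rw [integral_sub, integral_sub, integral_const_mul, integral_const_mul] at this
    · rw [airyMoment, airyMoment, airyMoment, this]
      rw [Real.zero_rpow (by norm_num)]; simp
    · exact hi1.const_mul 2
    · exact hi2.const_mul (4 * x)
    · exact (hi1.const_mul 2).sub (hi2.const_mul (4 * x))
    · exact hi3
  · intro t ht
    have ht' : (0 : ℝ) < t := ht
    have h1 : HasDerivAt (fun t : ℝ => -(x * t) - t ^ 3 / 12) (-x - 3 * t ^ 2 / 12) t := by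
      have := (((hasDerivAt_id t).const_mul x).neg).sub ((hasDerivAt_pow 3 t).div_const 12)
      refine this.congr_deriv ?_
      simp
    have h2 := (Real.hasDerivAt_rpow_const (p := (1/2 : ℝ)) (Or.inl ht'.ne')).const_mul 4
    refine (h2.mul h1.exp).congr_deriv ?_
    have e1 : t ^ (5/2 : ℝ) = t ^ (1/2 : ℝ) * t ^ 2 := by
      rw [← rpow_natCast, ← Real.rpow_add ht']; norm_num
    have e2 : t ^ ((1/2 : ℝ) - 1) = t ^ (-1/2 : ℝ) := by norm_num
    rw [e1, e2]; ring

theorem airyMoment_zero {r : ℝ} (hr : -1 < r) :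
    airyMoment r 0 = (12 : ℝ) ^ ((r + 1) / 3) * (1 / 3) * Real.Gamma ((r + 1) / 3) := by
  have := integral_rpow_mul_exp_neg_mul_rpow (p := 3) (q := r) (b := 1/12) (by norm_num) hr
    (by norm_num)
  have h2 : ((1:ℝ)/12) ^ (-(r + 1) / 3) = (12 : ℝ) ^ ((r + 1) / 3) := by
    rw [one_div, Real.inv_rpow (by norm_num), ← Real.rpow_neg (by norm_num)]
    congr 1; ring
  rw [← h2, ← this, airyMoment]
  refine setIntegral_congr_fun measurableSet_Ioi fun t ht => ?_
  simp only [zero_mul, neg_zero, zero_sub]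
  congr 2
  rw [show (3 : ℝ) = ((3 : ℕ) : ℝ) by norm_num, rpow_natCast]
  ring

theorem airyMoment_pos (r x : ℝ) (hr : -1 < r) : 0 < airyMoment r x := by
  rw [airyMoment, setIntegral_pos_iff_support_of_nonneg_ae]
  · have : (Function.support fun t : ℝ => t ^ r * Real.exp (-(x * t) - t ^ 3 / 12)) ∩ Ioi 0 = Ioi 0 := by
      refine inter_eq_right.2 fun t ht => ?_
      have ht' : (0 : ℝ) < t := ht
      exact (by positivity : (0 : ℝ) < t ^ r * Real.exp (-(x * t) - t ^ 3 / 12)).ne'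
    rw [this]; simp
  · filter_upwards [ae_restrict_mem measurableSet_Ioi] with t ht
    have ht' : (0 : ℝ) < t := ht
    simp only [Pi.zero_apply]; positivity
  · exact integrableOn_airyMoment hr x

/-- Uniqueness for the third-order equation satisfied by products of Airy functions. -/
theorem eq_zero_of_airy_product_ode {D D₁ D₂ : ℝ → ℂ}
    (h0 : ∀ x, HasDerivAt D (D₁ x) x) (h1 : ∀ x, HasDerivAt D₁ (D₂ x) x)
    (h2 : ∀ x, HasDerivAt D₂ (-(4 * x * D₁ x) - 2 * D x) x)
    (hD : D 0 = 0) (hD₁ : D₁ 0 = 0) (hD₂ : D₂ 0 = 0) {x : ℝ} (hx : 0 ≤ x) : D x = 0 := by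
  set f : ℝ → ℂ × ℂ × ℂ := fun t => (D t, D₁ t, D₂ t)
  set f' : ℝ → ℂ × ℂ × ℂ := fun t => (D₁ t, D₂ t, -(4 * t * D₁ t) - 2 * D t)
  have hf : ∀ t, HasDerivAt f (f' t) t := fun t => (h0 t).prodMk ((h1 t).prodMk (h2 t))
  have := norm_le_gronwallBound_of_norm_deriv_right_le (f := f) (f' := f') (δ := 0)
    (K := 4 * x + 2) (ε := 0) (a := 0) (b := x)
    (fun t _ => (hf t).continuousAt.continuousWithinAt)
    (fun t _ => (hf t).hasDerivWithinAt) (by simp [f, hD, hD₁, hD₂]) ?_ x ⟨hx, le_rfl⟩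
  · rw [gronwallBound_ε0_δ0] at this
    have hfx : f x = 0 := norm_le_zero_iff.1 this
    exact congrArg Prod.fst hfx
  · intro t ht
    have ht0 : 0 ≤ t := ht.1
    have a0 : ‖D t‖ ≤ ‖f t‖ := norm_fst_le (f t)
    have a1 : ‖D₁ t‖ ≤ ‖f t‖ := (norm_fst_le (f t).2).trans (norm_snd_le (f t))
    have a2 : ‖D₂ t‖ ≤ ‖f t‖ := (norm_snd_le (f t).2).trans (norm_snd_le (f t))
    have hn : 0 ≤ ‖f t‖ := norm_nonneg _
    have hxf : 0 ≤ x * ‖f t‖ := by positivity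
    rw [add_zero]
    refine norm_prod_le_iff.2 ⟨?_, norm_prod_le_iff.2 ⟨?_, ?_⟩⟩
    · simp only [f']; nlinarith
    · simp only [f']; nlinarith
    · simp only [f']
      calc _ ≤ ‖(4 * t * D₁ t : ℂ)‖ + ‖(2 * D t : ℂ)‖ := by
            refine (norm_sub_le _ _).trans ?_
            rw [norm_neg]
        _ = 4 * t * ‖D₁ t‖ + 2 * ‖D t‖ := by
            rw [norm_mul, norm_mul, norm_mul, norm_real, Real.norm_of_nonneg ht0]; simp
        _ ≤ 4 * x * ‖f t‖ + 2 * ‖f t‖ := by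
            have := ht.2.le
            gcongr
        _ = _ := by ring

section AiryPhase

variable {Ai : ℂ → ℂ}

theorem hasDerivAt_comp_mul_ofReal {f : ℂ → ℂ} (hf : Differentiable ℂ f) (w : ℂ) (x : ℝ) :
    HasDerivAt (fun x : ℝ => w * f (w * x)) (w ^ 2 * deriv f (w * x)) x := by
  have h1 : HasDerivAt (fun z : ℂ => w * f (w * z)) (w ^ 2 * deriv f (w * x)) (x : ℂ) := by
    have h2 : HasDerivAt (fun z : ℂ => w * z) w (x : ℂ) := by
      simpa using (hasDerivAt_id (x : ℂ)).const_mul w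
    refine (((hf (w * x)).hasDerivAt.comp (x : ℂ) h2).const_mul w).congr_deriv ?_
    ring
  exact h1.comp_ofReal

theorem hasDerivAt_deriv_comp_mul_ofReal (hAi_diff' : Differentiable ℂ (deriv Ai))
    (hAi_ode : ∀ z : ℂ, deriv (deriv Ai) z = z * Ai z) {w : ℂ} (hw : w ^ 3 = -1) (x : ℝ) :
    HasDerivAt (fun x : ℝ => w ^ 2 * deriv Ai (w * x)) (-(x * (w * Ai (w * x)))) x := by
  refine ((hasDerivAt_comp_mul_ofReal hAi_diff' w x).const_mul w |>.congr_deriv ?_).congr_of_eventuallyEq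
    (Eventually.of_forall fun y => ?_)
  · rw [hAi_ode]
    linear_combination (x * w * Ai (w * x)) * hw
  · simp only []; ring

theorem exp_pi_third_facts :
    cexp (-(Real.pi / 3 : ℂ) * Complex.I) = 1 / 2 - (√3 / 2 : ℝ) * I ∧
    cexp ((Real.pi / 3 : ℂ) * Complex.I) = 1 / 2 + (√3 / 2 : ℝ) * I := by
  have h1 : cexp ((Real.pi / 3 : ℂ) * Complex.I) = 1 / 2 + (√3 / 2 : ℝ) * I := by
    rw [Complex.exp_mul_I, show (Real.pi / 3 : ℂ) = ((Real.pi / 3 : ℝ) : ℂ) by push_cast; rfl,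
      ← Complex.ofReal_cos, ← Complex.ofReal_sin, Real.cos_pi_div_three, Real.sin_pi_div_three]
    push_cast; ring
  have h2 : cexp (-(Real.pi / 3 : ℂ) * Complex.I) = 1 / 2 - (√3 / 2 : ℝ) * I := by
    rw [show -(Real.pi / 3 : ℂ) = ((-(Real.pi / 3) : ℝ) : ℂ) by push_cast; rfl, Complex.exp_mul_I,
      ← Complex.ofReal_cos, ← Complex.ofReal_sin, Real.cos_neg, Real.sin_neg,
      Real.cos_pi_div_three, Real.sin_pi_div_three]
    push_cast; ring
  exact ⟨h2, h1⟩

/-- The values of the Airy integrals at the origin, in terms of `Ai(0)` and `Ai'(0)`. -/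
theorem airy_initial_values {p q : ℝ} (hp : p = (3 : ℝ) ^ (-(2 : ℝ)/3) / Real.Gamma (2/3))
    (hq : q = -((3 : ℝ) ^ (-(1 : ℝ)/3)) / Real.Gamma (1/3)) :
    -(p * q * √3 / (2 * √π)) * airyMoment (-1/2) 0 = p ^ 2 ∧
    -(p * q * √3 / (2 * √π)) * (-airyMoment (1/2) 0) = p * q ∧
    -(p * q * √3 / (2 * √π)) * airyMoment (3/2) 0 = 2 * q ^ 2 := by
  have d1 := Real.Gamma_mul_Gamma_add_half (1/6)
  have d2 := Real.Gamma_mul_Gamma_add_half (1/3)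
  rw [show (1/6 : ℝ) + 1/2 = 2/3 by norm_num, show (2 : ℝ) * (1/6) = 1/3 by norm_num] at d1
  rw [show (1/3 : ℝ) + 1/2 = 5/6 by norm_num, show (2 : ℝ) * (1/3) = 2/3 by norm_num] at d2
  rw [airyMoment_zero (by norm_num), airyMoment_zero (by norm_num), airyMoment_zero (by norm_num)]
  rw [show ((-1/2 : ℝ) + 1) / 3 = 1/6 by norm_num, show ((1/2 : ℝ) + 1) / 3 = 1/2 by norm_num,
    show ((3/2 : ℝ) + 1) / 3 = 5/6 by norm_num, Real.Gamma_one_half_eq]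
  have g1 : 0 < Real.Gamma (1/3) := Real.Gamma_pos_of_pos (by norm_num)
  have g2 : 0 < Real.Gamma (2/3) := Real.Gamma_pos_of_pos (by norm_num)
  have hsp : 0 < √π := sqrt_pos.2 Real.pi_pos
  -- everything is a monomial in `s = 3^{1/6}` and `t = 2^{1/3}`
  set s : ℝ := (3 : ℝ) ^ (1/6 : ℝ) with hs
  set t : ℝ := (2 : ℝ) ^ (1/3 : ℝ) with ht
  have hspos : 0 < s := by positivity
  have htpos : 0 < t := by positivity
  have hs6 : s ^ 6 = 3 := by
    rw [hs, ← rpow_natCast, ← rpow_mul (by norm_num)]; norm_num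
  have ht3 : t ^ 3 = 2 := by
    rw [ht, ← rpow_natCast, ← rpow_mul (by norm_num)]; norm_num
  have e3 : √3 = s ^ 3 := by
    rw [Real.sqrt_eq_rpow, hs, ← rpow_natCast, ← rpow_mul (by norm_num)]; norm_num
  have e12 : ∀ y : ℝ, (12 : ℝ) ^ y = (2 : ℝ) ^ (2 * y) * (3 : ℝ) ^ y := by
    intro y
    rw [rpow_mul (by norm_num), ← Real.mul_rpow (by positivity) (by positivity)]
    norm_num
  have p3 : ∀ k : ℕ, (3 : ℝ) ^ ((k : ℝ) / 6) = s ^ k := by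
    intro k
    rw [hs, ← rpow_natCast, ← rpow_mul (by norm_num)]; congr 1; ring
  have p2 : ∀ k : ℕ, (2 : ℝ) ^ ((k : ℝ) / 3) = t ^ k := by
    intro k
    rw [ht, ← rpow_natCast, ← rpow_mul (by norm_num)]; congr 1; ring
  have m1 : (12 : ℝ) ^ (1/6 : ℝ) = t * s := by
    rw [e12, show (2 : ℝ) * (1/6) = ((1 : ℕ) : ℝ) / 3 by norm_num,
      show (1/6 : ℝ) = ((1 : ℕ) : ℝ) / 6 by norm_num, p2, p3]; ring
  have m2 : (12 : ℝ) ^ (1/2 : ℝ) = 2 * s ^ 3 := by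
    rw [e12, show (2 : ℝ) * (1/2) = ((3 : ℕ) : ℝ) / 3 by norm_num,
      show (1/2 : ℝ) = ((3 : ℕ) : ℝ) / 6 by norm_num, p2, p3, ht3]
  have m3 : (12 : ℝ) ^ (5/6 : ℝ) = t ^ 5 * s ^ 5 := by
    rw [e12, show (2 : ℝ) * (5/6) = ((5 : ℕ) : ℝ) / 3 by norm_num,
      show (5/6 : ℝ) = ((5 : ℕ) : ℝ) / 6 by norm_num, p2, p3]
  have n1 : (2 : ℝ) ^ ((1 : ℝ) - 1/3) = t ^ 2 := by
    rw [show (1 : ℝ) - 1/3 = ((2 : ℕ) : ℝ) / 3 by norm_num, p2]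
  have n2 : (2 : ℝ) ^ ((1 : ℝ) - 2/3) = t := by
    rw [show (1 : ℝ) - 2/3 = ((1 : ℕ) : ℝ) / 3 by norm_num, p2, pow_one]
  have q1 : (3 : ℝ) ^ (-(2 : ℝ)/3) = (s ^ 4)⁻¹ := by
    rw [show -(2 : ℝ)/3 = -(((4 : ℕ) : ℝ) / 6) by norm_num, Real.rpow_neg (by norm_num), p3]
  have q2 : (3 : ℝ) ^ (-(1 : ℝ)/3) = (s ^ 2)⁻¹ := by
    rw [show -(1 : ℝ)/3 = -(((2 : ℕ) : ℝ) / 6) by norm_num, Real.rpow_neg (by norm_num), p3]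
  rw [n1] at d1
  rw [n2] at d2
  rw [q1] at hp
  rw [q2] at hq
  have G1 : Real.Gamma (1/6) = Real.Gamma (1/3) * t ^ 2 * √π / Real.Gamma (2/3) := by
    rw [eq_div_iff g2.ne', d1]
  have G2 : Real.Gamma (5/6) = Real.Gamma (2/3) * t * √π / Real.Gamma (1/3) := by
    rw [eq_div_iff g1.ne', mul_comm, d2]
  rw [m1, m2, m3, G1, G2, e3, hp, hq]
  refine ⟨?_, ?_, ?_⟩
  · field_simp
    rw [ht3]; linear_combination 2 * hs6
  · field_simp
    linear_combination -hs6
  · field_simp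
    have : t ^ 6 = 4 := by rw [show t ^ 6 = (t ^ 3) ^ 2 by ring, ht3]; norm_num
    rw [this]; linear_combination 4 * hs6

theorem complex_cpow_three (r : ℝ) : ((3 : ℂ) ^ (r : ℂ)) = (((3 : ℝ) ^ r : ℝ) : ℂ) := by
  rw [Complex.ofReal_cpow (by norm_num)]; norm_num

theorem airy_values_at_zero (hAi_zero : Ai 0 = (3 : ℂ) ^ (-(2 : ℂ)/3) / Complex.Gamma (2/3))
    (hAi_zero' : deriv Ai 0 = -((3 : ℂ) ^ (-(1 : ℂ)/3)) / Complex.Gamma (1/3)) :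
    Ai 0 = (((3 : ℝ) ^ (-(2 : ℝ)/3) / Real.Gamma (2/3) : ℝ) : ℂ) ∧
    deriv Ai 0 = ((-((3 : ℝ) ^ (-(1 : ℝ)/3)) / Real.Gamma (1/3) : ℝ) : ℂ) := by
  have e1 := complex_cpow_three (-(2 : ℝ)/3)
  have e2 := complex_cpow_three (-(1 : ℝ)/3)
  have f1 := Complex.Gamma_ofReal (2/3)
  have f2 := Complex.Gamma_ofReal (1/3)
  push_cast at e1 e2 f1 f2
  rw [hAi_zero, hAi_zero', e1, e2, f1, f2]
  push_cast
  exact ⟨rfl, rfl⟩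

/-- The product formula for `A₊ A₋` and the Wronskian of `A₊` and `A₋`. -/
theorem airy_product_and_wronskian
    (hAi_diff : Differentiable ℂ Ai) (hAi_diff' : Differentiable ℂ (deriv Ai))
    (hAi_ode : ∀ z : ℂ, deriv (deriv Ai) z = z * Ai z)
    (hAi_zero : Ai 0 = (3 : ℂ) ^ (-(2 : ℂ)/3) / Complex.Gamma (2/3))
    (hAi_zero' : deriv Ai 0 = -((3 : ℂ) ^ (-(1 : ℂ)/3)) / Complex.Gamma (1/3)) :
    ∃ (c : ℝ) (P M : ℝ → ℂ), c ≠ 0 ∧ (∀ x : ℝ, HasDerivAt (fun x : ℝ => Aplus Ai x) (P x) x) ∧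
      (∀ x : ℝ, HasDerivAt (fun x : ℝ => Aminus Ai x) (M x) x) ∧
      (∀ x : ℝ, 0 ≤ x → Aplus Ai x * Aminus Ai x = c * airyMoment (-1/2) x) ∧
      (∀ x : ℝ, Aplus Ai x * M x - Aminus Ai x * P x = -(2 * √π * c : ℝ) * I) := by
  obtain ⟨hα, hβ⟩ := exp_pi_third_facts
  set α := cexp (-(Real.pi / 3 : ℂ) * Complex.I) with hαdef
  set β := cexp ((Real.pi / 3 : ℂ) * Complex.I) with hβdef
  obtain ⟨h0, h0'⟩ := airy_values_at_zero hAi_zero hAi_zero'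
  set p : ℝ := (3 : ℝ) ^ (-(2 : ℝ)/3) / Real.Gamma (2/3) with hp
  set q : ℝ := -((3 : ℝ) ^ (-(1 : ℝ)/3)) / Real.Gamma (1/3) with hq
  obtain ⟨i0, i1, i2⟩ := airy_initial_values hp hq
  set c : ℝ := -(p * q * √3 / (2 * √π)) with hc
  have s3 : ((√3 : ℝ) : ℂ) ^ 2 = 3 := by
    rw [← Complex.ofReal_pow, sq_sqrt (by norm_num)]; norm_num
  have hα3 : α ^ 3 = -1 := by
    rw [hαdef, ← Complex.exp_nat_mul, show ((3 : ℕ) : ℂ) * (-(Real.pi / 3 : ℂ) * I) = -(Real.pi * I) by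
      push_cast; ring, Complex.exp_neg, Complex.exp_pi_mul_I]; norm_num
  have hβ3 : β ^ 3 = -1 := by
    rw [hβdef, ← Complex.exp_nat_mul, show ((3 : ℕ) : ℂ) * ((Real.pi / 3 : ℂ) * I) = (Real.pi * I) by
      push_cast; ring, Complex.exp_pi_mul_I]
  have hαβ : α * β = 1 := by rw [hαdef, hβdef, ← Complex.exp_add]; simp
  have hsum : α + β = 1 := by rw [hα, hβ]; ring
  have hdiff : β - α = √3 * I := by rw [hα, hβ]; push_cast; ring
  have dy := fun x => hasDerivAt_comp_mul_ofReal hAi_diff α x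
  have dz := fun x => hasDerivAt_comp_mul_ofReal hAi_diff β x
  have dy' := fun x => hasDerivAt_deriv_comp_mul_ofReal hAi_diff' hAi_ode hα3 x
  have dz' := fun x => hasDerivAt_deriv_comp_mul_ofReal hAi_diff' hAi_ode hβ3 x
  have hg1 : 0 < Real.Gamma (1/3) := Real.Gamma_pos_of_pos (by norm_num)
  have hg2 : 0 < Real.Gamma (2/3) := Real.Gamma_pos_of_pos (by norm_num)
  have hp0 : 0 < p := by positivity
  have hq0 : q < 0 := by
    rw [hq, neg_div]; exact neg_lt_zero.2 (by positivity)
  have hsp : 0 < √π := sqrt_pos.2 Real.pi_pos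
  have hcpos : 0 < c := by
    rw [hc, neg_pos]
    apply div_neg_of_neg_of_pos _ (by positivity)
    exact mul_neg_of_neg_of_pos (mul_neg_of_pos_of_neg hp0 hq0) (by positivity)
  refine ⟨c, fun x => α ^ 2 * deriv Ai (α * x), fun x => β ^ 2 * deriv Ai (β * x), hcpos.ne', dy, dz, ?_, ?_⟩
  · intro x hx
    have key := eq_zero_of_airy_product_ode
      (D := fun x : ℝ => (α * Ai (α * x)) * (β * Ai (β * x)) - (c * airyMoment (-1/2) x : ℝ))
      (D₁ := fun x : ℝ => (α ^ 2 * deriv Ai (α * x)) * (β * Ai (β * x))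
        + (α * Ai (α * x)) * (β ^ 2 * deriv Ai (β * x)) - (c * (-airyMoment (1/2) x) : ℝ))
      (D₂ := fun x : ℝ => 2 * ((α ^ 2 * deriv Ai (α * x)) * (β ^ 2 * deriv Ai (β * x)))
        - 2 * x * ((α * Ai (α * x)) * (β * Ai (β * x))) - (c * airyMoment (3/2) x : ℝ))
      ?_ ?_ ?_ ?_ ?_ ?_ hx
    · have := sub_eq_zero.1 key
      push_cast at this
      exact this
    · intro x
      have hm := (hasDerivAt_airyMoment (r := -1/2) (by norm_num) x).const_mul c
      rw [show (-1/2 : ℝ) + 1 = 1/2 by norm_num] at hm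
      exact ((dy x).mul (dz x)).sub hm.ofReal_comp
    · intro x
      have hm := ((hasDerivAt_airyMoment (r := 1/2) (by norm_num) x).neg).const_mul c
      rw [show (1/2 : ℝ) + 1 = 3/2 by norm_num, neg_neg] at hm
      refine ((((dy' x).mul (dz x)).add ((dy x).mul (dz' x))).sub hm.ofReal_comp).congr_deriv ?_
      ring
    · intro x
      have hm := (hasDerivAt_airyMoment (r := 3/2) (by norm_num) x).const_mul c
      rw [show (3/2 : ℝ) + 1 = 5/2 by norm_num] at hm
      have hrec := congrArg (fun r : ℝ => (r : ℂ)) (airyMoment_recurrence x)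
      have hid : HasDerivAt (fun x : ℝ => 2 * (x : ℂ)) 2 x := by
        simpa using ((hasDerivAt_id x).ofReal_comp).const_mul (2 : ℂ)
      refine (((((dy' x).mul (dz' x)).const_mul 2).sub
        (hid.mul ((dy x).mul (dz x)))).sub hm.ofReal_comp).congr_deriv ?_
      simp only [Pi.mul_apply]
      push_cast at hrec ⊢
      linear_combination (-(c : ℂ)) * hrec
    · simp only [Complex.ofReal_zero, mul_zero, h0]
      rw [i0]; push_cast
      linear_combination (p ^ 2 : ℂ) * hαβ
    · simp only [Complex.ofReal_zero, mul_zero, h0, h0']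
      rw [i1]; push_cast
      linear_combination (p * q : ℂ) * ((α + β) * hαβ + hsum)
    · simp only [Complex.ofReal_zero, mul_zero, h0, h0']
      rw [i2]; push_cast
      linear_combination (2 * q ^ 2 : ℂ) * (α * β + 1) * hαβ
  · have hconst : ∀ x : ℝ, HasDerivAt (fun x : ℝ => (α * Ai (α * x)) * (β ^ 2 * deriv Ai (β * x))
        - (β * Ai (β * x)) * (α ^ 2 * deriv Ai (α * x))) 0 x := by
      intro x
      refine (((dy x).mul (dz' x)).sub ((dz x).mul (dy' x))).congr_deriv ?_
      ring
    intro x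
    have := is_const_of_deriv_eq_zero (fun x => (hconst x).differentiableAt)
      (fun x => (hconst x).deriv) x 0
    simp only [Aplus, Aminus] at this ⊢
    rw [← hαdef, ← hβdef, this]
    simp only [Complex.ofReal_zero, mul_zero, h0, h0']
    have h2c : 2 * √π * c = -(p * q * √3) := by
      rw [hc]; field_simp
    rw [h2c]; push_cast
    linear_combination (p * q : ℂ) * ((β - α) * hαβ + hdiff)

/-- The derivative of the phase `L` on the half-line. -/
theorem hasDerivAt_airyPhase {L : ℝ → ℝ}
    (hAi_diff : Differentiable ℂ Ai) (hAi_diff' : Differentiable ℂ (deriv Ai))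
    (hAi_ode : ∀ z : ℂ, deriv (deriv Ai) z = z * Ai z)
    (hAi_zero : Ai 0 = (3 : ℂ) ^ (-(2 : ℂ)/3) / Complex.Gamma (2/3))
    (hAi_zero' : deriv Ai 0 = -((3 : ℂ) ^ (-(1 : ℂ)/3)) / Complex.Gamma (1/3))
    (hL_cont : Continuous L) (hAp_ne : ∀ w : ℝ, Aplus Ai w ≠ 0)
    (hL_char : ∀ w : ℝ, cexp (-(L w : ℂ) * Complex.I) = -(Aminus Ai w) / (Aplus Ai w))
    {x : ℝ} (hx : 0 ≤ x) : HasDerivAt L (2 * √π / airyMoment (-1/2) x) x := by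
  obtain ⟨c, P, M, hc, hP, hM, hprod, hW⟩ :=
    airy_product_and_wronskian hAi_diff hAi_diff' hAi_ode hAi_zero hAi_zero'
  have hQ : 0 < airyMoment (-1/2) x := airyMoment_pos _ _ (by norm_num)
  have hAm : Aminus Ai x ≠ 0 := by
    intro h
    have := hL_char x
    rw [h] at this
    simp at this
  have hg : HasDerivAt (fun y : ℝ => -(Aminus Ai y) / (Aplus Ai y))
      ((-(M x) * Aplus Ai x - -(Aminus Ai x) * P x) / (Aplus Ai x) ^ 2) x :=
    (hM x).neg.div (hP x) (hAp_ne x)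
  -- near `x`, the phase is a branch of the logarithm
  have hE : HasDerivAt (fun y : ℝ => cexp (-((L y - L x : ℝ) : ℂ) * I))
      ((-(M x) * Aplus Ai x - -(Aminus Ai x) * P x) / (Aplus Ai x) ^ 2 *
        cexp ((L x : ℂ) * I)) x := by
    refine (hg.mul_const (cexp ((L x : ℂ) * I))).congr_of_eventuallyEq
      (Eventually.of_forall fun y => ?_)
    simp only []
    rw [← hL_char, ← Complex.exp_add]
    congr 1; push_cast; ring
  have hlog : HasDerivAt (fun y : ℝ => Complex.log (cexp (-((L y - L x : ℝ) : ℂ) * I)))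
      ((-(M x) * Aplus Ai x - -(Aminus Ai x) * P x) / (Aplus Ai x) ^ 2 *
        cexp ((L x : ℂ) * I)) x := by
    refine (hE.clog_real ?_).congr_deriv ?_
    · simp
    · simp
  have hnear : ∀ᶠ y in nhds x, |L y - L x| < π := by
    have : Tendsto (fun y => |L y - L x|) (nhds x) (nhds |L x - L x|) :=
      ((hL_cont.sub continuous_const).abs).tendsto x
    rw [sub_self, abs_zero] at this
    exact this.eventually (gt_mem_nhds Real.pi_pos)
  have hval : (-(M x) * Aplus Ai x - -(Aminus Ai x) * P x) / (Aplus Ai x) ^ 2 *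
        cexp ((L x : ℂ) * I) = -((2 * √π / airyMoment (-1/2) x : ℝ) : ℂ) * I := by
    have h1 : cexp ((L x : ℂ) * I) = -(Aplus Ai x) / (Aminus Ai x) := by
      rw [show (L x : ℂ) * I = -(-(L x : ℂ) * I) by ring, Complex.exp_neg, hL_char]
      field_simp
    have h2 := hW x
    have h3 := hprod x hx
    have hQ' : (airyMoment (-1/2) x : ℂ) ≠ 0 := by exact_mod_cast hQ.ne'
    have hc' : (c : ℂ) ≠ 0 := by exact_mod_cast hc
    have hA := hAp_ne x
    have h4 : (-(M x) * Aplus Ai x - -(Aminus Ai x) * P x) / (Aplus Ai x) ^ 2 *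
        (-(Aplus Ai x) / (Aminus Ai x)) =
        (Aplus Ai x * M x - Aminus Ai x * P x) / (Aplus Ai x * Aminus Ai x) := by
      field_simp
      ring
    rw [h1, h4, h2, h3]
    push_cast
    field_simp
  have hfin : HasDerivAt (fun y : ℝ => -((L y - L x : ℝ) : ℂ) * I)
      (-((2 * √π / airyMoment (-1/2) x : ℝ) : ℂ) * I) x := by
    rw [← hval]
    refine hlog.congr_of_eventuallyEq ?_
    filter_upwards [hnear] with y hy
    rw [abs_lt] at hy
    rw [Complex.log_exp] <;> simp <;> linarith
  have h5 := (hfin.mul_const I)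
  have h6 : HasDerivAt (fun y : ℝ => ((L y - L x : ℝ) : ℂ))
      ((2 * √π / airyMoment (-1/2) x : ℝ) : ℂ) x := by
    refine (h5.congr_of_eventuallyEq (Eventually.of_forall fun y => ?_)).congr_deriv ?_
    · simp only []
      linear_combination ((L y - L x : ℝ) : ℂ) * Complex.I_sq
    · linear_combination (-((2 * √π / airyMoment (-1/2) x : ℝ) : ℂ)) * Complex.I_sq
  have h7 := Complex.reCLM.hasFDerivAt.comp_hasDerivAt x h6
  have h8 := h7.add_const (L x)
  refine (h8.congr_of_eventuallyEq (Eventually.of_forall fun y => ?_))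
  simp

end AiryPhase

theorem rescaled_bound {r v s : ℝ} (hv : 0 ≤ v) (hs : 0 < s) :
    ‖s ^ r * Real.exp (-s - v * s ^ 3 / 12)‖ ≤ s ^ r * Real.exp (-s) := by
  rw [Real.norm_of_nonneg (by positivity)]
  have : 0 ≤ v * s ^ 3 / 12 := by positivity
  gcongr
  linarith

theorem integrableOn_rescaled {r v : ℝ} (hr : -1 < r) (hv : 0 ≤ v) :
    IntegrableOn (fun s : ℝ => s ^ r * Real.exp (-s - v * s ^ 3 / 12)) (Ioi 0) := by
  refine Integrable.mono' (integrableOn_rpow_mul_exp_neg hr)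
    (aestronglyMeasurable_airy r (by fun_prop)) ?_
  filter_upwards [ae_restrict_mem measurableSet_Ioi] with t ht
  exact rescaled_bound hv ht

theorem airyMoment_eq_rescaled {r x : ℝ} (hx : 0 < x) :
    airyMoment r x = x ^ (-(r + 1)) *
      ∫ s in Ioi (0 : ℝ), s ^ r * Real.exp (-s - (x ^ 3)⁻¹ * s ^ 3 / 12) := by
  have h := integral_comp_mul_left_Ioi
    (fun s : ℝ => x ^ (-r) * (s ^ r * Real.exp (-s - (x ^ 3)⁻¹ * s ^ 3 / 12))) 0 hx
  rw [mul_zero] at h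
  rw [show -(r + 1) = -r + (-1) by ring, Real.rpow_add hx, Real.rpow_neg_one, mul_comm (x ^ (-r)),
    mul_assoc]
  rw [smul_eq_mul] at h
  rw [← integral_const_mul, ← h, airyMoment]
  refine setIntegral_congr_fun measurableSet_Ioi fun t ht => ?_
  have ht' : (0 : ℝ) < t := ht
  rw [Real.mul_rpow hx.le ht'.le, ← mul_assoc, ← mul_assoc, ← Real.rpow_add hx, neg_add_cancel,
    Real.rpow_zero, one_mul]
  congr 2
  field_simp

theorem rescaled_le {r v : ℝ} (hr : -1 < r) (hv : 0 ≤ v) :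
    ∫ s in Ioi (0 : ℝ), s ^ r * Real.exp (-s - v * s ^ 3 / 12) ≤
      ∫ s in Ioi (0 : ℝ), s ^ r * Real.exp (-s) := by
  refine setIntegral_mono_on (integrableOn_rescaled hr hv) (integrableOn_rpow_mul_exp_neg hr)
    measurableSet_Ioi fun s hs => ?_
  exact (le_abs_self _).trans (rescaled_bound hv hs)

theorem le_rescaled {r v : ℝ} (hr : -1 < r) (hv : 0 ≤ v) (hv1 : v ≤ 1) :
    airyMoment r 1 ≤ ∫ s in Ioi (0 : ℝ), s ^ r * Real.exp (-s - v * s ^ 3 / 12) := by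
  refine setIntegral_mono_on (integrableOn_airyMoment hr 1) (integrableOn_rescaled hr hv)
    measurableSet_Ioi fun s hs => ?_
  have hs' : (0 : ℝ) < s := hs
  have : v * s ^ 3 ≤ s ^ 3 := by nlinarith [pow_pos hs' 3]
  simp only [one_mul]
  gcongr

theorem integral_sub_rescaled {v : ℝ} (hv : 0 ≤ v) :
    |(∫ s in Ioi (0 : ℝ), s ^ (-1/2 : ℝ) * Real.exp (-s - v * s ^ 3 / 12)) - √π| ≤
      v * ∫ s in Ioi (0 : ℝ), s ^ (5/2 : ℝ) * Real.exp (-s) := by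
  have h0 : √π = ∫ s in Ioi (0 : ℝ), s ^ (-1/2 : ℝ) * Real.exp (-s) := by
    rw [← Real.Gamma_one_half_eq, Real.Gamma_eq_integral (by norm_num)]
    refine setIntegral_congr_fun measurableSet_Ioi fun t ht => ?_
    rw [mul_comm]; norm_num
  rw [h0, abs_sub_comm, ← integral_sub (integrableOn_rpow_mul_exp_neg (by norm_num))
    (integrableOn_rescaled (by norm_num) hv), ← integral_const_mul, ← Real.norm_eq_abs]
  refine norm_integral_le_of_norm_le ((integrableOn_rpow_mul_exp_neg (by norm_num)).const_mul v) ?_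
  filter_upwards [ae_restrict_mem measurableSet_Ioi] with s hs
  have hs' : (0 : ℝ) < s := hs
  have e1 : s ^ (5/2 : ℝ) = s ^ (-1/2 : ℝ) * s ^ 3 := by
    rw [← rpow_natCast, ← Real.rpow_add hs']; norm_num
  have hy : 0 ≤ v * s ^ 3 / 12 := by positivity
  have h1 := Real.add_one_le_exp (-(v * s ^ 3 / 12))
  have h2 : Real.exp (-(v * s ^ 3 / 12)) ≤ 1 := Real.exp_le_one_iff.2 (by linarith)
  rw [show -s - v * s ^ 3 / 12 = -s + -(v * s ^ 3 / 12) by ring, Real.exp_add,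
    show s ^ (-1/2 : ℝ) * Real.exp (-s) - s ^ (-1/2 : ℝ) * (Real.exp (-s) * Real.exp (-(v * s ^ 3 / 12)))
      = (s ^ (-1/2 : ℝ) * Real.exp (-s)) * (1 - Real.exp (-(v * s ^ 3 / 12))) by ring,
    Real.norm_of_nonneg (mul_nonneg (by positivity) (by linarith)), e1]
  have h3 : 1 - Real.exp (-(v * s ^ 3 / 12)) ≤ v * s ^ 3 := by
    have : 0 ≤ v * s ^ 3 := by positivity
    linarith
  calc _ ≤ (s ^ (-1/2 : ℝ) * Real.exp (-s)) * (v * s ^ 3) := by gcongr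
    _ = _ := by ring

/-- The function `B` has `B' = O(u⁻²)` and `B'' ≍ u⁻³`. -/
theorem exists_Bfun_derivatives {Ai : ℂ → ℂ} {L : ℝ → ℝ}
    (hAi_diff : Differentiable ℂ Ai) (hAi_diff' : Differentiable ℂ (deriv Ai))
    (hAi_ode : ∀ z : ℂ, deriv (deriv Ai) z = z * Ai z)
    (hAi_zero : Ai 0 = (3 : ℂ) ^ (-(2 : ℂ)/3) / Complex.Gamma (2/3))
    (hAi_zero' : deriv Ai 0 = -((3 : ℂ) ^ (-(1 : ℂ)/3)) / Complex.Gamma (1/3))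
    (hL_cont : Continuous L) (hAp_ne : ∀ w : ℝ, Aplus Ai w ≠ 0)
    (hL_char : ∀ w : ℝ, cexp (-(L w : ℂ) * Complex.I) = -(Aminus Ai w) / (Aplus Ai w)) :
    ∃ (B₁ B₂ : ℝ → ℝ) (c C : ℝ), 0 < c ∧ 0 < C ∧
      (∀ u, 0 < u → HasDerivAt (Bfun L) (B₁ u) u) ∧ (∀ u, 0 < u → HasDerivAt B₁ (B₂ u) u) ∧
      ContinuousOn B₂ (Ioi 0) ∧
      (∀ u, 1 ≤ u → |B₁ u| ≤ C / u ^ 2 ∧ c / u ^ 3 ≤ B₂ u ∧ B₂ u ≤ C / u ^ 3) := by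
  have hsp : 0 < √π := sqrt_pos.2 Real.pi_pos
  have hQpos : ∀ x, 0 < airyMoment (-1/2) x := fun x => airyMoment_pos _ _ (by norm_num)
  have hMpos : ∀ x, 0 < airyMoment (5/2) x := fun x => airyMoment_pos _ _ (by norm_num)
  set B₁ : ℝ → ℝ := fun u => 4/3 - (4/3) * √π * u ^ (-1/3 : ℝ) / airyMoment (-1/2) (u ^ (2/3 : ℝ)) with hB₁
  set B₂ : ℝ → ℝ := fun u => (2/9) * √π * u ^ (-4/3 : ℝ) * airyMoment (5/2) (u ^ (2/3 : ℝ)) /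
    airyMoment (-1/2) (u ^ (2/3 : ℝ)) ^ 2 with hB₂
  set k₁ := airyMoment (-1/2) 1
  set k₂ := airyMoment (5/2) 1
  set l₁ := ∫ s in Ioi (0 : ℝ), s ^ (-1/2 : ℝ) * Real.exp (-s)
  set l₂ := ∫ s in Ioi (0 : ℝ), s ^ (5/2 : ℝ) * Real.exp (-s)
  have hk₁ : 0 < k₁ := hQpos 1
  have hk₂ : 0 < k₂ := hMpos 1
  have hl₁ : 0 < l₁ := hk₁.trans_le
    ((le_rescaled (by norm_num) zero_le_one le_rfl).trans (rescaled_le (by norm_num) zero_le_one))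
  have hl₂ : 0 < l₂ := hk₂.trans_le
    ((le_rescaled (by norm_num) zero_le_one le_rfl).trans (rescaled_le (by norm_num) zero_le_one))
  have hpow : ∀ u : ℝ, 0 < u → HasDerivAt (fun u : ℝ => u ^ (2/3 : ℝ)) ((2/3) * u ^ (-1/3 : ℝ)) u := by
    intro u hu
    have := Real.hasDerivAt_rpow_const (x := u) (p := (2/3 : ℝ)) (Or.inl hu.ne')
    rwa [show (2/3 : ℝ) - 1 = -1/3 by norm_num] at this
  refine ⟨B₁, B₂, (2/9) * √π * k₂ / l₁ ^ 2, (4/3) * l₂ / k₁ + (2/9) * √π * l₂ / k₁ ^ 2,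
    by positivity, by positivity, ?_, ?_, ?_, ?_⟩
  · intro u hu
    have h1 := hasDerivAt_airyPhase hAi_diff hAi_diff' hAi_ode hAi_zero hAi_zero' hL_cont hAp_ne
      hL_char (x := u ^ (2/3 : ℝ)) (by positivity)
    have h2 := h1.comp u (hpow u hu)
    have h3 := (((hasDerivAt_id u).const_mul (4/3 : ℝ)).add_const (π / 2)).sub h2
    refine h3.congr_deriv ?_
    simp only [hB₁]
    ring
  · intro u hu
    have hm := (hasDerivAt_airyMoment (r := -1/2) (by norm_num) (u ^ (2/3 : ℝ))).comp u (hpow u hu)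
    rw [show (-1/2 : ℝ) + 1 = 1/2 by norm_num] at hm
    have hn : HasDerivAt (fun u : ℝ => u ^ (-1/3 : ℝ)) ((-1/3) * u ^ (-4/3 : ℝ)) u := by
      have := Real.hasDerivAt_rpow_const (x := u) (p := (-1/3 : ℝ)) (Or.inl hu.ne')
      rwa [show (-1/3 : ℝ) - 1 = -4/3 by norm_num] at this
    have h3 := ((hn.const_mul ((4/3) * √π)).div hm (hQpos _).ne').const_sub (4/3)
    refine h3.congr_deriv ?_
    have hrec := airyMoment_recurrence (u ^ (2/3 : ℝ))
    have hQ := hQpos (u ^ (2/3 : ℝ))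
    simp only [hB₂, Function.comp]
    have e1 : u ^ (-1/3 : ℝ) * u ^ (-1/3 : ℝ) = u ^ (-4/3 : ℝ) * u ^ (2/3 : ℝ) := by
      rw [← Real.rpow_add hu, ← Real.rpow_add hu]; norm_num
    have e2 : airyMoment (5/2) (u ^ (2/3 : ℝ)) =
      2 * airyMoment (-1/2) (u ^ (2/3 : ℝ)) - 4 * u ^ (2/3 : ℝ) * airyMoment (1/2) (u ^ (2/3 : ℝ)) := by
      linarith
    rw [e2]
    generalize airyMoment (-1/2) (u ^ (2/3 : ℝ)) = Q at *
    generalize airyMoment (1/2) (u ^ (2/3 : ℝ)) = R at *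
    generalize u ^ (-1/3 : ℝ) = a at *
    generalize u ^ (-4/3 : ℝ) = b at *
    generalize u ^ (2/3 : ℝ) = d at *
    field_simp
    linear_combination (-72 * R) * e1
  · have hc : ∀ r : ℝ, -1 < r → Continuous (airyMoment r) := fun r hr =>
      continuous_iff_continuousAt.2 fun x => (hasDerivAt_airyMoment hr x).continuousAt
    have hp : ∀ p : ℝ, ContinuousOn (fun u : ℝ => u ^ p) (Ioi 0) := fun p u hu =>
      (Real.continuousAt_rpow_const u p (Or.inl (ne_of_gt hu))).continuousWithinAt
    refine ContinuousOn.div ?_ ?_ ?_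
    · exact (continuousOn_const.mul (hp _)).mul ((hc _ (by norm_num)).comp_continuousOn (hp _))
    · exact ((hc _ (by norm_num)).comp_continuousOn (hp _)).pow 2
    · intro u _; exact pow_ne_zero 2 (hQpos _).ne'
  · intro u hu
    have hu0 : 0 < u := by linarith
    have hx : (0 : ℝ) < u ^ (2/3 : ℝ) := by positivity
    have hv : ((u ^ (2/3 : ℝ)) ^ 3)⁻¹ = (u ^ 2)⁻¹ := by
      rw [← rpow_natCast, ← rpow_mul hu0.le, ← rpow_natCast]; norm_num
    have r1 := airyMoment_eq_rescaled (r := -1/2) hx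
    have r2 := airyMoment_eq_rescaled (r := 5/2) hx
    rw [hv, ← rpow_mul hu0.le] at r1 r2
    rw [show (2/3 : ℝ) * -(-1/2 + 1) = -1/3 by norm_num] at r1
    rw [show (2/3 : ℝ) * -(5/2 + 1) = -7/3 by norm_num] at r2
    have hv0 : 0 ≤ (u ^ 2)⁻¹ := by positivity
    have hv1 : (u ^ 2)⁻¹ ≤ 1 := inv_le_one_of_one_le₀ (one_le_pow₀ hu)
    have a1 := le_rescaled (r := -1/2) (by norm_num) hv0 hv1
    have a2 := le_rescaled (r := 5/2) (by norm_num) hv0 hv1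
    have b1 := rescaled_le (r := -1/2) (by norm_num) hv0
    have b2 := rescaled_le (r := 5/2) (by norm_num) hv0
    have d1 := integral_sub_rescaled hv0
    set q₁ := ∫ s in Ioi (0 : ℝ), s ^ (-1/2 : ℝ) * Real.exp (-s - (u ^ 2)⁻¹ * s ^ 3 / 12)
    set q₂ := ∫ s in Ioi (0 : ℝ), s ^ (5/2 : ℝ) * Real.exp (-s - (u ^ 2)⁻¹ * s ^ 3 / 12)
    change k₁ ≤ q₁ at a1
    change k₂ ≤ q₂ at a2
    change q₁ ≤ l₁ at b1
    change q₂ ≤ l₂ at b2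
    have hq₁ : 0 < q₁ := hk₁.trans_le a1
    have hq₂ : 0 < q₂ := hk₂.trans_le a2
    have hB₁' : B₁ u = (4/3) * ((q₁ - √π) / q₁) := by
      simp only [hB₁]
      rw [r1]
      have : (0 : ℝ) < u ^ (-1/3 : ℝ) := by positivity
      field_simp
    have hB₂' : B₂ u = (2/9) * √π * q₂ / q₁ ^ 2 * (u ^ 3)⁻¹ := by
      simp only [hB₂]
      rw [r1, r2]
      have e1 : u ^ (-4/3 : ℝ) * u ^ (-7/3 : ℝ) = (u ^ (-1/3 : ℝ)) ^ 2 * (u ^ 3)⁻¹ := by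
        rw [← rpow_natCast, ← rpow_natCast, ← Real.rpow_neg hu0.le, ← rpow_mul hu0.le,
          ← Real.rpow_add hu0, ← Real.rpow_add hu0]
        norm_num
      have : (0 : ℝ) < u ^ (-1/3 : ℝ) := by positivity
      rw [show (2/9) * √π * u ^ (-4/3 : ℝ) * (u ^ (-7/3 : ℝ) * q₂) =
        (2/9) * √π * q₂ * (u ^ (-4/3 : ℝ) * u ^ (-7/3 : ℝ)) by ring, e1]
      field_simp
    refine ⟨?_, ?_, ?_⟩
    · rw [hB₁', abs_mul, abs_of_pos (by norm_num : (0:ℝ) < 4/3), abs_div, abs_of_pos hq₁]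
      have h1 : |q₁ - √π| / q₁ ≤ ((u ^ 2)⁻¹ * l₂) / k₁ := div_le_div₀ (by positivity) d1 hk₁ a1
      have h2 : 0 ≤ (2/9) * √π * l₂ / k₁ ^ 2 / u ^ 2 := by positivity
      calc _ ≤ (4/3) * (((u ^ 2)⁻¹ * l₂) / k₁) := by gcongr
        _ ≤ (4/3) * (((u ^ 2)⁻¹ * l₂) / k₁) + (2/9) * √π * l₂ / k₁ ^ 2 / u ^ 2 := by linarith
        _ = _ := by rw [add_div, div_eq_mul_inv _ (u ^ 2)]; ring
    · rw [hB₂', div_eq_mul_inv _ (u ^ 3)]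
      gcongr
    · rw [hB₂', div_eq_mul_inv _ (u ^ 3)]
      gcongr
      have : 0 ≤ (4/3) * l₂ / k₁ := by positivity
      calc _ ≤ (2/9) * √π * l₂ / k₁ ^ 2 := by gcongr
        _ ≤ _ := by linarith

/-- First derivative test when `φ''` is monotone. -/
theorem vdC_one_of_convex {φ φ' φ'' φ₃ : ℝ → ℝ} {a b m : ℝ} (hab : a ≤ b) (hm : 0 < m)
    (h1 : ∀ x ∈ Icc a b, HasDerivAt φ (φ' x) x) (h2 : ∀ x ∈ Icc a b, HasDerivAt φ' (φ'' x) x)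
    (h3 : ∀ x ∈ Icc a b, HasDerivAt φ'' (φ₃ x) x)
    (hφ' : (∀ x ∈ Icc a b, m ≤ φ' x) ∨ (∀ x ∈ Icc a b, φ' x ≤ -m))
    (hφ₃ : ∀ x ∈ Icc a b, 0 ≤ φ₃ x) :
    ‖∫ x in a..b, cexp (I * (φ x : ℂ))‖ ≤ 6 / m := by
  have hφc : ContinuousOn φ (Icc a b) := fun x hx => (h1 x hx).continuousAt.continuousWithinAt
  have hc : ContinuousOn φ'' (Icc a b) := fun x hx => (h3 x hx).continuousAt.continuousWithinAt
  have hmono : MonotoneOn φ'' (Icc a b) := by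
    refine monotoneOn_of_hasDerivWithinAt_nonneg (f' := φ₃) (convex_Icc a b) hc ?_ ?_
    · intro x hx
      exact (h3 x (interior_subset hx)).hasDerivWithinAt
    · intro x hx
      exact hφ₃ x (interior_subset hx)
  have hEc : ContinuousOn (fun x => cexp (I * (φ x : ℂ))) (Icc a b) :=
    (continuousOn_const.mul (continuous_ofReal.comp_continuousOn hφc)).cexp
  have hpiece : ∀ x y, a ≤ x → x ≤ y → y ≤ b →
      ((∀ t ∈ Icc x y, 0 ≤ φ'' t) ∨ (∀ t ∈ Icc x y, φ'' t ≤ 0)) →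
      ‖∫ x in x..y, cexp (I * (φ x : ℂ))‖ ≤ 3 / m := by
    intro x y hx hxy hy hs
    have hsub : Icc x y ⊆ Icc a b := Icc_subset_Icc hx hy
    exact vdC_one hxy hm (fun t ht => h1 t (hsub ht)) (fun t ht => h2 t (hsub ht)) (hc.mono hsub)
      (hφ'.imp (fun h t ht => h t (hsub ht)) (fun h t ht => h t (hsub ht))) hs
  have h36 : 3 / m ≤ 6 / m := by gcongr; norm_num
  have ha : a ∈ Icc a b := ⟨le_rfl, hab⟩
  have hb : b ∈ Icc a b := ⟨hab, le_rfl⟩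
  by_cases hA : 0 ≤ φ'' a
  · exact (hpiece a b le_rfl hab le_rfl (Or.inl fun t ht => hA.trans (hmono ha ht ht.1))).trans h36
  by_cases hB : φ'' b ≤ 0
  · exact (hpiece a b le_rfl hab le_rfl (Or.inr fun t ht => (hmono ht hb ht.2).trans hB)).trans h36
  push Not at hA hB
  obtain ⟨c, hcI, hc0⟩ := intermediate_value_Icc hab hc ⟨hA.le, hB.le⟩
  have hi : ∀ x ∈ Icc a b, ∀ y ∈ Icc a b,
      IntervalIntegrable (fun x => cexp (I * (φ x : ℂ))) volume x y := fun x hx y hy =>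
    (hEc.mono (uIcc_subset_Icc hx hy)).intervalIntegrable
  rw [← integral_add_adjacent_intervals (hi a ha c hcI) (hi c hcI b hb)]
  refine (norm_add_le _ _).trans ?_
  have e1 := hpiece a c le_rfl hcI.1 hcI.2
    (Or.inr fun t ht => (hmono ⟨ht.1, ht.2.trans hcI.2⟩ hcI ht.2).trans hc0.le)
  have e2 := hpiece c b hcI.1 hcI.2 le_rfl
    (Or.inl fun t ht => hc0.ge.trans (hmono hcI ⟨hcI.1.trans ht.1, ht.2⟩ ht.1))
  have : 6 / m = 3 / m + 3 / m := by ring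
  linarith

theorem hasDerivAt_neg_two_div_sqrt {x : ℝ} (hx : 0 < x) :
    HasDerivAt (fun x => -2 / √x) (1 / (x * √x)) x := by
  have hs := sqrt_pos.2 hx
  have := ((Real.hasDerivAt_sqrt hx.ne').inv hs.ne').const_mul (-2)
  refine (this.congr_deriv ?_).congr_of_eventuallyEq (Eventually.of_forall fun y => ?_)
  · rw [sq_sqrt hx.le]; field_simp
  · simp [div_eq_mul_inv]

/-- An oscillatory integral bound survives an amplitude decaying like `p^{-1/2}`. -/
theorem norm_integral_mul_le_of_decay {E M M' : ℝ → ℂ} {x y K Ko : ℝ} (hx : 0 < x) (hxy : x ≤ y)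
    (hK : 0 ≤ K)
    (hE : ContinuousOn E (Icc x y)) (hM : ∀ p ∈ Icc x y, HasDerivAt M (M' p) p)
    (hM'c : ContinuousOn M' (Icc x y)) (hM0 : ∀ p ∈ Icc x y, ‖M p‖ ≤ K / √p)
    (hM1 : ∀ p ∈ Icc x y, ‖M' p‖ ≤ K / (p * √p))
    (hKo : ∀ z ∈ Icc x y, ‖∫ p in x..z, E p‖ ≤ Ko) :
    ‖∫ p in x..y, E p * M p‖ ≤ Ko * (2 * K / √x) := by
  have hKo0 : 0 ≤ Ko := (norm_nonneg _).trans (hKo x ⟨le_rfl, hxy⟩)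
  refine (norm_integral_mul_le hxy hE hM hM'c hKo).trans ?_
  refine mul_le_mul_of_nonneg_left ?_ hKo0
  have hpos : ∀ p ∈ Icc x y, 0 < p := fun p hp => hx.trans_le hp.1
  have hcont : ContinuousOn (fun p : ℝ => 1 / (p * √p)) (Icc x y) := by
    refine continuousOn_const.div (continuousOn_id.mul Real.continuous_sqrt.continuousOn) ?_
    intro p hp
    have := hpos p hp
    have := sqrt_pos.2 this
    positivity
  have hsplit : ∫ p in x..y, 1 / (p * √p) = -2 / √y - -2 / √x := by
    refine integral_eq_sub_of_hasDerivAt (f := fun p : ℝ => -2 / √p) ?_ ?_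
    · intro p hp
      rw [uIcc_of_le hxy] at hp
      exact hasDerivAt_neg_two_div_sqrt (hpos p hp)
    · exact (hcont.mono (by rw [uIcc_of_le hxy])).intervalIntegrable
  have h1 : ∫ p in x..y, ‖M' p‖ ≤ ∫ p in x..y, K * (1 / (p * √p)) := by
    refine intervalIntegral.integral_mono_on hxy ?_ ?_ ?_
    · exact (hM'c.norm.mono (by rw [uIcc_of_le hxy])).intervalIntegrable
    · exact ((hcont.mono (by rw [uIcc_of_le hxy])).intervalIntegrable).const_mul K
    · intro p hp
      refine (hM1 p hp).trans (le_of_eq ?_); ring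
  rw [intervalIntegral.integral_const_mul, hsplit] at h1
  have h2 := hM0 y ⟨hxy, le_rfl⟩
  have h3 : 0 ≤ K / √y := by positivity
  have e1 : K * (-2 / √y - -2 / √x) = 2 * K / √x - 2 * (K / √y) := by ring
  linarith

/-- Trivial bound near the origin. -/
theorem norm_integral_le_sqrt {N : ℝ → ℂ} {x K : ℝ} (hx : 0 ≤ x)
    (hb : ∀ p ∈ Ioc 0 x, ‖N p‖ ≤ K / √p) :
    ‖∫ p in (0:ℝ)..x, N p‖ ≤ 2 * K * √x := by
  have hi : IntervalIntegrable (fun p : ℝ => K * p ^ (-(1/2) : ℝ)) volume 0 x :=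
    (intervalIntegral.intervalIntegrable_rpow' (by norm_num)).const_mul K
  have hval : ∫ p in (0:ℝ)..x, K * p ^ (-(1/2) : ℝ) = 2 * K * √x := by
    rw [intervalIntegral.integral_const_mul, integral_rpow (Or.inl (by norm_num)),
      Real.zero_rpow (by norm_num), Real.sqrt_eq_rpow]
    norm_num
    ring
  rw [← hval]
  refine intervalIntegral.norm_integral_le_of_norm_le hx ?_ hi
  refine (ae_of_all _ fun p hp => ?_)
  refine (hb p hp).trans (le_of_eq ?_)
  rw [Real.rpow_neg hp.1.le, Real.sqrt_eq_rpow, div_eq_mul_inv]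

set_option maxHeartbeats 2000000 in
theorem cubic_phase_integral {E σ ν ℓ d K : ℝ} {f f' f'' f₃ r r' : ℝ → ℝ} {N M M' : ℝ → ℂ}
    (hℓ : 2 ≤ ℓ) (hd0 : 0 ≤ d) (hd2 : d ≤ 2) (hσ : |σ| = d ^ 4) (hν : ℓ ^ 2 / 2 ≤ ν) (hK : 0 ≤ K)
    (hf1 : ∀ p ∈ Ioc (0:ℝ) 6, HasDerivAt f (f' p) p)
    (hf2 : ∀ p ∈ Ioc (0:ℝ) 6, HasDerivAt f' (f'' p) p)
    (hf3 : ∀ p ∈ Ioc (0:ℝ) 6, HasDerivAt f'' (f₃ p) p)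
    (hf' : ∀ p ∈ Ioc (0:ℝ) 6, f' p = ((E / p - p) / 2) ^ 2 + σ - r p)
    (hf'' : ∀ p ∈ Ioc (0:ℝ) 6, f'' p = (p - E ^ 2 / p ^ 3) / 2 - r' p)
    (hf₃ : ∀ p ∈ Ioc (0:ℝ) 6, 1 / 4 ≤ f₃ p)
    (hr : ∀ p ∈ Ioc (0:ℝ) 6, |r p| ≤ 3 * p / ν)
    (hr' : ∀ p ∈ Ioc (0:ℝ) 6, |r' p| ≤ 3 / ν)
    (hNc : ContinuousOn N (Icc 0 6))
    (hN : ∀ p ∈ Ioc (0:ℝ) 6, N p = cexp (I * ((ℓ ^ 6 * f p : ℝ) : ℂ)) * M p)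
    (hM : ∀ p ∈ Ioc (0:ℝ) 6, HasDerivAt M (M' p) p)
    (hM'c : ContinuousOn M' (Ioc 0 6))
    (hM0 : ∀ p ∈ Ioc (0:ℝ) 6, ‖M p‖ ≤ K / √p)
    (hM1 : ∀ p ∈ Ioc (0:ℝ) 6, 1 / ℓ ^ 6 ≤ p → ‖M' p‖ ≤ K / (p * √p)) :
    ‖∫ p in (0:ℝ)..6, N p‖ ≤ 74 * K / ℓ ∧ ‖∫ p in (0:ℝ)..6, N p‖ * d ≤ 518 * K / ℓ ^ 2 := by
  have hℓ0 : 0 < ℓ := by linarith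
  have hν0 : 0 < ν := lt_of_lt_of_le (by positivity) hν
  have hinv : 1 / ℓ ^ 2 ≤ 1 / 4 := by
    apply one_div_le_one_div_of_le (by norm_num); nlinarith
  have hi : ∀ x ∈ Icc (0:ℝ) 6, ∀ y ∈ Icc (0:ℝ) 6, IntervalIntegrable N volume x y :=
    fun x hx y hy => (hNc.mono (uIcc_subset_Icc hx hy)).intervalIntegrable
  have hzero : ∀ x ∈ Icc (0:ℝ) 6, ‖∫ p in (0:ℝ)..x, N p‖ ≤ 2 * K * √x := by
    intro x hx
    refine norm_integral_le_sqrt hx.1 fun p hp => ?_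
    have hp6 : p ∈ Ioc (0:ℝ) 6 := ⟨hp.1, hp.2.trans hx.2⟩
    rw [hN p hp6, norm_mul, norm_exp_I_mul, one_mul]
    exact hM0 p hp6
  have hpiece : ∀ x y Ko, 0 < x → 1 / ℓ ^ 6 ≤ x → x ≤ y → y ≤ 6 →
      (∀ z ∈ Icc x y, ‖∫ p in x..z, cexp (I * ((ℓ ^ 6 * f p : ℝ) : ℂ))‖ ≤ Ko) →
      ‖∫ p in x..y, N p‖ ≤ Ko * (2 * K / √x) := by
    intro x y Ko hx hx' hxy hy h
    have hsub : Icc x y ⊆ Ioc (0:ℝ) 6 := fun p hp => ⟨hx.trans_le hp.1, hp.2.trans hy⟩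
    have hfc : ContinuousOn f (Icc x y) := fun p hp =>
      (hf1 p (hsub hp)).continuousAt.continuousWithinAt
    have := norm_integral_mul_le_of_decay hx hxy hK
      (continuousOn_const.mul (continuous_ofReal.comp_continuousOn
        (continuousOn_const.mul hfc))).cexp (fun p hp => hM p (hsub hp)) (hM'c.mono hsub)
      (fun p hp => hM0 p (hsub hp)) (fun p hp => hM1 p (hsub hp) (hx'.trans hp.1)) h
    refine le_trans (le_of_eq ?_) this
    congr 1
    refine integral_congr fun p hp => ?_
    rw [uIcc_of_le hxy] at hp
    exact hN p (hsub hp)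
  have h3 : ∀ x z, 0 < x → x ≤ z → z ≤ 6 →
      ‖∫ p in x..z, cexp (I * ((ℓ ^ 6 * f p : ℝ) : ℂ))‖ ≤ 36 / ℓ ^ 2 := by
    intro x z hx hxz hz
    have hsub : Icc x z ⊆ Ioc (0:ℝ) 6 := fun p hp => ⟨hx.trans_le hp.1, hp.2.trans hz⟩
    refine (vdC_three (m := ℓ ^ 2 / 2) hxz (by positivity)
      (fun p hp => (hf1 p (hsub hp)).const_mul (ℓ ^ 6))
      (fun p hp => (hf2 p (hsub hp)).const_mul (ℓ ^ 6))
      (fun p hp => (hf3 p (hsub hp)).const_mul (ℓ ^ 6)) ?_).trans (le_of_eq ?_)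
    · intro p hp
      have := mul_le_mul_of_nonneg_left (hf₃ p (hsub hp)) (by positivity : 0 ≤ ℓ ^ 6)
      nlinarith [pow_pos hℓ0 6]
    · (field_simp; try ring)
  have hℓ2 : 1 / ℓ ^ 2 ∈ Icc (0:ℝ) 6 := ⟨by positivity, by linarith⟩
  have hsqℓ : √(1 / ℓ ^ 2) = 1 / ℓ := by
    rw [Real.sqrt_div zero_le_one, Real.sqrt_one, Real.sqrt_sq hℓ0.le]
  have hpow : 1 / ℓ ^ 6 ≤ 1 / ℓ ^ 2 :=
    one_div_le_one_div_of_le (by positivity) (pow_le_pow_right₀ (by linarith) (by norm_num))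
  have h6 : (6:ℝ) ∈ Icc (0:ℝ) 6 := ⟨by norm_num, le_rfl⟩
  have h0 : (0:ℝ) ∈ Icc (0:ℝ) 6 := ⟨le_rfl, by norm_num⟩
  have first : ‖∫ p in (0:ℝ)..6, N p‖ ≤ 74 * K / ℓ := by
    rw [← integral_add_adjacent_intervals (hi 0 h0 _ hℓ2) (hi _ hℓ2 6 h6)]
    refine (norm_add_le _ _).trans ?_
    have e1 := hzero _ hℓ2
    have e2 := hpiece (1 / ℓ ^ 2) 6 (36 / ℓ ^ 2) (by positivity) hpow hℓ2.2 le_rfl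
      (fun z hz => h3 _ z (by positivity) hz.1 hz.2)
    rw [hsqℓ] at e1 e2
    have e3 : 36 / ℓ ^ 2 * (2 * K / (1 / ℓ)) = 72 * K / ℓ := by (field_simp; try ring)
    have e4 : 2 * K * (1 / ℓ) + 72 * K / ℓ = 74 * K / ℓ := by ring
    linarith
  refine ⟨first, ?_⟩
  by_cases hs : ℓ * d ≤ 7
  · have e : 518 * K / ℓ ^ 2 = (74 * K / ℓ) * (7 / ℓ) := by (field_simp; try ring)
    rw [e]
    refine mul_le_mul first ?_ hd0 (by positivity)
    rw [le_div_iff₀ hℓ0]; linarith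
  push Not at hs
  have hd : 0 < d := by
    by_contra h
    have : d = 0 := le_antisymm (not_lt.1 h) hd0
    rw [this] at hs; linarith
  have hsd : 49 ≤ ℓ ^ 2 * d ^ 2 := by nlinarith
  set P0 := 1 / (ℓ ^ 4 * d ^ 2) with hP0
  set q := d ^ 2 / 4 with hq
  have hP0pos : 0 < P0 := by positivity
  have hsqP0 : √P0 = 1 / (ℓ ^ 2 * d) := by
    rw [hP0, Real.sqrt_div zero_le_one, Real.sqrt_one,
      show ℓ ^ 4 * d ^ 2 = (ℓ ^ 2 * d) ^ 2 by ring, Real.sqrt_sq (by positivity)]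
  have hsqq : √q = d / 2 := by
    rw [hq, show d ^ 2 / 4 = (d / 2) ^ 2 by ring, Real.sqrt_sq (by positivity)]
  have hP0q : P0 ≤ q := by
    rw [hP0, hq, div_le_div_iff₀ (by positivity) (by norm_num)]
    nlinarith
  have hq1 : q ≤ 1 := by rw [hq]; nlinarith
  have hP0Λ : 1 / ℓ ^ 6 ≤ P0 := by
    apply one_div_le_one_div_of_le (by positivity)
    have : d ^ 2 ≤ ℓ ^ 2 := pow_le_pow_left₀ hd0 (by linarith) 2
    calc ℓ ^ 4 * d ^ 2 ≤ ℓ ^ 4 * ℓ ^ 2 := by gcongr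
      _ = ℓ ^ 6 := by ring
  have hqpos : 0 < q := by positivity
  have hνinv : 3 / ν ≤ 6 * d ^ 2 / 49 := by
    rw [div_le_div_iff₀ hν0 (by norm_num)]
    nlinarith [mul_le_mul_of_nonneg_left hν (sq_nonneg d)]
  have hrs : ∀ p, 0 < p → p ≤ q → |r p| ≤ d ^ 4 / 4 := by
    intro p hp hpq
    have hp6 : p ∈ Ioc (0:ℝ) 6 := ⟨hp, by linarith⟩
    have e1 := hr p hp6
    have e2 : 3 * p / ν = p * (3 / ν) := by ring
    have e3 : p * (3 / ν) ≤ q * (6 * d ^ 2 / 49) := mul_le_mul hpq hνinv (by positivity) hqpos.le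
    rw [hq] at e3
    have : d ^ 2 / 4 * (6 * d ^ 2 / 49) = 6 / 196 * d ^ 4 := by ring
    have : 0 ≤ d ^ 4 := by positivity
    linarith
  have hbig : ∀ x y z, 0 < x → x ≤ z → z ≤ y → y ≤ q →
      ((∀ p ∈ Icc x y, d ^ 4 / 2 ≤ f' p) ∨ (∀ p ∈ Icc x y, f' p ≤ -(d ^ 4 / 2))) →
      ‖∫ p in x..z, cexp (I * ((ℓ ^ 6 * f p : ℝ) : ℂ))‖ ≤ 12 / (ℓ ^ 6 * d ^ 4) := by
    intro x y z hx hxz hzy hy h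
    have hsub : Icc x z ⊆ Ioc (0:ℝ) 6 := fun p hp =>
      ⟨hx.trans_le hp.1, by linarith [hp.2]⟩
    have hsub' : Icc x z ⊆ Icc x y := Icc_subset_Icc le_rfl hzy
    refine (vdC_one_of_convex (m := ℓ ^ 6 * (d ^ 4 / 2)) hxz (by positivity)
      (fun p hp => (hf1 p (hsub hp)).const_mul (ℓ ^ 6))
      (fun p hp => (hf2 p (hsub hp)).const_mul (ℓ ^ 6))
      (fun p hp => (hf3 p (hsub hp)).const_mul (ℓ ^ 6)) ?_ ?_).trans (le_of_eq ?_)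
    · refine h.imp (fun h p hp => ?_) (fun h p hp => ?_)
      · exact mul_le_mul_of_nonneg_left (h p (hsub' hp)) (by positivity)
      · rw [← mul_neg]
        exact mul_le_mul_of_nonneg_left (h p (hsub' hp)) (by positivity)
    · intro p hp
      have := hf₃ p (hsub hp)
      have : 0 ≤ f₃ p := by linarith
      positivity
    · (field_simp; try ring)
  have hbig' : ∀ x y, P0 ≤ x → x ≤ y → y ≤ q →
      ((∀ p ∈ Icc x y, d ^ 4 / 2 ≤ f' p) ∨ (∀ p ∈ Icc x y, f' p ≤ -(d ^ 4 / 2))) →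
      ‖∫ p in x..y, N p‖ ≤ 24 * K / (ℓ ^ 2 * d) := by
    intro x y hx hxy hy h
    have hx0 := hP0pos.trans_le hx
    have e2 := hpiece x y _ hx0 (hP0Λ.trans hx) hxy (by linarith)
      (fun z hz => hbig x y z hx0 hz.1 hz.2 hy h)
    refine e2.trans ?_
    have e3 : 2 * K / √x ≤ 2 * K / √P0 := by
      have := Real.sqrt_le_sqrt hx
      have := sqrt_pos.2 hP0pos
      gcongr
    rw [hsqP0] at e3
    calc 12 / (ℓ ^ 6 * d ^ 4) * (2 * K / √x)
        ≤ 12 / (ℓ ^ 6 * d ^ 4) * (2 * K / (1 / (ℓ ^ 2 * d))) := by gcongr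
      _ = 24 * K / (ℓ ^ 2 * d) / (ℓ ^ 2 * d ^ 2) := by (field_simp; try ring)
      _ ≤ 24 * K / (ℓ ^ 2 * d) := div_le_self (by positivity) (by linarith)
  have hP06 : P0 ∈ Icc (0:ℝ) 6 := ⟨hP0pos.le, by linarith⟩
  have hq6 : q ∈ Icc (0:ℝ) 6 := ⟨hqpos.le, by linarith⟩
  have middle : ‖∫ p in P0..q, N p‖ ≤ 120 * K / (ℓ ^ 2 * d) := by
    rcases abs_eq (by positivity : 0 ≤ d ^ 4) |>.1 hσ with hσ' | hσ'
    · refine (hbig' P0 q le_rfl hP0q le_rfl (Or.inl fun p hp => ?_)).trans ?_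
      · have hp0 := hP0pos.trans_le hp.1
        rw [hf' p ⟨hp0, by linarith [hp.2]⟩, hσ']
        have := abs_le.1 (hrs p hp0 hp.2)
        have : 0 ≤ d ^ 4 := by positivity
        linarith [sq_nonneg ((E / p - p) / 2)]
      · gcongr; norm_num
    set ps := 2 * |E| / d ^ 2 with hps
    have hps0 : 0 ≤ ps := by positivity
    set s := max P0 (min q ps) with hs'
    set t := max P0 (min s (1 / ℓ ^ 2)) with ht'
    have hsq : s ≤ q := max_le hP0q (min_le_left _ _)
    have hPs : P0 ≤ s := le_max_left _ _
    have hPt : P0 ≤ t := le_max_left _ _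
    have hts : t ≤ s := max_le hPs (min_le_left _ _)
    have ht6 : t ∈ Icc (0:ℝ) 6 := ⟨hP0pos.le.trans hPt, by linarith⟩
    have hs6 : s ∈ Icc (0:ℝ) 6 := ⟨hP0pos.le.trans hPs, by linarith⟩
    have hconc : ∀ p, P0 < s → P0 ≤ p → p ≤ s → f'' p ≤ -(d ^ 4 / (16 * p)) := by
      intro p hlt hp hps'
      have hp0 := hP0pos.trans_le hp
      have hsps : s ≤ ps := by
        rcases max_choice P0 (min q ps) with h | h
        · rw [← hs'] at h; linarith
        · rw [hs', h]; exact min_le_right _ _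
      have hp6 : p ∈ Ioc (0:ℝ) 6 := ⟨hp0, by linarith⟩
      rw [hf'' p hp6]
      have e1 := (abs_le.1 (hr' p hp6)).1
      have hEp : p * d ^ 2 ≤ 2 * |E| := by
        have : p ≤ 2 * |E| / d ^ 2 := hps'.trans hsps
        rwa [le_div_iff₀ (by positivity)] at this
      have hE2 : p ^ 2 * d ^ 4 ≤ 4 * E ^ 2 := by
        have := pow_le_pow_left₀ (by positivity) hEp 2
        rw [mul_pow, mul_pow 2, sq_abs] at this
        linarith [show p ^ 2 * (d ^ 2) ^ 2 = p ^ 2 * d ^ 4 by ring]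
      have e2 : d ^ 4 / (4 * p) ≤ E ^ 2 / p ^ 3 := by
        rw [div_le_div_iff₀ (by positivity) (by positivity)]
        have := mul_le_mul_of_nonneg_left hE2 hp0.le
        linarith [show d ^ 4 * p ^ 3 = p * (p ^ 2 * d ^ 4) by ring]
      have hpq : p ≤ d ^ 2 / 4 := by rw [← hq]; linarith
      have e3 : p / 2 ≤ d ^ 4 / (32 * p) := by
        rw [div_le_div_iff₀ (by positivity) (by positivity)]
        have := pow_le_pow_left₀ hp0.le hpq 2
        linarith [show (d ^ 2 / 4) ^ 2 = d ^ 4 / 16 by ring]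
      have e4 : d ^ 2 / 8 ≤ d ^ 4 / (32 * p) := by
        rw [div_le_div_iff₀ (by positivity) (by positivity)]
        have := mul_le_mul_of_nonneg_left hpq (sq_nonneg d)
        linarith [show d ^ 2 * (d ^ 2 / 4) = d ^ 4 / 4 by ring,
          show d ^ 2 * (32 * p) = 32 * (d ^ 2 * p) by ring]
      have e5 : d ^ 4 / (4 * p) = 8 * (d ^ 4 / (32 * p)) := by (field_simp; try ring)
      have e6 : d ^ 4 / (16 * p) = 2 * (d ^ 4 / (32 * p)) := by (field_simp; try ring)
      have : 0 ≤ d ^ 2 := by positivity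
      linarith
    have htwo : ∀ x y m, P0 < s → P0 ≤ x → x ≤ y → y ≤ s → 0 < m →
        (∀ p ∈ Icc x y, m ≤ ℓ ^ 6 * (d ^ 4 / (16 * p))) →
        ‖∫ p in x..y, N p‖ ≤ 8 / √m * (2 * K / √x) := by
      intro x y m hlt hx hxy hy hm h
      have hx0 := hP0pos.trans_le hx
      refine hpiece x y _ hx0 (hP0Λ.trans hx) hxy (by linarith) fun z hz => ?_
      have hsub : Icc x z ⊆ Ioc (0:ℝ) 6 := fun p hp =>
        ⟨hx0.trans_le hp.1, by linarith [hp.2, hz.2]⟩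
      refine vdC_two hz.1 hm
        (fun p hp => (hf1 p (hsub hp)).const_mul (ℓ ^ 6))
        (fun p hp => (hf2 p (hsub hp)).const_mul (ℓ ^ 6))
        (fun p hp => ((hf3 p (hsub hp)).const_mul (ℓ ^ 6)).continuousAt.continuousWithinAt)
        (Or.inr fun p hp => ?_)
      have e1 := h p ⟨hp.1, hp.2.trans hz.2⟩
      have e2 := mul_le_mul_of_nonneg_left
        (hconc p hlt (hx.trans hp.1) (hp.2.trans (hz.2.trans hy))) (by positivity : 0 ≤ ℓ ^ 6)
      rw [mul_neg] at e2
      linarith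
    have m1 : ‖∫ p in P0..t, N p‖ ≤ 64 * K / (ℓ ^ 2 * d) := by
      rcases eq_or_lt_of_le hPt with h | h
      · rw [← h, intervalIntegral.integral_same, norm_zero]; positivity
      · have htl : t ≤ 1 / ℓ ^ 2 := by
          rcases max_choice P0 (min s (1 / ℓ ^ 2)) with h' | h'
          · rw [← ht'] at h'; linarith
          · rw [ht', h']; exact min_le_right _ _
        have := htwo P0 t ((ℓ ^ 4 * d ^ 2 / 4) ^ 2) (h.trans_le hts) le_rfl hPt hts (by positivity) ?_
        · rw [hsqP0, Real.sqrt_sq (by positivity)] at this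
          refine this.trans (le_of_eq ?_)
          (field_simp; try ring)
        · intro p hp
          have hp0 := hP0pos.trans_le hp.1
          have e1 : p ≤ 1 / ℓ ^ 2 := hp.2.trans htl
          rw [le_div_iff₀ (by positivity)] at e1
          rw [← mul_div_assoc, le_div_iff₀ (by positivity)]
          have : (ℓ ^ 4 * d ^ 2 / 4) ^ 2 * (16 * p) = ℓ ^ 6 * d ^ 4 * (p * ℓ ^ 2) := by ring
          rw [this]
          exact mul_le_of_le_one_right (by positivity) e1
    have m2 : ‖∫ p in t..s, N p‖ ≤ 32 * K / (ℓ ^ 2 * d) := by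
      rcases eq_or_lt_of_le hts with h | h
      · rw [h, intervalIntegral.integral_same, norm_zero]; positivity
      · have htl : 1 / ℓ ^ 2 ≤ t := by
          rcases min_choice s (1 / ℓ ^ 2) with h' | h'
          · exfalso
            have : s ≤ t := by rw [ht', h']; exact le_max_right _ _
            linarith
          · have : min s (1 / ℓ ^ 2) ≤ t := le_max_right _ _
            rwa [h'] at this
        have := htwo t s ((ℓ ^ 3 * d / 2) ^ 2) (hPt.trans_lt h) hPt hts le_rfl (by positivity) ?_
        · rw [Real.sqrt_sq (by positivity)] at this
          refine this.trans ?_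
          have e3 : 2 * K / √t ≤ 2 * K / √(1 / ℓ ^ 2) := by
            have := Real.sqrt_le_sqrt htl
            have : 0 < √(1 / ℓ ^ 2) := by rw [hsqℓ]; positivity
            gcongr
          rw [hsqℓ] at e3
          calc 8 / (ℓ ^ 3 * d / 2) * (2 * K / √t) ≤ 8 / (ℓ ^ 3 * d / 2) * (2 * K / (1 / ℓ)) := by
                gcongr
            _ = 32 * K / (ℓ ^ 2 * d) := by (field_simp; try ring)
        · intro p hp
          have hp0 := (hP0pos.trans_le hPt).trans_le hp.1
          have e1 : p ≤ d ^ 2 / 4 := by rw [← hq]; linarith [hp.2]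
          rw [← mul_div_assoc, le_div_iff₀ (by positivity)]
          have : (ℓ ^ 3 * d / 2) ^ 2 * (16 * p) = ℓ ^ 6 * d ^ 2 * (4 * p) := by ring
          rw [this, show ℓ ^ 6 * d ^ 4 = ℓ ^ 6 * d ^ 2 * d ^ 2 by ring]
          exact mul_le_mul_of_nonneg_left (by linarith) (by positivity)
    have m3 : ‖∫ p in s..q, N p‖ ≤ 24 * K / (ℓ ^ 2 * d) := by
      rcases eq_or_lt_of_le hsq with h | h
      · rw [h, intervalIntegral.integral_same, norm_zero]; positivity
      refine hbig' s q hPs hsq le_rfl (Or.inr fun p hp => ?_)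
      have hp0 := (hP0pos.trans_le hPs).trans_le hp.1
      have hpss : ps ≤ p := by
        refine le_trans ?_ hp.1
        rcases min_choice q ps with h' | h'
        · exfalso
          have : min q ps ≤ s := le_max_right _ _
          rw [h'] at this; linarith
        · have : min q ps ≤ s := le_max_right _ _
          rwa [h'] at this
      rw [hf' p ⟨hp0, by linarith [hp.2]⟩, hσ']
      have e1 := abs_le.1 (hrs p hp0 hp.2)
      have e2 : |E / p| ≤ d ^ 2 / 2 := by
        rw [hps, div_le_iff₀ (by positivity)] at hpss
        rw [abs_div, abs_of_pos hp0, div_le_div_iff₀ hp0 (by norm_num)]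
        linarith
      have e3 : |(E / p - p) / 2| ≤ 3 / 8 * d ^ 2 := by
        have hpq : p ≤ d ^ 2 / 4 := by rw [← hq]; exact hp.2
        rw [abs_le] at e2 ⊢
        constructor <;> linarith
      have e4 : ((E / p - p) / 2) ^ 2 ≤ (3 / 8 * d ^ 2) ^ 2 := by
        rw [← sq_abs]; exact pow_le_pow_left₀ (abs_nonneg _) e3 2
      have : 0 ≤ d ^ 4 := by positivity
      have e5 : (3 / 8 * d ^ 2) ^ 2 = 9 / 64 * d ^ 4 := by ring
      linarith
    rw [← integral_add_adjacent_intervals (hi _ hP06 _ hs6) (hi _ hs6 _ hq6),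
      ← integral_add_adjacent_intervals (hi _ hP06 _ ht6) (hi _ ht6 _ hs6)]
    have e : 120 * K / (ℓ ^ 2 * d)
      = 64 * K / (ℓ ^ 2 * d) + 32 * K / (ℓ ^ 2 * d) + 24 * K / (ℓ ^ 2 * d) := by ring
    rw [e]
    exact (norm_add_le _ _).trans (add_le_add ((norm_add_le _ _).trans (add_le_add m1 m2)) m3)
  have l1 := hzero P0 hP06
  have l2 := hpiece q 6 (36 / ℓ ^ 2) hqpos (hP0Λ.trans hP0q) hq6.2 le_rfl
      (fun z hz => h3 _ z hqpos hz.1 hz.2)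
  rw [hsqP0] at l1
  rw [hsqq] at l2
  have e1 : 2 * K * (1 / (ℓ ^ 2 * d)) = 2 * K / (ℓ ^ 2 * d) := by ring
  have e2 : 36 / ℓ ^ 2 * (2 * K / (d / 2)) = 144 * K / (ℓ ^ 2 * d) := by (field_simp; try ring)
  have tot : ‖∫ p in (0:ℝ)..6, N p‖ ≤ 266 * K / (ℓ ^ 2 * d) := by
    rw [← integral_add_adjacent_intervals (hi _ h0 _ hq6) (hi _ hq6 _ h6),
      ← integral_add_adjacent_intervals (hi _ h0 _ hP06) (hi _ hP06 _ hq6)]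
    have e : 266 * K / (ℓ ^ 2 * d)
      = 2 * K / (ℓ ^ 2 * d) + 120 * K / (ℓ ^ 2 * d) + 144 * K / (ℓ ^ 2 * d) := by ring
    rw [e]
    exact (norm_add_le _ _).trans (add_le_add ((norm_add_le _ _).trans
      (add_le_add (l1.trans e1.le) middle)) (l2.trans e2.le))
  calc ‖∫ p in (0:ℝ)..6, N p‖ * d ≤ 266 * K / (ℓ ^ 2 * d) * d := by gcongr
    _ = 266 * K / ℓ ^ 2 := by field_simp
    _ ≤ 518 * K / ℓ ^ 2 := by gcongr; norm_num

theorem continuousOn_intervalIntegral_param {E : Type*} [PseudoMetricSpace E] [ProperSpace E]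
    {F : E → ℝ → ℂ} {U : Set E} (hU : IsOpen U)
    {a b : ℝ} (hab : a ≤ b) (hF : ContinuousOn (uncurry F) (U ×ˢ Icc a b)) :
    ContinuousOn (fun x => ∫ t in a..b, F x t) U := by
  intro x₀ hx₀
  obtain ⟨r, hr, hrU⟩ := Metric.isOpen_iff.1 hU x₀ hx₀
  set V := Metric.closedBall x₀ (r / 2)
  have hVU : V ⊆ U := (Metric.closedBall_subset_ball (by linarith)).trans hrU
  have hVnhds : V ∈ nhds x₀ := Metric.closedBall_mem_nhds x₀ (by linarith)
  have hsec : ∀ x ∈ U, ContinuousOn (F x) (Icc a b) := fun x hx =>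
    hF.comp (f := fun t => (x, t)) (by fun_prop) (fun t ht => ⟨hx, ht⟩)
  have hcpt : IsCompact (V ×ˢ Icc a b) := (isCompact_closedBall x₀ (r/2)).prod isCompact_Icc
  obtain ⟨K, hK⟩ := hcpt.exists_bound_of_continuousOn (hF.mono (prod_mono hVU le_rfl))
  refine ContinuousAt.continuousWithinAt ?_
  refine intervalIntegral.continuousAt_of_dominated_interval (bound := fun _ => K) ?_ ?_ ?_ ?_
  · filter_upwards [hVnhds] with x hx
    rw [uIoc_of_le hab]
    exact ((hsec x (hVU hx)).mono Ioc_subset_Icc_self).aestronglyMeasurable measurableSet_Ioc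
  · filter_upwards [hVnhds] with x hx
    refine Eventually.of_forall fun t ht => ?_
    rw [uIoc_of_le hab] at ht
    exact hK (x, t) ⟨hx, Ioc_subset_Icc_self ht⟩
  · exact intervalIntegrable_const
  · refine Eventually.of_forall fun t ht => ?_
    rw [uIoc_of_le hab] at ht
    have h1 := hF (x₀, t) ⟨hx₀, Ioc_subset_Icc_self ht⟩
    have h2 : ContinuousWithinAt (fun x => F x t) U x₀ :=
      h1.comp (f := fun x => (x, t)) (by fun_prop) (fun x hx => ⟨hx, Ioc_subset_Icc_self ht⟩)
    exact h2.continuousAt (hU.mem_nhds hx₀)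

/-- The centered quadratic phase `p (y - (p² + E) / (2p))²`. -/
noncomputable def fresnelPhase (E p y : ℝ) : ℝ := p * (y - (p ^ 2 + E) / (2 * p)) ^ 2

theorem hasDerivAt_fresnelPhase_left {E p y : ℝ} (hp : 0 < p) :
    HasDerivAt (fun p => fresnelPhase E p y)
      ((y - (p ^ 2 + E) / (2 * p)) * (y - 3 * p / 2 + E / (2 * p))) p := by
  unfold fresnelPhase
  have h1 : HasDerivAt (fun p : ℝ => (p ^ 2 + E) / (2 * p)) (1 / 2 - E / (2 * p ^ 2)) p := by
    refine ((((hasDerivAt_id p).pow 2).add_const E).div ((hasDerivAt_id p).const_mul 2)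
      (by simpa using hp.ne')).congr_deriv ?_
    simp only [id, Pi.pow_apply]
    field_simp
    ring
  refine ((hasDerivAt_id p).mul ((h1.const_sub y).pow 2)).congr_deriv ?_
  have e1 : (p ^ 2 + E) / (2 * p) = p / 2 + E / (2 * p) := by field_simp
  have e2 : E / (2 * p ^ 2) = E / (2 * p) / p := by field_simp
  simp only [id, Pi.pow_apply]
  rw [e1, e2]
  generalize E / (2 * p) = q
  field_simp
  norm_num
  ring

theorem hasDerivAt_fresnelPhase_right {E p : ℝ} (y : ℝ) :
    HasDerivAt (fun y => fresnelPhase E p y) (2 * p * (y - (p ^ 2 + E) / (2 * p))) y := by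
  unfold fresnelPhase
  refine ((((hasDerivAt_id y).sub_const _).pow 2).const_mul p).congr_deriv ?_
  simp; ring

theorem norm_fresnel_integral_le {E p Λ W₀ x y : ℝ} (hp : 0 < p) (hΛ : 0 < Λ) (hxy : x ≤ y)
    {w w' : ℝ → ℂ} (hw : ∀ t ∈ Icc x y, HasDerivAt w (w' t) t) (hw'c : ContinuousOn w' (Icc x y))
    (hW : ∀ t ∈ Icc x y, ‖w t‖ ≤ W₀) (hW' : ∀ t ∈ Icc x y, ‖w' t‖ ≤ W₀) :
    ‖∫ t in x..y, cexp (I * ((Λ * fresnelPhase E p t : ℝ) : ℂ)) * w t‖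
      ≤ 8 / √(Λ * p) * (W₀ + W₀ * (y - x)) := by
  have hφc : Continuous fun t => fresnelPhase E p t := by unfold fresnelPhase; fun_prop
  refine norm_integral_mul_le_const hxy (by fun_prop) hw hw'c (fun z hz => ?_) hW hW'
  refine (vdC_two (φ := fun t => Λ * fresnelPhase E p t) (m := 2 * (Λ * p))
    hz.1 (by positivity) (fun t _ => (hasDerivAt_fresnelPhase_right t).const_mul Λ)
    (fun t _ => (((hasDerivAt_id t).sub_const _).const_mul (2 * p)).const_mul Λ)
    continuousOn_const (Or.inl fun t _ => le_of_eq (by ring))).trans ?_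
  have h0 : 0 < √(Λ * p) := sqrt_pos.2 (by positivity)
  have : √(Λ * p) ≤ √(2 * (Λ * p)) := Real.sqrt_le_sqrt (by linarith [mul_pos hΛ hp])
  gcongr

theorem norm_fresnel_integral_le_of_far {E p Λ W₀ : ℝ} (hp : 0 < p) (hp6 : p ≤ 6) (hΛ : 0 < Λ)
    (hE : 20 ≤ |E| / (2 * p))
    {w w' : ℝ → ℂ} (hw : ∀ t ∈ Icc (-3:ℝ) 3, HasDerivAt w (w' t) t)
    (hw'c : ContinuousOn w' (Icc (-3) 3))
    (hW : ∀ t ∈ Icc (-3:ℝ) 3, ‖w t‖ ≤ W₀) (hW' : ∀ t ∈ Icc (-3:ℝ) 3, ‖w' t‖ ≤ W₀) :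
    ‖∫ t in (-3:ℝ)..3, cexp (I * ((Λ * fresnelPhase E p t : ℝ) : ℂ)) * w t‖
      ≤ 15 * W₀ / (Λ * p * (|E| / (2 * p))) := by
  have hφc : Continuous fun t => fresnelPhase E p t := by unfold fresnelPhase; fun_prop
  set e := |E| / (2 * p) with he
  have he0 : 0 < e := by linarith
  have key : ∀ z ∈ Icc (-3:ℝ) 3,
      ‖∫ t in (-3:ℝ)..z, cexp (I * ((Λ * fresnelPhase E p t : ℝ) : ℂ))‖
        ≤ 3 / (7 / 5 * (Λ * p * e)) := by
    intro z hz
    have hz0 : (p ^ 2 + E) / (2 * p) = p / 2 + E / (2 * p) := by field_simp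
    refine vdC_one (φ := fun t => Λ * fresnelPhase E p t)
      (φ'' := fun t => Λ * (2 * p * 1))
      hz.1 (by positivity) (fun t _ => (hasDerivAt_fresnelPhase_right t).const_mul Λ)
      (fun t _ => (((hasDerivAt_id t).sub_const _).const_mul (2 * p)).const_mul Λ)
      continuousOn_const ?_ (Or.inl fun t _ => by positivity)
    rcases le_total 0 E with h | h
    · right
      intro t ht
      have : e = E / (2 * p) := by rw [he, abs_of_nonneg h]
      have ht3 : t ≤ 3 := ht.2.trans hz.2
      rw [hz0, ← this]
      have h2 : t - (p / 2 + e) ≤ -(7 / 10 * e) := by linarith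
      have := mul_le_mul_of_nonneg_left h2 (by positivity : 0 ≤ Λ * (2 * p))
      linarith [show Λ * (2 * p) * (t - (p / 2 + e)) = Λ * (2 * p * (t - (p / 2 + e))) by ring]
    · left
      intro t ht
      have : e = -(E / (2 * p)) := by rw [he, abs_of_nonpos h]; ring
      have ht3 : -3 ≤ t := ht.1
      rw [hz0, show E / (2 * p) = -e by linarith]
      have h2 : 7 / 10 * e ≤ t - (p / 2 + -e) := by linarith
      have := mul_le_mul_of_nonneg_left h2 (by positivity : 0 ≤ Λ * (2 * p))
      linarith [show Λ * (2 * p) * (t - (p / 2 + -e)) = Λ * (2 * p * (t - (p / 2 + -e))) by ring]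
  have := norm_integral_mul_le_const (by norm_num : (-3:ℝ) ≤ 3) (by fun_prop) hw hw'c key hW hW'
  refine this.trans (le_of_eq ?_)
  field_simp
  ring

theorem fresnel_amplitude {g gp gu gpu guu : ℝ → ℝ → ℝ} {G Λ E X : ℝ} (hΛ : 1 ≤ Λ) (hX : E = 1 - X)
    (hg : Continuous (uncurry g)) (hgp : Continuous (uncurry gp))
    (hgu : Continuous (uncurry gu)) (hgpu : Continuous (uncurry gpu))
    (hguu : Continuous (uncurry guu))
    (dp : ∀ p y, HasDerivAt (fun p => g p y) (gp p y) p)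
    (du : ∀ p y, HasDerivAt (fun y => g p y) (gu p y) y)
    (dpu : ∀ p y, HasDerivAt (fun y => gp p y) (gpu p y) y)
    (duu : ∀ p y, HasDerivAt (fun y => gu p y) (guu p y) y)
    (bg : ∀ p y, |g p y| ≤ G) (bgp : ∀ p y, |gp p y| ≤ G) (bgu : ∀ p y, |gu p y| ≤ G)
    (bgpu : ∀ p y, |gpu p y| ≤ G) (bguu : ∀ p y, |guu p y| ≤ G)
    (hm : ∀ p, g p (-3) = 0) (hM : ∀ p, g p 3 = 0) :
    ∃ Q Q' : ℝ → ℂ, (∀ p, 0 < p → HasDerivAt Q (Q' p) p) ∧ ContinuousOn Q' (Ioi 0) ∧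
      (∀ p ∈ Ioc (0:ℝ) 6, ‖Q p‖ ≤ 2000 * G / √(Λ * p)) ∧
      (∀ p ∈ Ioc (0:ℝ) 6, 1 / Λ ≤ p → ‖Q' p‖ ≤ 2000 * G / (p * √(Λ * p))) ∧
      ∀ p, 0 < p → ∫ y in (-3:ℝ)..3, cexp (I * ((Λ * (y ^ 3 / 3 + y * X + (p - y) ^ 3 / 3
          + (p - y)) : ℝ) : ℂ)) * (g p y : ℂ)
        = cexp (I * ((Λ * (p ^ 3 / 12 + p * (1 + X) / 2 - E ^ 2 / (4 * p)) : ℝ) : ℂ))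
          * Q p := by
  have hΛ0 : 0 < Λ := by linarith
  have hG : 0 ≤ G := (abs_nonneg _).trans (bg 0 0)
  have h33 : (-3:ℝ) ≤ 3 := by norm_num
  set e : ℝ → ℝ → ℂ := fun p y => cexp (I * ((Λ * fresnelPhase E p y : ℝ) : ℂ)) with he
  set z : ℝ → ℝ → ℝ := fun p y => y - (p ^ 2 + E) / (2 * p) with hz
  set Z : ℝ → ℝ → ℝ := fun p y => y - 3 * p / 2 + E / (2 * p) with hZ
  have hφc : ContinuousOn (fun q : ℝ × ℝ => fresnelPhase E q.1 q.2) (Ioi 0 ×ˢ Icc (-3:ℝ) 3) := by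
    unfold fresnelPhase
    refine ContinuousOn.mul (by fun_prop) (ContinuousOn.pow (ContinuousOn.sub (by fun_prop)
      (ContinuousOn.div (by fun_prop) (by fun_prop) ?_)) 2)
    intro q hq
    have : 0 < q.1 := hq.1
    positivity
  have hec : ContinuousOn (fun q : ℝ × ℝ => e q.1 q.2) (Ioi 0 ×ˢ Icc (-3:ℝ) 3) :=
    (continuousOn_const.mul (continuous_ofReal.comp_continuousOn
      (continuousOn_const.mul hφc))).cexp
  have hzc : ContinuousOn (fun q : ℝ × ℝ => z q.1 q.2 * Z q.1 q.2) (Ioi 0 ×ˢ Icc (-3:ℝ) 3) := by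
    refine ContinuousOn.mul (ContinuousOn.sub (by fun_prop)
      (ContinuousOn.div (by fun_prop) (by fun_prop) ?_)) (ContinuousOn.add (by fun_prop)
      (ContinuousOn.div (by fun_prop) (by fun_prop) ?_)) <;>
    · intro q hq
      have : 0 < q.1 := hq.1
      positivity
  have hg' : Continuous fun q : ℝ × ℝ => ((g q.1 q.2 : ℝ) : ℂ) := continuous_ofReal.comp hg
  have hgp' : Continuous fun q : ℝ × ℝ => ((gp q.1 q.2 : ℝ) : ℂ) :=
    continuous_ofReal.comp hgp
  set F' : ℝ → ℝ → ℂ := fun p y => e p y * (I * ((Λ * (z p y * Z p y) : ℝ) : ℂ) * (g p y : ℂ)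
    + (gp p y : ℂ)) with hF'
  have hF'c : ContinuousOn (uncurry F') (Ioi 0 ×ˢ Icc (-3:ℝ) 3) :=
    hec.mul (((continuousOn_const.mul (continuous_ofReal.comp_continuousOn
      (continuousOn_const.mul hzc))).mul hg'.continuousOn).add hgp'.continuousOn)
  have hFc : ContinuousOn (uncurry fun p y => e p y * (g p y : ℂ))
      (Ioi 0 ×ˢ Icc (-3:ℝ) 3) := hec.mul hg'.continuousOn
  have gdu : ∀ p y, HasDerivAt (fun y => ((g p y : ℝ) : ℂ)) ((gu p y : ℝ) : ℂ) y :=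
    fun p y => (du p y).ofReal_comp
  have sec : ∀ {k : ℝ → ℝ → ℝ}, Continuous (uncurry k) → ∀ p, Continuous (k p) :=
    fun hk p => hk.comp (Continuous.prodMk_right p)
  refine ⟨fun p => ∫ y in (-3:ℝ)..3, e p y * (g p y : ℂ), fun p => ∫ y in (-3:ℝ)..3, F' p y,
    ?_, ?_, ?_, ?_, ?_⟩
  · intro p hp
    refine hasDerivAt_intervalIntegral_param isOpen_Ioi h33 hp hFc hF'c fun x hx t _ => ?_
    have h1 := (((hasDerivAt_fresnelPhase_left (E := E) (y := t) hx).const_mul Λ).ofReal_comp.const_mul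
      I).cexp
    refine (h1.mul (dp x t).ofReal_comp).congr_deriv ?_
    simp only [hF', he, hz, hZ]
    push_cast
    ring
  · exact continuousOn_intervalIntegral_param isOpen_Ioi h33 hF'c
  · intro p hp
    have h0 : 0 < √(Λ * p) := sqrt_pos.2 (mul_pos hΛ0 hp.1)
    refine (norm_fresnel_integral_le (W₀ := G) hp.1 hΛ0 h33 (fun t _ => gdu p t)
      (continuous_ofReal.comp (sec hgu p)).continuousOn ?_ ?_).trans ?_
    · intro t _; rw [norm_real]; exact bg p t
    · intro t _; rw [norm_real]; exact bgu p t
    · rw [div_mul_eq_mul_div]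
      refine div_le_div_of_nonneg_right ?_ h0.le
      linarith
  · intro p hp hpΛ
    have hp0 := hp.1
    have hp6 := hp.2
    set W : ℝ → ℝ := fun y => gp p y - (1 / (2 * p)) * (g p y + Z p y * gu p y) with hW
    set W' : ℝ → ℝ := fun y => gpu p y - (1 / (2 * p)) * (2 * gu p y + Z p y * guu p y) with hW'
    have hZd : ∀ y, HasDerivAt (fun y => Z p y) 1 y := fun y =>
      ((hasDerivAt_id y).sub_const _).add_const _
    have hWd : ∀ y, HasDerivAt W (W' y) y := by
      intro y
      refine ((dpu p y).sub (((du p y).add ((hZd y).mul (duu p y))).const_mul _)).congr_deriv ?_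
      simp only [hW']; ring
    have hZcont : Continuous (Z p) := by simp only [hZ]; fun_prop
    have hW'c : Continuous W' := by
      have h1 := sec hgpu p
      have h2 := sec hgu p
      have h3 := sec hguu p
      simp only [hW']
      fun_prop
    have hWc : Continuous W := continuous_iff_continuousAt.2 fun y => (hWd y).continuousAt
    have hec' : Continuous (e p) := by
      simp only [he]; unfold fresnelPhase; fun_prop
    have hF'cont : ContinuousOn (F' p) (Icc (-3) 3) :=
      hF'c.comp (f := fun t => (p, t)) (by fun_prop) (fun t ht => ⟨hp0, ht⟩)
    have hi1 : IntervalIntegrable (fun y => F' p y) volume (-3) 3 :=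
      hF'cont.intervalIntegrable_of_Icc h33
    have hi2 : IntervalIntegrable (fun y => e p y * ((W y : ℝ) : ℂ)) volume (-3) 3 :=
      (hec'.mul (continuous_ofReal.comp hWc)).intervalIntegrable _ _
    have hibp : ∫ y in (-3:ℝ)..3, F' p y = ∫ y in (-3:ℝ)..3, e p y * ((W y : ℝ) : ℂ) := by
      rw [← sub_eq_zero, ← intervalIntegral.integral_sub hi1 hi2]
      have := integral_eq_sub_of_hasDerivAt (a := -3) (b := 3)
        (f := fun y => e p y * (((1 / (2 * p)) * (Z p y * g p y) : ℝ) : ℂ))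
        (f' := fun y => F' p y - e p y * ((W y : ℝ) : ℂ)) ?_ ?_
      · rw [this, hm, hM]; simp
      · intro y _
        have h1 := (((hasDerivAt_fresnelPhase_right (E := E) (p := p) y).const_mul
          Λ).ofReal_comp.const_mul I).cexp
        refine (h1.mul (((hZd y).mul (du p y)).const_mul (1 / (2 * p))).ofReal_comp).congr_deriv ?_
        have hpc : (p : ℂ) ≠ 0 := by exact_mod_cast hp0.ne'
        simp only [hF', he, hz, hW, Pi.mul_apply]
        push_cast
        field_simp
        ring
      · exact hi1.sub hi2
    simp only []
    rw [hibp]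
    set ε := |E| / (2 * p) with hε
    have hε0 : 0 ≤ ε := by positivity
    have hZb : ∀ y ∈ Icc (-3:ℝ) 3, |Z p y| ≤ 12 + ε := by
      intro y hy
      have : |E / (2 * p)| = ε := by rw [hε, abs_div, abs_of_pos (by positivity : 0 < 2 * p)]
      have h2 := abs_le.1 this.le
      simp only [hZ]
      rw [abs_le]
      constructor <;> linarith [hy.1, hy.2, h2.1, h2.2]
    have hcomb : ∀ u v w c Zy : ℝ, |u| ≤ G → |v| ≤ c * G → |w| ≤ G → |Zy| ≤ 12 + ε → c ≤ 2 →
        |u - (1 / (2 * p)) * (v + Zy * w)| ≤ (13 + ε / 2) * G / p := by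
      intro u v w c Zy hu hv hw hZy hc
      have h1 : |Zy * w| ≤ (12 + ε) * G := by
        rw [abs_mul]; exact mul_le_mul hZy hw (abs_nonneg _) (by positivity)
      have h2 : |v + Zy * w| ≤ (14 + ε) * G := by
        have := abs_add_le v (Zy * w)
        nlinarith
      have h3 : |(1 / (2 * p)) * (v + Zy * w)| ≤ (1 / (2 * p)) * ((14 + ε) * G) := by
        rw [abs_mul, abs_of_pos (by positivity : 0 < 1 / (2 * p))]
        gcongr
      have h4 : G ≤ 6 * G / p := by
        rw [le_div_iff₀ hp0]; nlinarith
      have h5 : (13 + ε / 2) * G / p = 6 * G / p + (1 / (2 * p)) * ((14 + ε) * G) := by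
        field_simp; ring
      have := abs_sub u ((1 / (2 * p)) * (v + Zy * w))
      linarith
    have hWb : ∀ t ∈ Icc (-3:ℝ) 3, ‖((W t : ℝ) : ℂ)‖ ≤ (13 + ε / 2) * G / p := by
      intro t ht
      rw [norm_real]
      exact hcomb _ _ _ 1 _ (bgp p t) (by linarith [bg p t]) (bgu p t) (hZb t ht) (by norm_num)
    have hWb' : ∀ t ∈ Icc (-3:ℝ) 3, ‖((W' t : ℝ) : ℂ)‖ ≤ (13 + ε / 2) * G / p := by
      intro t ht
      rw [norm_real]
      refine hcomb _ _ _ 2 _ (bgpu p t) ?_ (bguu p t) (hZb t ht) le_rfl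
      rw [abs_mul, abs_of_pos two_pos]; linarith [bgu p t]
    have hs1 : 1 ≤ √(Λ * p) := by
      rw [Real.one_le_sqrt]
      rw [div_le_iff₀ hΛ0] at hpΛ; linarith
    have hs0 : 0 < √(Λ * p) := by linarith
    have hss : √(Λ * p) * √(Λ * p) = Λ * p := Real.mul_self_sqrt (by positivity)
    rcases le_total ε 20 with h20 | h20
    · refine (norm_fresnel_integral_le hp0 hΛ0 h33 (fun t _ => (hWd t).ofReal_comp)
        (continuous_ofReal.comp hW'c).continuousOn hWb hWb').trans ?_
      have : (13 + ε / 2) * G / p ≤ 23 * G / p := by gcongr; linarith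
      calc 8 / √(Λ * p) * ((13 + ε / 2) * G / p + (13 + ε / 2) * G / p * (3 - -3))
          ≤ 8 / √(Λ * p) * (23 * G / p + 23 * G / p * (3 - -3)) := by gcongr
        _ = 1288 * G / (p * √(Λ * p)) := by (field_simp; try ring)
        _ ≤ 2000 * G / (p * √(Λ * p)) := by gcongr; norm_num
    · refine (norm_fresnel_integral_le_of_far hp0 hp6 hΛ0 h20 (fun t _ => (hWd t).ofReal_comp)
        (continuous_ofReal.comp hW'c).continuousOn hWb hWb').trans ?_
      rw [← hε]
      have hεp : 0 < ε := by linarith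
      calc 15 * ((13 + ε / 2) * G / p) / (Λ * p * ε)
          ≤ 15 * ((2 * ε) * G / p) / (Λ * p * ε) := by gcongr; linarith
        _ = 30 * G / (p * (√(Λ * p) * √(Λ * p))) := by rw [hss]; (field_simp; try ring)
        _ ≤ 30 * G / (p * (√(Λ * p) * 1)) := by gcongr
        _ ≤ 2000 * G / (p * √(Λ * p)) := by rw [mul_one]; gcongr; norm_num
  · intro p hp
    rw [← intervalIntegral.integral_const_mul]
    refine integral_congr fun y _ => ?_
    simp only [he]
    rw [← mul_assoc, ← Complex.exp_add]
    congr 2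
    rw [← mul_add, ← Complex.ofReal_add]
    congr 2
    rw [hX]
    unfold fresnelPhase
    field_simp
    ring

section DirectionalDerivative

variable {E : Type*} [NormedAddCommGroup E] [NormedSpace ℝ E]

/-- Directional derivative of `f` in the direction `v`. -/
noncomputable def dirDeriv (v : E) (f : E → ℝ) (x : E) : ℝ := fderiv ℝ f x v

theorem ContDiffAt.dirDeriv {f : E → ℝ} {x : E} (hf : ContDiffAt ℝ ∞ f x) (v : E) :
    ContDiffAt ℝ ∞ (dirDeriv v f) x :=
  (hf.fderiv_right (m := ∞) (by norm_cast)).clm_apply contDiffAt_const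

theorem ContDiff.dirDeriv {f : E → ℝ} (hf : ContDiff ℝ ∞ f) (v : E) :
    ContDiff ℝ ∞ (dirDeriv v f) :=
  contDiff_iff_contDiffAt.2 fun x => hf.contDiffAt.dirDeriv v

theorem ContDiffAt.hasDerivAt_comp_line {f : E → ℝ} {c : ℝ → E} {v : E} {t : ℝ}
    (hf : ContDiffAt ℝ ∞ f (c t)) (hc : HasDerivAt c v t) :
    HasDerivAt (fun s => f (c s)) (_root_.dirDeriv v f (c t)) t :=
  (hf.differentiableAt (by simp)).hasFDerivAt.comp_hasDerivAt t hc

theorem tsupport_dirDeriv_subset (v : E) (f : E → ℝ) : tsupport (dirDeriv v f) ⊆ tsupport f := by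
  refine closure_minimal (fun x hx => ?_) (isClosed_tsupport f)
  by_contra h
  exact hx (by simp [dirDeriv, fderiv_of_notMem_tsupport ℝ h])

theorem HasCompactSupport.dirDeriv {f : E → ℝ} (hf : HasCompactSupport f) (v : E) :
    HasCompactSupport (dirDeriv v f) :=
  hf.of_isClosed_subset (isClosed_tsupport _) (tsupport_dirDeriv_subset v f)

theorem IsCompact.exists_abs_bound {f : E → ℝ} {K : Set E} (hK : IsCompact K)
    (hf : ∀ x ∈ K, ContDiffAt ℝ ∞ f x) : ∃ C, 0 < C ∧ ∀ x ∈ K, |f x| ≤ C := by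
  obtain ⟨C, hC⟩ := hK.exists_bound_of_continuousOn
    (fun x hx => (hf x hx).continuousAt.continuousWithinAt)
  exact ⟨max C 1, by positivity, fun x hx => (hC x hx).trans (le_max_left _ _)⟩

theorem HasCompactSupport.exists_abs_bound {f : E → ℝ} (hf : HasCompactSupport f)
    (hc : Continuous f) : ∃ C, 0 < C ∧ ∀ x, |f x| ≤ C := by
  obtain ⟨C, hC⟩ := hf.exists_bound_of_continuous hc
  exact ⟨max C 1, by positivity, fun x => (hC x).trans (le_max_left _ _)⟩

end DirectionalDerivative

theorem saddle_amplitude {ϑ ϑ' ϑ'' β β' : ℝ → ℝ} {w w' w'' : ℝ → ℂ} {U : Set ℝ}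
    {x y n Λ K W : ℝ} (hx0 : 0 < x) (hxy : x ≤ y) (hn : n ≠ 0) (hΛ : 0 < Λ) (hU : IsOpen U)
    (hϑ1 : ∀ A, 0 < A → HasDerivAt ϑ (ϑ' A) A) (hϑ2 : ∀ A, 0 < A → HasDerivAt ϑ' (ϑ'' A) A)
    (hϑ2c : ContinuousOn ϑ'' (Icc x y))
    (hβ : ∀ p ∈ U, HasDerivAt β (β' p) p) (hβ0 : ∀ p ∈ U, 0 < β p)
    (hcrit : ∀ p ∈ U, n * ϑ' (β p) = p) (hϑ'' : ∀ A ∈ Icc x y, ϑ'' A ≤ -(1 / 3))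
    (hw1 : ∀ A ∈ Icc x y, HasDerivAt w (w' A) A) (hw2 : ∀ A ∈ Icc x y, HasDerivAt w' (w'' A) A)
    (hw2c : ContinuousOn w'' (Icc x y)) (hwx : w x = 0) (hwy : w y = 0)
    (bw : ∀ A ∈ Icc x y, ‖w A‖ ≤ W) (bw' : ∀ A ∈ Icc x y, ‖w' A‖ ≤ W)
    (bw'' : ∀ A ∈ Icc x y, ‖w'' A‖ ≤ W) (hK : 0 ≤ K)
    (hH : ∀ p ∈ U, ∃ H H' H'' : ℝ → ℝ, (∀ A ∈ Icc x y, HasDerivAt H (H' A) A) ∧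
      (∀ A ∈ Icc x y, HasDerivAt H' (H'' A) A) ∧ ContinuousOn H'' (Icc x y) ∧
      (∀ A ∈ Icc x y, |H A| ≤ K ∧ |H' A| ≤ K ∧ |H'' A| ≤ K) ∧
      ∀ A ∈ Icc x y, (n * ϑ' A - p) * H A = n * (A - β p)) :
    ∃ J J' : ℝ → ℂ, (∀ p ∈ U, HasDerivAt J (J' p) p) ∧ ContinuousOn J' U ∧
      (∀ p ∈ U, ‖J p‖ ≤ 16 / √(Λ * |n|) * (W + W * (y - x))) ∧
      (∀ p ∈ U, ‖J' p‖ ≤ 16 / √(Λ * |n|) * (4 * K * W + 4 * K * W * (y - x)) / |n|) ∧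
      ∀ p ∈ U, ∫ A in x..y, cexp (I * ((Λ * (n * ϑ A - p * A) : ℝ) : ℂ)) * w A
        = cexp (I * ((Λ * (n * ϑ (β p) - p * β p) : ℝ) : ℂ)) * J p := by
  have hW : 0 ≤ W := (norm_nonneg _).trans (bw x ⟨le_rfl, hxy⟩)
  have hn0 : 0 < |n| := abs_pos.2 hn
  have hpos : ∀ A ∈ Icc x y, 0 < A := fun A hA => hx0.trans_le hA.1
  have hβc : ContinuousOn β U := fun p hp => (hβ p hp).continuousAt.continuousWithinAt
  have hϑc : ContinuousOn ϑ (Icc x y) := fun A hA =>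
    (hϑ1 A (hpos A hA)).continuousAt.continuousWithinAt
  have hϑβc : ContinuousOn (fun p => ϑ (β p)) U := fun p hp =>
    ((hϑ1 _ (hβ0 p hp)).continuousAt.comp (hβ p hp).continuousAt).continuousWithinAt
  have hwc : ContinuousOn w (Icc x y) := fun A hA => (hw1 A hA).continuousAt.continuousWithinAt
  have hw'c : ContinuousOn w' (Icc x y) := fun A hA => (hw2 A hA).continuousAt.continuousWithinAt
  set Φ : ℝ → ℝ → ℝ := fun p A => n * (ϑ A - ϑ (β p)) - p * (A - β p) with hΦ
  set e : ℝ → ℝ → ℂ := fun p A => cexp (I * ((Λ * Φ p A : ℝ) : ℂ)) with he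
  have fst2 : ContinuousOn (fun q : ℝ × ℝ => β q.1) (U ×ˢ Icc x y) :=
    hβc.comp continuousOn_fst fun q hq => hq.1
  have hΦc : ContinuousOn (fun q : ℝ × ℝ => Φ q.1 q.2) (U ×ˢ Icc x y) := by
    refine ContinuousOn.sub (continuousOn_const.mul (ContinuousOn.sub
      (hϑc.comp continuousOn_snd fun q hq => hq.2) (hϑβc.comp continuousOn_fst fun q hq => hq.1)))
      (continuousOn_fst.mul (continuousOn_snd.sub fst2))
  have hec : ContinuousOn (fun q : ℝ × ℝ => e q.1 q.2) (U ×ˢ Icc x y) :=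
    (continuousOn_const.mul (continuous_ofReal.comp_continuousOn
      (continuousOn_const.mul hΦc))).cexp
  have hwc2 : ContinuousOn (fun q : ℝ × ℝ => w q.2) (U ×ˢ Icc x y) :=
    hwc.comp continuousOn_snd fun q hq => hq.2
  set F' : ℝ → ℝ → ℂ := fun p A => e p A * (I * ((Λ * -(A - β p) : ℝ) : ℂ)) * w A with hF'
  have hF'c : ContinuousOn (uncurry F') (U ×ˢ Icc x y) :=
    (hec.mul (continuousOn_const.mul (continuous_ofReal.comp_continuousOn
      (continuousOn_const.mul (continuousOn_snd.sub fst2).neg)))).mul hwc2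
  have hFc : ContinuousOn (uncurry fun p A => e p A * w A) (U ×ˢ Icc x y) := hec.mul hwc2
  have hΦA : ∀ p, ∀ A ∈ Icc x y, HasDerivAt (fun A => Φ p A) (n * ϑ' A - p) A := by
    intro p A hA
    refine ((((hϑ1 A (hpos A hA)).sub_const _).const_mul n).sub
      (((hasDerivAt_id A).sub_const (β p)).const_mul p)).congr_deriv ?_
    ring
  have hosc : ∀ p, ∀ z ∈ Icc x y, ‖∫ A in x..z, e p A‖ ≤ 16 / √(Λ * |n|) := by
    intro p z hz
    have hsub : Icc x z ⊆ Icc x y := Icc_subset_Icc le_rfl hz.2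
    refine (vdC_two (φ := fun A => Λ * Φ p A) (φ' := fun A => Λ * (n * ϑ' A - p))
      (φ'' := fun A => Λ * (n * ϑ'' A)) (m := Λ * |n| / 4)
      hz.1 (by positivity) (fun A hA => (hΦA p A (hsub hA)).const_mul Λ)
      (fun A hA => (((hϑ2 A (hpos A (hsub hA))).const_mul n).sub_const p).const_mul Λ)
      (continuousOn_const.mul (continuousOn_const.mul (hϑ2c.mono hsub))) ?_).trans ?_
    · rcases lt_or_gt_of_ne hn with h | h
      · left
        intro A hA
        have := hϑ'' A (hsub hA)
        rw [abs_of_neg h]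
        have h2 : -n / 4 ≤ n * ϑ'' A := by nlinarith
        have := mul_le_mul_of_nonneg_left h2 hΛ.le
        linarith [show Λ * (-n / 4) = Λ * -n / 4 by ring]
      · right
        intro A hA
        have := hϑ'' A (hsub hA)
        rw [abs_of_pos h]
        have h2 : n * ϑ'' A ≤ -(n / 4) := by nlinarith
        have := mul_le_mul_of_nonneg_left h2 hΛ.le
        linarith [show Λ * -(n / 4) = -(Λ * n / 4) by ring]
    · rw [show Λ * |n| / 4 = Λ * |n| / 2 ^ 2 by norm_num, Real.sqrt_div (by positivity),
        Real.sqrt_sq two_pos.le]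
      have : 0 < √(Λ * |n|) := sqrt_pos.2 (by positivity)
      apply le_of_eq
      field_simp
      norm_num
  refine ⟨fun p => ∫ A in x..y, e p A * w A, fun p => ∫ A in x..y, F' p A, ?_, ?_, ?_, ?_, ?_⟩
  · intro p hp
    refine hasDerivAt_intervalIntegral_param hU hxy hp hFc hF'c fun q hq t _ => ?_
    have hΦp : HasDerivAt (fun p => Φ p t) (-(t - β q)) q := by
      refine (((((hϑ1 _ (hβ0 q hq)).comp q (hβ q hq)).const_sub (ϑ t)).const_mul n).sub
        ((hasDerivAt_id q).mul ((hβ q hq).const_sub t))).congr_deriv ?_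
      simp only [id]
      linear_combination (-(β' q)) * hcrit q hq
    exact ((hΦp.const_mul Λ).ofReal_comp.const_mul I).cexp.mul_const (w t)
  · exact continuousOn_intervalIntegral_param hU hxy hF'c
  · intro p hp
    exact norm_integral_mul_le_const hxy
      (hec.comp (f := fun t => (p, t)) (by fun_prop) (fun t ht => ⟨hp, ht⟩)) hw1 hw'c (hosc p) bw bw'
  · intro p hp
    obtain ⟨H, H', H'', dH, dH', cH'', bH, hHe⟩ := hH p hp
    have hep : ContinuousOn (e p) (Icc x y) :=
      hec.comp (f := fun t => (p, t)) (by fun_prop) (fun t ht => ⟨hp, ht⟩)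
    have cH : ContinuousOn H (Icc x y) := fun A hA => (dH A hA).continuousAt.continuousWithinAt
    have cH' : ContinuousOn H' (Icc x y) := fun A hA => (dH' A hA).continuousAt.continuousWithinAt
    have ofc : ∀ {k : ℝ → ℝ}, ContinuousOn k (Icc x y) →
        ContinuousOn (fun A => ((k A : ℝ) : ℂ)) (Icc x y) := fun hk =>
      continuous_ofReal.comp_continuousOn hk
    set V : ℝ → ℂ := fun A => (H' A : ℂ) * w A + (H A : ℂ) * w' A with hV
    set V' : ℝ → ℂ := fun A => ((H'' A : ℂ) * w A + (H' A : ℂ) * w' A)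
      + ((H' A : ℂ) * w' A + (H A : ℂ) * w'' A) with hV'
    have dV : ∀ A ∈ Icc x y, HasDerivAt V (V' A) A := fun A hA =>
      ((dH' A hA).ofReal_comp.mul (hw1 A hA)).add ((dH A hA).ofReal_comp.mul (hw2 A hA))
    have cV : ContinuousOn V (Icc x y) := ((ofc cH').mul hwc).add ((ofc cH).mul hw'c)
    have cV' : ContinuousOn V' (Icc x y) :=
      (((ofc cH'').mul hwc).add ((ofc cH').mul hw'c)).add (((ofc cH').mul hw'c).add
        ((ofc cH).mul hw2c))
    have bprod : ∀ (k : ℝ) (z : ℂ), |k| ≤ K → ‖z‖ ≤ W → ‖(k : ℂ) * z‖ ≤ K * W := by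
      intro k z hk hz
      rw [norm_mul, norm_real]
      exact mul_le_mul hk hz (norm_nonneg _) hK
    have bV : ∀ A ∈ Icc x y, ‖V A‖ ≤ 4 * K * W := by
      intro A hA
      obtain ⟨h0, h1, h2⟩ := bH A hA
      have := norm_add_le ((H' A : ℂ) * w A) ((H A : ℂ) * w' A)
      have := bprod _ _ h1 (bw A hA)
      have := bprod _ _ h0 (bw' A hA)
      have : 0 ≤ K * W := by positivity
      simp only [hV]
      linarith
    have bV' : ∀ A ∈ Icc x y, ‖V' A‖ ≤ 4 * K * W := by
      intro A hA
      obtain ⟨h0, h1, h2⟩ := bH A hA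
      have := norm_add_le ((H'' A : ℂ) * w A + (H' A : ℂ) * w' A)
        ((H' A : ℂ) * w' A + (H A : ℂ) * w'' A)
      have := norm_add_le ((H'' A : ℂ) * w A) ((H' A : ℂ) * w' A)
      have := norm_add_le ((H' A : ℂ) * w' A) ((H A : ℂ) * w'' A)
      have := bprod _ _ h2 (bw A hA)
      have := bprod _ _ h1 (bw' A hA)
      have := bprod _ _ h0 (bw'' A hA)
      simp only [hV']
      linarith
    have hF'p : ContinuousOn (F' p) (Icc x y) :=
      hF'c.comp (f := fun t => (p, t)) (by fun_prop) (fun t ht => ⟨hp, ht⟩)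
    have hi1 : IntervalIntegrable (F' p) volume x y := hF'p.intervalIntegrable_of_Icc hxy
    have hi2 : IntervalIntegrable (fun A => (1 / (n : ℂ)) * (e p A * V A)) volume x y :=
      (continuousOn_const.mul (hep.mul cV)).intervalIntegrable_of_Icc hxy
    have hibp : ∫ A in x..y, F' p A = ∫ A in x..y, (1 / (n : ℂ)) * (e p A * V A) := by
      rw [← sub_eq_zero, ← intervalIntegral.integral_sub hi1 hi2]
      have := integral_eq_sub_of_hasDerivAt (a := x) (b := y)
        (f := fun A => -(1 / (n : ℂ)) * (e p A * ((H A : ℂ) * w A)))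
        (f' := fun A => F' p A - (1 / (n : ℂ)) * (e p A * V A)) ?_ (hi1.sub hi2)
      · rw [this, hwx, hwy]; simp
      · intro A hA
        rw [uIcc_of_le hxy] at hA
        have h1 := ((hΦA p A hA).const_mul Λ).ofReal_comp.const_mul I |>.cexp
        refine ((h1.mul ((dH A hA).ofReal_comp.mul (hw1 A hA))).const_mul _).congr_deriv ?_
        have hnc : (n : ℂ) ≠ 0 := by exact_mod_cast hn
        have hq : ((n : ℂ) * (ϑ' A : ℂ) - (p : ℂ)) * (H A : ℂ) = (n : ℂ) * ((A : ℂ) - (β p : ℂ)) := by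
          exact_mod_cast hHe A hA
        simp only [hF', he, hV, Pi.mul_apply]
        push_cast
        field_simp
        linear_combination (-(I * Λ * w A)) * hq
    simp only []
    rw [hibp, intervalIntegral.integral_const_mul, norm_mul, norm_div, norm_one, norm_real,
      Real.norm_eq_abs, mul_comm, mul_one_div]
    refine div_le_div_of_nonneg_right ?_ hn0.le
    exact norm_integral_mul_le_const hxy hep dV cV' (hosc p) bV bV'
  · intro p hp
    rw [← intervalIntegral.integral_const_mul]
    refine integral_congr fun A _ => ?_
    simp only [he]
    rw [← mul_assoc, ← Complex.exp_add]
    congr 2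
    rw [← mul_add, ← Complex.ofReal_add]
    congr 2
    simp only [hΦ]
    ring

/-- The coefficient of `T` in the phase. -/
noncomputable def travelTime (a A : ℝ) : ℝ := √(1 + a) * (A - 1) / (√(1 + a * A) + √(1 + a))

theorem one_lt_one_add_mul {a A : ℝ} (ha : 0 < a) (hA : 0 < A) : 1 < 1 + a * A := by
  have := mul_pos ha hA
  linarith

theorem one_lt_sqrt_one_add_mul {a A : ℝ} (ha : 0 < a) (hA : 0 < A) : 1 < √(1 + a * A) :=
  Real.lt_sqrt_of_sq_lt (by simpa using mul_pos ha hA)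

theorem hasDerivAt_sqrt_one_add_mul {a A : ℝ} (ha : 0 < a) (hA : 0 < A) :
    HasDerivAt (fun A => √(1 + a * A)) (a / (2 * √(1 + a * A))) A := by
  have h := (((hasDerivAt_id A).const_mul a).const_add 1).sqrt
    (show 1 + a * A ≠ 0 by have := one_lt_one_add_mul ha hA; positivity)
  simpa using h

theorem hasDerivAt_travelTime {a A : ℝ} (ha : 0 < a) (hA : 0 < A) :
    HasDerivAt (travelTime a) (√(1 + a) / (2 * √(1 + a * A))) A := by
  have hρ := one_lt_sqrt_one_add_mul ha hA
  have hκ : 0 < √(1 + a) := sqrt_pos.2 (by linarith)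
  have h2 : √(1 + a * A) ^ 2 = 1 + a * A :=
    sq_sqrt (by have := one_lt_one_add_mul ha hA; linarith)
  have h3 : √(1 + a) ^ 2 = 1 + a := sq_sqrt (by linarith)
  have hρ0 : √(1 + a * A) ≠ 0 := by positivity
  have hs : √(1 + a * A) + √(1 + a) ≠ 0 := by positivity
  refine ((((hasDerivAt_id A).sub_const 1).const_mul (√(1 + a))).div
    ((hasDerivAt_sqrt_one_add_mul ha hA).add_const _) hs).congr_deriv ?_
  simp only [id]
  set ρ := √(1 + a * A)
  set κ := √(1 + a)
  field_simp
  linear_combination h2 - h3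

theorem hasDerivAt_travelTime_deriv {a A : ℝ} (ha : 0 < a) (hA : 0 < A) :
    HasDerivAt (fun A => √(1 + a) / (2 * √(1 + a * A)))
      (-(√(1 + a) * a / (4 * √(1 + a * A) ^ 3))) A := by
  have hρ := one_lt_sqrt_one_add_mul ha hA
  have hρ0 : √(1 + a * A) ≠ 0 := by positivity
  refine ((hasDerivAt_const A (√(1 + a))).div
    ((hasDerivAt_sqrt_one_add_mul ha hA).const_mul 2) (by positivity)).congr_deriv ?_
  field_simp
  ring

theorem hasDerivAt_travelTime_deriv₂ {a A : ℝ} (ha : 0 < a) (hA : 0 < A) :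
    HasDerivAt (fun A => -(√(1 + a) * a / (4 * √(1 + a * A) ^ 3)))
      (3 * √(1 + a) * a ^ 2 / (8 * √(1 + a * A) ^ 5)) A := by
  have hρ := one_lt_sqrt_one_add_mul ha hA
  have hρ0 : √(1 + a * A) ≠ 0 := by positivity
  refine ((hasDerivAt_const A (√(1 + a) * a)).div
    (((hasDerivAt_sqrt_one_add_mul ha hA).pow 3).const_mul 4) (by simp only [Pi.pow_apply]; positivity)).neg.congr_deriv ?_
  simp only [Pi.pow_apply]
  field_simp
  ring

theorem hasDerivAt_rpow_three_halves {A : ℝ} (hA : 0 < A) :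
    HasDerivAt (fun A : ℝ => A ^ ((3 : ℝ) / 2)) (3 / 2 * √A) A := by
  refine (Real.hasDerivAt_rpow_const (p := 3 / 2) (Or.inl hA.ne')).congr_deriv ?_
  rw [Real.sqrt_eq_rpow]
  norm_num

theorem hasDerivAt_sqrt_self {A : ℝ} (hA : 0 < A) : HasDerivAt (fun A => √A) (1 / (2 * √A)) A :=
  Real.hasDerivAt_sqrt hA.ne'

/-- The coefficient of `N` in the phase when `T = 4 N τ`. -/
noncomputable def reducedPhase (a τ A : ℝ) : ℝ :=
  4 * τ * travelTime a A - 4 / 3 * A ^ ((3 : ℝ) / 2)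

/-- First derivative of `reducedPhase`. -/
noncomputable def reducedPhase₁ (a τ A : ℝ) : ℝ := 2 * τ * √(1 + a) / √(1 + a * A) - 2 * √A

/-- Second derivative of `reducedPhase`. -/
noncomputable def reducedPhase₂ (a τ A : ℝ) : ℝ :=
  -(τ * √(1 + a) * a / √(1 + a * A) ^ 3) - 1 / √A

/-- Third derivative of `reducedPhase`. -/
noncomputable def reducedPhase₃ (a τ A : ℝ) : ℝ :=
  3 / 2 * τ * √(1 + a) * a ^ 2 / √(1 + a * A) ^ 5 + 1 / (2 * A * √A)

theorem hasDerivAt_reducedPhase {a τ A : ℝ} (ha : 0 < a) (hA : 0 < A) :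
    HasDerivAt (reducedPhase a τ) (reducedPhase₁ a τ A) A := by
  have hρ := one_lt_sqrt_one_add_mul ha hA
  refine (((hasDerivAt_travelTime ha hA).const_mul (4 * τ)).sub
    ((hasDerivAt_rpow_three_halves hA).const_mul (4 / 3))).congr_deriv ?_
  rw [reducedPhase₁]
  field_simp
  ring

theorem hasDerivAt_reducedPhase₁ {a τ A : ℝ} (ha : 0 < a) (hA : 0 < A) :
    HasDerivAt (reducedPhase₁ a τ) (reducedPhase₂ a τ A) A := by
  have hρ := one_lt_sqrt_one_add_mul ha hA
  have hs : 0 < √A := sqrt_pos.2 hA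
  have h := ((hasDerivAt_travelTime_deriv ha hA).const_mul (4 * τ)).sub
    ((hasDerivAt_sqrt_self hA).const_mul 2)
  refine (h.congr_deriv (g' := reducedPhase₂ a τ A) ?_).congr_of_eventuallyEq
    (Eventually.of_forall fun B => ?_)
  · rw [reducedPhase₂]
    field_simp
  · simp only [reducedPhase₁, Pi.sub_apply]
    ring

theorem hasDerivAt_reducedPhase₂ {a τ A : ℝ} (ha : 0 < a) (hA : 0 < A) :
    HasDerivAt (reducedPhase₂ a τ) (reducedPhase₃ a τ A) A := by
  have hρ := one_lt_sqrt_one_add_mul ha hA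
  have hs : 0 < √A := sqrt_pos.2 hA
  have h := ((hasDerivAt_travelTime_deriv₂ ha hA).const_mul (4 * τ)).sub
    (((hasDerivAt_sqrt_self hA).inv hs.ne'))
  refine (h.congr_deriv (g' := reducedPhase₃ a τ A) ?_).congr_of_eventuallyEq
    (Eventually.of_forall fun B => ?_)
  · rw [reducedPhase₃]
    have h2 : √A ^ 2 = A := sq_sqrt hA.le
    rw [show 2 * A * √A = 2 * √A ^ 3 by linear_combination (-2 * √A) * h2]
    field_simp
    try ring
  · simp only [reducedPhase₂, Pi.sub_apply, Pi.inv_apply]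
    ring

/-- Comparison of `√(1 + a)` with `√(1 + a A)`. -/
theorem sqrt_one_add_div_bounds {a A : ℝ} (ha : 0 < a) (ha' : a ≤ 1 / 200) (hA : 0 < A)
    (hA' : A ≤ 8) : 97 / 100 ≤ √(1 + a) / √(1 + a * A) ∧ √(1 + a) / √(1 + a * A) ≤ 201 / 200 ∧
      (A ≤ 1 → 1 ≤ √(1 + a) / √(1 + a * A)) ∧ (1 ≤ A → √(1 + a) / √(1 + a * A) ≤ 1) := by
  have h1 := one_lt_one_add_mul ha hA
  have hpos : 0 < √(1 + a * A) := sqrt_pos.2 (by linarith)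
  have hup : a * A ≤ 8 / 200 := by nlinarith
  refine ⟨?_, ?_, fun h => ?_, fun h => ?_⟩
  · rw [le_div_iff₀ hpos]
    refine Real.le_sqrt_of_sq_le ?_
    rw [mul_pow, sq_sqrt (by linarith)]
    linarith
  · rw [div_le_iff₀ hpos, Real.sqrt_le_left (by positivity), mul_pow, sq_sqrt (by linarith)]
    linarith
  · rw [le_div_iff₀ hpos, one_mul]
    exact Real.sqrt_le_sqrt (by nlinarith)
  · rw [div_le_iff₀ hpos, one_mul]
    exact Real.sqrt_le_sqrt (by nlinarith)

theorem sqrt_one_add_bounds {a A : ℝ} (ha : 0 < a) (ha' : a ≤ 1 / 200) (hA : 0 < A)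
    (hA' : A ≤ 8) : √(1 + a) ≤ 11 / 10 ∧ 0 < √(1 + a) ∧ 1 < √(1 + a * A) ∧
      √(1 + a * A) ≤ 11 / 10 := by
  refine ⟨?_, sqrt_pos.2 (by linarith), one_lt_sqrt_one_add_mul ha hA, ?_⟩
  · rw [Real.sqrt_le_left (by norm_num)]
    linarith
  · rw [Real.sqrt_le_left (by norm_num)]
    nlinarith

theorem reducedPhase₂_le {a τ A : ℝ} (ha : 0 < a) (hτ : 0 ≤ τ) (hA : 0 < A) (hA' : A ≤ 8) :
    reducedPhase₂ a τ A ≤ -(1 / 3) := by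
  have hs : 0 < √A := sqrt_pos.2 hA
  have h3 : √A ≤ 3 := by rw [Real.sqrt_le_left (by norm_num)]; linarith
  have h4 : 1 / 3 ≤ 1 / √A := one_div_le_one_div_of_le hs h3
  have : 0 ≤ τ * √(1 + a) * a / √(1 + a * A) ^ 3 := by positivity
  rw [reducedPhase₂]
  linarith

theorem abs_reducedPhase₂_le {a τ A : ℝ} (ha : 0 < a) (ha' : a ≤ 1 / 200) (hA : 4 / 5 ≤ A)
    (hA' : A ≤ 8) : |reducedPhase₂ a τ A| ≤ 2 * (1 + |τ|) := by
  obtain ⟨h1, h2, h3, h4⟩ := sqrt_one_add_bounds ha ha' (by linarith) hA'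
  have hs : 1 / 2 ≤ √A := Real.le_sqrt_of_sq_le (by linarith)
  have e1 : |τ * √(1 + a) * a / √(1 + a * A) ^ 3| ≤ |τ| := by
    rw [abs_div, abs_mul, abs_mul, abs_of_pos h2, abs_of_pos ha, abs_of_pos (by positivity :
      0 < √(1 + a * A) ^ 3), div_le_iff₀ (by positivity)]
    have : 1 ≤ √(1 + a * A) ^ 3 := one_le_pow₀ h3.le
    have h5 : √(1 + a) * a ≤ 1 := by nlinarith
    calc |τ| * √(1 + a) * a = |τ| * (√(1 + a) * a) := by ring
      _ ≤ |τ| * 1 := by gcongr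
      _ ≤ |τ| * √(1 + a * A) ^ 3 := by gcongr
  have e2 : 1 / √A ≤ 2 := by rw [div_le_iff₀ (by linarith)]; linarith
  have e3 : 0 < 1 / √A := by positivity
  rw [reducedPhase₂]
  rw [abs_le] at e1 ⊢
  have := abs_nonneg τ
  constructor <;> linarith [e1.1, e1.2]

theorem abs_reducedPhase₃_le {a τ A : ℝ} (ha : 0 < a) (ha' : a ≤ 1 / 200) (hA : 4 / 5 ≤ A)
    (hA' : A ≤ 8) : |reducedPhase₃ a τ A| ≤ 7 / 10 + |τ| / 1000 := by
  obtain ⟨h1, h2, h3, h4⟩ := sqrt_one_add_bounds ha ha' (by linarith) hA'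
  have hs : 894 / 1000 ≤ √A := Real.le_sqrt_of_sq_le (by norm_num; linarith)
  have e1 : |3 / 2 * τ * √(1 + a) * a ^ 2 / √(1 + a * A) ^ 5| ≤ |τ| / 1000 := by
    rw [abs_div, abs_of_pos (by positivity : 0 < √(1 + a * A) ^ 5), div_le_iff₀ (by positivity),
      show 3 / 2 * τ * √(1 + a) * a ^ 2 = τ * (3 / 2 * √(1 + a) * a ^ 2) by ring, abs_mul,
      abs_of_pos (by positivity : 0 < 3 / 2 * √(1 + a) * a ^ 2)]
    have : 1 ≤ √(1 + a * A) ^ 5 := one_le_pow₀ h3.le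
    have h6 : a ^ 2 ≤ (1 / 200) ^ 2 := by gcongr
    have h5 : 3 / 2 * √(1 + a) * a ^ 2 ≤ 3 / 2 * (11 / 10) * (1 / 200) ^ 2 := by gcongr
    calc |τ| * (3 / 2 * √(1 + a) * a ^ 2) ≤ |τ| * (1 / 1000) := by
          gcongr; linarith [h5, show (3 / 2 * (11 / 10) * (1 / 200) ^ 2 : ℝ) ≤ 1 / 1000 by norm_num]
      _ = |τ| / 1000 * 1 := by ring
      _ ≤ |τ| / 1000 * √(1 + a * A) ^ 5 := by gcongr
  have e2 : 1 / (2 * A * √A) ≤ 7 / 10 := by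
    have : 8 / 10 * (894 / 1000) ≤ A * √A := by gcongr; linarith
    rw [div_le_iff₀ (by positivity)]; linarith
  have e3 : 0 < 1 / (2 * A * √A) := by positivity
  rw [reducedPhase₃]
  rw [abs_le] at e1 ⊢
  have := abs_nonneg τ
  constructor <;> linarith [e1.1, e1.2]

theorem continuousOn_reducedPhase₃ {a τ : ℝ} (ha : 0 < a) :
    ContinuousOn (reducedPhase₃ a τ) (Ioi 0) := by
  intro A hA
  have hA : 0 < A := hA
  have hρ := one_lt_sqrt_one_add_mul ha hA
  have hs : 0 < √A := sqrt_pos.2 hA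
  have h : ContinuousAt (reducedPhase₃ a τ) A := by
    unfold reducedPhase₃
    refine ContinuousAt.add (ContinuousAt.div (by fun_prop) (by fun_prop) (by positivity))
      (ContinuousAt.div (by fun_prop) (by fun_prop) (by positivity))
  exact h.continuousWithinAt

theorem reducedPhase₁_sub_le {a τ A B : ℝ} (ha : 0 < a) (hτ : 0 ≤ τ) (hA : 0 < A) (hAB : A ≤ B)
    (hB : B ≤ 8) : (B - A) / 3 ≤ reducedPhase₁ a τ A - reducedPhase₁ a τ B := by
  have hpos : ∀ x ∈ Icc A B, 0 < x := fun x hx => hA.trans_le hx.1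
  have hd : ∀ x ∈ Icc A B, HasDerivAt (fun x => reducedPhase₁ a τ x + x / 3)
      (reducedPhase₂ a τ x + 1 / 3) x := fun x hx =>
    (hasDerivAt_reducedPhase₁ ha (hpos x hx)).add ((hasDerivAt_id x).div_const 3)
  have hanti : AntitoneOn (fun x => reducedPhase₁ a τ x + x / 3) (Icc A B) := by
    refine antitoneOn_of_deriv_nonpos (convex_Icc A B)
      (fun x hx => (hd x hx).continuousAt.continuousWithinAt)
      (fun x hx => (hd x (interior_subset hx)).differentiableAt.differentiableWithinAt)
      fun x hx => ?_
    have hx := interior_subset hx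
    rw [(hd x hx).deriv]
    linarith [reducedPhase₂_le ha hτ (hpos x hx) (hx.2.trans hB)]
  have := hanti ⟨le_rfl, hAB⟩ ⟨hAB, le_rfl⟩ hAB
  simp only [] at this
  linarith

theorem exists_critical_point {a τ : ℝ} (ha : 0 < a) (ha' : a ≤ 1 / 200) (hτ : 23 / 25 ≤ τ)
    (hτ' : τ ≤ 51 / 20) : ∃ α : ℝ → ℝ,
      (∀ s ∈ Ioo (-(1 / 30) : ℝ) (1 / 30), 4 / 5 ≤ α s ∧ α s ≤ 7 ∧ reducedPhase₁ a τ (α s) = s ∧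
        HasDerivAt α (1 / reducedPhase₂ a τ (α s)) s) ∧
      ∀ s ∈ Ioo (-(1 / 30) : ℝ) (1 / 30), ∀ t ∈ Ioo (-(1 / 30) : ℝ) (1 / 30),
        |α s - α t| ≤ 3 * |s - t| := by
  have hτ0 : 0 ≤ τ := by linarith
  have hcont : ContinuousOn (reducedPhase₁ a τ) (Icc (4 / 5) 7) := fun x hx =>
    (hasDerivAt_reducedPhase₁ ha (by linarith [hx.1])).continuousAt.continuousWithinAt
  have hlow : 1 / 30 ≤ reducedPhase₁ a τ (4 / 5) := by
    have h := (sqrt_one_add_div_bounds (A := 4 / 5) ha ha' (by norm_num) (by norm_num)).2.2.1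
      (by norm_num)
    have hs : √(4 / 5) ≤ 895 / 1000 := by rw [Real.sqrt_le_left (by norm_num)]; norm_num
    rw [reducedPhase₁, mul_div_assoc]
    nlinarith
  have hhigh : reducedPhase₁ a τ 7 ≤ -(1 / 30) := by
    have h := (sqrt_one_add_div_bounds (A := 7) ha ha' (by norm_num) (by norm_num)).2.2.2
      (by norm_num)
    have hs : 264 / 100 ≤ √7 := Real.le_sqrt_of_sq_le (by norm_num)
    rw [reducedPhase₁, mul_div_assoc]
    nlinarith
  have hex : ∀ s ∈ Ioo (-(1 / 30) : ℝ) (1 / 30), ∃ A ∈ Icc (4 / 5 : ℝ) 7,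
      reducedPhase₁ a τ A = s := fun s hs =>
    intermediate_value_Icc' (by norm_num) hcont ⟨hhigh.trans hs.1.le, hs.2.le.trans hlow⟩
  choose! α hα1 hα2 using hex
  have hlip : ∀ s ∈ Ioo (-(1 / 30) : ℝ) (1 / 30), ∀ t ∈ Ioo (-(1 / 30) : ℝ) (1 / 30),
        |α s - α t| ≤ 3 * |s - t| := by
    have key : ∀ s ∈ Ioo (-(1 / 30) : ℝ) (1 / 30), ∀ t ∈ Ioo (-(1 / 30) : ℝ) (1 / 30),
        α s ≤ α t → |α s - α t| ≤ 3 * |s - t| := by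
      intro s hs t ht hst
      have h := reducedPhase₁_sub_le ha hτ0 (by linarith [(hα1 s hs).1]) hst
        (by linarith [(hα1 t ht).2])
      rw [hα2 s hs, hα2 t ht] at h
      rw [abs_sub_comm, abs_of_nonneg (sub_nonneg.2 hst)]
      linarith [le_abs_self (s - t)]
    intro s hs t ht
    rcases le_total (α s) (α t) with h | h
    · exact key s hs t ht h
    · rw [abs_sub_comm, abs_sub_comm s]
      exact key t ht s hs h
  refine ⟨α, fun s hs => ⟨(hα1 s hs).1, (hα1 s hs).2, hα2 s hs, ?_⟩, hlip⟩
  have hU : Ioo (-(1 / 30) : ℝ) (1 / 30) ∈ nhds s := isOpen_Ioo.mem_nhds hs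
  have hcα : ContinuousAt α s := by
    rw [Metric.continuousAt_iff']
    intro ε hε
    filter_upwards [hU, Metric.ball_mem_nhds s (show 0 < ε / 4 by positivity)] with t ht ht2
    have := hlip t ht s hs
    rw [Metric.mem_ball, Real.dist_eq] at ht2
    rw [Real.dist_eq]
    linarith
  have hpos : 0 < α s := by linarith [(hα1 s hs).1]
  have hne : reducedPhase₂ a τ (α s) ≠ 0 := by
    have := reducedPhase₂_le ha hτ0 hpos (by linarith [(hα1 s hs).2])
    linarith
  rw [one_div]
  refine HasDerivAt.of_local_left_inverse hcα (hasDerivAt_reducedPhase₁ ha hpos) hne ?_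
  filter_upwards [hU] with t ht using hα2 t ht

/-- The secant slope of `-reducedPhase₁`, as a function of `(a, τ, α, A)`. -/
noncomputable def secantSlope (q : ℝ × ℝ × ℝ × ℝ) : ℝ :=
  2 * q.2.1 * √(1 + q.1) * q.1 / (√(1 + q.1 * q.2.2.2) * √(1 + q.1 * q.2.2.1) *
    (√(1 + q.1 * q.2.2.2) + √(1 + q.1 * q.2.2.1))) + 2 / (√q.2.2.2 + √q.2.2.1)

theorem reducedPhase₁_sub_eq {a τ A α : ℝ} (ha : 0 < a) (hA : 0 < A) (hα : 0 < α) :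
    reducedPhase₁ a τ A - reducedPhase₁ a τ α = -((A - α) * secantSlope (a, τ, α, A)) := by
  have h1 := one_lt_sqrt_one_add_mul ha hA
  have h2 := one_lt_sqrt_one_add_mul ha hα
  have h3 : √(1 + a * A) ^ 2 = 1 + a * A :=
    sq_sqrt (by have := one_lt_one_add_mul ha hA; linarith)
  have h4 : √(1 + a * α) ^ 2 = 1 + a * α :=
    sq_sqrt (by have := one_lt_one_add_mul ha hα; linarith)
  have h5 : 0 < √A := sqrt_pos.2 hA
  have h6 : 0 < √α := sqrt_pos.2 hα
  have h7 : √A ^ 2 = A := sq_sqrt hA.le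
  have h8 : √α ^ 2 = α := sq_sqrt hα.le
  have e1 : 2 * τ * √(1 + a) / √(1 + a * A) - 2 * τ * √(1 + a) / √(1 + a * α)
      = -((A - α) * (2 * τ * √(1 + a) * a / (√(1 + a * A) * √(1 + a * α) *
        (√(1 + a * A) + √(1 + a * α))))) := by
    have : a * (A - α) = √(1 + a * A) ^ 2 - √(1 + a * α) ^ 2 := by rw [h3, h4]; ring
    rw [show (A - α) * (2 * τ * √(1 + a) * a / (√(1 + a * A) * √(1 + a * α) *
        (√(1 + a * A) + √(1 + a * α)))) = (a * (A - α)) * (2 * τ * √(1 + a) / (√(1 + a * A) *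
        √(1 + a * α) * (√(1 + a * A) + √(1 + a * α)))) by ring, this]
    generalize √(1 + a * A) = ρ at *
    generalize √(1 + a * α) = ρ' at *
    field_simp
    ring
  have e2 : 2 * √A - 2 * √α = (A - α) * (2 / (√A + √α)) := by
    have : A - α = √A ^ 2 - √α ^ 2 := by rw [h7, h8]
    rw [this]
    field_simp
    ring
  simp only [reducedPhase₁, secantSlope]
  linear_combination e1 - e2

theorem secantSlope_pos {q : ℝ × ℝ × ℝ × ℝ} (h1 : 0 ≤ q.1) (h2 : 0 < q.2.1) (h3 : 0 < q.2.2.1)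
    (h4 : 0 < q.2.2.2) : 0 < secantSlope q := by
  have h5 : 0 < √q.2.2.2 := sqrt_pos.2 h4
  have h6 : 0 < √q.2.2.1 := sqrt_pos.2 h3
  rw [secantSlope]
  positivity

theorem contDiffAt_secantSlope {q : ℝ × ℝ × ℝ × ℝ} (h1 : 0 ≤ q.1) (h3 : 0 < q.2.2.1)
    (h4 : 0 < q.2.2.2) : ContDiffAt ℝ ∞ secantSlope q := by
  have h5 : 0 < √q.2.2.2 := sqrt_pos.2 h4
  have h6 : 0 < √q.2.2.1 := sqrt_pos.2 h3
  have m3 := mul_nonneg h1 h3.le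
  have m4 := mul_nonneg h1 h4.le
  have c1 : ContDiffAt ℝ ∞ (fun q : ℝ × ℝ × ℝ × ℝ => q.1) q := by fun_prop
  have c2 : ContDiffAt ℝ ∞ (fun q : ℝ × ℝ × ℝ × ℝ => q.2.1) q := by fun_prop
  have c3 : ContDiffAt ℝ ∞ (fun q : ℝ × ℝ × ℝ × ℝ => q.2.2.1) q := by fun_prop
  have c4 : ContDiffAt ℝ ∞ (fun q : ℝ × ℝ × ℝ × ℝ => q.2.2.2) q := by fun_prop
  have s0 := (contDiffAt_const (c := (1 : ℝ)).add c1).sqrt (by positivity)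
  have s3 := (contDiffAt_const (c := (1 : ℝ)).add (c1.mul c3)).sqrt (by positivity)
  have s4 := (contDiffAt_const (c := (1 : ℝ)).add (c1.mul c4)).sqrt (by positivity)
  have p3 : 0 < √(1 + q.1 * q.2.2.1) := sqrt_pos.2 (by linarith)
  have p4 : 0 < √(1 + q.1 * q.2.2.2) := sqrt_pos.2 (by linarith)
  exact ((((contDiffAt_const (c := (2 : ℝ)).mul c2).mul s0).mul c1).div
    ((s4.mul s3).mul (s4.add s3)) (by positivity)).add
    (contDiffAt_const.div ((c4.sqrt h4.ne').add (c3.sqrt h3.ne')) (by positivity))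

theorem exists_secant_inverse_bound : ∃ K : ℝ, 0 < K ∧ ∀ a τ α : ℝ, 0 < a → a ≤ 1 / 200 →
    23 / 25 ≤ τ → τ ≤ 51 / 20 → 4 / 5 ≤ α → α ≤ 7 → ∃ H H' H'' : ℝ → ℝ,
      (∀ A ∈ Icc (89 / 100 : ℝ) (61 / 10), HasDerivAt H (H' A) A) ∧
      (∀ A ∈ Icc (89 / 100 : ℝ) (61 / 10), HasDerivAt H' (H'' A) A) ∧
      ContinuousOn H'' (Icc (89 / 100 : ℝ) (61 / 10)) ∧
      (∀ A ∈ Icc (89 / 100 : ℝ) (61 / 10), |H A| ≤ K ∧ |H' A| ≤ K ∧ |H'' A| ≤ K) ∧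
      ∀ A ∈ Icc (89 / 100 : ℝ) (61 / 10),
        (reducedPhase₁ a τ A - reducedPhase₁ a τ α) * H A = A - α := by
  set Z : Set (ℝ × ℝ × ℝ × ℝ) := Icc 0 (1 / 200) ×ˢ Icc (23 / 25) (51 / 20) ×ˢ Icc (4 / 5) 7 ×ˢ
    Icc (89 / 100) (61 / 10) with hZ
  have hZc : IsCompact Z := isCompact_Icc.prod (isCompact_Icc.prod (isCompact_Icc.prod isCompact_Icc))
  set f : ℝ × ℝ × ℝ × ℝ → ℝ := fun q => -(secantSlope q)⁻¹ with hf
  set v : ℝ × ℝ × ℝ × ℝ := (0, 0, 0, 1) with hv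
  have hmem : ∀ q ∈ Z, 0 ≤ q.1 ∧ 0 < q.2.1 ∧ 0 < q.2.2.1 ∧ 0 < q.2.2.2 := by
    rintro ⟨q1, q2, q3, q4⟩ ⟨h1, h2, h3, h4⟩
    exact ⟨h1.1, by linarith [h2.1], by linarith [h3.1], by linarith [h4.1]⟩
  have c0 : ∀ q ∈ Z, ContDiffAt ℝ ∞ f q := fun q hq => by
    obtain ⟨h1, h2, h3, h4⟩ := hmem q hq
    exact ((contDiffAt_secantSlope h1 h3 h4).inv (secantSlope_pos h1 h2 h3 h4).ne').neg
  have c1 : ∀ q ∈ Z, ContDiffAt ℝ ∞ (dirDeriv v f) q := fun q hq => (c0 q hq).dirDeriv v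
  have c2 : ∀ q ∈ Z, ContDiffAt ℝ ∞ (dirDeriv v (dirDeriv v f)) q := fun q hq =>
    (c1 q hq).dirDeriv v
  obtain ⟨K0, hK0, b0⟩ := hZc.exists_abs_bound c0
  obtain ⟨K1, hK1, b1⟩ := hZc.exists_abs_bound c1
  obtain ⟨K2, hK2, b2⟩ := hZc.exists_abs_bound c2
  refine ⟨K0 + K1 + K2, by positivity, fun a τ α ha ha' hτ hτ' hα hα' =>
    ⟨fun A => f (a, τ, α, A), fun A => dirDeriv v f (a, τ, α, A),
      fun A => dirDeriv v (dirDeriv v f) (a, τ, α, A), ?_⟩⟩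
  have hm : ∀ A ∈ Icc (89 / 100 : ℝ) (61 / 10), (a, τ, α, A) ∈ Z := fun A hA =>
    ⟨⟨ha.le, ha'⟩, ⟨hτ, hτ'⟩, ⟨hα, hα'⟩, hA⟩
  have hc : ∀ A, HasDerivAt (fun A : ℝ => (a, τ, α, A)) v A := fun A =>
    (hasDerivAt_const A a).prodMk ((hasDerivAt_const A τ).prodMk
      ((hasDerivAt_const A α).prodMk (hasDerivAt_id A)))
  refine ⟨fun A hA => (c0 _ (hm A hA)).hasDerivAt_comp_line (hc A),
    fun A hA => (c1 _ (hm A hA)).hasDerivAt_comp_line (hc A),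
    fun A hA => ContinuousAt.continuousWithinAt
      ((c2 _ (hm A hA)).continuousAt.comp (f := fun A : ℝ => (a, τ, α, A)) (hc A).continuousAt),
    fun A hA => ⟨?_, ?_, ?_⟩, fun A hA => ?_⟩
  · linarith [b0 _ (hm A hA)]
  · linarith [b1 _ (hm A hA)]
  · linarith [b2 _ (hm A hA)]
  · obtain ⟨h1, h2, h3, h4⟩ := hmem _ (hm A hA)
    have := secantSlope_pos h1 h2 h3 h4
    rw [reducedPhase₁_sub_eq ha h4 h3]
    simp only [hf]
    field_simp

theorem exists_oscillating_amplitude_derivatives {b b' b'' v v' v'' : ℝ → ℝ} {x y P M : ℝ}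
    (hM : 0 ≤ M) (hP : 0 ≤ P)
    (hb : ∀ A ∈ Icc x y, HasDerivAt b (b' A) A) (hb' : ∀ A ∈ Icc x y, HasDerivAt b' (b'' A) A)
    (hb''c : ContinuousOn b'' (Icc x y))
    (hv : ∀ A ∈ Icc x y, HasDerivAt v (v' A) A) (hv' : ∀ A ∈ Icc x y, HasDerivAt v' (v'' A) A)
    (hv''c : ContinuousOn v'' (Icc x y))
    (bb' : ∀ A ∈ Icc x y, |b' A| ≤ M) (bb'' : ∀ A ∈ Icc x y, |b'' A| ≤ M)
    (bv : ∀ A ∈ Icc x y, |v A| ≤ P) (bv' : ∀ A ∈ Icc x y, |v' A| ≤ P)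
    (bv'' : ∀ A ∈ Icc x y, |v'' A| ≤ P) :
    ∃ w' w'' : ℝ → ℂ,
      (∀ A ∈ Icc x y, HasDerivAt (fun A => cexp (I * (b A : ℂ)) * (v A : ℂ)) (w' A) A) ∧
      (∀ A ∈ Icc x y, HasDerivAt w' (w'' A) A) ∧ ContinuousOn w'' (Icc x y) ∧
      (∀ A ∈ Icc x y, ‖cexp (I * (b A : ℂ)) * (v A : ℂ)‖ ≤ P * (1 + M) ^ 2 * 2) ∧
      (∀ A ∈ Icc x y, ‖w' A‖ ≤ P * (1 + M) ^ 2 * 2) ∧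
      (∀ A ∈ Icc x y, ‖w'' A‖ ≤ P * (1 + M) ^ 2 * 2) := by
  have hexp : ∀ A ∈ Icc x y, HasDerivAt (fun A => cexp (I * (b A : ℂ)))
      (cexp (I * (b A : ℂ)) * (I * (b' A : ℂ))) A := fun A hA =>
    ((hb A hA).ofReal_comp.const_mul I).cexp
  have ofc : ∀ {k : ℝ → ℝ}, ContinuousOn k (Icc x y) →
      ContinuousOn (fun A => ((k A : ℝ) : ℂ)) (Icc x y) := fun hk =>
    continuous_ofReal.comp_continuousOn hk
  have cb : ContinuousOn b (Icc x y) := fun A hA => (hb A hA).continuousAt.continuousWithinAt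
  have cb' : ContinuousOn b' (Icc x y) := fun A hA => (hb' A hA).continuousAt.continuousWithinAt
  have cv : ContinuousOn v (Icc x y) := fun A hA => (hv A hA).continuousAt.continuousWithinAt
  have cv' : ContinuousOn v' (Icc x y) := fun A hA => (hv' A hA).continuousAt.continuousWithinAt
  have nE : ∀ A, ‖cexp (I * (b A : ℂ))‖ = 1 := fun A => norm_exp_I_mul _
  refine ⟨fun A => cexp (I * (b A : ℂ)) * (I * (b' A : ℂ) * (v A : ℂ) + (v' A : ℂ)),
    fun A => cexp (I * (b A : ℂ)) * ((I * (b' A : ℂ)) * (I * (b' A : ℂ) * (v A : ℂ) + (v' A : ℂ))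
      + (I * (b'' A : ℂ) * (v A : ℂ) + I * (b' A : ℂ) * (v' A : ℂ) + (v'' A : ℂ))),
    fun A hA => ?_, fun A hA => ?_, ?_, fun A hA => ?_, fun A hA => ?_, fun A hA => ?_⟩
  · refine ((hexp A hA).mul (hv A hA).ofReal_comp).congr_deriv ?_
    ring
  · refine ((hexp A hA).mul ((((hb' A hA).ofReal_comp.const_mul I).mul (hv A hA).ofReal_comp).add
      (hv' A hA).ofReal_comp)).congr_deriv ?_
    simp only [Pi.mul_apply, Pi.add_apply]
    ring
  · have ci : ContinuousOn (fun _ : ℝ => I) (Icc x y) := continuousOn_const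
    exact ((ci.mul (ofc cb)).cexp).mul (((ci.mul (ofc cb')).mul (((ci.mul (ofc cb')).mul (ofc cv)).add
      (ofc cv'))).add ((((ci.mul (ofc hb''c)).mul (ofc cv)).add ((ci.mul (ofc cb')).mul (ofc cv'))).add
      (ofc hv''c)))
  · rw [norm_mul, nE, one_mul, norm_real, Real.norm_eq_abs]
    have := bv A hA
    nlinarith [mul_nonneg hP hM, mul_nonneg hP (mul_nonneg hM hM)]
  · rw [norm_mul, nE, one_mul]
    refine (norm_add_le _ _).trans ?_
    simp only [norm_mul, norm_I, norm_real, Real.norm_eq_abs, one_mul]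
    have h1 := mul_le_mul (bb' A hA) (bv A hA) (abs_nonneg _) hM
    have := bv' A hA
    nlinarith [mul_nonneg hP hM, mul_nonneg hP (mul_nonneg hM hM)]
  · rw [norm_mul, nE, one_mul]
    have t1 := mul_le_mul (bb' A hA) (bv A hA) (abs_nonneg _) hM
    have t2 := mul_le_mul (bb' A hA) (bv' A hA) (abs_nonneg _) hM
    have t3 := mul_le_mul (bb'' A hA) (bv A hA) (abs_nonneg _) hM
    have t4 := mul_le_mul (bb' A hA) (add_le_add t1 (bv' A hA)) (by positivity) hM
    have t5 := bv'' A hA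
    calc _ ≤ |b' A| * (|b' A| * |v A| + |v' A|) + (|b'' A| * |v A| + |b' A| * |v' A| + |v'' A|) := by
          refine (norm_add_le _ _).trans (add_le_add ?_ ((norm_add₃_le).trans (le_of_eq ?_)))
          · rw [norm_mul]
            refine mul_le_mul (le_of_eq (by simp)) ((norm_add_le _ _).trans (le_of_eq (by simp)))
              (norm_nonneg _) (abs_nonneg _)
          · simp
      _ ≤ M * (M * P + P) + (M * P + M * P + P) := by linarith
      _ ≤ P * (1 + M) ^ 2 * 2 := by nlinarith [mul_nonneg hP hM, mul_nonneg hP (mul_nonneg hM hM)]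

theorem boundary_phase_derivatives {L B₁ B₂ : ℝ → ℝ} {C Λ n : ℝ} (hC : 0 ≤ C)
    (hB1 : ∀ u, 0 < u → HasDerivAt (Bfun L) (B₁ u) u)
    (hB2 : ∀ u, 0 < u → HasDerivAt B₁ (B₂ u) u) (hB2c : ContinuousOn B₂ (Ioi 0))
    (hBb : ∀ u, 1 ≤ u → |B₁ u| ≤ C / u ^ 2 ∧ |B₂ u| ≤ C / u ^ 3)
    (hΛ : 2 ≤ Λ) (hn : |n| ≤ 2 * Λ) : ∃ b' b'' : ℝ → ℝ,
      (∀ A ∈ Icc (89 / 100 : ℝ) (61 / 10),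
        HasDerivAt (fun A => n * Bfun L (Λ * A ^ ((3 : ℝ) / 2))) (b' A) A) ∧
      (∀ A ∈ Icc (89 / 100 : ℝ) (61 / 10), HasDerivAt b' (b'' A) A) ∧
      ContinuousOn b'' (Icc (89 / 100 : ℝ) (61 / 10)) ∧
      (∀ A ∈ Icc (89 / 100 : ℝ) (61 / 10), |b' A| ≤ 64 * C) ∧
      (∀ A ∈ Icc (89 / 100 : ℝ) (61 / 10), |b'' A| ≤ 64 * C) := by
  have hΛ0 : 0 < Λ := by linarith
  have hpos : ∀ A ∈ Icc (89 / 100 : ℝ) (61 / 10), 0 < A := fun A hA => by linarith [hA.1]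
  have hu0 : ∀ A ∈ Icc (89 / 100 : ℝ) (61 / 10), 0 < Λ * A ^ ((3 : ℝ) / 2) := fun A hA => by
    have := hpos A hA
    positivity
  have hs1 : ∀ A ∈ Icc (89 / 100 : ℝ) (61 / 10), 9 / 10 ≤ √A ∧ √A ≤ 5 / 2 := fun A hA =>
    ⟨Real.le_sqrt_of_sq_le (by linarith [hA.1]), by
      rw [Real.sqrt_le_left (by norm_num)]; linarith [hA.2]⟩
  have hr : ∀ A ∈ Icc (89 / 100 : ℝ) (61 / 10), A ^ ((3 : ℝ) / 2) = A * √A := fun A hA => by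
    have := hpos A hA
    rw [Real.sqrt_eq_rpow, show (3 : ℝ) / 2 = 1 + 1 / 2 by norm_num, Real.rpow_add this, Real.rpow_one]
  have hu1 : ∀ A ∈ Icc (89 / 100 : ℝ) (61 / 10), Λ * (4 / 5) ≤ Λ * A ^ ((3 : ℝ) / 2) := fun A hA => by
    rw [hr A hA]
    have : 89 / 100 * (9 / 10) ≤ A * √A := mul_le_mul hA.1 (hs1 A hA).1 (by norm_num) (hpos A hA).le
    gcongr
    linarith
  have du : ∀ A ∈ Icc (89 / 100 : ℝ) (61 / 10),
      HasDerivAt (fun A : ℝ => Λ * A ^ ((3 : ℝ) / 2)) (Λ * (3 / 2 * √A)) A := fun A hA =>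
    (hasDerivAt_rpow_three_halves (hpos A hA)).const_mul Λ
  have cu : ContinuousOn (fun A : ℝ => Λ * A ^ ((3 : ℝ) / 2)) (Icc (89 / 100 : ℝ) (61 / 10)) :=
    fun A hA => (du A hA).continuousAt.continuousWithinAt
  have cs : ContinuousOn (fun A : ℝ => √A) (Icc (89 / 100 : ℝ) (61 / 10)) := by fun_prop
  have cB1 : ContinuousOn (fun A : ℝ => B₁ (Λ * A ^ ((3 : ℝ) / 2))) (Icc (89 / 100 : ℝ) (61 / 10)) :=
    fun A hA => ((hB2 _ (hu0 A hA)).comp A (du A hA)).continuousAt.continuousWithinAt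
  have bnd : ∀ A ∈ Icc (89 / 100 : ℝ) (61 / 10),
      |n * B₁ (Λ * A ^ ((3 : ℝ) / 2)) * Λ| ≤ 4 * C ∧
      |n * B₂ (Λ * A ^ ((3 : ℝ) / 2)) * Λ ^ 2| ≤ 4 * C := by
    intro A hA
    have hu := hu1 A hA
    obtain ⟨h1, h2⟩ := hBb (Λ * A ^ ((3 : ℝ) / 2)) (by linarith)
    have h3 : C / (Λ * A ^ ((3 : ℝ) / 2)) ^ 2 ≤ C / (Λ * (4 / 5)) ^ 2 := by gcongr
    have h4 : C / (Λ * A ^ ((3 : ℝ) / 2)) ^ 3 ≤ C / (Λ * (4 / 5)) ^ 3 := by gcongr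
    constructor
    · rw [abs_mul, abs_mul, abs_of_pos hΛ0]
      calc |n| * |B₁ (Λ * A ^ ((3 : ℝ) / 2))| * Λ ≤ (2 * Λ) * (C / (Λ * (4 / 5)) ^ 2) * Λ := by
            gcongr; exact h1.trans h3
        _ = C * (25 / 8) := by field_simp; ring
        _ ≤ 4 * C := by linarith
    · rw [abs_mul, abs_mul, abs_of_pos (pow_pos hΛ0 2)]
      calc |n| * |B₂ (Λ * A ^ ((3 : ℝ) / 2))| * Λ ^ 2 ≤ (2 * Λ) * (C / (Λ * (4 / 5)) ^ 3) * Λ ^ 2 := by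
            gcongr; exact h2.trans h4
        _ = C * (125 / 32) := by field_simp; ring
        _ ≤ 4 * C := by linarith
  refine ⟨fun A => n * (B₁ (Λ * A ^ ((3 : ℝ) / 2)) * (Λ * (3 / 2 * √A))),
    fun A => n * (B₂ (Λ * A ^ ((3 : ℝ) / 2)) * (Λ * (3 / 2 * √A)) * (Λ * (3 / 2 * √A)) +
      B₁ (Λ * A ^ ((3 : ℝ) / 2)) * (Λ * (3 / 2 * (1 / (2 * √A))))),
    fun A hA => ?_, fun A hA => ?_, ?_, fun A hA => ?_, fun A hA => ?_⟩
  · exact ((hB1 _ (hu0 A hA)).comp A (du A hA)).const_mul n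
  · exact (((hB2 _ (hu0 A hA)).comp A (du A hA)).mul
      (((hasDerivAt_sqrt_self (hpos A hA)).const_mul (3 / 2)).const_mul Λ)).const_mul n
  · have cB2 : ContinuousOn (fun A : ℝ => B₂ (Λ * A ^ ((3 : ℝ) / 2))) (Icc (89 / 100 : ℝ) (61 / 10)) :=
      hB2c.comp cu fun A hA => hu0 A hA
    have ci : ContinuousOn (fun A : ℝ => 1 / (2 * √A)) (Icc (89 / 100 : ℝ) (61 / 10)) :=
      continuousOn_const.div (continuousOn_const.mul cs) fun A hA => by
        have := (hs1 A hA).1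
        positivity
    have cq := (continuousOn_const (c := Λ)).mul ((continuousOn_const (c := (3 / 2 : ℝ))).mul cs)
    exact continuousOn_const.mul (((cB2.mul cq).mul cq).add (cB1.mul
      (continuousOn_const.mul (continuousOn_const.mul ci))))
  · obtain ⟨h1, h2⟩ := bnd A hA
    obtain ⟨h3, h4⟩ := hs1 A hA
    simp only []
    rw [show n * (B₁ (Λ * A ^ ((3 : ℝ) / 2)) * (Λ * (3 / 2 * √A)))
      = (n * B₁ (Λ * A ^ ((3 : ℝ) / 2)) * Λ) * (3 / 2 * √A) by ring, abs_mul,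
      abs_of_nonneg (by positivity : 0 ≤ 3 / 2 * √A)]
    have := mul_le_mul h1 (show 3 / 2 * √A ≤ 15 / 4 by linarith) (by positivity) (by positivity)
    linarith
  · obtain ⟨h1, h2⟩ := bnd A hA
    obtain ⟨h3, h4⟩ := hs1 A hA
    have h5 : 1 / (2 * √A) ≤ 1 := by rw [div_le_one (by positivity)]; linarith
    simp only []
    rw [show n * (B₂ (Λ * A ^ ((3 : ℝ) / 2)) * (Λ * (3 / 2 * √A)) * (Λ * (3 / 2 * √A)) +
      B₁ (Λ * A ^ ((3 : ℝ) / 2)) * (Λ * (3 / 2 * (1 / (2 * √A)))))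
      = (n * B₂ (Λ * A ^ ((3 : ℝ) / 2)) * Λ ^ 2) * (9 / 4 * √A ^ 2) +
        (n * B₁ (Λ * A ^ ((3 : ℝ) / 2)) * Λ) * (3 / 2 * (1 / (2 * √A))) by ring,
        sq_sqrt (hpos A hA).le]
    have e1 := mul_le_mul h1 (show 3 / 2 * (1 / (2 * √A)) ≤ 3 / 2 by linarith) (by positivity)
      (by positivity)
    have e2 := mul_le_mul h2 (show 9 / 4 * A ≤ 9 / 4 * (61 / 10) by linarith [hA.2])
      (by have := hpos A hA; positivity) (by positivity)
    refine (abs_add_le _ _).trans ?_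
    rw [abs_mul (n * B₂ _ * _), abs_mul (n * B₁ _ * _),
      abs_of_nonneg (by positivity : 0 ≤ 3 / 2 * (1 / (2 * √A))),
      abs_of_nonneg (by have := hpos A hA; positivity : 0 ≤ 9 / 4 * A)]
    linarith

theorem ContDiff.hasDerivAt_dirDeriv_one {f : ℝ → ℝ} (hf : ContDiff ℝ ∞ f) (t : ℝ) :
    HasDerivAt f (_root_.dirDeriv 1 f t) t :=
  hf.contDiffAt.hasDerivAt_comp_line (c := fun s => s) (hasDerivAt_id t)

theorem exists_derivative_bounds_of_tsupport_subset {ψ₃ : ℝ → ℝ} {x y : ℝ}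
    (hψ₃ : ContDiff ℝ ∞ ψ₃) (hψ₃s : tsupport ψ₃ ⊆ Icc x y) : ∃ P, 0 < P ∧
      ∀ A, |ψ₃ A| ≤ P ∧ |dirDeriv 1 ψ₃ A| ≤ P ∧ |dirDeriv 1 (dirDeriv 1 ψ₃) A| ≤ P := by
  have hc : HasCompactSupport ψ₃ := isCompact_Icc.of_isClosed_subset (isClosed_tsupport _) hψ₃s
  obtain ⟨P0, h0, b0⟩ := hc.exists_abs_bound hψ₃.continuous
  obtain ⟨P1, h1, b1⟩ := (hc.dirDeriv 1).exists_abs_bound (hψ₃.dirDeriv 1).continuous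
  obtain ⟨P2, h2, b2⟩ := ((hc.dirDeriv 1).dirDeriv 1).exists_abs_bound
    ((hψ₃.dirDeriv 1).dirDeriv 1).continuous
  exact ⟨P0 + P1 + P2, by positivity, fun A => ⟨by linarith [b0 A], by linarith [b1 A],
    by linarith [b2 A]⟩⟩

/-- `g(p, y)` is `C²` enough, bounded by `G` with its derivatives and vanishes at `y = ±3`. -/
def IsFresnelAmplitude (G : ℝ) (g : ℝ → ℝ → ℝ) : Prop :=
  ∃ gp gu gpu guu : ℝ → ℝ → ℝ, Continuous (uncurry g) ∧
    Continuous (uncurry gp) ∧ Continuous (uncurry gu) ∧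
    Continuous (uncurry gpu) ∧ Continuous (uncurry guu) ∧
    (∀ p y, HasDerivAt (fun p => g p y) (gp p y) p) ∧
    (∀ p y, HasDerivAt (fun y => g p y) (gu p y) y) ∧
    (∀ p y, HasDerivAt (fun y => gp p y) (gpu p y) y) ∧
    (∀ p y, HasDerivAt (fun y => gu p y) (guu p y) y) ∧
    (∀ p y, |g p y| ≤ G) ∧ (∀ p y, |gp p y| ≤ G) ∧ (∀ p y, |gu p y| ≤ G) ∧
    (∀ p y, |gpu p y| ≤ G) ∧ (∀ p y, |guu p y| ≤ G) ∧ (∀ p, g p (-3) = 0) ∧ (∀ p, g p 3 = 0)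

/-- `w` is `C²` on `[x, y]`, vanishes at the ends, and is bounded by `W` with its derivatives. -/
def IsSaddleAmplitude (W x y : ℝ) (w : ℝ → ℂ) : Prop :=
  ∃ w' w'' : ℝ → ℂ, (∀ A ∈ Icc x y, HasDerivAt w (w' A) A) ∧
    (∀ A ∈ Icc x y, HasDerivAt w' (w'' A) A) ∧ ContinuousOn w'' (Icc x y) ∧ w x = 0 ∧ w y = 0 ∧
    (∀ A ∈ Icc x y, ‖w A‖ ≤ W) ∧ (∀ A ∈ Icc x y, ‖w' A‖ ≤ W) ∧ (∀ A ∈ Icc x y, ‖w'' A‖ ≤ W)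

/-- The amplitude left after integrating over `Υ` and `A` at fixed `p = S + Υ`. -/
noncomputable def sliceIntegral (ϑ : ℝ → ℝ) (n Λ X : ℝ) (g : ℝ → ℝ → ℝ) (w : ℝ → ℂ) (p : ℝ) : ℂ :=
  (∫ y in (-3:ℝ)..3, cexp (I * ((Λ * (y ^ 3 / 3 + y * X + (p - y) ^ 3 / 3
    + (p - y)) : ℝ) : ℂ)) * (g p y : ℂ)) *
  ∫ A in (89 / 100 : ℝ)..(61 / 10), cexp (I * ((Λ * (n * ϑ A - p * A) : ℝ) : ℂ)) * w A

theorem continuous_sliceIntegral {ϑ : ℝ → ℝ} {n Λ X : ℝ} {g : ℝ → ℝ → ℝ} {w : ℝ → ℂ}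
    (hϑ : ContinuousOn ϑ (Icc (89 / 100 : ℝ) (61 / 10))) (hg : Continuous (uncurry g))
    (hw : ContinuousOn w (Icc (89 / 100 : ℝ) (61 / 10))) : Continuous (sliceIntegral ϑ n Λ X g w) := by
  rw [← continuousOn_univ]
  refine ContinuousOn.mul (continuousOn_intervalIntegral_param isOpen_univ (by norm_num) ?_)
    (continuousOn_intervalIntegral_param isOpen_univ (by norm_num) ?_)
  · refine ContinuousOn.mul ?_ (continuous_ofReal.comp hg).continuousOn
    fun_prop
  · have h1 : ContinuousOn (fun q : ℝ × ℝ => ϑ q.2) (univ ×ˢ Icc (89 / 100 : ℝ) (61 / 10)) :=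
      hϑ.comp continuousOn_snd fun q hq => hq.2
    have h2 : ContinuousOn (fun q : ℝ × ℝ => w q.2) (univ ×ˢ Icc (89 / 100 : ℝ) (61 / 10)) :=
      hw.comp continuousOn_snd fun q hq => hq.2
    have h3 : ContinuousOn (fun q : ℝ × ℝ => q.1 * q.2) (univ ×ˢ Icc (89 / 100 : ℝ) (61 / 10)) := by
      fun_prop
    exact ((continuousOn_const (c := I)).mul (continuous_ofReal.comp_continuousOn
      ((continuousOn_const (c := Λ)).mul (((continuousOn_const (c := n)).mul h1).sub h3)))).cexp.mul h2

theorem abs_sub_one_le_of_critical {a τ A : ℝ} (ha : 0 < a) (ha' : a ≤ 1 / 200) (hτ : 0 ≤ τ)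
    (hA : 4 / 5 ≤ A) (hA' : A ≤ 7) (h : reducedPhase₁ a τ A = 0) : |τ - 1| ≤ 2 * |A - 1| := by
  have hA0 : 0 < A := by linarith
  have hρ := one_lt_sqrt_one_add_mul ha hA0
  have h3 : √(1 + a * A) ^ 2 = 1 + a * A :=
    sq_sqrt (by have := one_lt_one_add_mul ha hA0; linarith)
  have h4 : √(1 + a) ^ 2 = 1 + a := sq_sqrt (by linarith)
  have h5 : √A ^ 2 = A := sq_sqrt hA0.le
  have h6 : τ * √(1 + a) = √A * √(1 + a * A) := by
    rw [reducedPhase₁] at h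
    field_simp at h
    linarith
  have h7 : τ ^ 2 * (1 + a) = A * (1 + a * A) := by
    rw [← h4, ← mul_pow, h6, mul_pow, h5, h3]
  have h8 : (τ - 1) * ((τ + 1) * (1 + a)) = (A - 1) * (1 + a * (A + 1)) := by linarith
  have h9 : 1 ≤ (τ + 1) * (1 + a) := by nlinarith
  have h10 : 1 + a * (A + 1) ≤ 2 := by nlinarith
  have h11 : 0 ≤ 1 + a * (A + 1) := by positivity
  calc |τ - 1| ≤ |τ - 1| * ((τ + 1) * (1 + a)) := le_mul_of_one_le_right (abs_nonneg _) h9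
    _ = |A - 1| * (1 + a * (A + 1)) := by
        rw [← abs_of_nonneg (zero_le_one.trans h9), ← abs_mul, h8, abs_mul, abs_of_nonneg h11]
    _ ≤ 2 * |A - 1| := by rw [mul_comm]; gcongr

theorem exists_half_line_bound : ∃ K₀ : ℝ, 0 < K₀ ∧
    ∀ {a τ n Λ ℓ X G W : ℝ} {g : ℝ → ℝ → ℝ} {w : ℝ → ℂ}, 0 < a → a ≤ 1 / 200 → 23 / 25 ≤ τ →
      τ ≤ 51 / 20 → 400 ≤ |n| → 2 ≤ ℓ → ℓ ^ 6 = Λ → ℓ ^ 2 / 2 ≤ |n| → IsFresnelAmplitude G g →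
      IsSaddleAmplitude W (89 / 100) (61 / 10) w → ∃ d, 0 ≤ d ∧ |τ - 1| ≤ 2 * d ^ 4 ∧
      ‖∫ p in (0:ℝ)..6, sliceIntegral (reducedPhase a τ) n Λ X g w p‖
        ≤ 74 * (K₀ * G * W / (√Λ * √(Λ * |n|))) / ℓ ∧
      ‖∫ p in (0:ℝ)..6, sliceIntegral (reducedPhase a τ) n Λ X g w p‖ * d
        ≤ 518 * (K₀ * G * W / (√Λ * √(Λ * |n|))) / ℓ ^ 2 := by
  obtain ⟨Kh, hKh, hHb⟩ := exists_secant_inverse_bound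
  refine ⟨224000 + 800000 * Kh, by positivity, ?_⟩
  intro a τ n Λ ℓ X G W g w ha ha' hτ hτ' hn400 hℓ hΛℓ hℓn hg hw
  obtain ⟨gp, gu, gpu, guu, cg, cgp, cgu, cgpu, cguu, dp, du, dpu, duu, bg, bgp, bgu, bgpu, bguu,
    hm, hM⟩ := hg
  obtain ⟨w', w'', dw, dw', cw'', hwx, hwy, bw, bw', bw''⟩ := hw
  have hτ0 : 0 ≤ τ := by linarith
  have hG : 0 ≤ G := (abs_nonneg _).trans (bg 0 0)
  have hW : 0 ≤ W := (norm_nonneg _).trans (bw (89 / 100) ⟨le_rfl, by norm_num⟩)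
  have hn0 : n ≠ 0 := by
    intro h; rw [h, abs_zero] at hn400; linarith
  have hna : 0 < |n| := by linarith
  have hΛ1 : 1 ≤ Λ := hΛℓ ▸ one_le_pow₀ (by linarith)
  have hΛ0 : 0 < Λ := by linarith
  obtain ⟨α, hα, hαlip⟩ := exists_critical_point ha ha' hτ hτ'
  have h0mem : (0 : ℝ) ∈ Ioo (-(1 / 30) : ℝ) (1 / 30) := by constructor <;> norm_num
  have hmem : ∀ p ∈ Ioo (0:ℝ) 7, p / n ∈ Ioo (-(1 / 30) : ℝ) (1 / 30) := by
    intro p hp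
    rw [mem_Ioo, ← abs_lt, abs_div, abs_of_pos hp.1, div_lt_iff₀ hna]
    linarith [hp.2]
  set β : ℝ → ℝ := fun p => α (p / n) with hβ
  set β' : ℝ → ℝ := fun p => 1 / (n * reducedPhase₂ a τ (β p)) with hβ'
  set β'' : ℝ → ℝ := fun p => -(n * (reducedPhase₃ a τ (β p) * β' p)) /
    (n * reducedPhase₂ a τ (β p)) ^ 2 with hβ''
  have hβr : ∀ p ∈ Ioo (0:ℝ) 7, 4 / 5 ≤ β p ∧ β p ≤ 7 := fun p hp =>
    ⟨(hα _ (hmem p hp)).1, (hα _ (hmem p hp)).2.1⟩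
  have hβpos : ∀ p ∈ Ioo (0:ℝ) 7, 0 < β p := fun p hp => by linarith [(hβr p hp).1]
  have hϑ2β : ∀ p ∈ Ioo (0:ℝ) 7, reducedPhase₂ a τ (β p) ≤ -(1 / 3) := fun p hp =>
    reducedPhase₂_le ha hτ0 (hβpos p hp) (by linarith [(hβr p hp).2])
  have hcrit : ∀ p ∈ Ioo (0:ℝ) 7, n * reducedPhase₁ a τ (β p) = p := fun p hp => by
    rw [(hα _ (hmem p hp)).2.2.1]; field_simp
  have dβ : ∀ p ∈ Ioo (0:ℝ) 7, HasDerivAt β (β' p) p := fun p hp => by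
    refine ((hα _ (hmem p hp)).2.2.2.comp p ((hasDerivAt_id p).div_const n)).congr_deriv ?_
    have := hϑ2β p hp
    have : reducedPhase₂ a τ (β p) ≠ 0 := by linarith
    simp only [hβ', hβ]
    field_simp
  have hden : ∀ p ∈ Ioo (0:ℝ) 7, n * reducedPhase₂ a τ (β p) ≠ 0 := fun p hp => by
    have := hϑ2β p hp
    exact mul_ne_zero hn0 (by linarith)
  have dβ' : ∀ p ∈ Ioo (0:ℝ) 7, HasDerivAt β' (β'' p) p := fun p hp => by
    have h := (((hasDerivAt_reducedPhase₂ (τ := τ) ha (hβpos p hp)).comp p (dβ p hp)).const_mul n)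
    exact ((hasDerivAt_const p (1:ℝ)).div h (hden p hp)).congr_deriv (by simp [hβ''])
  have hden3 : ∀ p ∈ Ioo (0:ℝ) 7, |n| / 3 ≤ |n * reducedPhase₂ a τ (β p)| := fun p hp => by
    have := hϑ2β p hp
    rw [abs_mul, div_eq_mul_one_div]
    gcongr
    rw [abs_of_neg (by linarith)]
    linarith
  have bβ' : ∀ p ∈ Ioo (0:ℝ) 7, |β' p| ≤ 3 / |n| := fun p hp => by
    rw [abs_div, abs_one, show 3 / |n| = 1 / (|n| / 3) by field_simp]
    exact one_div_le_one_div_of_le (by positivity) (hden3 p hp)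
  have bβ'' : ∀ p ∈ Ioo (0:ℝ) 7, |β'' p| ≤ 1 / 4 := fun p hp => by
    have h3 : |reducedPhase₃ a τ (β p)| ≤ 1 := by
      refine (abs_reducedPhase₃_le ha ha' (hβr p hp).1 (by linarith [(hβr p hp).2])).trans ?_
      rw [abs_of_nonneg hτ0]
      linarith
    have h4 : (|n| / 3) ^ 2 ≤ |n * reducedPhase₂ a τ (β p)| ^ 2 := by gcongr; exact hden3 p hp
    rw [abs_div, abs_neg, abs_mul, abs_mul, abs_pow, div_le_iff₀ (by
      have := hden p hp; positivity)]
    have h5 := mul_le_mul h3 (bβ' p hp) (abs_nonneg _) zero_le_one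
    have h6 := mul_le_mul_of_nonneg_left h5 hna.le
    have h7 : |n| * (1 * (3 / |n|)) = 3 := by field_simp
    have h8 : (400 / 3 : ℝ) ^ 2 ≤ (|n| / 3) ^ 2 := by gcongr
    linarith
  obtain ⟨Q, Q', dQ, cQ', bQ, bQ', hQ⟩ := fresnel_amplitude (g := g) (X := X) (E := 1 - X) hΛ1 rfl cg
    cgp cgu cgpu cguu dp du dpu duu bg bgp bgu bgpu bguu hm hM
  have hAr : ∀ A ∈ Icc (89 / 100 : ℝ) (61 / 10), 0 < A ∧ A ≤ 8 := fun A hA =>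
    ⟨by linarith [hA.1], by linarith [hA.2]⟩
  obtain ⟨J, J', dJ, cJ', bJ, bJ', hJ⟩ := saddle_amplitude (ϑ := reducedPhase a τ)
    (ϑ' := reducedPhase₁ a τ) (ϑ'' := reducedPhase₂ a τ) (β := β) (β' := β') (w := w)
    (w' := w') (w'' := w'') (U := Ioo 0 7) (x := 89 / 100) (y := 61 / 10) (n := n) (Λ := Λ) (K := Kh)
    (W := W) (by norm_num) (by norm_num) hn0 hΛ0 isOpen_Ioo
    (fun A hA => hasDerivAt_reducedPhase ha hA) (fun A hA => hasDerivAt_reducedPhase₁ ha hA)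
    (fun A hA => (hasDerivAt_reducedPhase₂ ha (hAr A hA).1).continuousAt.continuousWithinAt)
    dβ hβpos hcrit (fun A hA => reducedPhase₂_le ha hτ0 (hAr A hA).1 (hAr A hA).2) dw dw' cw'' hwx hwy
    bw bw' bw'' hKh.le (fun p hp => by
      obtain ⟨H, H', H'', h1, h2, h3, h4, h5⟩ := hHb a τ (β p) ha ha' hτ hτ' (hβr p hp).1 (hβr p hp).2
      refine ⟨H, H', H'', h1, h2, h3, h4, fun A hA => ?_⟩
      linear_combination n * h5 A hA + H A * hcrit p hp)
  have h60 : ∀ p ∈ Ioc (0:ℝ) 6, p ∈ Ioo (0:ℝ) 7 := fun p hp => ⟨hp.1, by linarith [hp.2]⟩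
  obtain ⟨hA01, hA02, hA03, -⟩ := hα 0 h0mem
  set A0 := α 0 with hA0
  set d := √(√|A0 - 1|) with hd
  have hd4 : d ^ 4 = |A0 - 1| := by
    rw [show d ^ 4 = (d ^ 2) ^ 2 by ring, hd, sq_sqrt (Real.sqrt_nonneg _),
      sq_sqrt (abs_nonneg _)]
  have hd0 : 0 ≤ d := Real.sqrt_nonneg _
  have hd2 : d ≤ 2 := by
    have : d ^ 4 ≤ 2 ^ 4 := by
      rw [hd4, abs_le]; constructor <;> linarith
    exact le_of_pow_le_pow_left₀ (by norm_num) (by norm_num) this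
  set s := √(Λ * |n|) with hs
  have hs0 : 0 < s := sqrt_pos.2 (by positivity)
  have hsΛ : 0 < √Λ := sqrt_pos.2 hΛ0
  have bJ2 : ∀ p ∈ Ioo (0:ℝ) 7, ‖J p‖ ≤ 112 * W / s := fun p hp => by
    refine (bJ p hp).trans ?_
    rw [div_mul_eq_mul_div]
    refine div_le_div_of_nonneg_right ?_ hs0.le
    linarith
  have bJ2' : ∀ p ∈ Ioo (0:ℝ) 7, ‖J' p‖ ≤ 400 * Kh * W / s / |n| := fun p hp => by
    refine (bJ' p hp).trans ?_
    rw [div_mul_eq_mul_div]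
    refine div_le_div_of_nonneg_right (div_le_div_of_nonneg_right ?_ hs0.le) hna.le
    have : 0 ≤ Kh * W := by positivity
    linarith
  refine ⟨d, hd0, (abs_sub_one_le_of_critical ha ha' hτ0 hA01 hA02 hA03).trans (by rw [hd4]), ?_⟩
  refine cubic_phase_integral (E := 1 - X) (σ := 1 - A0) (ν := |n|)
    (f := fun p => p ^ 3 / 12 + p * (1 + X) / 2 - (1 - X) ^ 2 / (4 * p) +
      (n * reducedPhase a τ (β p) - p * β p))
    (f' := fun p => p ^ 2 / 4 + (1 + X) / 2 + (1 - X) ^ 2 / (4 * p ^ 2) - β p)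
    (f'' := fun p => p / 2 - (1 - X) ^ 2 / (2 * p ^ 3) - β' p)
    (f₃ := fun p => 1 / 2 + 3 * (1 - X) ^ 2 / (2 * p ^ 4) - β'' p)
    (r := fun p => β p - A0) (r' := β') (M := fun p => Q p * J p)
    (M' := fun p => Q' p * J p + Q p * J' p) hℓ hd0 hd2
    (by rw [hd4, abs_sub_comm]) hℓn (by positivity) ?_ ?_ ?_ ?_ ?_ ?_ ?_ ?_ ?_ ?_ ?_ ?_ ?_ ?_
  · intro p hp
    have hp0 : p ≠ 0 := hp.1.ne'
    have hp7 := h60 p hp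
    have h1 : HasDerivAt (fun p : ℝ => p ^ 3 / 12 + p * (1 + X) / 2 - (1 - X) ^ 2 / (4 * p))
        (p ^ 2 / 4 + (1 + X) / 2 + (1 - X) ^ 2 / (4 * p ^ 2)) p := by
      refine ((((hasDerivAt_id p).pow 3).div_const 12).add
        (((hasDerivAt_id p).mul_const (1 + X)).div_const 2)).sub
        ((hasDerivAt_const p ((1 - X) ^ 2)).div ((hasDerivAt_id p).const_mul 4)
          (by simpa using hp0)) |>.congr_deriv ?_
      simp only [id]
      field_simp
      ring
    have h2 := (((hasDerivAt_reducedPhase (τ := τ) ha (hβpos p hp7)).comp p (dβ p hp7)).const_mul n).sub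
      ((hasDerivAt_id p).mul (dβ p hp7))
    refine (h1.add h2).congr_deriv ?_
    simp only [id]
    linear_combination (β' p) * hcrit p hp7
  · intro p hp
    have hp0 : p ≠ 0 := hp.1.ne'
    have h1 : HasDerivAt (fun p : ℝ => p ^ 2 / 4 + (1 + X) / 2 + (1 - X) ^ 2 / (4 * p ^ 2))
        (p / 2 - (1 - X) ^ 2 / (2 * p ^ 3)) p := by
      refine ((((hasDerivAt_id p).pow 2).div_const 4).add_const ((1 + X) / 2)).add
        ((hasDerivAt_const p ((1 - X) ^ 2)).div (((hasDerivAt_id p).pow 2).const_mul 4)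
          (by simpa using hp0)) |>.congr_deriv ?_
      simp only [id, Pi.pow_apply]
      field_simp
      ring
    exact h1.sub (dβ p (h60 p hp))
  · intro p hp
    have hp0 : p ≠ 0 := hp.1.ne'
    have h1 : HasDerivAt (fun p : ℝ => p / 2 - (1 - X) ^ 2 / (2 * p ^ 3))
        (1 / 2 + 3 * (1 - X) ^ 2 / (2 * p ^ 4)) p := by
      refine ((hasDerivAt_id p).div_const 2).sub
        ((hasDerivAt_const p ((1 - X) ^ 2)).div (((hasDerivAt_id p).pow 3).const_mul 2)
          (by simpa using hp0)) |>.congr_deriv ?_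
      simp only [id, Pi.pow_apply]
      field_simp
      ring
    exact h1.sub (dβ' p (h60 p hp))
  · intro p hp
    have hp0 : p ≠ 0 := hp.1.ne'
    field_simp
    ring
  · intro p hp
    have hp0 : p ≠ 0 := hp.1.ne'
    field_simp
  · intro p hp
    have h1 : 0 ≤ 3 * (1 - X) ^ 2 / (2 * p ^ 4) := by positivity
    have h2 := (abs_le.1 (bβ'' p (h60 p hp))).2
    linarith
  · intro p hp
    refine (hαlip _ (hmem p (h60 p hp)) 0 h0mem).trans (le_of_eq ?_)
    rw [sub_zero, abs_div, abs_of_pos hp.1]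
    ring
  · intro p hp
    exact bβ' p (h60 p hp)
  · exact (continuous_sliceIntegral (fun A hA => (hasDerivAt_reducedPhase ha
      (hAr A hA).1).continuousAt.continuousWithinAt) cg
      (fun A hA => (dw A hA).continuousAt.continuousWithinAt)).continuousOn
  · intro p hp
    rw [sliceIntegral, hQ p hp.1, hJ p (h60 p hp), hΛℓ, mul_mul_mul_comm, ← Complex.exp_add,
      ← mul_add, ← Complex.ofReal_add, ← mul_add]
  · intro p hp
    exact (dQ p hp.1).mul (dJ p (h60 p hp))
  · have cQ : ContinuousOn Q (Ioc 0 6) := fun p hp => (dQ p hp.1).continuousAt.continuousWithinAt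
    have cJ : ContinuousOn J (Ioc 0 6) := fun p hp =>
      (dJ p (h60 p hp)).continuousAt.continuousWithinAt
    exact ((cQ'.mono fun p hp => hp.1).mul cJ).add (cQ.mul (cJ'.mono h60))
  · intro p hp
    have hsp : 0 < √p := sqrt_pos.2 hp.1
    rw [norm_mul]
    refine (mul_le_mul (bQ p hp) (bJ2 p (h60 p hp)) (norm_nonneg _) (by positivity)).trans ?_
    rw [Real.sqrt_mul hΛ0.le, show 2000 * G / (√Λ * √p) * (112 * W / s)
      = 224000 * G * W / (√Λ * s) / √p by field_simp; ring]
    gcongr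
    linarith
  · intro p hp hp1
    rw [hΛℓ] at hp1
    have hsp : 0 < √p := sqrt_pos.2 hp.1
    have hp0 : 0 < p := hp.1
    have e1 := mul_le_mul (bQ' p hp hp1) (bJ2 p (h60 p hp)) (norm_nonneg _) (by positivity)
    have e2 := mul_le_mul (bQ p hp) (bJ2' p (h60 p hp)) (norm_nonneg _) (by positivity)
    have e3 : 400 * Kh * W / s / |n| ≤ 400 * Kh * W / s / p := by
      gcongr
      linarith [hp.2]
    have e4 := mul_le_mul_of_nonneg_left e3 (show 0 ≤ 2000 * G / √(Λ * p) by positivity)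
    refine (norm_add_le _ _).trans ?_
    rw [norm_mul, norm_mul]
    refine (add_le_add e1 (e2.trans e4)).trans (le_of_eq ?_)
    rw [Real.sqrt_mul hΛ0.le]
    field_simp
    ring

theorem norm_integral_le_two_ibp {φ φ' φ'' φ₃ : ℝ → ℝ} {w w' w'' : ℝ → ℂ} {x y m C W : ℝ}
    (hxy : x ≤ y) (hm : 0 < m) (hC : 0 ≤ C)
    (h1 : ∀ A ∈ Icc x y, HasDerivAt φ (φ' A) A) (h2 : ∀ A ∈ Icc x y, HasDerivAt φ' (φ'' A) A)
    (h3 : ∀ A ∈ Icc x y, HasDerivAt φ'' (φ₃ A) A) (h3c : ContinuousOn φ₃ (Icc x y))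
    (b1 : ∀ A ∈ Icc x y, m ≤ |φ' A|) (b2 : ∀ A ∈ Icc x y, |φ'' A| ≤ C * m)
    (b3 : ∀ A ∈ Icc x y, |φ₃ A| ≤ C * m)
    (dw : ∀ A ∈ Icc x y, HasDerivAt w (w' A) A) (dw' : ∀ A ∈ Icc x y, HasDerivAt w' (w'' A) A)
    (cw'' : ContinuousOn w'' (Icc x y)) (hwx : w x = 0) (hwy : w y = 0)
    (bw : ∀ A ∈ Icc x y, ‖w A‖ ≤ W) (bw' : ∀ A ∈ Icc x y, ‖w' A‖ ≤ W)
    (bw'' : ∀ A ∈ Icc x y, ‖w'' A‖ ≤ W) :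
    ‖∫ A in x..y, cexp (I * (φ A : ℂ)) * w A‖
      ≤ (2 * (1 + C) * W + 3 * (1 + C) ^ 2 * W * (y - x)) / m ^ 2 := by
  have hW : 0 ≤ W := (norm_nonneg _).trans (bw x ⟨le_rfl, hxy⟩)
  have hne : ∀ A ∈ Icc x y, φ' A ≠ 0 := fun A hA => abs_pos.1 (hm.trans_le (b1 A hA))
  set q : ℝ → ℝ := fun A => (φ' A)⁻¹ with hq
  set q' : ℝ → ℝ := fun A => -φ'' A / φ' A ^ 2 with hq'
  set q'' : ℝ → ℝ := fun A => -φ₃ A / φ' A ^ 2 + 2 * φ'' A ^ 2 / φ' A ^ 3 with hq''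
  have dq : ∀ A ∈ Icc x y, HasDerivAt q (q' A) A := fun A hA => (h2 A hA).inv (hne A hA)
  have dq' : ∀ A ∈ Icc x y, HasDerivAt q' (q'' A) A := fun A hA => by
    have := hne A hA
    refine ((h3 A hA).neg.div ((h2 A hA).pow 2) (by simpa using this)).congr_deriv ?_
    simp only [hq'', Pi.pow_apply, Pi.neg_apply]
    field_simp
    ring
  have c1 : ContinuousOn φ' (Icc x y) := fun A hA => (h2 A hA).continuousAt.continuousWithinAt
  have c2 : ContinuousOn φ'' (Icc x y) := fun A hA => (h3 A hA).continuousAt.continuousWithinAt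
  have cq : ContinuousOn q (Icc x y) := fun A hA => (dq A hA).continuousAt.continuousWithinAt
  have cq' : ContinuousOn q' (Icc x y) := fun A hA => (dq' A hA).continuousAt.continuousWithinAt
  have cq'' : ContinuousOn q'' (Icc x y) :=
    (h3c.neg.div (c1.pow 2) fun A hA => pow_ne_zero _ (hne A hA)).add
      ((continuousOn_const.mul (c2.pow 2)).div (c1.pow 3) fun A hA => pow_ne_zero _ (hne A hA))
  have cw : ContinuousOn w (Icc x y) := fun A hA => (dw A hA).continuousAt.continuousWithinAt
  have cw' : ContinuousOn w' (Icc x y) := fun A hA => (dw' A hA).continuousAt.continuousWithinAt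
  have ofc : ∀ {k : ℝ → ℝ}, ContinuousOn k (Icc x y) →
      ContinuousOn (fun A => ((k A : ℝ) : ℂ)) (Icc x y) := fun hk =>
    continuous_ofReal.comp_continuousOn hk
  have bq : ∀ A ∈ Icc x y, |q A| ≤ 1 / m := fun A hA => by
    rw [hq, abs_inv, one_div]
    exact inv_anti₀ hm (b1 A hA)
  have bq' : ∀ A ∈ Icc x y, |q' A| ≤ C / m := fun A hA => by
    rw [abs_div, abs_neg, abs_pow]
    calc |φ'' A| / |φ' A| ^ 2 ≤ C * m / m ^ 2 := by
          gcongr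
          exacts [b2 A hA, b1 A hA]
      _ = C / m := by field_simp
  have bq'' : ∀ A ∈ Icc x y, |q'' A| ≤ (C + 2 * C ^ 2) / m := fun A hA => by
    refine (abs_add_le _ _).trans ?_
    rw [abs_div, abs_neg, abs_pow, abs_div, abs_mul, abs_pow, abs_pow, abs_two]
    calc |φ₃ A| / |φ' A| ^ 2 + 2 * |φ'' A| ^ 2 / |φ' A| ^ 3
        ≤ C * m / m ^ 2 + 2 * (C * m) ^ 2 / m ^ 3 := by
          gcongr
          exacts [b3 A hA, b1 A hA, b2 A hA, b1 A hA]
      _ = (C + 2 * C ^ 2) / m := by field_simp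
  set E : ℝ → ℂ := fun A => cexp (I * (φ A : ℂ)) with hE
  have nE : ∀ A, ‖E A‖ = 1 := fun A => norm_exp_I_mul _
  have dE : ∀ A ∈ Icc x y, HasDerivAt E (E A * (I * (φ' A : ℂ))) A := fun A hA =>
    ((h1 A hA).ofReal_comp.const_mul I).cexp
  have cE : ContinuousOn E (Icc x y) := fun A hA => (dE A hA).continuousAt.continuousWithinAt
  set v : ℝ → ℂ := fun A => w' A * q A + w A * q' A with hv
  set v' : ℝ → ℂ := fun A => (w'' A * q A + w' A * q' A) + (w' A * q' A + w A * q'' A) with hv'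
  have dv : ∀ A ∈ Icc x y, HasDerivAt v (v' A) A := fun A hA =>
    ((dw' A hA).mul (dq A hA).ofReal_comp).add ((dw A hA).mul (dq' A hA).ofReal_comp)
  have cv : ContinuousOn v (Icc x y) := fun A hA => (dv A hA).continuousAt.continuousWithinAt
  have cv' : ContinuousOn v' (Icc x y) :=
    ((cw''.mul (ofc cq)).add (cw'.mul (ofc cq'))).add ((cw'.mul (ofc cq')).add (cw.mul (ofc cq'')))
  have bprod : ∀ (k : ℝ) (z : ℂ) (c : ℝ), |k| ≤ c / m → ‖z‖ ≤ W → ‖z * (k : ℂ)‖ ≤ W * c / m := by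
    intro k z c hk hz
    rw [norm_mul, norm_real, mul_div_assoc]
    exact mul_le_mul hz hk (abs_nonneg _) hW
  have bv : ∀ A ∈ Icc x y, ‖v A‖ ≤ W * (1 + C) / m := fun A hA => by
    refine (norm_add_le _ _).trans ((add_le_add (bprod _ _ _ (bq A hA) (bw' A hA))
      (bprod _ _ _ (bq' A hA) (bw A hA))).trans (le_of_eq (by ring)))
  have bv' : ∀ A ∈ Icc x y, ‖v' A‖ ≤ W * (2 * (1 + C) ^ 2) / m := fun A hA => by
    have e1 := bprod _ _ _ (bq A hA) (bw'' A hA)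
    have e2 := bprod _ _ _ (bq' A hA) (bw' A hA)
    have e3 := bprod _ _ _ (bq'' A hA) (bw A hA)
    refine (norm_add_le _ _).trans ((add_le_add ((norm_add_le _ _).trans (add_le_add e1 e2))
      ((norm_add_le _ _).trans (add_le_add e2 e3))).trans ?_)
    rw [← add_div, ← add_div, ← add_div]
    gcongr
    nlinarith [mul_nonneg hW hC]
  have step1 : ∫ A in x..y, E A * w A = ∫ A in x..y, I * (E A * v A) := by
    have i1 : IntervalIntegrable (fun A => E A * w A) volume x y :=
      (cE.mul cw).intervalIntegrable_of_Icc hxy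
    have i2 : IntervalIntegrable (fun A => I * (E A * v A)) volume x y :=
      (continuousOn_const.mul (cE.mul cv)).intervalIntegrable_of_Icc hxy
    rw [← sub_eq_zero, ← intervalIntegral.integral_sub i1 i2]
    have := integral_eq_sub_of_hasDerivAt (a := x) (b := y)
      (f := fun A => -I * (E A * (w A * (q A : ℂ))))
      (f' := fun A => E A * w A - I * (E A * v A)) ?_ (i1.sub i2)
    · rw [this, hwx, hwy]; simp
    · intro A hA
      rw [uIcc_of_le hxy] at hA
      refine (((dE A hA).mul ((dw A hA).mul (dq A hA).ofReal_comp)).const_mul (-I)).congr_deriv ?_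
      have hqc : (φ' A : ℂ) * (q A : ℂ) = 1 := by
        rw [← Complex.ofReal_mul, hq, mul_inv_cancel₀ (hne A hA), Complex.ofReal_one]
      simp only [hv, Pi.mul_apply]
      linear_combination (E A * w A) * hqc - (E A * w A * φ' A * q A) * Complex.I_sq
  set u' : ℝ → ℂ := fun A => v' A * (q A : ℂ) + v A * (q' A : ℂ) with hu'
  have cu' : ContinuousOn u' (Icc x y) := (cv'.mul (ofc cq)).add (cv.mul (ofc cq'))
  have step2 : ∫ A in x..y, E A * v A = (-I * (E y * (v y * (q y : ℂ)))
      - -I * (E x * (v x * (q x : ℂ)))) + ∫ A in x..y, I * (E A * u' A) := by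
    have i1 : IntervalIntegrable (fun A => E A * v A) volume x y :=
      (cE.mul cv).intervalIntegrable_of_Icc hxy
    have i2 : IntervalIntegrable (fun A => I * (E A * u' A)) volume x y :=
      (continuousOn_const.mul (cE.mul cu')).intervalIntegrable_of_Icc hxy
    rw [← sub_eq_iff_eq_add, ← intervalIntegral.integral_sub i1 i2]
    refine integral_eq_sub_of_hasDerivAt (a := x) (b := y)
      (f := fun A => -I * (E A * (v A * (q A : ℂ))))
      (f' := fun A => E A * v A - I * (E A * u' A)) ?_ (i1.sub i2)
    intro A hA
    rw [uIcc_of_le hxy] at hA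
    refine (((dE A hA).mul ((dv A hA).mul (dq A hA).ofReal_comp)).const_mul (-I)).congr_deriv ?_
    have hqc : (φ' A : ℂ) * (q A : ℂ) = 1 := by
      rw [← Complex.ofReal_mul, hq, mul_inv_cancel₀ (hne A hA), Complex.ofReal_one]
    simp only [hu', Pi.mul_apply]
    linear_combination (E A * v A) * hqc - (E A * v A * φ' A * q A) * Complex.I_sq
  have bvq : ∀ A ∈ Icc x y, ‖v A * (q A : ℂ)‖ ≤ W * (1 + C) / m * (1 / m) := fun A hA => by
    rw [norm_mul, norm_real]
    exact mul_le_mul (bv A hA) (bq A hA) (abs_nonneg _) (by positivity)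
  have bu' : ∀ A ∈ Icc x y, ‖I * (E A * u' A)‖ ≤ 3 * (1 + C) ^ 2 * W / m ^ 2 := fun A hA => by
    rw [norm_mul, norm_mul, nE, norm_I, one_mul, one_mul]
    refine (norm_add_le _ _).trans ?_
    rw [norm_mul, norm_mul, norm_real, norm_real]
    have e1 := mul_le_mul (bv' A hA) (bq A hA) (abs_nonneg _) (by positivity)
    have e2 := mul_le_mul (bv A hA) (bq' A hA) (abs_nonneg _) (by positivity)
    refine (add_le_add e1 e2).trans ?_
    rw [show W * (2 * (1 + C) ^ 2) / m * (1 / m) + W * (1 + C) / m * (C / m)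
      = (W * (2 * (1 + C) ^ 2) + W * (1 + C) * C) / m ^ 2 by field_simp]
    gcongr
    nlinarith [mul_nonneg hW hC]
  have last := intervalIntegral.norm_integral_le_of_norm_le_const (a := x) (b := y)
    (f := fun A => I * (E A * u' A)) (C := 3 * (1 + C) ^ 2 * W / m ^ 2) fun A hA =>
      bu' A (Ioc_subset_Icc_self (by rwa [uIoc_of_le hxy] at hA))
  rw [abs_of_nonneg (sub_nonneg.2 hxy)] at last
  rw [step1, intervalIntegral.integral_const_mul, norm_mul, norm_I, one_mul, step2]
  have ey := bvq y ⟨hxy, le_rfl⟩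
  have ex := bvq x ⟨le_rfl, hxy⟩
  refine (norm_add_le _ _).trans ((add_le_add ((norm_sub_le _ _).trans (add_le_add
    (b := W * (1 + C) / m * (1 / m)) (d := W * (1 + C) / m * (1 / m)) ?_ ?_)) last).trans
    (le_of_eq (by field_simp; ring)))
  · rw [norm_mul, norm_mul, nE, norm_neg, norm_I, one_mul, one_mul]; exact ey
  · rw [norm_mul, norm_mul, nE, norm_neg, norm_I, one_mul, one_mul]; exact ex

theorem abs_reducedPhase₁_ge {a τ A : ℝ} (ha : 0 < a) (ha' : a ≤ 1 / 200)
    (hτ : τ < 23 / 25 ∨ 51 / 20 < τ) (hA : 89 / 100 ≤ A) (hA' : A ≤ 61 / 10) :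
    15 / 1000 * (1 + |τ|) ≤ |reducedPhase₁ a τ A| := by
  obtain ⟨h1, h2, -, -⟩ := sqrt_one_add_div_bounds (A := A) ha ha' (by linarith) (by linarith)
  have h3 : 98 / 100 ≤ √(1 + a) / √(1 + a * A) := by
    have hpos : 0 < √(1 + a * A) := sqrt_pos.2 (by nlinarith)
    rw [le_div_iff₀ hpos]
    refine Real.le_sqrt_of_sq_le ?_
    rw [mul_pow, sq_sqrt (by nlinarith)]
    nlinarith
  have hs1 : 943 / 1000 ≤ √A := Real.le_sqrt_of_sq_le (by linarith)
  have hs2 : √A ≤ 247 / 100 := by rw [Real.sqrt_le_left (by norm_num)]; linarith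
  rw [reducedPhase₁, mul_div_assoc]
  set κ := √(1 + a) / √(1 + a * A)
  rcases hτ with h | h
  · refine le_trans ?_ (neg_le_abs _)
    rcases le_total 0 τ with h0 | h0
    · rw [abs_of_nonneg h0]; nlinarith
    · rw [abs_of_nonpos h0]; nlinarith
  · refine le_trans ?_ (le_abs_self _)
    rw [abs_of_nonneg (by linarith)]; nlinarith

theorem norm_saddle_integral_le_of_nonresonant {a τ n Λ p W : ℝ} {w : ℝ → ℂ} (ha : 0 < a)
    (ha' : a ≤ 1 / 200) (hτ : τ < 23 / 25 ∨ 51 / 20 < τ) (hn : 1000 ≤ |n|) (hΛ : 0 < Λ)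
    (hp : |p| ≤ 6) (hw : IsSaddleAmplitude W (89 / 100) (61 / 10) w) :
    ‖∫ A in (89 / 100 : ℝ)..(61 / 10), cexp (I * ((Λ * (n * reducedPhase a τ A - p * A) : ℝ) : ℂ))
      * w A‖ ≤ 10 ^ 11 * W / (Λ * |n| * (1 + |τ|)) ^ 2 := by
  obtain ⟨w', w'', dw, dw', cw'', hwx, hwy, bw, bw', bw''⟩ := hw
  have hW : 0 ≤ W := (norm_nonneg _).trans (bw (89 / 100) ⟨le_rfl, by norm_num⟩)
  have hpos : ∀ A ∈ Icc (89 / 100 : ℝ) (61 / 10), 0 < A := fun A hA => by linarith [hA.1]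
  have hτ1 : 1 ≤ 1 + |τ| := by linarith [abs_nonneg τ]
  have hna : 0 < |n| := by linarith
  refine (norm_integral_le_two_ibp (φ := fun A => Λ * (n * reducedPhase a τ A - p * A))
    (φ' := fun A => Λ * (n * reducedPhase₁ a τ A - p)) (φ'' := fun A => Λ * (n * reducedPhase₂ a τ A))
    (φ₃ := fun A => Λ * (n * reducedPhase₃ a τ A)) (m := Λ * |n| * (1 + |τ|) * (3 / 400)) (C := 267)
    (by norm_num) (by positivity) (by norm_num) ?_ ?_ ?_ ?_ ?_ ?_ ?_ dw dw' cw'' hwx hwy bw bw'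
    bw'').trans ?_
  · intro A hA
    exact ((((hasDerivAt_reducedPhase ha (hpos A hA)).const_mul n).sub
      ((hasDerivAt_id A).const_mul p)).const_mul Λ).congr_deriv (by ring)
  · intro A hA
    exact (((hasDerivAt_reducedPhase₁ ha (hpos A hA)).const_mul n).sub_const p).const_mul Λ
  · intro A hA
    exact ((hasDerivAt_reducedPhase₂ ha (hpos A hA)).const_mul n).const_mul Λ
  · exact continuousOn_const.mul (continuousOn_const.mul ((continuousOn_reducedPhase₃ ha).mono hpos))
  · intro A hA
    have h1 := abs_reducedPhase₁_ge (τ := τ) ha ha' hτ hA.1 hA.2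
    have h2 := mul_le_mul_of_nonneg_left h1 hna.le
    have h3 : |n| * |reducedPhase₁ a τ A| ≤ |n * reducedPhase₁ a τ A - p| + |p| := by
      rw [← abs_mul]
      calc |n * reducedPhase₁ a τ A| = |(n * reducedPhase₁ a τ A - p) + p| := by ring_nf
        _ ≤ _ := abs_add_le _ _
    have h4 : |n| * 1 ≤ |n| * (1 + |τ|) := by gcongr
    rw [abs_mul, abs_of_pos hΛ, mul_assoc, mul_assoc]
    gcongr
    linarith
  · intro A hA
    have h1 := abs_reducedPhase₂_le (A := A) (τ := τ) ha ha' (by linarith [hA.1]) (by linarith [hA.2])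
    rw [abs_mul, abs_mul, abs_of_pos hΛ]
    calc Λ * (|n| * |reducedPhase₂ a τ A|) ≤ Λ * (|n| * (2 * (1 + |τ|))) := by gcongr
      _ = 2 * (Λ * |n| * (1 + |τ|)) := by ring
      _ ≤ 267 * (Λ * |n| * (1 + |τ|) * (3 / 400)) := by
        have : 0 ≤ Λ * |n| * (1 + |τ|) := by positivity
        linarith
  · intro A hA
    have h1 := abs_reducedPhase₃_le (A := A) (τ := τ) ha ha' (by linarith [hA.1]) (by linarith [hA.2])
    have h2 : |reducedPhase₃ a τ A| ≤ 2 * (1 + |τ|) := by linarith [abs_nonneg τ]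
    rw [abs_mul, abs_mul, abs_of_pos hΛ]
    calc Λ * (|n| * |reducedPhase₃ a τ A|) ≤ Λ * (|n| * (2 * (1 + |τ|))) := by gcongr
      _ = 2 * (Λ * |n| * (1 + |τ|)) := by ring
      _ ≤ 267 * (Λ * |n| * (1 + |τ|) * (3 / 400)) := by
        have : 0 ≤ Λ * |n| * (1 + |τ|) := by positivity
        linarith
  · have h0 : 0 < Λ * |n| * (1 + |τ|) := by positivity
    rw [mul_pow, div_le_div_iff₀ (by positivity) (by positivity)]
    have : 0 ≤ W * (Λ * |n| * (1 + |τ|)) ^ 2 := by positivity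
    linarith

theorem exists_half_line_weighted_bound : ∃ K₀ : ℝ, 0 < K₀ ∧
    ∀ {a τ n Λ ℓ X G W : ℝ} {g : ℝ → ℝ → ℝ} {w : ℝ → ℂ}, 0 < a → a ≤ 1 / 200 → 1000 ≤ |n| →
      2 ≤ ℓ → ℓ ^ 6 = Λ → ℓ ^ 2 / 2 ≤ |n| → IsFresnelAmplitude G g →
      IsSaddleAmplitude W (89 / 100) (61 / 10) w →
      ‖∫ p in (0:ℝ)..6, sliceIntegral (reducedPhase a τ) n Λ X g w p‖ * (Λ * √|n| * ℓ)
        ≤ K₀ * G * W ∧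
      ∀ d, 0 ≤ d → d ^ 4 = |τ - 1| →
        ‖∫ p in (0:ℝ)..6, sliceIntegral (reducedPhase a τ) n Λ X g w p‖ * (Λ * √|n| * ℓ ^ 2 * d)
          ≤ K₀ * G * W := by
  obtain ⟨K₀, hK₀, hK⟩ := exists_half_line_bound
  refine ⟨1036 * K₀ + 72 * 10 ^ 11, by positivity, ?_⟩
  intro a τ n Λ ℓ X G W g w ha ha' hn hℓ hΛℓ hℓn hg hw
  have hG : 0 ≤ G := by
    obtain ⟨gp, gu, gpu, guu, -, -, -, -, -, -, -, -, -, bg, -⟩ := hg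
    exact (abs_nonneg _).trans (bg 0 0)
  have hW : 0 ≤ W := by
    obtain ⟨w', w'', -, -, -, -, -, bw, -⟩ := hw
    exact (norm_nonneg _).trans (bw (89 / 100) ⟨le_rfl, by norm_num⟩)
  have hna : 0 < |n| := by linarith
  have hΛ0 : 0 < Λ := hΛℓ ▸ by positivity
  have hGW : 0 ≤ G * W := mul_nonneg hG hW
  set R := ‖∫ p in (0:ℝ)..6, sliceIntegral (reducedPhase a τ) n Λ X g w p‖ with hR
  by_cases hτ : 23 / 25 ≤ τ ∧ τ ≤ 51 / 20
  · obtain ⟨d', hd', hτd, h1, h2⟩ := hK (X := X) ha ha' hτ.1 hτ.2 (by linarith) hℓ hΛℓ hℓn hg hw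
    have hs : √Λ * √(Λ * |n|) = Λ * √|n| := by
      rw [Real.sqrt_mul hΛ0.le, ← mul_assoc, Real.mul_self_sqrt hΛ0.le]
    have hsn : 0 < √|n| := sqrt_pos.2 hna
    rw [hs] at h1 h2
    have hsl : 0 < Λ * √|n| := by positivity
    have e1 : R * (Λ * √|n| * ℓ) ≤ 74 * (K₀ * G * W) := by
      rw [le_div_iff₀ (by linarith)] at h1
      calc R * (Λ * √|n| * ℓ) = R * ℓ * (Λ * √|n|) := by ring
        _ ≤ 74 * (K₀ * G * W / (Λ * √|n|)) * (Λ * √|n|) := by gcongr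
        _ = 74 * (K₀ * G * W) := by field_simp
    have e2 : R * d' * (Λ * √|n| * ℓ ^ 2) ≤ 518 * (K₀ * G * W) := by
      rw [le_div_iff₀ (by positivity)] at h2
      calc R * d' * (Λ * √|n| * ℓ ^ 2) = R * d' * ℓ ^ 2 * (Λ * √|n|) := by ring
        _ ≤ 518 * (K₀ * G * W / (Λ * √|n|)) * (Λ * √|n|) := by gcongr
        _ = 518 * (K₀ * G * W) := by field_simp
    have hKGW : 0 ≤ K₀ * (G * W) := by positivity
    refine ⟨by linarith, fun d hd hd4 => ?_⟩
    have hdd : d ≤ 2 * d' := by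
      refine le_of_pow_le_pow_left₀ (n := 4) (by norm_num) (by positivity) ?_
      rw [hd4, mul_pow]
      have : 0 ≤ d' ^ 4 := by positivity
      linarith
    have : R * (Λ * √|n| * ℓ ^ 2 * d) ≤ 2 * (R * d' * (Λ * √|n| * ℓ ^ 2)) := by
      calc R * (Λ * √|n| * ℓ ^ 2 * d) ≤ R * (Λ * √|n| * ℓ ^ 2 * (2 * d')) := by
            have : 0 ≤ R := norm_nonneg _
            gcongr
        _ = _ := by ring
    linarith
  · have hτ' : τ < 23 / 25 ∨ 51 / 20 < τ := by
      rcases lt_or_ge τ (23 / 25) with h | h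
      · exact Or.inl h
      · exact Or.inr (not_le.1 fun h' => hτ ⟨h, h'⟩)
    have hb : R ≤ 36 * 10 ^ 11 * (G * W) / (Λ * |n| * (1 + |τ|)) ^ 2 := by
      have := intervalIntegral.norm_integral_le_of_norm_le_const (a := 0) (b := 6)
        (f := sliceIntegral (reducedPhase a τ) n Λ X g w)
        (C := G * 6 * (10 ^ 11 * W / (Λ * |n| * (1 + |τ|)) ^ 2)) ?_
      · refine this.trans (le_of_eq ?_)
        rw [sub_zero, abs_of_pos (by norm_num : (0:ℝ) < 6)]
        ring
      · intro p hp
        rw [uIoc_of_le (by norm_num)] at hp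
        rw [sliceIntegral, norm_mul]
        refine mul_le_mul ?_ (norm_saddle_integral_le_of_nonresonant ha ha' hτ' hn hΛ0
          (by rw [abs_of_pos hp.1]; exact hp.2) hw) (norm_nonneg _) (by positivity)
        obtain ⟨gp, gu, gpu, guu, -, -, -, -, -, -, -, -, -, bg, -⟩ := hg
        refine (intervalIntegral.norm_integral_le_of_norm_le_const (C := G) ?_).trans
          (le_of_eq (by norm_num))
        intro y _
        rw [norm_mul, norm_exp_I_mul, one_mul, norm_real]
        exact bg p y
    have hτ1 : 1 ≤ 1 + |τ| := by linarith [abs_nonneg τ]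
    have hsn : √|n| ≤ |n| := by
      rw [Real.sqrt_le_left hna.le]; nlinarith
    have hℓ2 : ℓ ^ 2 ≤ Λ := by
      rw [← hΛℓ]
      exact pow_le_pow_right₀ (by linarith) (by norm_num)
    have hℓ1 : ℓ ≤ Λ := by nlinarith
    have key : ∀ e, 0 ≤ e → e ≤ 2 * (Λ * |n| * (1 + |τ|)) ^ 2 →
        R * e ≤ (1036 * K₀ + 72 * 10 ^ 11) * G * W := by
      intro e he he'
      calc R * e ≤ 36 * 10 ^ 11 * (G * W) / (Λ * |n| * (1 + |τ|)) ^ 2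
            * (2 * (Λ * |n| * (1 + |τ|)) ^ 2) := by gcongr
        _ = 72 * 10 ^ 11 * (G * W) := by field_simp; ring
        _ ≤ _ := by
          have : 0 ≤ K₀ * (G * W) := by positivity
          linarith
    have hΛn1 : Λ * √|n| ≤ Λ * |n| := by gcongr
    have h1n : (1:ℝ) ≤ |n| := by linarith
    have base : ∀ e, 0 ≤ e → e ≤ Λ * (2 * (1 + |τ|)) →
        Λ * √|n| * e ≤ 2 * (Λ * |n| * (1 + |τ|)) ^ 2 := by
      intro e he he'
      calc Λ * √|n| * e ≤ Λ * |n| * (Λ * (2 * (1 + |τ|))) := by gcongr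
        _ = 2 * (Λ * |n| * (1 + |τ|)) * (Λ * 1 * 1) := by ring
        _ ≤ 2 * (Λ * |n| * (1 + |τ|)) * (Λ * |n| * (1 + |τ|)) := by gcongr
        _ = _ := by ring
    refine ⟨key _ (by positivity) (base _ (by positivity) ?_), fun d hd hd4 => ?_⟩
    · nlinarith
    · rw [mul_assoc]
      refine key _ (by positivity) (base _ (by positivity) ?_)
      have hd1 : d ≤ 2 * (1 + |τ|) := by
        have : |τ - 1| ≤ |τ| + 1 := (abs_sub _ _).trans (by simp)
        have h4 : d ≤ 1 + d ^ 4 := by nlinarith [sq_nonneg (d ^ 2 - 1), sq_nonneg (d - 1), sq_nonneg (d ^ 2 - d)]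
        linarith
      gcongr

theorem IsFresnelAmplitude.neg {G : ℝ} {g : ℝ → ℝ → ℝ} (hg : IsFresnelAmplitude G g) :
    IsFresnelAmplitude G fun p y => g (-p) (-y) := by
  obtain ⟨gp, gu, gpu, guu, cg, cgp, cgu, cgpu, cguu, dp, du, dpu, duu, bg, bgp, bgu, bgpu, bguu,
    hm, hM⟩ := hg
  have hc : ∀ {f : ℝ → ℝ → ℝ}, Continuous (uncurry f) →
      Continuous (uncurry fun p y => f (-p) (-y)) := fun hf =>
    hf.comp (continuous_fst.neg.prodMk continuous_snd.neg)
  have hd : ∀ {f : ℝ → ℝ} {f' t : ℝ}, HasDerivAt f f' (-t) → HasDerivAt (fun s => f (-s)) (-f') t :=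
    fun {f f' t} h => (h.comp t (hasDerivAt_neg t)).congr_deriv (by ring)
  refine ⟨fun p y => -gp (-p) (-y), fun p y => -gu (-p) (-y), fun p y => gpu (-p) (-y),
    fun p y => guu (-p) (-y), hc cg, (hc cgp).neg, (hc cgu).neg, hc cgpu, hc cguu,
    fun p y => hd (f := fun p => g p (-y)) (dp _ _), fun p y => hd (f := g (-p)) (du _ _),
    fun p y => (hd (f := gp (-p)) (dpu _ _)).neg.congr_deriv (neg_neg _),
    fun p y => (hd (f := gu (-p)) (duu _ _)).neg.congr_deriv (neg_neg _), fun p y => bg _ _,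
    fun p y => ?_, fun p y => ?_, fun p y => bgpu _ _, fun p y => bguu _ _, fun p => ?_, fun p => ?_⟩
  · rw [abs_neg]; exact bgp _ _
  · rw [abs_neg]; exact bgu _ _
  · simpa using hM (-p)
  · exact hm _

theorem IsSaddleAmplitude.conj {W x y : ℝ} {w : ℝ → ℂ} (hw : IsSaddleAmplitude W x y w) :
    IsSaddleAmplitude W x y fun A => star (w A) := by
  obtain ⟨w', w'', dw, dw', cw'', hwx, hwy, bw, bw', bw''⟩ := hw
  exact ⟨fun A => star (w' A), fun A => star (w'' A), fun A hA => (dw A hA).star,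
    fun A hA => (dw' A hA).star, continuous_star.comp_continuousOn cw'', by simp [hwx], by simp [hwy],
    fun A hA => by rw [norm_star]; exact bw A hA, fun A hA => by rw [norm_star]; exact bw' A hA,
    fun A hA => by rw [norm_star]; exact bw'' A hA⟩

theorem star_exp_I_mul (x : ℝ) : star (cexp (I * (x : ℂ))) = cexp (I * ((-x : ℝ) : ℂ)) := by
  rw [Complex.star_def, ← Complex.exp_conj]
  simp

theorem star_intervalIntegral (f : ℝ → ℂ) (x y : ℝ) :
    star (∫ t in x..y, f t) = ∫ t in x..y, star (f t) := by
  simp only [Complex.star_def]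
  exact (intervalIntegral.intervalIntegral_conj (f := f) (a := x) (b := y)).symm

theorem sliceIntegral_neg {ϑ : ℝ → ℝ} {n Λ X : ℝ} {g : ℝ → ℝ → ℝ} {w : ℝ → ℂ} (p : ℝ) :
    sliceIntegral ϑ n Λ X g w (-p)
      = star (sliceIntegral ϑ (-n) Λ X (fun p y => g (-p) (-y)) (fun A => star (w A)) p) := by
  rw [sliceIntegral, sliceIntegral, star_mul', star_intervalIntegral, star_intervalIntegral]
  congr 1
  · have := intervalIntegral.integral_comp_neg (a := -3) (b := 3) (fun y : ℝ =>
      cexp (I * ((Λ * (y ^ 3 / 3 + y * X + (-p - y) ^ 3 / 3 + (-p - y)) : ℝ) : ℂ))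
        * (g (-p) y : ℂ))
    rw [neg_neg] at this
    rw [← this]
    refine integral_congr fun y _ => ?_
    simp only [star_mul', star_exp_I_mul]
    congr 3
    · congr 2; ring
    · simp
  · refine integral_congr fun A _ => ?_
    simp only [star_mul', star_exp_I_mul, star_star]
    congr 4
    ring

theorem exists_line_bound : ∃ K₀ : ℝ, 0 < K₀ ∧
    ∀ {a τ n Λ ℓ X G W : ℝ} {g : ℝ → ℝ → ℝ} {w : ℝ → ℂ}, 0 < a → a ≤ 1 / 200 → 1000 ≤ |n| →
      2 ≤ ℓ → ℓ ^ 6 = Λ → ℓ ^ 2 / 2 ≤ |n| → IsFresnelAmplitude G g →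
      IsSaddleAmplitude W (89 / 100) (61 / 10) w →
      ‖∫ p in (-6:ℝ)..6, sliceIntegral (reducedPhase a τ) n Λ X g w p‖ * (Λ * √|n| * ℓ)
        ≤ K₀ * G * W ∧
      ∀ d, 0 ≤ d → d ^ 4 = |τ - 1| →
        ‖∫ p in (-6:ℝ)..6, sliceIntegral (reducedPhase a τ) n Λ X g w p‖ * (Λ * √|n| * ℓ ^ 2 * d)
          ≤ K₀ * G * W := by
  obtain ⟨K₀, hK₀, hK⟩ := exists_half_line_weighted_bound
  refine ⟨2 * K₀, by positivity, ?_⟩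
  intro a τ n Λ ℓ X G W g w ha ha' hn hℓ hΛℓ hℓn hg hw
  have hc : Continuous (sliceIntegral (reducedPhase a τ) n Λ X g w) := by
    refine continuous_sliceIntegral ?_ ?_ ?_
    · exact fun A hA => (hasDerivAt_reducedPhase ha
        (by linarith [hA.1] : 0 < A)).continuousAt.continuousWithinAt
    · obtain ⟨gp, gu, gpu, guu, cg, -⟩ := hg
      exact cg
    · obtain ⟨w', w'', dw, -⟩ := hw
      exact fun A hA => (dw A hA).continuousAt.continuousWithinAt
  set R₁ := ‖∫ p in (0:ℝ)..6, sliceIntegral (reducedPhase a τ) n Λ X g w p‖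
  set R₂ := ‖∫ p in (0:ℝ)..6, sliceIntegral (reducedPhase a τ) (-n) Λ X (fun p y => g (-p) (-y))
    (fun A => star (w A)) p‖ with hR₂
  have hneg : ‖∫ p in (-6:ℝ)..0, sliceIntegral (reducedPhase a τ) n Λ X g w p‖ = R₂ := by
    have := intervalIntegral.integral_comp_neg (a := 0) (b := 6)
      (sliceIntegral (reducedPhase a τ) n Λ X g w)
    rw [neg_zero] at this
    rw [← this, hR₂, ← norm_star (∫ p in (0:ℝ)..6, sliceIntegral (reducedPhase a τ) (-n) _ _ _ _ p),
      star_intervalIntegral]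
    simp only [sliceIntegral_neg]
  have hle : ‖∫ p in (-6:ℝ)..6, sliceIntegral (reducedPhase a τ) n Λ X g w p‖ ≤ R₂ + R₁ := by
    rw [← integral_add_adjacent_intervals (hc.intervalIntegrable (-6) 0)
      (hc.intervalIntegrable 0 6), ← hneg]
    exact norm_add_le _ _
  have h1 := hK (τ := τ) (X := X) ha ha' hn hℓ hΛℓ hℓn hg hw
  have h2 := hK (τ := τ) (n := -n) (X := X) ha ha' (by rwa [abs_neg]) hℓ hΛℓ (by rwa [abs_neg])
    hg.neg hw.conj
  rw [abs_neg] at h2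
  have hΛ0 : 0 < Λ := hΛℓ ▸ by positivity
  have comb : ∀ e, 0 ≤ e → R₁ * e ≤ K₀ * G * W → R₂ * e ≤ K₀ * G * W →
      ‖∫ p in (-6:ℝ)..6, sliceIntegral (reducedPhase a τ) n Λ X g w p‖ * e ≤ 2 * K₀ * G * W := by
    intro e he e1 e2
    have := mul_le_mul_of_nonneg_right hle he
    linarith
  refine ⟨comb _ (by positivity) h1.1 h2.1, fun d hd hd4 => comb _ (by positivity)
    (h1.2 d hd hd4) (h2.2 d hd hd4)⟩

theorem intervalIntegral_swap_of_continuousOn {f : ℝ → ℝ → ℂ} {a b c d : ℝ} (hab : a ≤ b)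
    (hcd : c ≤ d) (hf : ContinuousOn (uncurry f) (Icc a b ×ˢ Icc c d)) :
    ∫ x in a..b, ∫ y in c..d, f x y = ∫ y in c..d, ∫ x in a..b, f x y := by
  simp only [intervalIntegral.integral_of_le hab, intervalIntegral.integral_of_le hcd]
  refine integral_integral_swap ?_
  rw [Measure.prod_restrict]
  exact (hf.integrableOn_compact (isCompact_Icc.prod isCompact_Icc)).mono_set
    (prod_mono Ioc_subset_Icc_self Ioc_subset_Icc_self)

theorem eq_zero_of_three_le {χ₂ : ℝ × ℝ → ℝ}
    (hχ₂s : tsupport χ₂ ⊆ {p : ℝ × ℝ | |p.1| < 3 ∧ |p.2| < 3}) {x y : ℝ}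
    (h : 3 ≤ |x| ∨ 3 ≤ |y|) : χ₂ (x, y) = 0 := by
  refine image_eq_zero_of_notMem_tsupport fun hmem => ?_
  have := hχ₂s hmem
  rcases h with h | h
  · exact absurd this.1 (not_lt.2 h)
  · exact absurd this.2 (not_lt.2 h)

theorem exists_isFresnelAmplitude {χ₂ : ℝ × ℝ → ℝ} (hχ₂ : ContDiff ℝ ∞ χ₂)
    (hχ₂c : HasCompactSupport χ₂) (hχ₂s : tsupport χ₂ ⊆ {p : ℝ × ℝ | |p.1| < 3 ∧ |p.2| < 3}) :
    ∃ G, 0 < G ∧ IsFresnelAmplitude G fun p y => χ₂ (p - y, y) := by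
  have hc : ∀ {f : ℝ × ℝ → ℝ}, ContDiff ℝ ∞ f →
      Continuous (uncurry fun p y => f (p - y, y)) := fun hf =>
    hf.continuous.comp ((continuous_fst.sub continuous_snd).prodMk continuous_snd)
  have hl : ∀ {f : ℝ × ℝ → ℝ}, ContDiff ℝ ∞ f → ∀ p y,
      HasDerivAt (fun p => f (p - y, y)) (dirDeriv (1, 0) f (p - y, y)) p := fun hf p y =>
    hf.contDiffAt.hasDerivAt_comp_line (c := fun p => (p - y, y))
      (((hasDerivAt_id p).sub_const y).prodMk (hasDerivAt_const p y))
  have hr : ∀ {f : ℝ × ℝ → ℝ}, ContDiff ℝ ∞ f → ∀ p y,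
      HasDerivAt (fun y => f (p - y, y)) (dirDeriv (-1, 1) f (p - y, y)) y := fun hf p y =>
    hf.contDiffAt.hasDerivAt_comp_line (c := fun y => (p - y, y))
      (((hasDerivAt_id y).const_sub p).prodMk (hasDerivAt_id y))
  set fp := dirDeriv (1, 0) χ₂
  set fu := dirDeriv (-1, 1) χ₂
  have cp : ContDiff ℝ ∞ fp := hχ₂.dirDeriv _
  have cu : ContDiff ℝ ∞ fu := hχ₂.dirDeriv _
  have sp : HasCompactSupport fp := hχ₂c.dirDeriv _
  have su : HasCompactSupport fu := hχ₂c.dirDeriv _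
  obtain ⟨G₀, h₀, b₀⟩ := hχ₂c.exists_abs_bound hχ₂.continuous
  obtain ⟨G₁, h₁, b₁⟩ := sp.exists_abs_bound cp.continuous
  obtain ⟨G₂, h₂, b₂⟩ := su.exists_abs_bound cu.continuous
  obtain ⟨G₃, h₃, b₃⟩ := (sp.dirDeriv (-1, 1)).exists_abs_bound (cp.dirDeriv (-1, 1)).continuous
  obtain ⟨G₄, h₄, b₄⟩ := (su.dirDeriv (-1, 1)).exists_abs_bound (cu.dirDeriv (-1, 1)).continuous
  refine ⟨G₀ + G₁ + G₂ + G₃ + G₄, by positivity, fun p y => fp (p - y, y),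
    fun p y => fu (p - y, y), fun p y => dirDeriv (-1, 1) fp (p - y, y),
    fun p y => dirDeriv (-1, 1) fu (p - y, y), hc hχ₂, hc cp, hc cu, hc (cp.dirDeriv _),
    hc (cu.dirDeriv _), hl hχ₂, hr hχ₂, hr cp, hr cu, fun p y => ?_, fun p y => ?_, fun p y => ?_,
    fun p y => ?_, fun p y => ?_, fun p => ?_, fun p => ?_⟩
  · linarith [b₀ (p - y, y)]
  · linarith [b₁ (p - y, y)]
  · linarith [b₂ (p - y, y)]
  · linarith [b₃ (p - y, y)]
  · linarith [b₄ (p - y, y)]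
  · exact eq_zero_of_three_le hχ₂s (Or.inr (by norm_num))
  · exact eq_zero_of_three_le hχ₂s (Or.inr (by norm_num))

theorem exists_isSaddleAmplitude {L B₁ B₂ : ℝ → ℝ} {C : ℝ} (hC : 0 ≤ C)
    (hB1 : ∀ u, 0 < u → HasDerivAt (Bfun L) (B₁ u) u)
    (hB2 : ∀ u, 0 < u → HasDerivAt B₁ (B₂ u) u) (hB2c : ContinuousOn B₂ (Ioi 0))
    (hBb : ∀ u, 1 ≤ u → |B₁ u| ≤ C / u ^ 2 ∧ |B₂ u| ≤ C / u ^ 3) {ψ₃ : ℝ → ℝ}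
    (hψ₃ : ContDiff ℝ ∞ ψ₃) (hψ₃s : tsupport ψ₃ ⊆ Icc (9 / 10 : ℝ) 6) :
    ∃ W, 0 < W ∧ ∀ n Λ : ℝ, 2 ≤ Λ → |n| ≤ 2 * Λ → IsSaddleAmplitude W (89 / 100) (61 / 10)
      fun A => cexp (I * ((n * Bfun L (Λ * A ^ ((3 : ℝ) / 2)) : ℝ) : ℂ)) * (ψ₃ A : ℂ) := by
  obtain ⟨P, hP, bP⟩ := exists_derivative_bounds_of_tsupport_subset hψ₃ hψ₃s
  refine ⟨P * (1 + 64 * C) ^ 2 * 2, by positivity, fun n Λ hΛ hn => ?_⟩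
  obtain ⟨b', b'', db, db', cb'', bb', bb''⟩ := boundary_phase_derivatives hC hB1 hB2 hB2c hBb hΛ hn
  obtain ⟨w', w'', dw, dw', cw'', bw, bw', bw''⟩ := exists_oscillating_amplitude_derivatives
    (v := ψ₃) (P := P) (M := 64 * C) (by positivity) hP.le db db' cb''
    (fun A _ => hψ₃.hasDerivAt_dirDeriv_one A)
    (fun A _ => (hψ₃.dirDeriv 1).hasDerivAt_dirDeriv_one A)
    ((hψ₃.dirDeriv 1).dirDeriv 1).continuous.continuousOn bb' bb''
    (fun A _ => (bP A).1) (fun A _ => (bP A).2.1) (fun A _ => (bP A).2.2)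
  have hz : ∀ A, A ∉ Icc (9 / 10 : ℝ) 6 → ψ₃ A = 0 := fun A hA =>
    image_eq_zero_of_notMem_tsupport fun h => hA (hψ₃s h)
  refine ⟨w', w'', dw, dw', cw'', ?_, ?_, bw, bw', bw''⟩
  · simp only []
    rw [hz _ (by simp only [mem_Icc]; norm_num)]; simp
  · simp only []
    rw [hz _ (by simp only [mem_Icc]; norm_num)]; simp

theorem shear_integral {χ₂ : ℝ × ℝ → ℝ} (hχ₂ : Continuous χ₂)
    (hχ₂s : tsupport χ₂ ⊆ {p : ℝ × ℝ | |p.1| < 3 ∧ |p.2| < 3}) {E : ℝ → ℝ → ℂ}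
    (hE : Continuous (uncurry E)) {J : ℝ → ℂ} (hJ : Continuous J) :
    ∫ S in (-3:ℝ)..3, ∫ y in (-3:ℝ)..3, E S y * (χ₂ (S, y) : ℂ) * J (S + y)
      = ∫ p in (-6:ℝ)..6, (∫ y in (-3:ℝ)..3, E (p - y) y * (χ₂ (p - y, y) : ℂ)) * J p := by
  have hc : Continuous (uncurry fun S y => E S y * (χ₂ (S, y) : ℂ) * J (S + y)) :=
    (hE.mul (continuous_ofReal.comp hχ₂)).mul (hJ.comp (continuous_fst.add continuous_snd))
  have hc2 : Continuous (uncurry fun p y => E (p - y) y * (χ₂ (p - y, y) : ℂ) * J p) := by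
    have h1 : Continuous fun q : ℝ × ℝ => (q.1 - q.2, q.2) :=
      (continuous_fst.sub continuous_snd).prodMk continuous_snd
    exact ((hE.comp h1).mul (continuous_ofReal.comp (hχ₂.comp h1))).mul
      (hJ.comp continuous_fst)
  rw [intervalIntegral_swap_of_continuousOn (by norm_num) (by norm_num) hc.continuousOn]
  simp only [← intervalIntegral.integral_mul_const]
  rw [intervalIntegral_swap_of_continuousOn (by norm_num) (by norm_num) hc2.continuousOn]
  refine integral_congr fun y hy => ?_
  rw [uIcc_of_le (by norm_num)] at hy
  have hsub := intervalIntegral.integral_comp_sub_right (a := -6) (b := 6)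
    (fun S => E S y * (χ₂ (S, y) : ℂ) * J (S + y)) y
  have hsupp : Function.support (fun S => E S y * (χ₂ (S, y) : ℂ) * J (S + y)) ⊆ Ioc (-3) 3 := by
    intro S hS
    by_contra h
    refine hS ?_
    have : 3 ≤ |S| := by
      by_contra h'
      rw [not_le, abs_lt] at h'
      exact h ⟨h'.1, h'.2.le⟩
    simp [eq_zero_of_three_le hχ₂s (Or.inl this)]
  simp only [sub_add_cancel] at hsub
  rw [hsub, intervalIntegral.integral_eq_integral_of_support_subset hsupp,
    intervalIntegral.integral_eq_integral_of_support_subset (hsupp.trans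
      (Ioc_subset_Ioc (by linarith [hy.1]) (by linarith [hy.2])))]

/-- The phase `λΨ` at `Y = 0`, with `n = N` and `Λ = ηλ`. -/
noncomputable def frequencyPhase (L : ℝ → ℝ) (a n Λ T X S y A : ℝ) : ℝ :=
  Λ * (y ^ 3 / 3 + y * (X - A) + S ^ 3 / 3 + S * (1 - A) + T * travelTime a A
    - 4 / 3 * n * A ^ ((3 : ℝ) / 2)) + n * Bfun L (Λ * A ^ ((3 : ℝ) / 2))

theorem exists_fixed_frequency_bound {L B₁ B₂ : ℝ → ℝ} {C : ℝ} (hC : 0 ≤ C)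
    (hB1 : ∀ u, 0 < u → HasDerivAt (Bfun L) (B₁ u) u)
    (hB2 : ∀ u, 0 < u → HasDerivAt B₁ (B₂ u) u) (hB2c : ContinuousOn B₂ (Ioi 0))
    (hBb : ∀ u, 1 ≤ u → |B₁ u| ≤ C / u ^ 2 ∧ |B₂ u| ≤ C / u ^ 3)
    {χ₂ : ℝ × ℝ → ℝ} (hχ₂ : ContDiff ℝ ∞ χ₂)
    (hχ₂c : HasCompactSupport χ₂) (hχ₂s : tsupport χ₂ ⊆ {p : ℝ × ℝ | |p.1| < 3 ∧ |p.2| < 3})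
    {ψ₃ : ℝ → ℝ} (hψ₃ : ContDiff ℝ ∞ ψ₃) (hψ₃s : tsupport ψ₃ ⊆ Icc (9 / 10 : ℝ) 6) :
    ∃ K : ℝ, 0 < K ∧ ∀ a T X n Λ ℓ : ℝ, 0 < a → a ≤ 1 / 200 → 1000 ≤ |n| → |n| ≤ 2 * Λ →
      2 ≤ ℓ → ℓ ^ 6 = Λ → ℓ ^ 2 / 2 ≤ |n| →
      ‖∫ S in (-3:ℝ)..3, ∫ y in (-3:ℝ)..3, ∫ A in (89 / 100 : ℝ)..(61 / 10),
        cexp (I * (frequencyPhase L a n Λ T X S y A : ℂ)) * ((χ₂ (S, y) * ψ₃ A : ℝ) : ℂ)‖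
        * (Λ * √|n| * ℓ) ≤ K ∧
      ∀ d, 0 ≤ d → d ^ 4 = |T / (4 * n) - 1| →
        ‖∫ S in (-3:ℝ)..3, ∫ y in (-3:ℝ)..3, ∫ A in (89 / 100 : ℝ)..(61 / 10),
          cexp (I * (frequencyPhase L a n Λ T X S y A : ℂ)) * ((χ₂ (S, y) * ψ₃ A : ℝ) : ℂ)‖
          * (Λ * √|n| * ℓ ^ 2 * d) ≤ K := by
  obtain ⟨G, hG, hg⟩ := exists_isFresnelAmplitude hχ₂ hχ₂c hχ₂s
  obtain ⟨W, hW, hw⟩ := exists_isSaddleAmplitude hC hB1 hB2 hB2c hBb hψ₃ hψ₃s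
  obtain ⟨K₀, hK₀, hK⟩ := exists_line_bound
  refine ⟨K₀ * G * W, by positivity, fun a T X n Λ ℓ ha ha' hn hnΛ hℓ hℓΛ hℓn => ?_⟩
  have hn0 : n ≠ 0 := by
    intro h; rw [h, abs_zero] at hn; linarith
  have hw' := hw n Λ (by linarith) hnΛ
  have := hK (τ := T / (4 * n)) (X := X) ha ha' hn hℓ hℓΛ hℓn hg hw'
  have key : ∫ S in (-3:ℝ)..3, ∫ y in (-3:ℝ)..3, ∫ A in (89 / 100 : ℝ)..(61 / 10),
        cexp (I * (frequencyPhase L a n Λ T X S y A : ℂ)) * ((χ₂ (S, y) * ψ₃ A : ℝ) : ℂ)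
      = ∫ p in (-6:ℝ)..6, sliceIntegral (reducedPhase a (T / (4 * n))) n Λ X
        (fun p y => χ₂ (p - y, y)) (fun A => Complex.exp
          (I * ((n * Bfun L (Λ * A ^ ((3 : ℝ) / 2)) : ℝ) : ℂ)) * (ψ₃ A : ℂ)) p := by
    have hJ : Continuous fun p : ℝ => ∫ A in (89 / 100 : ℝ)..(61 / 10), Complex.exp
        (I * ((Λ * (n * reducedPhase a (T / (4 * n)) A - p * A) : ℝ) : ℂ)) * (Complex.exp
          (I * ((n * Bfun L (Λ * A ^ ((3 : ℝ) / 2)) : ℝ) : ℂ)) * (ψ₃ A : ℂ)) := by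
      obtain ⟨w', w'', dw, -⟩ := hw'
      rw [← continuousOn_univ]
      refine continuousOn_intervalIntegral_param isOpen_univ (by norm_num) ?_
      have h1 : ContinuousOn (fun q : ℝ × ℝ => reducedPhase a (T / (4 * n)) q.2)
          (univ ×ˢ Icc (89 / 100 : ℝ) (61 / 10)) := fun q hq =>
        ((hasDerivAt_reducedPhase ha (by linarith [hq.2.1] : 0 < q.2)).continuousAt.comp
          continuousAt_snd).continuousWithinAt
      have h2 : ContinuousOn (fun q : ℝ × ℝ => Complex.exp
          (I * ((n * Bfun L (Λ * q.2 ^ ((3 : ℝ) / 2)) : ℝ) : ℂ)) * (ψ₃ q.2 : ℂ))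
          (univ ×ˢ Icc (89 / 100 : ℝ) (61 / 10)) := fun q hq =>
        ((dw q.2 hq.2).continuousAt.comp (f := Prod.snd) continuousAt_snd).continuousWithinAt
      have h3 : ContinuousOn (fun q : ℝ × ℝ => q.1 * q.2) (univ ×ˢ Icc (89 / 100 : ℝ) (61 / 10)) := by
        fun_prop
      exact ((continuousOn_const (c := I)).mul (continuous_ofReal.comp_continuousOn
        ((continuousOn_const (c := Λ)).mul (((continuousOn_const (c := n)).mul h1).sub h3)))).cexp.mul h2
    have hE : Continuous (uncurry fun S y : ℝ => Complex.exp
        (I * ((Λ * (y ^ 3 / 3 + y * X + S ^ 3 / 3 + S) : ℝ) : ℂ))) := by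
      unfold uncurry
      fun_prop
    refine Eq.trans ?_ (shear_integral hχ₂.continuous hχ₂s hE hJ)
    refine integral_congr fun S _ => integral_congr fun y _ => ?_
    simp only []
    rw [← intervalIntegral.integral_const_mul]
    refine integral_congr fun A _ => ?_
    have hexp : cexp (I * (frequencyPhase L a n Λ T X S y A : ℂ)) = Complex.exp
        (I * ((Λ * (y ^ 3 / 3 + y * X + S ^ 3 / 3 + S) : ℝ) : ℂ)) * (Complex.exp
        (I * ((Λ * (n * reducedPhase a (T / (4 * n)) A - (S + y) * A) : ℝ) : ℂ)) * Complex.exp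
          (I * ((n * Bfun L (Λ * A ^ ((3 : ℝ) / 2)) : ℝ) : ℂ))) := by
      rw [← Complex.exp_add, ← Complex.exp_add, ← mul_add, ← mul_add, ← Complex.ofReal_add,
        ← Complex.ofReal_add]
      congr 3
      rw [frequencyPhase, reducedPhase]
      field_simp
      ring
    rw [hexp, Complex.ofReal_mul (χ₂ (S, y))]
    ring
  rw [key]
  exact this

theorem norm_integral_le_of_quadratic_half {R₀ R₁ R₂ : ℝ → ℂ} {ε K b : ℝ} (hε : 0 < ε)
    (hR₁ : ∀ x ∈ Icc (0:ℝ) 3, HasDerivAt R₁ (((x ^ 2 - b : ℝ) : ℂ) * R₀ x + R₂ x) x)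
    (hR₀c : ContinuousOn R₀ (Icc 0 3)) (hR₂c : ContinuousOn R₂ (Icc 0 3))
    (b₀ : ∀ x ∈ Icc (0:ℝ) 3, ‖R₀ x‖ ≤ K) (b₁ : ∀ x ∈ Icc (0:ℝ) 3, ‖R₁ x‖ ≤ K * ε ^ 3)
    (b₂ : ∀ x ∈ Icc (0:ℝ) 3, ‖R₂ x‖ ≤ K * ε ^ 3) :
    ‖∫ x in (0:ℝ)..3, R₀ x‖ ≤ 14 * K * ε := by
  have hK : 0 ≤ K := (norm_nonneg _).trans (b₀ 0 ⟨le_rfl, by norm_num⟩)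
  set r := √(max b 0) with hr
  have hr0 : 0 ≤ r := Real.sqrt_nonneg _
  have hr2 : r ^ 2 = max b 0 := sq_sqrt (le_max_right _ _)
  have hbr : b ≤ r ^ 2 := hr2 ▸ le_max_left _ _
  have main : ∀ x y, 0 ≤ x → x ≤ y → y ≤ 3 → ((∀ t ∈ Icc x y, ε ^ 2 ≤ t ^ 2 - b) ∨
      ∀ t ∈ Icc x y, t ^ 2 - b ≤ -ε ^ 2) → ‖∫ t in x..y, R₀ t‖ ≤ 6 * K * ε := by
    intro x y hx hxy hy hg
    have hsub : Icc x y ⊆ Icc 0 3 := Icc_subset_Icc hx hy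
    refine (norm_integral_le_of_ibp (R₁ := R₁) (R₂ := R₂) (g := fun t => t ^ 2 - b)
      (g' := fun t => 2 * t) hxy (pow_pos hε 2) (fun t ht => hR₁ t (hsub ht)) (fun t _ => ?_)
      (hR₀c.mono hsub) (hR₂c.mono hsub) (by fun_prop) hg
      (Or.inl fun t ht => by show 0 ≤ 2 * t; linarith [ht.1]) (fun t ht => b₁ t (hsub ht))
      (fun t ht => b₂ t (hsub ht))).trans ?_
    · exact (((hasDerivAt_id t).pow 2).sub_const b).congr_deriv (by simp)
    · rw [← add_div, div_le_iff₀ (by positivity)]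
      have : K * ε ^ 3 * (y - x) ≤ K * ε ^ 3 * 3 := by gcongr; linarith
      linarith
  refine (norm_integral_le_of_window (c := r) (δ := ε) (K := K) (M := 6 * K * ε) (by norm_num) hε.le
    (by positivity) hR₀c b₀ ?_ ?_).trans (le_of_eq (by ring))
  · intro x y hx hrx hxy hy
    refine main x y hx hxy hy (Or.inl fun t ht => ?_)
    nlinarith [ht.1]
  · intro x y hx hxy hyr hy
    refine main x y hx hxy hy (Or.inr fun t ht => ?_)
    have hpos : 0 < r := by linarith
    have hb : b = r ^ 2 := by
      rw [hr2, max_eq_left]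
      by_contra h
      rw [max_eq_right (by linarith)] at hr2
      nlinarith
    rw [hb]
    nlinarith [ht.1, ht.2]

theorem norm_integral_le_of_quadratic {R₀ R₁ R₂ : ℝ → ℂ} {ε K b : ℝ} (hε : 0 < ε)
    (hR₁ : ∀ x ∈ Icc (-3:ℝ) 3, HasDerivAt R₁ (((x ^ 2 - b : ℝ) : ℂ) * R₀ x + R₂ x) x)
    (hR₀c : ContinuousOn R₀ (Icc (-3) 3)) (hR₂c : ContinuousOn R₂ (Icc (-3) 3))
    (b₀ : ∀ x ∈ Icc (-3:ℝ) 3, ‖R₀ x‖ ≤ K) (b₁ : ∀ x ∈ Icc (-3:ℝ) 3, ‖R₁ x‖ ≤ K * ε ^ 3)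
    (b₂ : ∀ x ∈ Icc (-3:ℝ) 3, ‖R₂ x‖ ≤ K * ε ^ 3) :
    ‖∫ x in (-3:ℝ)..3, R₀ x‖ ≤ 28 * K * ε := by
  have hp : Icc (0:ℝ) 3 ⊆ Icc (-3) 3 := Icc_subset_Icc (by norm_num) le_rfl
  have hm : MapsTo (fun x : ℝ => -x) (Icc (0:ℝ) 3) (Icc (-3) 3) := fun x hx =>
    ⟨by linarith [hx.2], by linarith [hx.1]⟩
  have h1 := norm_integral_le_of_quadratic_half hε (fun x hx => hR₁ x (hp hx)) (hR₀c.mono hp)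
    (hR₂c.mono hp) (fun x hx => b₀ x (hp hx)) (fun x hx => b₁ x (hp hx)) (fun x hx => b₂ x (hp hx))
  have h2 := norm_integral_le_of_quadratic_half (R₀ := fun x => R₀ (-x)) (R₁ := fun x => -R₁ (-x))
    (R₂ := fun x => R₂ (-x)) (b := b) (K := K) hε ?_ (hR₀c.comp continuous_neg.continuousOn hm)
    (hR₂c.comp continuous_neg.continuousOn hm) (fun x hx => b₀ _ (hm hx))
    (fun x hx => by rw [norm_neg]; exact b₁ _ (hm hx)) (fun x hx => b₂ _ (hm hx))
  · have h3 := intervalIntegral.integral_comp_neg (a := 0) (b := 3) R₀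
    rw [neg_zero] at h3
    rw [h3] at h2
    rw [← integral_add_adjacent_intervals (b := 0)]
    · refine (norm_add_le _ _).trans ?_
      linarith
    · exact (hR₀c.mono (Icc_subset_Icc le_rfl (by norm_num))).intervalIntegrable_of_Icc (by norm_num)
    · exact (hR₀c.mono hp).intervalIntegrable_of_Icc (by norm_num)
  · intro x hx
    have := (HasDerivAt.scomp x (hR₁ (-x) (hm hx)) (hasDerivAt_neg x)).neg
    refine this.congr_deriv ?_
    simp
    ring

theorem norm_cubic_integral_le {Z W : ℝ → ℂ} {c c' : ℝ → ℝ} {ε K M b s₀ : ℝ} (hε : 0 < ε)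
    (hZ : Continuous Z) (hW : ∀ y, HasDerivAt W (Z y) y) (bZ : ∀ y, ‖Z y‖ ≤ K)
    (bW : ∀ y, ‖W y‖ ≤ K * ε ^ 3) (hc : ∀ y ∈ Icc (-3:ℝ) 3, HasDerivAt c (c' y) y)
    (hc'c : ContinuousOn c' (Icc (-3) 3)) (bc : ∀ y ∈ Icc (-3:ℝ) 3, |c y| ≤ M)
    (bc' : ∀ y ∈ Icc (-3:ℝ) 3, |c' y| ≤ M) :
    ‖∫ y in (-3:ℝ)..3, (c y : ℂ) * Z (s₀ + (y ^ 3 / 3 - b * y))‖ ≤ 28 * (K * M) * ε := by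
  have hM : 0 ≤ M := (abs_nonneg _).trans (bc 0 ⟨by norm_num, by norm_num⟩)
  have hWc : Continuous W := continuous_iff_continuousAt.2 fun y => (hW y).continuousAt
  have hcc : ContinuousOn c (Icc (-3) 3) := fun y hy => (hc y hy).continuousAt.continuousWithinAt
  have hph : Continuous fun y : ℝ => s₀ + (y ^ 3 / 3 - b * y) := by fun_prop
  have bmul : ∀ {k : ℝ} {z : ℂ} {κ : ℝ}, |k| ≤ M → ‖z‖ ≤ κ → ‖(k : ℂ) * z‖ ≤ M * κ := by
    intro k z κ hk hz
    rw [norm_mul, norm_real]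
    exact mul_le_mul hk hz (norm_nonneg _) hM
  refine norm_integral_le_of_quadratic (R₁ := fun y => (c y : ℂ) * W (s₀ + (y ^ 3 / 3 - b * y)))
    (R₂ := fun y => (c' y : ℂ) * W (s₀ + (y ^ 3 / 3 - b * y))) (b := b) (K := K * M) hε ?_ ?_ ?_ ?_ ?_ ?_
  · intro y hy
    have h1 : HasDerivAt (fun y : ℝ => s₀ + (y ^ 3 / 3 - b * y)) (y ^ 2 - b) y :=
      (((((hasDerivAt_id y).pow 3).div_const 3).sub ((hasDerivAt_id y).const_mul b)).const_add
        s₀).congr_deriv (by simp)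
    refine ((hc y hy).ofReal_comp.mul (HasDerivAt.scomp y (hW _) h1)).congr_deriv ?_
    simp only [Complex.real_smul, Function.comp_apply]
    ring
  · exact (continuous_ofReal.comp_continuousOn hcc).mul (hZ.comp hph).continuousOn
  · exact (continuous_ofReal.comp_continuousOn hc'c).mul (hWc.comp hph).continuousOn
  · exact fun y hy => (bmul (bc y hy) (bZ _)).trans (le_of_eq (by ring))
  · exact fun y hy => (bmul (bc y hy) (bW _)).trans (le_of_eq (by ring))
  · exact fun y hy => (bmul (bc' y hy) (bW _)).trans (le_of_eq (by ring))

/-- `c` and its derivatives `∂₁c`, `∂₂c`, `∂₂∂₁c` exist and are bounded by `M` on `(-4, 4)²`. -/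
def IsMixedAmplitude (M : ℝ) (c : ℝ → ℝ → ℝ) : Prop :=
  ∃ cs cu csu : ℝ → ℝ → ℝ,
    ContinuousOn (uncurry c) (Ioo (-4) 4 ×ˢ Ioo (-4) 4) ∧
    ContinuousOn (uncurry cs) (Ioo (-4) 4 ×ˢ Ioo (-4) 4) ∧
    ContinuousOn (uncurry cu) (Ioo (-4) 4 ×ˢ Ioo (-4) 4) ∧
    ContinuousOn (uncurry csu) (Ioo (-4) 4 ×ˢ Ioo (-4) 4) ∧
    (∀ s ∈ Ioo (-4:ℝ) 4, ∀ u ∈ Ioo (-4:ℝ) 4, HasDerivAt (fun s => c s u) (cs s u) s ∧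
      HasDerivAt (fun u => c s u) (cu s u) u ∧ HasDerivAt (fun u => cs s u) (csu s u) u ∧
      |c s u| ≤ M ∧ |cs s u| ≤ M ∧ |cu s u| ≤ M ∧ |csu s u| ≤ M)

theorem IsMixedAmplitude.mono {M M' : ℝ} {c : ℝ → ℝ → ℝ} (h : IsMixedAmplitude M c) (hM : M ≤ M') :
    IsMixedAmplitude M' c := by
  obtain ⟨cs, cu, csu, h1, h2, h3, h4, h5⟩ := h
  refine ⟨cs, cu, csu, h1, h2, h3, h4, fun s hs u hu => ?_⟩
  obtain ⟨d1, d2, d3, b1, b2, b3, b4⟩ := h5 s hs u hu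
  exact ⟨d1, d2, d3, b1.trans hM, b2.trans hM, b3.trans hM, b4.trans hM⟩

theorem IsMixedAmplitude.mul {M M' : ℝ} {c e : ℝ → ℝ → ℝ} (hc : IsMixedAmplitude M c)
    (he : IsMixedAmplitude M' e) : IsMixedAmplitude (4 * M * M') fun s u => c s u * e s u := by
  obtain ⟨cs, cu, csu, c1, c2, c3, c4, c5⟩ := hc
  obtain ⟨es, eu, esu, e1, e2, e3, e4, e5⟩ := he
  have hM : 0 ≤ M := (abs_nonneg _).trans
    (c5 0 ⟨by norm_num, by norm_num⟩ 0 ⟨by norm_num, by norm_num⟩).2.2.2.1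
  refine ⟨fun s u => cs s u * e s u + c s u * es s u, fun s u => cu s u * e s u + c s u * eu s u,
    fun s u => (csu s u * e s u + cs s u * eu s u) + (cu s u * es s u + c s u * esu s u),
    c1.mul e1, (c2.mul e1).add (c1.mul e2), (c3.mul e1).add (c1.mul e3),
    ((c4.mul e1).add (c2.mul e3)).add ((c3.mul e2).add (c1.mul e4)), fun s hs u hu => ?_⟩
  obtain ⟨d1, d2, d3, b1, b2, b3, b4⟩ := c5 s hs u hu
  obtain ⟨f1, f2, f3, g1, g2, g3, g4⟩ := e5 s hs u hu
  have hb : ∀ {x y : ℝ}, |x| ≤ M → |y| ≤ M' → |x * y| ≤ M * M' := by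
    intro x y hx hy
    rw [abs_mul]
    exact mul_le_mul hx hy (abs_nonneg _) hM
  have hMM : 0 ≤ M * M' := (abs_nonneg _).trans (hb b1 g1)
  have e1 := abs_le.1 (hb b1 g1)
  have e2 := abs_le.1 (hb b2 g1)
  have e3 := abs_le.1 (hb b1 g2)
  have e4 := abs_le.1 (hb b3 g1)
  have e5 := abs_le.1 (hb b1 g3)
  have e6 := abs_le.1 (hb b4 g1)
  have e7 := abs_le.1 (hb b2 g3)
  have e8 := abs_le.1 (hb b3 g2)
  have e9 := abs_le.1 (hb b1 g4)
  refine ⟨d1.mul f1, d2.mul f2, (d3.mul f2).add (d2.mul f3), ?_, ?_, ?_, ?_⟩ <;>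
  · rw [abs_le]
    constructor <;> linarith

theorem IsMixedAmplitude.add {M M' : ℝ} {c e : ℝ → ℝ → ℝ} (hc : IsMixedAmplitude M c)
    (he : IsMixedAmplitude M' e) : IsMixedAmplitude (M + M') fun s u => c s u + e s u := by
  obtain ⟨cs, cu, csu, c1, c2, c3, c4, c5⟩ := hc
  obtain ⟨es, eu, esu, e1, e2, e3, e4, e5⟩ := he
  refine ⟨fun s u => cs s u + es s u, fun s u => cu s u + eu s u, fun s u => csu s u + esu s u,
    c1.add e1, c2.add e2, c3.add e3, c4.add e4, fun s hs u hu => ?_⟩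
  obtain ⟨d1, d2, d3, b1, b2, b3, b4⟩ := c5 s hs u hu
  obtain ⟨f1, f2, f3, g1, g2, g3, g4⟩ := e5 s hs u hu
  exact ⟨d1.add f1, d2.add f2, d3.add f3, (abs_add_le _ _).trans (add_le_add b1 g1),
    (abs_add_le _ _).trans (add_le_add b2 g2), (abs_add_le _ _).trans (add_le_add b3 g3),
    (abs_add_le _ _).trans (add_le_add b4 g4)⟩

theorem IsMixedAmplitude.const_mul {M : ℝ} {c : ℝ → ℝ → ℝ} (hc : IsMixedAmplitude M c) (r : ℝ) :
    IsMixedAmplitude (|r| * M) fun s u => r * c s u := by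
  obtain ⟨cs, cu, csu, c1, c2, c3, c4, c5⟩ := hc
  refine ⟨fun s u => r * cs s u, fun s u => r * cu s u, fun s u => r * csu s u,
    continuousOn_const.mul c1, continuousOn_const.mul c2, continuousOn_const.mul c3,
    continuousOn_const.mul c4, fun s hs u hu => ?_⟩
  obtain ⟨d1, d2, d3, b1, b2, b3, b4⟩ := c5 s hs u hu
  simp only [abs_mul]
  exact ⟨d1.const_mul r, d2.const_mul r, d3.const_mul r, by gcongr, by gcongr, by gcongr, by gcongr⟩

theorem isMixedAmplitude_inv_of_separable {κ₁ κ₁' κ₂ κ₂' : ℝ → ℝ} {m Q : ℝ}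
    (h1 : ∀ s, HasDerivAt κ₁ (κ₁' s) s) (h1c : Continuous κ₁') (h2 : ∀ u, HasDerivAt κ₂ (κ₂' u) u)
    (h2c : Continuous κ₂') (hm : 0 < m) (hQ : 0 ≤ Q) (hQm : Q ≤ m)
    (hlow : ∀ s ∈ Ioo (-4:ℝ) 4, ∀ u ∈ Ioo (-4:ℝ) 4, m ≤ |κ₁ s + κ₂ u|)
    (b1 : ∀ s ∈ Ioo (-4:ℝ) 4, |κ₁' s| ≤ Q) (b2 : ∀ u ∈ Ioo (-4:ℝ) 4, |κ₂' u| ≤ Q) :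
    IsMixedAmplitude (2 / m) fun s u => (κ₁ s + κ₂ u)⁻¹ := by
  have c1 : Continuous κ₁ := continuous_iff_continuousAt.2 fun y => (h1 y).continuousAt
  have c2 : Continuous κ₂ := continuous_iff_continuousAt.2 fun y => (h2 y).continuousAt
  have hk : Continuous (uncurry fun s u => κ₁ s + κ₂ u) :=
    (c1.comp continuous_fst).add (c2.comp continuous_snd)
  have hne : ∀ s ∈ Ioo (-4:ℝ) 4, ∀ u ∈ Ioo (-4:ℝ) 4, κ₁ s + κ₂ u ≠ 0 := fun s hs u hu =>
    abs_pos.1 (hm.trans_le (hlow s hs u hu))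
  have hinv : ContinuousOn (uncurry fun s u => (κ₁ s + κ₂ u)⁻¹)
      (Ioo (-4) 4 ×ˢ Ioo (-4) 4) := hk.continuousOn.inv₀ fun p hp => hne _ hp.1 _ hp.2
  have k1 : Continuous fun p : ℝ × ℝ => κ₁' p.1 := h1c.comp continuous_fst
  have k2 : Continuous fun p : ℝ × ℝ => κ₂' p.2 := h2c.comp continuous_snd
  refine ⟨fun s u => -κ₁' s * (κ₁ s + κ₂ u)⁻¹ ^ 2, fun s u => -κ₂' u * (κ₁ s + κ₂ u)⁻¹ ^ 2,
    fun s u => 2 * κ₁' s * κ₂' u * (κ₁ s + κ₂ u)⁻¹ ^ 3, hinv,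
    (k1.neg.continuousOn.mul (hinv.pow 2)).congr fun _ _ => rfl,
    (k2.neg.continuousOn.mul (hinv.pow 2)).congr fun _ _ => rfl,
    (((continuous_const.mul k1).mul k2).continuousOn.mul (hinv.pow 3)).congr fun _ _ => rfl, fun s hs u hu => ?_⟩
  have h0 := hne s hs u hu
  have e1 : HasDerivAt (fun s => (κ₁ s + κ₂ u)⁻¹) (-κ₁' s * (κ₁ s + κ₂ u)⁻¹ ^ 2) s :=
    (((h1 s).add_const (κ₂ u)).fun_inv h0).congr_deriv (by field_simp)
  have e2 : HasDerivAt (fun u => (κ₁ s + κ₂ u)⁻¹) (-κ₂' u * (κ₁ s + κ₂ u)⁻¹ ^ 2) u :=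
    (((h2 u).const_add (κ₁ s)).fun_inv h0).congr_deriv (by field_simp)
  have hi : |(κ₁ s + κ₂ u)⁻¹| ≤ m⁻¹ := by
    rw [abs_inv]
    exact inv_anti₀ hm (hlow s hs u hu)
  have hQ1 : Q * m⁻¹ ≤ 1 := by
    rw [← div_eq_mul_inv]
    exact (div_le_one hm).2 hQm
  have hm' : 0 < m⁻¹ := inv_pos.2 hm
  have b1' := b1 s hs
  have b2' := b2 u hu
  have key : ∀ {x : ℝ}, |x| ≤ Q → |-x * (κ₁ s + κ₂ u)⁻¹ ^ 2| ≤ 2 / m := by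
    intro x hx
    rw [abs_mul, abs_neg, abs_pow]
    calc _ ≤ Q * m⁻¹ ^ 2 := by gcongr
      _ = Q * m⁻¹ * m⁻¹ := by ring
      _ ≤ 1 * m⁻¹ := by gcongr
      _ ≤ 2 / m := by rw [div_eq_mul_inv]; linarith
  refine ⟨e1, e2, ?_, ?_, key b1', key b2', ?_⟩
  · refine ((e2.fun_pow 2).const_mul (-κ₁' s)).congr_deriv ?_
    push_cast
    ring
  · refine hi.trans ?_
    rw [div_eq_mul_inv]
    linarith
  · rw [abs_mul, abs_mul, abs_mul, abs_pow, abs_of_pos (two_pos : (0:ℝ) < 2)]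
    calc _ ≤ 2 * Q * Q * m⁻¹ ^ 3 := by gcongr
      _ = 2 * (Q * m⁻¹) * (Q * m⁻¹) * m⁻¹ := by ring
      _ ≤ 2 * 1 * 1 * m⁻¹ := by gcongr
      _ = 2 / m := by rw [div_eq_mul_inv]; ring

theorem ContDiff.isMixedAmplitude {χ : ℝ × ℝ → ℝ} (hχ : ContDiff ℝ ∞ χ)
    (hχc : HasCompactSupport χ) : ∃ M, 0 < M ∧ IsMixedAmplitude M fun s u => χ (s, u) := by
  have hs := hχ.dirDeriv (1, 0)
  have hu := hχ.dirDeriv (0, 1)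
  have hsu := hs.dirDeriv (0, 1)
  obtain ⟨M₁, p1, m1⟩ := hχc.exists_abs_bound hχ.continuous
  obtain ⟨M₂, p2, m2⟩ := (hχc.dirDeriv _).exists_abs_bound hs.continuous
  obtain ⟨M₃, p3, m3⟩ := (hχc.dirDeriv _).exists_abs_bound hu.continuous
  obtain ⟨M₄, p4, m4⟩ := ((hχc.dirDeriv _).dirDeriv _).exists_abs_bound hsu.continuous
  have d1 : ∀ {f : ℝ × ℝ → ℝ}, ContDiff ℝ ∞ f → ∀ s u,
      HasDerivAt (fun s => f (s, u)) (_root_.dirDeriv (1, 0) f (s, u)) s := fun hf s u =>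
    hf.contDiffAt.hasDerivAt_comp_line ((hasDerivAt_id s).prodMk (hasDerivAt_const s u))
  have d2 : ∀ {f : ℝ × ℝ → ℝ}, ContDiff ℝ ∞ f → ∀ s u,
      HasDerivAt (fun u => f (s, u)) (_root_.dirDeriv (0, 1) f (s, u)) u := fun hf s u =>
    hf.contDiffAt.hasDerivAt_comp_line ((hasDerivAt_const u s).prodMk (hasDerivAt_id u))
  refine ⟨M₁ + M₂ + M₃ + M₄, by positivity,
    fun s u => _root_.dirDeriv (1, 0) χ (s, u), fun s u => _root_.dirDeriv (0, 1) χ (s, u),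
    fun s u => _root_.dirDeriv (0, 1) (_root_.dirDeriv (1, 0) χ) (s, u), hχ.continuous.continuousOn,
    hs.continuous.continuousOn, hu.continuous.continuousOn, hsu.continuous.continuousOn,
    fun s _ u _ => ⟨d1 hχ s u, d2 hχ s u, d2 hs s u, ?_, ?_, ?_, ?_⟩⟩
  · linarith [m1 (s, u)]
  · linarith [m2 (s, u)]
  · linarith [m3 (s, u)]
  · linarith [m4 (s, u)]

theorem norm_double_cubic_integral_le {Z₀ Z₁ Z₂ : ℝ → ℂ} {c : ℝ → ℝ → ℝ} {ε K M b₁ b₂ : ℝ}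
    (hε : 0 < ε) (hZ₀ : Continuous Z₀) (hZ₁ : ∀ y, HasDerivAt Z₁ (Z₀ y) y)
    (hZ₂ : ∀ y, HasDerivAt Z₂ (Z₁ y) y) (k₀ : ∀ y, ‖Z₀ y‖ ≤ K) (k₁ : ∀ y, ‖Z₁ y‖ ≤ K * ε ^ 3)
    (k₂ : ∀ y, ‖Z₂ y‖ ≤ K * ε ^ 3 * ε ^ 3) (hc : IsMixedAmplitude M c) :
    ‖∫ s in (-3:ℝ)..3, ∫ u in (-3:ℝ)..3,
      (c s u : ℂ) * Z₀ ((s ^ 3 / 3 - b₁ * s) + (u ^ 3 / 3 - b₂ * u))‖ ≤ 784 * K * M * ε ^ 2 := by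
  obtain ⟨cs, cu, csu, c1, c2, c3, c4, c5⟩ := hc
  have hZ₁c : Continuous Z₁ := continuous_iff_continuousAt.2 fun y => (hZ₁ y).continuousAt
  have hU : IsOpen (Ioo (-4:ℝ) 4) := isOpen_Ioo
  have hI : Icc (-3:ℝ) 3 ⊆ Ioo (-4) 4 := Icc_subset_Ioo (by norm_num) (by norm_num)
  have hab : (-3:ℝ) ≤ 3 := by norm_num
  have hprod : Ioo (-4:ℝ) 4 ×ˢ Icc (-3:ℝ) 3 ⊆ Ioo (-4) 4 ×ˢ Ioo (-4) 4 := prod_mono_right hI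
  have jc : ∀ {e : ℝ → ℝ → ℝ} {Z : ℝ → ℂ}, ContinuousOn (uncurry e)
      (Ioo (-4) 4 ×ˢ Ioo (-4) 4) → Continuous Z → ContinuousOn (uncurry fun s u =>
        (e s u : ℂ) * Z ((s ^ 3 / 3 - b₁ * s) + (u ^ 3 / 3 - b₂ * u)))
        (Ioo (-4:ℝ) 4 ×ˢ Icc (-3:ℝ) 3) := fun he hZ =>
    (continuous_ofReal.comp_continuousOn (he.mono hprod)).mul
      (hZ.comp (by fun_prop : Continuous fun p : ℝ × ℝ =>
        (p.1 ^ 3 / 3 - b₁ * p.1) + (p.2 ^ 3 / 3 - b₂ * p.2))).continuousOn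
  have sl : ∀ {e : ℝ → ℝ → ℝ} {s : ℝ}, ContinuousOn (uncurry e)
      (Ioo (-4) 4 ×ˢ Ioo (-4) 4) → s ∈ Icc (-3:ℝ) 3 → ContinuousOn (fun u => e s u) (Icc (-3) 3) :=
    fun {e s} he hs => he.comp (f := fun u => (s, u)) (by fun_prop) fun u hu => ⟨hI hs, hI hu⟩
  have inner : ∀ {e e' : ℝ → ℝ → ℝ} {s : ℝ}, s ∈ Icc (-3:ℝ) 3 →
      (∀ u ∈ Icc (-3:ℝ) 3, HasDerivAt (fun u => e s u) (e' s u) u) →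
      ContinuousOn (fun u => e' s u) (Icc (-3) 3) → (∀ u ∈ Icc (-3:ℝ) 3, |e s u| ≤ M) →
      (∀ u ∈ Icc (-3:ℝ) 3, |e' s u| ≤ M) → ∀ {Z W : ℝ → ℂ} {κ : ℝ}, Continuous Z →
      (∀ y, HasDerivAt W (Z y) y) → (∀ y, ‖Z y‖ ≤ κ) → (∀ y, ‖W y‖ ≤ κ * ε ^ 3) →
      ‖∫ u in (-3:ℝ)..3, (e s u : ℂ) * Z ((s ^ 3 / 3 - b₁ * s) + (u ^ 3 / 3 - b₂ * u))‖
        ≤ 28 * (κ * M) * ε := fun _ hd hc hb hb' _ _ _ hZ hW bZ bW =>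
    norm_cubic_integral_le hε hZ hW bZ bW hd hc hb hb'
  refine (norm_integral_le_of_quadratic (ε := ε) (b := b₁) (K := 28 * (K * M) * ε)
    (R₁ := fun s => ∫ u in (-3:ℝ)..3,
      (c s u : ℂ) * Z₁ ((s ^ 3 / 3 - b₁ * s) + (u ^ 3 / 3 - b₂ * u)))
    (R₂ := fun s => ∫ u in (-3:ℝ)..3,
      (cs s u : ℂ) * Z₁ ((s ^ 3 / 3 - b₁ * s) + (u ^ 3 / 3 - b₂ * u))) hε ?_
    ((continuousOn_intervalIntegral_param hU hab (jc c1 hZ₀)).mono hI)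
    ((continuousOn_intervalIntegral_param hU hab (jc c2 hZ₁c)).mono hI) ?_ ?_ ?_).trans
    (le_of_eq (by ring))
  · intro s hs
    have hd := hasDerivAt_intervalIntegral_param hU hab (hI hs) (jc c1 hZ₁c)
      (F' := fun s u => ((s ^ 2 - b₁ : ℝ) : ℂ) * ((c s u : ℂ) *
        Z₀ ((s ^ 3 / 3 - b₁ * s) + (u ^ 3 / 3 - b₂ * u))) + (cs s u : ℂ) *
        Z₁ ((s ^ 3 / 3 - b₁ * s) + (u ^ 3 / 3 - b₂ * u))) ?_ ?_
    · refine hd.congr_deriv ?_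
      have i0 : IntervalIntegrable (fun u => (c s u : ℂ) *
          Z₀ ((s ^ 3 / 3 - b₁ * s) + (u ^ 3 / 3 - b₂ * u))) volume (-3) 3 :=
        ((jc c1 hZ₀).comp (f := fun u => (s, u)) (by fun_prop)
          fun u hu => ⟨hI hs, hu⟩).intervalIntegrable_of_Icc hab
      have i1 : IntervalIntegrable (fun u => (cs s u : ℂ) *
          Z₁ ((s ^ 3 / 3 - b₁ * s) + (u ^ 3 / 3 - b₂ * u))) volume (-3) 3 :=
        ((jc c2 hZ₁c).comp (f := fun u => (s, u)) (by fun_prop)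
          fun u hu => ⟨hI hs, hu⟩).intervalIntegrable_of_Icc hab
      rw [intervalIntegral.integral_add (i0.const_mul _) i1, intervalIntegral.integral_const_mul]
    · refine ContinuousOn.add (ContinuousOn.mul ?_ (jc c1 hZ₀)) (jc c2 hZ₁c)
      exact (by fun_prop : Continuous fun p : ℝ × ℝ => ((p.1 ^ 2 - b₁ : ℝ) : ℂ)).continuousOn
    · intro s hs u hu
      have h1 : HasDerivAt (fun s : ℝ => (s ^ 3 / 3 - b₁ * s) + (u ^ 3 / 3 - b₂ * u)) (s ^ 2 - b₁) s :=
        (((((hasDerivAt_id s).pow 3).div_const 3).sub ((hasDerivAt_id s).const_mul b₁)).add_const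
          _).congr_deriv (by simp)
      refine ((c5 s hs u (hI hu)).1.ofReal_comp.mul (HasDerivAt.scomp s (hZ₁ _) h1)).congr_deriv ?_
      simp only [Complex.real_smul, Function.comp_apply]
      ring
  · intro s hs
    exact inner hs (fun u hu => (c5 s (hI hs) u (hI hu)).2.1) (sl c3 hs)
      (fun u hu => (c5 s (hI hs) u (hI hu)).2.2.2.1)
      (fun u hu => (c5 s (hI hs) u (hI hu)).2.2.2.2.2.1) hZ₀ hZ₁ k₀ k₁
  · intro s hs
    refine (inner hs (fun u hu => (c5 s (hI hs) u (hI hu)).2.1) (sl c3 hs)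
      (fun u hu => (c5 s (hI hs) u (hI hu)).2.2.2.1)
      (fun u hu => (c5 s (hI hs) u (hI hu)).2.2.2.2.2.1) hZ₁c hZ₂ k₁ k₂).trans (le_of_eq (by ring))
  · intro s hs
    refine (inner hs (fun u hu => (c5 s (hI hs) u (hI hu)).2.2.1) (sl c4 hs)
      (fun u hu => (c5 s (hI hs) u (hI hu)).2.2.2.2.1)
      (fun u hu => (c5 s (hI hs) u (hI hu)).2.2.2.2.2.2) hZ₁c hZ₂ k₁ k₂).trans (le_of_eq (by ring))

/-- The integral `∫ β(v) e^{i (Λ v M + n B(Λ v))} dv`. -/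
noncomputable def slowOsc (B : ℝ → ℝ) (Λ n : ℝ) (β : ℝ → ℝ) (M : ℝ) : ℂ :=
  ∫ v in (2/5:ℝ)..23, cexp (I * ((Λ * v * M + n * B (Λ * v) : ℝ) : ℂ)) * (β v : ℂ)

theorem norm_slowOsc_le {B B₁ B₂ : ℝ → ℝ} {c Λ n P M : ℝ} {β β' : ℝ → ℝ} (hc : 0 < c) (hΛ : 3 ≤ Λ)
    (hn : n ≠ 0) (hB : ∀ u, 0 < u → HasDerivAt B (B₁ u) u)
    (hB₁ : ∀ u, 0 < u → HasDerivAt B₁ (B₂ u) u) (hB₂ : ContinuousOn B₂ (Ioi 0))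
    (hlow : ∀ u, 1 ≤ u → c / u ^ 3 ≤ B₂ u)
    (hβ : ∀ v ∈ Icc (2/5:ℝ) 23, HasDerivAt β (β' v) v) (hβ'c : ContinuousOn β' (Icc (2/5) 23))
    (bβ : ∀ v ∈ Icc (2/5:ℝ) 23, |β v| ≤ P) (bβ' : ∀ v ∈ Icc (2/5:ℝ) 23, |β' v| ≤ P) :
    ‖slowOsc B Λ n β M‖ ≤ 30000 / √c * P * (√Λ / √|n|) := by
  have hP : 0 ≤ P := (abs_nonneg _).trans (bβ 1 ⟨by norm_num, by norm_num⟩)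
  have hΛ0 : 0 < Λ := by linarith
  have hn0 : 0 < |n| := abs_pos.2 hn
  set m := |n| * c / (12167 * Λ) with hm
  have hm0 : 0 < m := by positivity
  have hsq : √m = √|n| * √c / (√12167 * √Λ) := by
    rw [hm, Real.sqrt_div (by positivity), Real.sqrt_mul (by positivity),
      Real.sqrt_mul (by positivity)]
  have hab : (2/5:ℝ) ≤ 23 := by norm_num
  have hpos : ∀ v ∈ Icc (2/5:ℝ) 23, 0 < Λ * v := fun v hv => by
    have := hv.1
    have : 0 < v := by linarith
    positivity
  have hlin : ∀ v, HasDerivAt (fun v => Λ * v) Λ v := fun v => by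
    simpa using (hasDerivAt_id v).const_mul Λ
  have d1 : ∀ v ∈ Icc (2/5:ℝ) 23, HasDerivAt (fun v => Λ * v * M + n * B (Λ * v))
      (Λ * M + n * (B₁ (Λ * v) * Λ)) v := fun v hv =>
    ((hlin v).mul_const M).add (((hB _ (hpos v hv)).comp v (hlin v)).const_mul n)
  have d2 : ∀ v ∈ Icc (2/5:ℝ) 23, HasDerivAt (fun v => Λ * M + n * (B₁ (Λ * v) * Λ))
      (n * (B₂ (Λ * v) * Λ * Λ)) v := fun v hv =>
    ((((hB₁ _ (hpos v hv)).comp v (hlin v)).mul_const Λ).const_mul n).const_add _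
  have d2c : ContinuousOn (fun v => n * (B₂ (Λ * v) * Λ * Λ)) (Icc (2/5) 23) := by
    refine continuousOn_const.mul (((hB₂.comp (by fun_prop) hpos).mul
      continuousOn_const).mul continuousOn_const)
  have hsize : ∀ v ∈ Icc (2/5:ℝ) 23, m ≤ |n| * (B₂ (Λ * v) * Λ * Λ) := fun v hv => by
    have hv0 : 0 < v := by linarith [hv.1]
    have h1 : 1 ≤ Λ * v := by nlinarith [hv.1]
    have h2 : v ^ 3 ≤ 23 ^ 3 := by gcongr; exact hv.2
    calc m = |n| * (c / (12167 * Λ ^ 3) * Λ * Λ) := by rw [hm]; field_simp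
      _ ≤ |n| * (c / (Λ * v) ^ 3 * Λ * Λ) := by
        gcongr
        rw [mul_pow]
        nlinarith [pow_pos hΛ0 3]
      _ ≤ _ := by
        gcongr
        exact hlow _ h1
  have hsign : (∀ v ∈ Icc (2/5:ℝ) 23, m ≤ n * (B₂ (Λ * v) * Λ * Λ)) ∨
      ∀ v ∈ Icc (2/5:ℝ) 23, n * (B₂ (Λ * v) * Λ * Λ) ≤ -m := by
    rcases lt_or_gt_of_ne hn with h | h
    · refine Or.inr fun v hv => ?_
      have := hsize v hv
      rw [abs_of_neg h] at this
      linarith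
    · refine Or.inl fun v hv => ?_
      have := hsize v hv
      rwa [abs_of_pos h] at this
  have hE : ContinuousOn (fun v => cexp (I * ((Λ * v * M + n * B (Λ * v) : ℝ) : ℂ)))
      (Icc (2/5) 23) := fun v hv =>
    (continuousAt_const.mul (continuous_ofReal.continuousAt.comp
      (d1 v hv).continuousAt)).cexp.continuousWithinAt
  refine (norm_integral_mul_le_const (K := 8 / √m) (W₀ := P) (W₁ := P) hab hE
    (fun v hv => (hβ v hv).ofReal_comp) (continuous_ofReal.comp_continuousOn hβ'c) ?_ ?_
    ?_).trans ?_
  · intro x hx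
    have hsub : Icc (2/5) x ⊆ Icc (2/5:ℝ) 23 := Icc_subset_Icc le_rfl hx.2
    exact vdC_two hx.1 hm0 (fun v hv => d1 v (hsub hv)) (fun v hv => d2 v (hsub hv)) (d2c.mono hsub)
      (hsign.imp (fun h v hv => h v (hsub hv)) fun h v hv => h v (hsub hv))
  · intro v hv
    rw [norm_real]
    exact bβ v hv
  · intro v hv
    rw [norm_real]
    exact bβ' v hv
  · have h1 : √12167 ≤ 111 := by
      rw [Real.sqrt_le_left (by norm_num)]
      norm_num
    have hs1 : 0 < √|n| := sqrt_pos.2 hn0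
    have hs2 : 0 < √c := sqrt_pos.2 hc
    have hs3 : 0 < √Λ := sqrt_pos.2 hΛ0
    rw [hsq]
    calc 8 / (√|n| * √c / (√12167 * √Λ)) * (P + P * (23 - 2 / 5))
        = √12167 * (944 / 5 / √c * P * (√Λ / √|n|)) := by field_simp; ring
      _ ≤ 111 * (944 / 5 / √c * P * (√Λ / √|n|)) := by gcongr
      _ = 104784 / 5 * (1 / √c * P * (√Λ / √|n|)) := by field_simp; ring
      _ ≤ 30000 * (1 / √c * P * (√Λ / √|n|)) := by gcongr; norm_num
      _ = _ := by field_simp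

theorem continuousOn_slowOsc_integrand {E : Type*} [TopologicalSpace E] {B : ℝ → ℝ} {Λ n : ℝ}
    {e : E → ℝ → ℝ} {M : E → ℝ} {U : Set E} (hΛ : 0 < Λ) (hB : ContinuousOn B (Ioi 0))
    (hM : ContinuousOn M U) (he : ContinuousOn (uncurry e) (U ×ˢ Icc (2/5) 23)) :
    ContinuousOn (uncurry fun x v =>
      cexp (I * ((Λ * v * M x + n * B (Λ * v) : ℝ) : ℂ)) * (e x v : ℂ))
      (U ×ˢ Icc (2/5) 23) := by
  refine ContinuousOn.mul (ContinuousOn.cexp (continuousOn_const.mul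
    (continuous_ofReal.comp_continuousOn (ContinuousOn.add ?_ ?_))))
    (continuous_ofReal.comp_continuousOn he)
  · exact (continuousOn_const.mul continuousOn_snd).mul (hM.comp continuousOn_fst fun p hp => hp.1)
  · refine continuousOn_const.mul (hB.comp (continuousOn_const.mul continuousOn_snd) fun p hp => ?_)
    have : 0 < p.2 := by linarith [hp.2.1]
    exact mul_pos hΛ this

theorem continuousOn_slowOsc {E : Type*} [PseudoMetricSpace E] [ProperSpace E] {B : ℝ → ℝ} {Λ n : ℝ}
    {e : E → ℝ → ℝ} {M : E → ℝ} {U : Set E} (hU : IsOpen U) (hΛ : 0 < Λ)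
    (hB : ContinuousOn B (Ioi 0)) (hM : ContinuousOn M U)
    (he : ContinuousOn (uncurry e) (U ×ˢ Icc (2/5) 23)) :
    ContinuousOn (fun x => slowOsc B Λ n (e x) (M x)) U :=
  continuousOn_intervalIntegral_param hU (by norm_num) (continuousOn_slowOsc_integrand hΛ hB hM he)

theorem hasDerivAt_slowOsc {B : ℝ → ℝ} {Λ n x₀ : ℝ} {e e' : ℝ → ℝ → ℝ} {M M' : ℝ → ℝ} {U : Set ℝ}
    (hU : IsOpen U) (hx₀ : x₀ ∈ U) (hΛ : 0 < Λ) (hB : ContinuousOn B (Ioi 0))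
    (hM : ∀ x ∈ U, HasDerivAt M (M' x) x) (hM' : ContinuousOn M' U)
    (hec : ContinuousOn (uncurry e) (U ×ˢ Icc (2/5) 23))
    (he'c : ContinuousOn (uncurry e') (U ×ˢ Icc (2/5) 23))
    (he : ∀ x ∈ U, ∀ v ∈ Icc (2/5:ℝ) 23, HasDerivAt (fun x => e x v) (e' x v) x) :
    HasDerivAt (fun x => slowOsc B Λ n (e x) (M x))
      (I * Λ * M' x₀ * slowOsc B Λ n (fun v => v * e x₀ v) (M x₀) + slowOsc B Λ n (e' x₀) (M x₀))
      x₀ := by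
  have hMc : ContinuousOn M U := fun x hx => (hM x hx).continuousAt.continuousWithinAt
  have hve : ContinuousOn (uncurry fun x v => v * e x v) (U ×ˢ Icc (2/5) 23) :=
    continuousOn_snd.mul hec
  have c0 := continuousOn_slowOsc_integrand (n := n) hΛ hB hMc hec
  have c1 := continuousOn_slowOsc_integrand (n := n) hΛ hB hMc hve
  have c2 := continuousOn_slowOsc_integrand (n := n) hΛ hB hMc he'c
  have hab : (2/5:ℝ) ≤ 23 := by norm_num
  have hd := hasDerivAt_intervalIntegral_param hU hab hx₀ c0 (F' := fun x v =>
    I * Λ * M' x * (cexp (I * ((Λ * v * M x + n * B (Λ * v) : ℝ) : ℂ)) *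
      ((v * e x v : ℝ) : ℂ)) + cexp (I * ((Λ * v * M x + n * B (Λ * v) : ℝ) : ℂ)) *
      (e' x v : ℂ)) ?_ ?_
  · refine hd.congr_deriv ?_
    have sl : ∀ {F : ℝ → ℝ → ℂ}, ContinuousOn (uncurry F) (U ×ˢ Icc (2/5) 23) →
        IntervalIntegrable (F x₀) volume (2/5) 23 := fun {F} h =>
      (h.comp (f := fun v => (x₀, v)) (by fun_prop) fun v hv =>
        ⟨hx₀, hv⟩).intervalIntegrable_of_Icc hab
    rw [intervalIntegral.integral_add ((sl c1).const_mul _) (sl c2),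
      intervalIntegral.integral_const_mul]
    rfl
  · refine ContinuousOn.add (ContinuousOn.mul ?_ c1) c2
    exact continuousOn_const.mul (continuous_ofReal.comp_continuousOn
      (hM'.comp continuousOn_fst fun p hp => hp.1))
  · intro x hx v hv
    have h1 : HasDerivAt (fun x => Λ * v * M x + n * B (Λ * v)) (Λ * v * M' x) x :=
      ((hM x hx).const_mul _).add_const _
    refine (((h1.ofReal_comp.const_mul I).cexp).mul (he x hx v hv).ofReal_comp).congr_deriv ?_
    push_cast
    ring

theorem norm_integral_le_of_singular_ibp {R₀ R₁ R₂ : ℝ → ℂ} {a b c δ K M : ℝ} (hab : a ≤ b)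
    (hδ : 0 < δ) (hM : 0 ≤ M) (hR₀c : ContinuousOn R₀ (Icc a b))
    (hK : ∀ x ∈ Icc a b, ‖R₀ x‖ ≤ K)
    (hd : ∀ x ∈ Icc a b, δ ≤ |x - c| → HasDerivAt R₁ (R₀ x + R₂ x) x)
    (hR₂c : ContinuousOn R₂ {x ∈ Icc a b | δ ≤ |x - c|})
    (hR₁ : ∀ x ∈ Icc a b, δ ≤ |x - c| → ‖R₁ x‖ ≤ M / |x - c|)
    (hR₂ : ∀ x ∈ Icc a b, δ ≤ |x - c| → ‖R₂ x‖ ≤ M / |x - c| ^ 2) :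
    ‖∫ x in a..b, R₀ x‖ ≤ 6 * M / δ + 2 * δ * K := by
  have main : ∀ x y, a ≤ x → x ≤ y → y ≤ b → ((∀ t ∈ Icc x y, δ ≤ t - c) ∨
      ∀ t ∈ Icc x y, t - c ≤ -δ) → ‖∫ t in x..y, R₀ t‖ ≤ 3 * M / δ := by
    intro x y hx hxy hy hs
    have hs' : ∀ t ∈ Icc x y, δ ≤ |t - c| := fun t ht => by
      rcases hs with hs | hs
      · exact (hs t ht).trans (le_abs_self _)
      · have := hs t ht
        have := neg_le_abs (t - c)
        linarith
    have hsub : Icc x y ⊆ {x ∈ Icc a b | δ ≤ |x - c|} := fun t ht =>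
      ⟨⟨hx.trans ht.1, ht.2.trans hy⟩, hs' t ht⟩
    have hsub' : Icc x y ⊆ Icc a b := fun t ht => (hsub ht).1
    have i0 : IntervalIntegrable R₀ volume x y := (hR₀c.mono hsub').intervalIntegrable_of_Icc hxy
    have i2 : IntervalIntegrable R₂ volume x y := (hR₂c.mono hsub).intervalIntegrable_of_Icc hxy
    have hftc := integral_eq_sub_of_hasDerivAt (a := x) (b := y) (f := R₁)
      (f' := fun t => R₀ t + R₂ t) (fun t ht => by
        rw [uIcc_of_le hxy] at ht
        exact hd t (hsub ht).1 (hsub ht).2) (i0.add i2)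
    rw [intervalIntegral.integral_add i0 i2] at hftc
    have hne : ∀ t ∈ Icc x y, t - c ≠ 0 := fun t ht h => by
      have := hs' t ht
      rw [h, abs_zero] at this
      linarith
    have hinv : ∀ t ∈ Icc x y, HasDerivAt (fun t => -M * (t - c)⁻¹) (M / |t - c| ^ 2) t :=
      fun t ht => ((((hasDerivAt_id t).sub_const c).fun_inv (hne t ht)).const_mul (-M)).congr_deriv
        (by rw [sq_abs]; simp; field_simp)
    have hMc : ContinuousOn (fun t => M / |t - c| ^ 2) (Icc x y) :=
      continuousOn_const.div (by fun_prop) fun t ht => by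
        have := abs_pos.2 (hne t ht)
        positivity
    have h2 : ‖∫ t in x..y, R₂ t‖ ≤ -M * (y - c)⁻¹ - -M * (x - c)⁻¹ := by
      rw [← integral_eq_sub_of_hasDerivAt (fun t ht => hinv t
        (uIcc_of_le hxy ▸ ht)) (hMc.intervalIntegrable_of_Icc hxy)]
      refine intervalIntegral.norm_integral_le_of_norm_le hxy (ae_of_all _ fun t ht => ?_)
        (hMc.intervalIntegrable_of_Icc hxy)
      exact hR₂ t (hsub (Ioc_subset_Icc_self ht)).1 (hsub (Ioc_subset_Icc_self ht)).2
    have e : ∀ t ∈ Icc x y, M / |t - c| ≤ M / δ := fun t ht => by gcongr; exact hs' t ht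
    have hxm : x ∈ Icc x y := left_mem_Icc.2 hxy
    have hym : y ∈ Icc x y := right_mem_Icc.2 hxy
    have h3 : -M * (y - c)⁻¹ - -M * (x - c)⁻¹ ≤ M / δ := by
      rcases hs with hs | hs
      · have h1 := hs x hxm
        have h2 := hs y hym
        have h3 : M * (x - c)⁻¹ ≤ M / δ := by rw [div_eq_mul_inv]; gcongr
        have h4 : 0 ≤ M * (y - c)⁻¹ := mul_nonneg hM (inv_nonneg.2 (by linarith))
        linarith
      · have h1 := hs x hxm
        have h2 := hs y hym
        have h3 : M * (-(y - c))⁻¹ ≤ M / δ := by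
          rw [div_eq_mul_inv]
          gcongr
          linarith
        have h4 : 0 ≤ M * (-(x - c))⁻¹ := mul_nonneg hM (inv_nonneg.2 (by linarith))
        rw [inv_neg] at h3 h4
        linarith
    have h4 := (hR₁ x (hsub hxm).1 (hsub hxm).2).trans (e x hxm)
    have h5 := (hR₁ y (hsub hym).1 (hsub hym).2).trans (e y hym)
    rw [eq_sub_of_add_eq hftc]
    have h6 := norm_sub_le (R₁ y - R₁ x) (∫ t in x..y, R₂ t)
    have h7 := norm_sub_le (R₁ y) (R₁ x)
    have : 3 * M / δ = M / δ + M / δ + M / δ := by ring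
    linarith
  have hK0 : 0 ≤ K := (norm_nonneg _).trans (hK a ⟨le_rfl, hab⟩)
  refine (norm_integral_le_of_window (c := c) (δ := δ) (K := K) (M := 3 * M / δ) hab hδ.le
    (by positivity) hR₀c hK ?_ ?_).trans (le_of_eq (by ring))
  · intro x y hx hrx hxy hy
    exact main x y hx hxy hy (Or.inl fun t ht => by linarith [ht.1])
  · intro x y hx hxy hyr hy
    exact main x y hx hxy hy (Or.inr fun t ht => by linarith [ht.2])

theorem exists_center_of_deriv {g g' : ℝ → ℝ} {a b m : ℝ} (hab : a ≤ b)
    (hg : ∀ x ∈ Icc a b, HasDerivAt g (g' x) x)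
    (hg' : (∀ x ∈ Icc a b, m ≤ g' x) ∨ ∀ x ∈ Icc a b, g' x ≤ -m) :
    ∃ c ∈ Icc a b, ∀ x ∈ Icc a b, m * |x - c| ≤ |g x| := by
  wlog hpos : ∀ x ∈ Icc a b, m ≤ g' x generalizing g g'
  · have hneg := hg'.resolve_left hpos
    have h1 : ∀ x ∈ Icc a b, m ≤ -g' x := fun x hx => by linarith [hneg x hx]
    simpa using this (g := fun x => -g x) (g' := fun x => -g' x) (fun x hx => (hg x hx).neg)
      (Or.inl h1) h1
  obtain ⟨c, hc, hr, hl⟩ := exists_center_of_deriv_ge hab hg hpos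
  refine ⟨c, hc, fun x hx => ?_⟩
  rcases eq_or_ne x c with rfl | hne
  · simp
  rcases le_total c x with h | h
  · rw [abs_of_nonneg (sub_nonneg.2 h)]
    exact ((hr x hx h).resolve_right hne).trans (le_abs_self _)
  · rw [abs_of_nonpos (sub_nonpos.2 h)]
    have := (hl x hx h).resolve_right hne
    have := neg_le_abs (g x)
    linarith

/-- `β` and `β'` are bounded by `P` on `[2/5, 23]`. -/
def IsSlowAmplitude (P : ℝ) (β : ℝ → ℝ) : Prop :=
  ∃ β' : ℝ → ℝ, ContinuousOn β' (Icc (2/5) 23) ∧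
    ∀ v ∈ Icc (2/5:ℝ) 23, HasDerivAt β (β' v) v ∧ |β v| ≤ P ∧ |β' v| ≤ P

theorem IsSlowAmplitude.continuousOn {P : ℝ} {β : ℝ → ℝ} (h : IsSlowAmplitude P β) :
    ContinuousOn β (Icc (2/5) 23) := by
  obtain ⟨β', _, hb⟩ := h
  exact fun v hv => (hb v hv).1.continuousAt.continuousWithinAt

theorem IsSlowAmplitude.div_id {P : ℝ} {β : ℝ → ℝ} (h : IsSlowAmplitude P β) :
    IsSlowAmplitude (9 * P) fun v => β v / v := by
  have hβc := h.continuousOn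
  obtain ⟨β', hc, hb⟩ := h
  have h0 : ∀ v ∈ Icc (2/5:ℝ) 23, v ≠ 0 := fun v hv => by
    have := hv.1
    have : 0 < v := by linarith
    exact this.ne'
  refine ⟨fun v => (β' v * v - β v) / v ^ 2, (((hc.mul continuousOn_id).sub hβc).div
    (by fun_prop) fun v hv => pow_ne_zero 2 (h0 v hv)), fun v hv => ?_⟩
  obtain ⟨d, b, b'⟩ := hb v hv
  have hv0 : 0 < v := by linarith [hv.1]
  have hP : 0 ≤ P := (abs_nonneg _).trans b
  refine ⟨?_, ?_, ?_⟩
  · exact (d.fun_div (hasDerivAt_id v) hv0.ne').congr_deriv (by simp)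
  · rw [abs_div, abs_of_pos hv0, div_le_iff₀ hv0]
    nlinarith [hv.1]
  · rw [abs_div, abs_of_pos (by positivity : 0 < v ^ 2), div_le_iff₀ (by positivity)]
    calc |β' v * v - β v| ≤ |β' v * v| + |β v| := abs_sub _ _
      _ ≤ P * v + P := by rw [abs_mul, abs_of_pos hv0]; gcongr
      _ ≤ 9 * P * v ^ 2 := by
        have h1 : 0 ≤ 9 * v ^ 2 - v - 1 := by nlinarith [hv.1]
        nlinarith [mul_nonneg hP h1]

/-- The part of the phase depending on the launching variables `S` and `u`. -/
noncomputable def launchPhase (X S u A : ℝ) : ℝ := S ^ 3 / 3 + S * (1 - A) + u ^ 3 / 3 + u * (X - A)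

/-- The coefficient of `Λ v`, where `v = η A^{3/2}`, when the launch phase equals `y`. -/
noncomputable def mixPhase (a n T Y A y : ℝ) : ℝ :=
  (Y + T * travelTime a A + y) / A ^ ((3:ℝ)/2) - 4 / 3 * n

/-- `A^{5/2} ∂_A` of `mixPhase`, without the launching variables. -/
noncomputable def restSlope (a T Y A : ℝ) : ℝ :=
  A * (T * (√(1 + a) / (2 * √(1 + a * A)))) - 3 / 2 * (Y + T * travelTime a A)

/-- `A^{5/2} ∂_A` of `mixPhase` along the launch phase. -/
noncomputable def mixSlope (a T X Y S u A : ℝ) : ℝ :=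
  restSlope a T Y A - (A * (S + u) + 3 / 2 * launchPhase X S u A)

/-- The derivative of `restSlope` divided by `-T`. -/
noncomputable def slopeRate (a A : ℝ) : ℝ :=
  A * (√(1 + a) * a / (4 * √(1 + a * A) ^ 3)) + √(1 + a) / √(1 + a * A) / 4

theorem hasDerivAt_launchPhase (X S u A : ℝ) :
    HasDerivAt (launchPhase X S u) (-(S + u)) A := by
  unfold launchPhase
  have h := (((((hasDerivAt_id A).const_sub 1).const_mul S).const_add (S ^ 3 / 3)).add_const
    (u ^ 3 / 3)).add (((hasDerivAt_id A).const_sub X).const_mul u)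
  exact h.congr_deriv (by ring)

theorem rpow_three_halves_eq {A : ℝ} (hA : 0 < A) : A ^ ((3:ℝ)/2) = A * √A := by
  rw [Real.sqrt_eq_rpow, ← Real.rpow_one_add' hA.le (by norm_num)]
  norm_num

theorem hasDerivAt_restSlope {a T Y A : ℝ} (ha : 0 < a) (hA : 0 < A) :
    HasDerivAt (restSlope a T Y) (-(T * slopeRate a A)) A := by
  unfold restSlope slopeRate
  have h1 := hasDerivAt_travelTime ha hA
  have h2 := hasDerivAt_travelTime_deriv ha hA
  refine (((hasDerivAt_id A).mul (h2.const_mul T)).sub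
    (((h1.const_mul T).const_add Y).const_mul (3 / 2))).congr_deriv ?_
  have hρ := one_lt_sqrt_one_add_mul ha hA
  have hρ0 : √(1 + a * A) ≠ 0 := by positivity
  simp only [id]
  field_simp
  ring

theorem hasDerivAt_mixSlope {a T X Y S u A : ℝ} (ha : 0 < a) (hA : 0 < A) :
    HasDerivAt (mixSlope a T X Y S u) (-(T * slopeRate a A) + (S + u) / 2) A := by
  unfold mixSlope
  refine ((hasDerivAt_restSlope ha hA).sub (((hasDerivAt_id A).mul_const (S + u)).add
    ((hasDerivAt_launchPhase X S u A).const_mul (3 / 2)))).congr_deriv ?_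
  ring

theorem hasDerivAt_mixPhase {a n T X Y S u A : ℝ} (ha : 0 < a) (hA : 0 < A) :
    HasDerivAt (fun A => mixPhase a n T Y A (launchPhase X S u A))
      (mixSlope a T X Y S u A / (A * A ^ ((3:ℝ)/2))) A := by
  unfold mixPhase mixSlope restSlope
  have h1 := hasDerivAt_travelTime ha hA
  have hσ : A ^ ((3:ℝ)/2) ≠ 0 := (Real.rpow_pos_of_pos hA _).ne'
  refine (((((h1.const_mul T).const_add Y).add (hasDerivAt_launchPhase X S u A)).div
    (hasDerivAt_rpow_three_halves hA) hσ).sub_const (4 / 3 * n)).congr_deriv ?_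
  have hs : √A ^ 2 = A := sq_sqrt hA.le
  have hs0 : √A ≠ 0 := (sqrt_pos.2 hA).ne'
  have hρ := one_lt_sqrt_one_add_mul ha hA
  simp only [Pi.add_apply]
  rw [rpow_three_halves_eq hA]
  generalize √(1 + a * A) = ρ at *
  generalize travelTime a A = γ at *
  generalize launchPhase X S u A = g at *
  generalize √A = w at *
  subst hs
  have : ρ ≠ 0 := by positivity
  field_simp
  ring

theorem slopeRate_bounds {a A : ℝ} (ha : 0 < a) (ha' : a ≤ 1 / 200) (hA : 0 < A) (hA' : A ≤ 8) :
    1 / 8 ≤ slopeRate a A ∧ slopeRate a A ≤ 1 := by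
  obtain ⟨h1, h2, -, -⟩ := sqrt_one_add_div_bounds ha ha' hA hA'
  obtain ⟨h3, h4, h5, -⟩ := sqrt_one_add_bounds ha ha' hA hA'
  unfold slopeRate
  have h6 : A * (√(1 + a) * a / (4 * √(1 + a * A) ^ 3)) ≤ 1 / 10 := by
    calc A * (√(1 + a) * a / (4 * √(1 + a * A) ^ 3)) ≤ 8 * (11 / 10 * (1 / 200) / (4 * 1 ^ 3)) := by
          gcongr
      _ ≤ _ := by norm_num
  have h7 : 0 ≤ A * (√(1 + a) * a / (4 * √(1 + a * A) ^ 3)) := by positivity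
  constructor <;> linarith

theorem continuousOn_slopeRate {a : ℝ} (ha : 0 < a) : ContinuousOn (slopeRate a) (Ioi 0) := by
  unfold slopeRate
  have h : ∀ A ∈ Ioi (0:ℝ), √(1 + a * A) ≠ 0 := fun A hA => by
    have := one_lt_sqrt_one_add_mul ha hA
    positivity
  refine (continuousOn_id.mul (continuousOn_const.div (by fun_prop) fun A hA => ?_)).add
    ((continuousOn_const.div (by fun_prop) h).div_const 4)
  exact mul_ne_zero (by norm_num) (pow_ne_zero 3 (h A hA))

/-- The reciprocal of `∂_A mixPhase`. -/
noncomputable def mixWeight (a T X Y S u A : ℝ) : ℝ :=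
  A * A ^ ((3:ℝ)/2) * (mixSlope a T X Y S u A)⁻¹

/-- The derivative of `mixWeight` in `A`. -/
noncomputable def mixWeight' (a T X Y S u A : ℝ) : ℝ :=
  5 / 2 * A ^ ((3:ℝ)/2) * (mixSlope a T X Y S u A)⁻¹ +
    A * A ^ ((3:ℝ)/2) * ((T * slopeRate a A - (S + u) / 2) * (mixSlope a T X Y S u A)⁻¹ ^ 2)

theorem hasDerivAt_mixWeight {a T X Y S u A : ℝ} (ha : 0 < a) (hA : 0 < A)
    (hk : mixSlope a T X Y S u A ≠ 0) :
    HasDerivAt (mixWeight a T X Y S u) (mixWeight' a T X Y S u A) A := by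
  unfold mixWeight mixWeight'
  refine (((hasDerivAt_id A).mul (hasDerivAt_rpow_three_halves hA)).mul
    ((hasDerivAt_mixSlope ha hA).fun_inv hk)).congr_deriv ?_
  simp only [id, Pi.mul_apply]
  rw [rpow_three_halves_eq hA]
  field_simp
  ring

theorem rpow_three_halves_bounds {A : ℝ} (h1 : 89 / 100 ≤ A) (h2 : A ≤ 61 / 10) :
    4 / 5 ≤ A ^ ((3:ℝ)/2) ∧ A ^ ((3:ℝ)/2) ≤ 16 := by
  rw [rpow_three_halves_eq (by linarith)]
  have h3 : 94 / 100 ≤ √A := Real.le_sqrt_of_sq_le (by linarith)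
  have h4 : √A ≤ 5 / 2 := by
    rw [Real.sqrt_le_left (by norm_num)]
    linarith
  constructor <;> nlinarith

/-- A family of slow amplitudes with derivative `e'` in the parameter. -/
structure IsSlowFamily (P : ℝ) (e e' : ℝ → ℝ → ℝ) : Prop where
  nonneg : 0 ≤ P
  continuousOn : ContinuousOn (uncurry e) (Ioi 0 ×ˢ Icc (2/5) 23)
  continuousOn' : ContinuousOn (uncurry e') (Ioi 0 ×ˢ Icc (2/5) 23)
  hasDerivAt : ∀ A, 0 < A → ∀ v ∈ Icc (2/5:ℝ) 23, HasDerivAt (fun A => e A v) (e' A v) A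
  slow : ∀ A ∈ Icc (89/100:ℝ) (61/10), IsSlowAmplitude P (e A)
  slow' : ∀ A ∈ Icc (89/100:ℝ) (61/10), IsSlowAmplitude P (e' A)
  slow_mul : ∀ A ∈ Icc (89/100:ℝ) (61/10), IsSlowAmplitude P fun v => v * e A v

theorem IsSlowFamily.hasDerivAt_mixWeight_mul {P Λ n a T X Y S u A : ℝ} {B : ℝ → ℝ}
    {e e' : ℝ → ℝ → ℝ} (h : IsSlowFamily P e e') (hΛ : 0 < Λ) (hB : ContinuousOn B (Ioi 0))
    (ha : 0 < a) (hA : 0 < A) (hk : mixSlope a T X Y S u A ≠ 0) :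
    HasDerivAt (fun A => (mixWeight a T X Y S u A : ℂ) *
        slowOsc B Λ n (e A) (mixPhase a n T Y A (launchPhase X S u A)))
      (I * Λ * slowOsc B Λ n (fun v => v * e A v) (mixPhase a n T Y A (launchPhase X S u A)) +
        ((mixWeight a T X Y S u A : ℂ) *
          slowOsc B Λ n (e' A) (mixPhase a n T Y A (launchPhase X S u A)) +
        (mixWeight' a T X Y S u A : ℂ) *
          slowOsc B Λ n (e A) (mixPhase a n T Y A (launchPhase X S u A)))) A := by
  have hM' : ContinuousOn (fun A => mixSlope a T X Y S u A / (A * A ^ ((3:ℝ)/2))) (Ioi 0) := by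
    refine ContinuousOn.div (fun A hA => (hasDerivAt_mixSlope ha
      hA).continuousAt.continuousWithinAt) (continuousOn_id.mul fun A hA =>
      (hasDerivAt_rpow_three_halves hA).continuousAt.continuousWithinAt) fun A hA => ?_
    exact mul_ne_zero hA.ne' (Real.rpow_pos_of_pos hA _).ne'
  refine ((hasDerivAt_mixWeight ha hA hk).ofReal_comp.mul (hasDerivAt_slowOsc (n := n) isOpen_Ioi hA
    hΛ hB (fun A hA => hasDerivAt_mixPhase (n := n) ha hA) hM' h.continuousOn h.continuousOn'
    fun A hA v hv => h.hasDerivAt A hA v hv)).congr_deriv ?_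
  have hσ : A * A ^ ((3:ℝ)/2) ≠ 0 := mul_ne_zero hA.ne' (Real.rpow_pos_of_pos hA _).ne'
  have h1 : (mixWeight a T X Y S u A : ℂ) *
      ((mixSlope a T X Y S u A / (A * A ^ ((3:ℝ)/2)) : ℝ) : ℂ) = 1 := by
    rw [← Complex.ofReal_mul, mixWeight, ← Complex.ofReal_one]
    congr 1
    field_simp
  linear_combination I * Λ * slowOsc B Λ n (fun v => v * e A v)
    (mixPhase a n T Y A (launchPhase X S u A)) * h1

theorem continuousOn_travelTime {a : ℝ} (ha : 0 < a) : ContinuousOn (travelTime a) (Ioi 0) :=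
  fun _ hA => (hasDerivAt_travelTime ha hA).continuousAt.continuousWithinAt

theorem continuous_launchPhase (X : ℝ) :
    Continuous fun p : ℝ × ℝ × ℝ => launchPhase X p.2.1 p.2.2 p.1 := by
  unfold launchPhase
  fun_prop

theorem continuousOn_mixPhase {a n T X Y : ℝ} (ha : 0 < a) :
    ContinuousOn (fun p : ℝ × ℝ × ℝ => mixPhase a n T Y p.1 (launchPhase X p.2.1 p.2.2 p.1))
      {p | 0 < p.1} := by
  unfold mixPhase
  refine ((ContinuousOn.add (continuousOn_const.add (continuousOn_const.mul
    ((continuousOn_travelTime ha).comp continuousOn_fst fun p hp => hp)))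
    (continuous_launchPhase X).continuousOn).div (continuousOn_fst.rpow_const fun p hp =>
      Or.inr (by norm_num)) fun p hp => (Real.rpow_pos_of_pos hp _).ne').sub continuousOn_const

theorem continuousOn_mixSlope {a T X Y : ℝ} (ha : 0 < a) :
    ContinuousOn (fun p : ℝ × ℝ × ℝ => mixSlope a T X Y p.2.1 p.2.2 p.1) {p | 0 < p.1} := by
  unfold mixSlope
  refine ContinuousOn.sub ?_ ?_
  · exact ContinuousOn.comp (t := Ioi 0) (fun A hA => (hasDerivAt_restSlope ha
      hA).continuousAt.continuousWithinAt) continuousOn_fst fun p hp => hp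
  · exact (Continuous.add (by fun_prop)
      (continuous_const.mul (continuous_launchPhase X))).continuousOn

theorem continuousOn_mixWeight {a T X Y : ℝ} (ha : 0 < a) :
    ContinuousOn (fun p : ℝ × ℝ × ℝ => mixWeight a T X Y p.2.1 p.2.2 p.1)
      {p | 0 < p.1 ∧ mixSlope a T X Y p.2.1 p.2.2 p.1 ≠ 0} := by
  unfold mixWeight
  exact (continuousOn_fst.mul (continuousOn_fst.rpow_const fun p hp =>
    Or.inr (by norm_num))).mul (((continuousOn_mixSlope ha).mono fun p hp => hp.1).inv₀
    fun p hp => hp.2)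

theorem continuousOn_mixWeight' {a T X Y : ℝ} (ha : 0 < a) :
    ContinuousOn (fun p : ℝ × ℝ × ℝ => mixWeight' a T X Y p.2.1 p.2.2 p.1)
      {p | 0 < p.1 ∧ mixSlope a T X Y p.2.1 p.2.2 p.1 ≠ 0} := by
  unfold mixWeight'
  have h1 : ContinuousOn (fun p : ℝ × ℝ × ℝ => p.1 ^ ((3:ℝ)/2))
      {p | 0 < p.1 ∧ mixSlope a T X Y p.2.1 p.2.2 p.1 ≠ 0} :=
    continuousOn_fst.rpow_const fun p hp => Or.inr (by norm_num)
  have h2 : ContinuousOn (fun p : ℝ × ℝ × ℝ => (mixSlope a T X Y p.2.1 p.2.2 p.1)⁻¹)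
      {p | 0 < p.1 ∧ mixSlope a T X Y p.2.1 p.2.2 p.1 ≠ 0} :=
    ((continuousOn_mixSlope ha).mono fun p hp => hp.1).inv₀ fun p hp => hp.2
  refine ((continuousOn_const.mul h1).mul h2).add ((continuousOn_fst.mul h1).mul
    (ContinuousOn.mul (ContinuousOn.sub (continuousOn_const.mul ?_) (by fun_prop)) (h2.pow 2)))
  exact (continuousOn_slopeRate ha).comp continuousOn_fst fun p hp => hp.1

theorem continuousOn_slowOsc_mixPhase {a n T X Y Λ : ℝ} {B : ℝ → ℝ} {f : ℝ → ℝ → ℝ} (ha : 0 < a)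
    (hΛ : 0 < Λ) (hB : ContinuousOn B (Ioi 0))
    (hf : ContinuousOn (uncurry f) (Ioi 0 ×ˢ Icc (2/5) 23)) :
    ContinuousOn (fun p : ℝ × ℝ × ℝ => slowOsc B Λ n (f p.1)
      (mixPhase a n T Y p.1 (launchPhase X p.2.1 p.2.2 p.1))) {p | 0 < p.1} := by
  refine continuousOn_slowOsc (isOpen_lt continuous_const continuous_fst) hΛ hB
    (continuousOn_mixPhase ha) ?_
  exact hf.comp (f := fun q : (ℝ × ℝ × ℝ) × ℝ => (q.1.1, q.2)) (by fun_prop)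
    fun q hq => ⟨hq.1, hq.2⟩

theorem IsSlowFamily.continuousOn_mul {P : ℝ} {e e' : ℝ → ℝ → ℝ} (h : IsSlowFamily P e e') :
    ContinuousOn (uncurry fun A v => v * e A v) (Ioi 0 ×ˢ Icc (2/5) 23) :=
  continuousOn_snd.mul h.continuousOn

/-- Bounds for `B''` making `B` slowly convex. -/
structure IsSlowlyConvex (c : ℝ) (B B₁ B₂ : ℝ → ℝ) : Prop where
  pos : 0 < c
  deriv : ∀ u, 0 < u → HasDerivAt B (B₁ u) u
  deriv₁ : ∀ u, 0 < u → HasDerivAt B₁ (B₂ u) u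
  continuousOn₂ : ContinuousOn B₂ (Ioi 0)
  lower : ∀ u, 1 ≤ u → c / u ^ 3 ≤ B₂ u

theorem IsSlowlyConvex.continuousOn {c : ℝ} {B B₁ B₂ : ℝ → ℝ} (h : IsSlowlyConvex c B B₁ B₂) :
    ContinuousOn B (Ioi 0) := fun u hu => (h.deriv u hu).continuousAt.continuousWithinAt

theorem IsSlowlyConvex.norm_slowOsc_le {c Λ n P M : ℝ} {B B₁ B₂ β : ℝ → ℝ}
    (h : IsSlowlyConvex c B B₁ B₂) (hΛ : 3 ≤ Λ) (hn : n ≠ 0) (hβ : IsSlowAmplitude P β) :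
    ‖slowOsc B Λ n β M‖ ≤ 30000 / √c * P * (√Λ / √|n|) := by
  obtain ⟨β', hc, hb⟩ := hβ
  exact _root_.norm_slowOsc_le h.pos hΛ hn h.deriv h.deriv₁ h.continuousOn₂ h.lower
    (fun v hv => (hb v hv).1) hc (fun v hv => (hb v hv).2.1) fun v hv => (hb v hv).2.2

theorem norm_fixed_launch_integral_le {c₀ P P' Λ n a T X Y S u : ℝ} {B B₁ B₂ : ℝ → ℝ}
    {e e' : ℝ → ℝ → ℝ} {c c' : ℝ → ℝ} (hB : IsSlowlyConvex c₀ B B₁ B₂) (he : IsSlowFamily P e e')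
    (hΛ : 3 ≤ Λ) (hn : n ≠ 0) (ha : 0 < a) (ha' : a ≤ 1 / 200) (hT : 50 ≤ |T|) (hS : |S| ≤ 3)
    (hu : |u| ≤ 3) (hc : ∀ A ∈ Icc (89/100:ℝ) (61/10), HasDerivAt c (c' A) A)
    (hc'c : ContinuousOn c' (Icc (89/100) (61/10)))
    (bc : ∀ A ∈ Icc (89/100:ℝ) (61/10), |c A| ≤ P')
    (bc' : ∀ A ∈ Icc (89/100:ℝ) (61/10), |c' A| ≤ P') :
    ‖∫ A in (89/100:ℝ)..(61/10), (c A : ℂ) * slowOsc B Λ n (fun v => v * e A v)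
        (mixPhase a n T Y A (launchPhase X S u A))‖ ≤
      500000 * (P' * (30000 / √c₀ * P * (√Λ / √|n|))) / √(Λ * |T|) := by
  have hP := he.nonneg
  have hP' : 0 ≤ P' := (abs_nonneg _).trans (bc 1 ⟨by norm_num, by norm_num⟩)
  have hΛ0 : 0 < Λ := by linarith
  have hT0 : 0 < |T| := by linarith
  set κ := 30000 / √c₀ * P * (√Λ / √|n|) with hκ
  have hκ0 : 0 ≤ κ := by positivity
  have hI0 : Icc (89/100:ℝ) (61/10) ⊆ Ioi 0 := fun A hA => by
    have := hA.1
    show 0 < A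
    linarith
  have hab : (89/100:ℝ) ≤ 61/10 := by norm_num
  have hp : |S + u| ≤ 6 := (abs_add_le _ _).trans (by linarith)
  have hp' := abs_le.1 hp
  obtain ⟨A₀, hA₀, hk⟩ := exists_center_of_deriv (m := |T| / 16) hab
    (fun A hA => hasDerivAt_mixSlope (T := T) (X := X) (Y := Y) (S := S) (u := u) ha (hI0 hA)) (by
      rcases le_total 0 T with h | h
      · refine Or.inr fun A hA => ?_
        have hr := (slopeRate_bounds ha ha' (hI0 hA) (by linarith [hA.2])).1
        rw [abs_of_nonneg h] at hT ⊢
        nlinarith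
      · refine Or.inl fun A hA => ?_
        have hr := (slopeRate_bounds ha ha' (hI0 hA) (by linarith [hA.2])).1
        rw [abs_of_nonpos h] at hT ⊢
        nlinarith)
  have hsec : ∀ {f : ℝ × ℝ × ℝ → ℂ} {s : Set (ℝ × ℝ × ℝ)} {t : Set ℝ}, ContinuousOn f s →
      (∀ A ∈ t, (A, S, u) ∈ s) → ContinuousOn (fun A => f (A, S, u)) t := fun {f s t} hf hs =>
    hf.comp (f := fun A => (A, S, u)) (by fun_prop) hs
  set V : (ℝ → ℝ → ℝ) → ℝ → ℂ := fun f A =>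
    slowOsc B Λ n (f A) (mixPhase a n T Y A (launchPhase X S u A)) with hV
  have hVc : ∀ {f : ℝ → ℝ → ℝ}, ContinuousOn (uncurry f) (Ioi 0 ×ˢ Icc (2/5) 23) →
      ContinuousOn (V f) (Icc (89/100) (61/10)) := fun hf =>
    hsec (continuousOn_slowOsc_mixPhase ha hΛ0 hB.continuousOn hf) fun A hA => hI0 hA
  have hcc : ContinuousOn c (Icc (89/100) (61/10)) := fun A hA =>
    (hc A hA).continuousAt.continuousWithinAt
  set θ := mixWeight a T X Y S u
  set θ' := mixWeight' a T X Y S u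
  set δ := 1 / √(Λ * |T|) with hδ
  have hq : 0 < √(Λ * |T|) := sqrt_pos.2 (by positivity)
  have hq2 : √(Λ * |T|) ^ 2 = Λ * |T| := sq_sqrt (by positivity)
  have hδ0 : 0 < δ := by positivity
  have hne : ∀ A ∈ Icc (89/100:ℝ) (61/10), δ ≤ |A - A₀| → mixSlope a T X Y S u A ≠ 0 :=
    fun A hA hd => by
    have h0 : 0 < |A - A₀| := hδ0.trans_le hd
    exact abs_pos.1 ((by positivity : 0 < |T| / 16 * |A - A₀|).trans_le (hk A hA))
  have hinv : ∀ A ∈ Icc (89/100:ℝ) (61/10), δ ≤ |A - A₀| →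
      |(mixSlope a T X Y S u A)⁻¹| ≤ 16 / (|T| * |A - A₀|) := fun A hA hd => by
    have h0 : 0 < |A - A₀| := hδ0.trans_le hd
    rw [abs_inv]
    refine (inv_anti₀ (by positivity) (hk A hA)).trans (le_of_eq ?_)
    field_simp
  have hθ : ∀ A ∈ Icc (89/100:ℝ) (61/10), δ ≤ |A - A₀| →
      |θ A| ≤ 1568 / (|T| * |A - A₀|) := fun A hA hd => by
    have h0 : 0 < |A - A₀| := hδ0.trans_le hd
    obtain ⟨s1, s2⟩ := rpow_three_halves_bounds hA.1 hA.2
    have hA0 : 0 < A := hI0 hA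
    show |A * A ^ ((3:ℝ)/2) * (mixSlope a T X Y S u A)⁻¹| ≤ _
    rw [abs_mul, abs_of_pos (by positivity : 0 < A * A ^ ((3:ℝ)/2))]
    calc _ ≤ (49 / 8 * 16) * (16 / (|T| * |A - A₀|)) := by
          gcongr
          · linarith [hA.2]
          · exact hinv A hA hd
      _ = _ := by ring
  have hsix : ∀ A ∈ Icc (89/100:ℝ) (61/10), δ ≤ |A - A₀| →
      1 / (|T| * |A - A₀|) ≤ 6 / (|T| * |A - A₀| ^ 2) := fun A hA hd => by
    have h0 : 0 < |A - A₀| := hδ0.trans_le hd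
    have h6 : |A - A₀| ≤ 6 := abs_le.2 ⟨by linarith [hA.1, hA₀.2], by linarith [hA.2, hA₀.1]⟩
    rw [div_le_div_iff₀ (by positivity) (by positivity)]
    have : 0 ≤ |T| * |A - A₀| := by positivity
    nlinarith
  have hθ' : ∀ A ∈ Icc (89/100:ℝ) (61/10), δ ≤ |A - A₀| →
      |θ' A| ≤ 60000 / (|T| * |A - A₀| ^ 2) := fun A hA hd => by
    have h0 : 0 < |A - A₀| := hδ0.trans_le hd
    obtain ⟨s1, s2⟩ := rpow_three_halves_bounds hA.1 hA.2
    have hA0 : 0 < A := hI0 hA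
    obtain ⟨r1, r2⟩ := slopeRate_bounds ha ha' hA0 (by linarith [hA.2])
    have hr : |T * slopeRate a A - (S + u) / 2| ≤ 2 * |T| := by
      refine (abs_sub _ _).trans ?_
      rw [abs_mul, abs_of_pos (by linarith : 0 < slopeRate a A), abs_div,
        abs_of_pos (two_pos : (0:ℝ) < 2)]
      nlinarith
    have h1 : |5 / 2 * A ^ ((3:ℝ)/2) * (mixSlope a T X Y S u A)⁻¹| ≤
        640 * (1 / (|T| * |A - A₀|)) := by
      rw [abs_mul, abs_of_pos (by positivity : 0 < 5 / 2 * A ^ ((3:ℝ)/2))]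
      calc _ ≤ (5 / 2 * 16) * (16 / (|T| * |A - A₀|)) := by
            gcongr
            exact hinv A hA hd
        _ = _ := by ring
    have h2 : |A * A ^ ((3:ℝ)/2) * ((T * slopeRate a A - (S + u) / 2) *
        (mixSlope a T X Y S u A)⁻¹ ^ 2)| ≤ 50176 / (|T| * |A - A₀| ^ 2) := by
      rw [abs_mul, abs_of_pos (by positivity : 0 < A * A ^ ((3:ℝ)/2)), abs_mul, abs_pow]
      calc _ ≤ (49 / 8 * 16) * (2 * |T| * (16 / (|T| * |A - A₀|)) ^ 2) := by
            gcongr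
            · linarith [hA.2]
            · exact hinv A hA hd
        _ = _ := by field_simp; ring
    refine (abs_add_le _ _).trans ((add_le_add h1 h2).trans ?_)
    have h3 := hsix A hA hd
    have h4 : 60000 / (|T| * |A - A₀| ^ 2) = 640 * (6 / (|T| * |A - A₀| ^ 2)) +
      50176 / (|T| * |A - A₀| ^ 2) + 5984 / (|T| * |A - A₀| ^ 2) := by ring
    have h5 : 0 ≤ 5984 / (|T| * |A - A₀| ^ 2) := by positivity
    linarith
  have hVe : ∀ A ∈ Icc (89/100:ℝ) (61/10), ‖V e A‖ ≤ κ := fun A hA =>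
    hB.norm_slowOsc_le hΛ hn (he.slow A hA)
  have hVe' : ∀ A ∈ Icc (89/100:ℝ) (61/10), ‖V e' A‖ ≤ κ := fun A hA =>
    hB.norm_slowOsc_le hΛ hn (he.slow' A hA)
  have hVm : ∀ A ∈ Icc (89/100:ℝ) (61/10), ‖V (fun A v => v * e A v) A‖ ≤ κ := fun A hA =>
    hB.norm_slowOsc_le hΛ hn (he.slow_mul A hA)
  have hIΛ : ‖-I / (Λ : ℂ)‖ = 1 / Λ := by
    rw [norm_div, norm_neg, norm_I, norm_real, Real.norm_of_nonneg hΛ0.le]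
  have hfin := norm_integral_le_of_singular_ibp (c := A₀) (δ := δ) (K := P' * κ)
    (M := 80000 * (P' * κ) / (Λ * |T|)) (R₀ := fun A => (c A : ℂ) * V (fun A v => v * e A v) A)
    (R₁ := fun A => -I / Λ * ((c A : ℂ) * ((θ A : ℂ) * V e A)))
    (R₂ := fun A => -I / Λ * ((c' A : ℂ) * ((θ A : ℂ) * V e A) +
      (c A : ℂ) * ((θ A : ℂ) * V e' A + (θ' A : ℂ) * V e A))) hab hδ0 (by positivity)
    ((continuous_ofReal.comp_continuousOn hcc).mul (hVc he.continuousOn_mul))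
    ?_ ?_ ?_ ?_ ?_
  · refine hfin.trans ?_
    have e1 : 6 * (80000 * (P' * κ) / (Λ * |T|)) / δ = 480000 * (P' * κ) / √(Λ * |T|) := by
      have : ∀ r : ℝ, 0 < r → r ^ 2 = Λ * |T| →
          6 * (80000 * (P' * κ) / (Λ * |T|)) / (1 / r) = 480000 * (P' * κ) / r := by
        intro r hr h
        rw [← h]
        field_simp
        ring
      exact this _ hq hq2
    have e2 : 2 * δ * (P' * κ) = 2 * (P' * κ) / √(Λ * |T|) := by
      rw [hδ]
      ring
    rw [e1, e2, ← add_div]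
    gcongr
    have : 0 ≤ P' * κ := by positivity
    linarith
  · intro A hA
    rw [norm_mul, norm_real]
    exact mul_le_mul (bc A hA) (hVm A hA) (norm_nonneg _) hP'
  · intro A hA hd
    have h1 := he.hasDerivAt_mixWeight_mul (n := n) hΛ0 hB.continuousOn ha (hI0 hA) (hne A hA hd)
    refine (((hc A hA).ofReal_comp.mul h1).const_mul (-I / (Λ:ℂ))).congr_deriv ?_
    have hΛc : (Λ : ℂ) ≠ 0 := Complex.ofReal_ne_zero.2 hΛ0.ne'
    simp only [hV]
    field_simp
    linear_combination (-(Λ : ℂ) * (c A : ℂ) * slowOsc B Λ n (fun v => v * e A v)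
      (mixPhase a n T Y A (launchPhase X S u A))) * Complex.I_sq
  · have hs : {x | x ∈ Icc (89/100:ℝ) (61/10) ∧ δ ≤ |x - A₀|} ⊆ Icc (89/100) (61/10) :=
      fun x hx => hx.1
    have t1 : ContinuousOn (fun A => (θ A : ℂ)) {x | x ∈ Icc (89/100:ℝ) (61/10) ∧ δ ≤ |x - A₀|} :=
      hsec (continuous_ofReal.comp_continuousOn (continuousOn_mixWeight ha))
        fun A hA => ⟨hI0 hA.1, hne A hA.1 hA.2⟩
    have t2 : ContinuousOn (fun A => (θ' A : ℂ)) {x | x ∈ Icc (89/100:ℝ) (61/10) ∧ δ ≤ |x - A₀|} :=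
      hsec (continuous_ofReal.comp_continuousOn (continuousOn_mixWeight' ha))
        fun A hA => ⟨hI0 hA.1, hne A hA.1 hA.2⟩
    have t3 := (hVc he.continuousOn).mono hs
    have t4 := (hVc he.continuousOn').mono hs
    have t5 := continuous_ofReal.comp_continuousOn (hcc.mono hs)
    have t6 := continuous_ofReal.comp_continuousOn (hc'c.mono hs)
    exact continuousOn_const.mul ((t6.mul (t1.mul t3)).add (t5.mul ((t1.mul t4).add (t2.mul t3))))
  · intro A hA hd
    have h0 : 0 < |A - A₀| := hδ0.trans_le hd
    rw [norm_mul, hIΛ, norm_mul, norm_mul, norm_real, norm_real]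
    calc _ ≤ 1 / Λ * (P' * (1568 / (|T| * |A - A₀|) * κ)) := by
          gcongr
          · exact bc A hA
          · exact hθ A hA hd
          · exact hVe A hA
      _ = 1568 * (P' * κ) / (Λ * |T|) / |A - A₀| := by field_simp
      _ ≤ _ := by gcongr; norm_num
  · intro A hA hd
    have h0 : 0 < |A - A₀| := hδ0.trans_le hd
    have g1 := (hθ A hA hd).trans (le_of_eq (by ring : 1568 / (|T| * |A - A₀|) =
      1568 * (1 / (|T| * |A - A₀|))))
    have g2 : |θ A| ≤ 9408 / (|T| * |A - A₀| ^ 2) := g1.trans ((mul_le_mul_of_nonneg_left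
      (hsix A hA hd) (by norm_num)).trans (le_of_eq (by ring)))
    have g3 := hθ' A hA hd
    rw [norm_mul, hIΛ]
    calc _ ≤ 1 / Λ * (P' * (9408 / (|T| * |A - A₀| ^ 2) * κ) + P' *
          (9408 / (|T| * |A - A₀| ^ 2) * κ + 60000 / (|T| * |A - A₀| ^ 2) * κ)) := by
          refine mul_le_mul_of_nonneg_left ((norm_add_le _ _).trans (add_le_add ?_ ?_))
            (by positivity)
          · rw [norm_mul, norm_mul, norm_real, norm_real]
            exact mul_le_mul (bc' A hA) (mul_le_mul g2 (hVe A hA) (norm_nonneg _) (by positivity))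
              (by positivity) hP'
          · rw [norm_mul, norm_real]
            refine mul_le_mul (bc A hA) ((norm_add_le _ _).trans (add_le_add ?_ ?_))
              (norm_nonneg _) hP'
            · rw [norm_mul, norm_real]
              exact mul_le_mul g2 (hVe' A hA) (norm_nonneg _) (by positivity)
            · rw [norm_mul, norm_real]
              exact mul_le_mul g3 (hVe A hA) (norm_nonneg _) (by positivity)
      _ = 78816 * (P' * κ) / (Λ * |T|) / |A - A₀| ^ 2 := by field_simp; ring
      _ ≤ _ := by gcongr; norm_num

theorem hasDerivAt_slowOsc_div_id {B : ℝ → ℝ} {Λ n P a T Y A y : ℝ} {β : ℝ → ℝ}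
    (hβ : IsSlowAmplitude P β) (hΛ : 0 < Λ) (hB : ContinuousOn B (Ioi 0)) (hA : 0 < A) :
    HasDerivAt (fun y => ((A ^ ((3:ℝ)/2) / Λ : ℝ) : ℂ) / I *
        slowOsc B Λ n (fun v => β v / v) (mixPhase a n T Y A y))
      (slowOsc B Λ n β (mixPhase a n T Y A y)) y := by
  have hσ : 0 < A ^ ((3:ℝ)/2) := Real.rpow_pos_of_pos hA _
  have hc : ContinuousOn (fun v => β v / v) (Icc (2/5) 23) := hβ.div_id.continuousOn
  have hM : ∀ x ∈ univ, HasDerivAt (mixPhase a n T Y A) (1 / A ^ ((3:ℝ)/2)) x := fun x _ => by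
    unfold mixPhase
    exact ((((hasDerivAt_id x).const_add _).div_const _).sub_const _)
  have hd := hasDerivAt_slowOsc (B := B) (Λ := Λ) (n := n) (x₀ := y) (e := fun _ v => β v / v)
    (e' := fun _ _ => 0) isOpen_univ (mem_univ y) hΛ hB hM continuousOn_const
    (hc.comp (f := fun p : ℝ × ℝ => p.2) continuousOn_snd fun p hp => hp.2) continuousOn_const
    (fun x _ v _ => hasDerivAt_const _ _)
  refine (hd.const_mul _).congr_deriv ?_
  have h0 : slowOsc B Λ n (fun _ => 0) (mixPhase a n T Y A y) = 0 := by simp [slowOsc]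
  have h1 : slowOsc B Λ n (fun v => v * (β v / v)) (mixPhase a n T Y A y) =
      slowOsc B Λ n β (mixPhase a n T Y A y) := by
    refine integral_congr fun v hv => ?_
    rw [uIcc_of_le (by norm_num)] at hv
    have hv0 : v ≠ 0 := by linarith [hv.1]
    simp only
    rw [mul_div_cancel₀ _ hv0]
  rw [h0, h1]
  generalize A ^ ((3:ℝ)/2) = σ at *
  have e2 : (Λ : ℂ) ≠ 0 := Complex.ofReal_ne_zero.2 hΛ.ne'
  have e3 : (σ : ℂ) ≠ 0 := Complex.ofReal_ne_zero.2 hσ.ne'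
  push_cast
  field_simp
  ring

theorem norm_launch_integral_slowOsc_le {c₀ P Q Λ n a T X Y A ε : ℝ} {B B₁ B₂ β : ℝ → ℝ}
    {c : ℝ → ℝ → ℝ} (hB : IsSlowlyConvex c₀ B B₁ B₂) (hβ : IsSlowAmplitude P β) (hΛ : 3 ≤ Λ)
    (hn : n ≠ 0) (hε : 0 < ε) (hεΛ : ε ^ 3 * Λ = 16) (hA : A ∈ Icc (89/100:ℝ) (61/10))
    (hc : IsMixedAmplitude Q c) :
    ‖∫ S in (-3:ℝ)..3, ∫ u in (-3:ℝ)..3,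
      (c S u : ℂ) * slowOsc B Λ n β (mixPhase a n T Y A (launchPhase X S u A))‖ ≤
      784 * (30000 / √c₀ * (81 * P) * (√Λ / √|n|)) * Q * ε ^ 2 := by
  have hΛ0 : 0 < Λ := by linarith
  have hA0 : 0 < A := by linarith [hA.1]
  have hP : 0 ≤ P := by
    obtain ⟨β', -, hb⟩ := hβ
    exact (abs_nonneg _).trans (hb 1 ⟨by norm_num, by norm_num⟩).2.1
  obtain ⟨s1, s2⟩ := rpow_three_halves_bounds hA.1 hA.2
  have hσ : ‖((A ^ ((3:ℝ)/2) / Λ : ℝ) : ℂ) / I‖ ≤ ε ^ 3 := by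
    rw [norm_div, norm_I, div_one, norm_real, Real.norm_of_nonneg (by positivity),
      div_le_iff₀ hΛ0, hεΛ]
    exact s2
  set w : ℂ := ((A ^ ((3:ℝ)/2) / Λ : ℝ) : ℂ) / I with hw
  have hβ1 := hβ.div_id
  have hβ2 := hβ1.div_id
  have key := norm_double_cubic_integral_le (b₁ := A - 1) (b₂ := A - X) (c := c) (M := Q)
    (K := 30000 / √c₀ * (81 * P) * (√Λ / √|n|))
    (Z₀ := fun y => slowOsc B Λ n β (mixPhase a n T Y A y))
    (Z₁ := fun y => w * slowOsc B Λ n (fun v => β v / v) (mixPhase a n T Y A y))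
    (Z₂ := fun y => w * (w * slowOsc B Λ n (fun v => β v / v / v) (mixPhase a n T Y A y))) hε ?_
    (fun y => hasDerivAt_slowOsc_div_id hβ hΛ0 hB.continuousOn hA0)
    (fun y => (hasDerivAt_slowOsc_div_id hβ1 hΛ0 hB.continuousOn hA0).const_mul w) ?_ ?_ ?_ hc
  · refine le_trans (le_of_eq ?_) key
    congr 1
    refine integral_congr fun S _ => integral_congr fun u _ => ?_
    have : launchPhase X S u A = S ^ 3 / 3 - (A - 1) * S + (u ^ 3 / 3 - (A - X) * u) := by
      unfold launchPhase
      ring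
    simp only [this]
  · refine continuousOn_univ.1 (continuousOn_slowOsc isOpen_univ hΛ0 hB.continuousOn ?_
      (hβ.continuousOn.comp (f := fun p : ℝ × ℝ => p.2) continuousOn_snd fun p hp => hp.2))
    unfold mixPhase
    fun_prop
  · intro y
    refine (hB.norm_slowOsc_le hΛ hn hβ).trans ?_
    gcongr
    linarith
  · intro y
    rw [norm_mul, mul_comm]
    refine mul_le_mul ((hB.norm_slowOsc_le hΛ hn hβ1).trans ?_) hσ (norm_nonneg _) (by positivity)
    gcongr
    linarith
  · intro y
    rw [norm_mul, norm_mul, mul_comm, mul_comm ‖w‖]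
    refine mul_le_mul (mul_le_mul ((hB.norm_slowOsc_le hΛ hn hβ2).trans (le_of_eq ?_)) hσ
      (norm_nonneg _) (by positivity)) hσ (norm_nonneg _) (by positivity)
    ring

theorem continuousOn_double_intervalIntegral_param {E : Type*} [PseudoMetricSpace E] [ProperSpace E]
    {F : E → ℝ → ℝ → ℂ} {U : Set E} (hU : IsOpen U)
    (hF : ContinuousOn (fun p : E × ℝ × ℝ => F p.1 p.2.1 p.2.2) (U ×ˢ Ioo (-4) 4 ×ˢ Ioo (-4) 4)) :
    ContinuousOn (uncurry fun x s => ∫ u in (-3:ℝ)..3, F x s u) (U ×ˢ Ioo (-4) 4) ∧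
    ContinuousOn (fun x => ∫ s in (-3:ℝ)..3, ∫ u in (-3:ℝ)..3, F x s u) U := by
  have hI : Icc (-3:ℝ) 3 ⊆ Ioo (-4) 4 := Icc_subset_Ioo (by norm_num) (by norm_num)
  have h1 : ContinuousOn (fun p : E × ℝ => ∫ u in (-3:ℝ)..3, F p.1 p.2 u) (U ×ˢ Ioo (-4) 4) :=
    continuousOn_intervalIntegral_param (hU.prod isOpen_Ioo) (by norm_num)
      (hF.comp (f := fun q : (E × ℝ) × ℝ => (q.1.1, q.1.2, q.2)) (by fun_prop)
        fun q hq => ⟨hq.1.1, hq.1.2, hI hq.2⟩)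
  exact ⟨h1, continuousOn_intervalIntegral_param hU (by norm_num)
    (h1.mono (prod_mono_right hI))⟩

theorem hasDerivAt_double_intervalIntegral_param {F F' : ℝ → ℝ → ℝ → ℂ} {U : Set ℝ} {x₀ : ℝ}
    (hU : IsOpen U) (hx₀ : x₀ ∈ U)
    (hF : ContinuousOn (fun p : ℝ × ℝ × ℝ => F p.1 p.2.1 p.2.2) (U ×ˢ Ioo (-4) 4 ×ˢ Ioo (-4) 4))
    (hF' : ContinuousOn (fun p : ℝ × ℝ × ℝ => F' p.1 p.2.1 p.2.2) (U ×ˢ Ioo (-4) 4 ×ˢ Ioo (-4) 4))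
    (hd : ∀ x ∈ U, ∀ s ∈ Icc (-3:ℝ) 3, ∀ u ∈ Icc (-3:ℝ) 3,
      HasDerivAt (fun x => F x s u) (F' x s u) x) :
    HasDerivAt (fun x => ∫ s in (-3:ℝ)..3, ∫ u in (-3:ℝ)..3, F x s u)
      (∫ s in (-3:ℝ)..3, ∫ u in (-3:ℝ)..3, F' x₀ s u) x₀ := by
  have hI : Icc (-3:ℝ) 3 ⊆ Ioo (-4) 4 := Icc_subset_Ioo (by norm_num) (by norm_num)
  refine hasDerivAt_intervalIntegral_param hU (by norm_num) hx₀
    ((continuousOn_double_intervalIntegral_param hU hF).1.mono (prod_mono_right hI))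
    ((continuousOn_double_intervalIntegral_param hU hF').1.mono (prod_mono_right hI))
    fun x hx s hs => ?_
  refine hasDerivAt_intervalIntegral_param (F := fun x u => F x s u) (F' := fun x u => F' x s u) hU
    (by norm_num) hx (hF.comp (f := fun q : ℝ × ℝ => (q.1, s, q.2)) (by fun_prop)
      fun q hq => ⟨hq.1, hI hs, hI hq.2⟩)
    (hF'.comp (f := fun q : ℝ × ℝ => (q.1, s, q.2)) (by fun_prop)
      fun q hq => ⟨hq.1, hI hs, hI hq.2⟩) fun x hx u hu => hd x hx s hs u hu

theorem double_intervalIntegral_add {f g : ℝ → ℝ → ℂ}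
    (hf : ContinuousOn (uncurry f) (Ioo (-4) 4 ×ˢ Ioo (-4) 4))
    (hg : ContinuousOn (uncurry g) (Ioo (-4) 4 ×ˢ Ioo (-4) 4)) :
    (∫ s in (-3:ℝ)..3, ∫ u in (-3:ℝ)..3, (f s u + g s u)) =
      (∫ s in (-3:ℝ)..3, ∫ u in (-3:ℝ)..3, f s u) + ∫ s in (-3:ℝ)..3, ∫ u in (-3:ℝ)..3, g s u := by
  have hI : Icc (-3:ℝ) 3 ⊆ Ioo (-4) 4 := Icc_subset_Ioo (by norm_num) (by norm_num)
  have hab : (-3:ℝ) ≤ 3 := by norm_num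
  have inner : ∀ {f : ℝ → ℝ → ℂ}, ContinuousOn (uncurry f) (Ioo (-4) 4 ×ˢ Ioo (-4) 4) →
      ∀ s ∈ Icc (-3:ℝ) 3, IntervalIntegrable (f s) volume (-3) 3 := fun {f} hf s hs =>
    ContinuousOn.intervalIntegrable_of_Icc hab (hf.comp (f := fun u => (s, u)) (by fun_prop)
      fun u hu => ⟨hI hs, hI hu⟩)
  have outer : ∀ {f : ℝ → ℝ → ℂ}, ContinuousOn (uncurry f) (Ioo (-4) 4 ×ˢ Ioo (-4) 4) →
      IntervalIntegrable (fun s => ∫ u in (-3:ℝ)..3, f s u) volume (-3) 3 := fun {f} hf =>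
    ContinuousOn.intervalIntegrable_of_Icc hab ((continuousOn_intervalIntegral_param isOpen_Ioo hab
      (hf.mono (prod_mono_right hI))).mono hI)
  rw [← intervalIntegral.integral_add (outer hf) (outer hg)]
  refine integral_congr fun s hs => ?_
  rw [uIcc_of_le hab] at hs
  exact intervalIntegral.integral_add (inner hf s hs) (inner hg s hs)

theorem abs_launchSlope_le {X S u A : ℝ} (hX : 0 ≤ X) (hX' : X ≤ 20) (hS : S ∈ Ioo (-4:ℝ) 4)
    (hu : u ∈ Ioo (-4:ℝ) 4) (hA : 0 < A) (hA' : A < 7) :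
    |A * (S + u) + 3 / 2 * launchPhase X S u A| ≤ 300 := by
  have hS' : |S| ≤ 4 := abs_le.2 ⟨hS.1.le, hS.2.le⟩
  have hu' : |u| ≤ 4 := abs_le.2 ⟨hu.1.le, hu.2.le⟩
  have cube : ∀ x : ℝ, |x| ≤ 4 → |x ^ 3| ≤ 64 := fun x hx => by
    rw [abs_pow]
    calc |x| ^ 3 ≤ 4 ^ 3 := by gcongr
      _ = 64 := by norm_num
  have prod : ∀ x y : ℝ, |x| ≤ 4 → ∀ b, |y| ≤ b → |x * y| ≤ 4 * b := fun x y hx b hy => by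
    rw [abs_mul]
    gcongr
  have h1 := abs_le.1 (cube S hS')
  have h2 := abs_le.1 (cube u hu')
  have h3 := abs_le.1 (prod S (1 - A) hS' 6 (abs_le.2 ⟨by linarith, by linarith⟩))
  have h4 := abs_le.1 (prod u (X - A) hu' 20 (abs_le.2 ⟨by linarith, by linarith⟩))
  have h5 := abs_le.1 (prod S A hS' 7 (abs_le.2 ⟨by linarith, by linarith⟩))
  have h6 := abs_le.1 (prod u A hu' 7 (abs_le.2 ⟨by linarith, by linarith⟩))
  unfold launchPhase
  rw [abs_le]
  constructor <;> linarith

theorem isMixedAmplitude_inv_mixSlope {a T X Y A m : ℝ} (hX : 0 ≤ X) (hX' : X ≤ 20) (hA : 0 < A)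
    (hA' : A < 7) (hm : 300 ≤ m) (h : m + 300 ≤ |restSlope a T Y A|) :
    IsMixedAmplitude (2 / m) fun S u => (mixSlope a T X Y S u A)⁻¹ := by
  have key := isMixedAmplitude_inv_of_separable (m := m) (Q := 300)
    (κ₁ := fun S => restSlope a T Y A - (A * S + 3 / 2 * (S ^ 3 / 3 + S * (1 - A))))
    (κ₁' := fun S => -(A + 3 / 2 * (S ^ 2 + (1 - A))))
    (κ₂ := fun u => -(A * u + 3 / 2 * (u ^ 3 / 3 + u * (X - A))))
    (κ₂' := fun u => -(A + 3 / 2 * (u ^ 2 + (X - A)))) (fun s => ?_) (by fun_prop) (fun u => ?_)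
    (by fun_prop) (by linarith) (by norm_num) hm (fun s hs u hu => ?_) (fun s hs => ?_)
    (fun u hu => ?_)
  · convert key using 4
    unfold mixSlope launchPhase
    ring
  · refine ((((hasDerivAt_id s).const_mul A).add (((((hasDerivAt_id s).pow 3).div_const 3).add
      ((hasDerivAt_id s).mul_const (1 - A))).const_mul (3 / 2))).const_sub _).congr_deriv ?_
    simp only [id]
    ring
  · refine ((((hasDerivAt_id u).const_mul A).add (((((hasDerivAt_id u).pow 3).div_const 3).add
      ((hasDerivAt_id u).mul_const (X - A))).const_mul (3 / 2))).neg).congr_deriv ?_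
    simp only [id]
    ring
  · have h1 := abs_launchSlope_le hX hX' hs hu hA hA'
    have h2 := abs_sub_abs_le_abs_sub (restSlope a T Y A) (A * (s + u) + 3 / 2 * launchPhase X s u A)
    have h3 : restSlope a T Y A - (A * s + 3 / 2 * (s ^ 3 / 3 + s * (1 - A))) +
        -(A * u + 3 / 2 * (u ^ 3 / 3 + u * (X - A))) =
        restSlope a T Y A - (A * (s + u) + 3 / 2 * launchPhase X s u A) := by
      unfold launchPhase
      ring
    rw [h3]
    linarith
  · have : s ^ 2 ≤ 16 := by nlinarith [hs.1, hs.2]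
    rw [abs_le]
    constructor <;> nlinarith [sq_nonneg s]
  · have : u ^ 2 ≤ 16 := by nlinarith [hu.1, hu.2]
    rw [abs_le]
    constructor <;> nlinarith [sq_nonneg u]

theorem isMixedAmplitude_mixWeight {a T X Y A m : ℝ} (hX : 0 ≤ X) (hX' : X ≤ 20)
    (hA : A ∈ Icc (89/100:ℝ) (61/10)) (hm : 300 ≤ m) (h : m + 300 ≤ |restSlope a T Y A|) :
    IsMixedAmplitude (196 / m) fun S u => mixWeight a T X Y S u A := by
  obtain ⟨s1, s2⟩ := rpow_three_halves_bounds hA.1 hA.2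
  have hA0 : 0 < A := by linarith [hA.1]
  have hm0 : 0 < m := by linarith
  refine ((isMixedAmplitude_inv_mixSlope (X := X) hX hX' hA0 (by linarith [hA.2]) hm h).const_mul
    (A * A ^ ((3:ℝ)/2))).mono ?_
  rw [abs_of_pos (by positivity)]
  calc A * A ^ ((3:ℝ)/2) * (2 / m) ≤ 61 / 10 * 16 * (2 / m) := by
        gcongr
        exact hA.2
    _ = 976 / 5 / m := by ring
    _ ≤ _ := by gcongr; norm_num

theorem isMixedAmplitude_mixWeight' {a T X Y A m : ℝ} (ha : 0 < a) (ha' : a ≤ 1 / 200)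
    (hT : 4 ≤ |T|) (hX : 0 ≤ X) (hX' : X ≤ 20)
    (hA : A ∈ Icc (89/100:ℝ) (61/10)) (hm : 300 ≤ m) (h : m + 300 ≤ |restSlope a T Y A|) :
    IsMixedAmplitude (80 / m + 12800 * |T| / m ^ 2) fun S u => mixWeight' a T X Y S u A := by
  obtain ⟨s1, s2⟩ := rpow_three_halves_bounds hA.1 hA.2
  have hA0 : 0 < A := by linarith [hA.1]
  have hm0 : 0 < m := by linarith
  have hk := isMixedAmplitude_inv_mixSlope (X := X) hX hX' hA0 (by linarith [hA.2]) hm h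
  obtain ⟨r1, r2⟩ := slopeRate_bounds ha ha' hA0 (by linarith [hA.2])
  have hlin : IsMixedAmplitude (2 * |T|) fun S u => T * slopeRate a A - (S + u) / 2 := by
    refine ⟨fun _ _ => -(1 / 2), fun _ _ => -(1 / 2), fun _ _ => 0, by fun_prop, by fun_prop,
      by fun_prop, by fun_prop, fun s hs u hu => ⟨?_, ?_, hasDerivAt_const _ _, ?_, ?_, ?_, ?_⟩⟩
    · exact (((hasDerivAt_id s).add_const u).div_const 2).const_sub _
    · exact (((hasDerivAt_id u).const_add s).div_const 2).const_sub _
    · refine (abs_sub _ _).trans ?_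
      have h1 : |(s + u) / 2| ≤ 4 := by
        rw [abs_le]
        constructor <;> linarith [hs.1, hs.2, hu.1, hu.2]
      have h2 : |T * slopeRate a A| ≤ |T| := by
        rw [abs_mul, abs_of_pos (by linarith : 0 < slopeRate a A)]
        nlinarith
      linarith
    all_goals norm_num
    all_goals linarith
  have h1 := hk.const_mul (5 / 2 * A ^ ((3:ℝ)/2))
  have h2 := (hlin.mul (hk.mul hk)).const_mul (A * A ^ ((3:ℝ)/2))
  have h3 : IsMixedAmplitude (|5 / 2 * A ^ ((3:ℝ)/2)| * (2 / m) + |A * A ^ ((3:ℝ)/2)| *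
      (4 * (2 * |T|) * (4 * (2 / m) * (2 / m)))) fun S u => mixWeight' a T X Y S u A := by
    unfold mixWeight'
    simp only [pow_two]
    exact h1.add h2
  refine h3.mono (add_le_add ?_ ?_)
  · rw [abs_of_pos (by positivity)]
    calc 5 / 2 * A ^ ((3:ℝ)/2) * (2 / m) ≤ 5 / 2 * 16 * (2 / m) := by gcongr
      _ = _ := by ring
  · rw [abs_of_pos (by positivity)]
    calc _ ≤ 61 / 10 * 16 * (4 * (2 * |T|) * (4 * (2 / m) * (2 / m))) := by
          gcongr
          exact hA.2
      _ = 62464 / 5 * |T| / m ^ 2 := by ring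
      _ ≤ _ := by gcongr; norm_num

theorem norm_mixed_launch_integral_le {c₀ P Q Λ n a T X Y ε : ℝ} {B B₁ B₂ : ℝ → ℝ}
    {e e' χ : ℝ → ℝ → ℝ} (hB : IsSlowlyConvex c₀ B B₁ B₂) (he : IsSlowFamily P e e') (hΛ : 3 ≤ Λ)
    (hn : n ≠ 0) (hε : 0 < ε) (hεΛ : ε ^ 3 * Λ = 16) (ha : 0 < a) (ha' : a ≤ 1 / 200)
    (hT : 50 ≤ |T|) (hΛT : Λ ≤ 2 * |T|) (hX : 0 ≤ X) (hX' : X ≤ 20) (hχ : IsMixedAmplitude Q χ) :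
    ‖∫ A in (89/100:ℝ)..(61/10), ∫ S in (-3:ℝ)..3, ∫ u in (-3:ℝ)..3, (χ S u : ℂ) *
        slowOsc B Λ n (fun v => v * e A v) (mixPhase a n T Y A (launchPhase X S u A))‖ ≤
      40000 * (784 * (30000 / √c₀ * (81 * P) * (√Λ / √|n|)) * Q * ε ^ 2) / √(Λ * |T|) := by
  have hP := he.nonneg
  have hΛ0 : 0 < Λ := by linarith
  have hT0 : 0 < |T| := by linarith
  have hQ : 0 ≤ Q := by
    obtain ⟨_, _, _, -, -, -, -, h⟩ := hχ
    exact (abs_nonneg _).trans (h 0 ⟨by norm_num, by norm_num⟩ 0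
      ⟨by norm_num, by norm_num⟩).2.2.2.1
  have hχc : ContinuousOn (uncurry χ) (Ioo (-4) 4 ×ˢ Ioo (-4) 4) := by
    obtain ⟨_, _, _, h, -⟩ := hχ
    exact h
  set κ := 784 * (30000 / √c₀ * (81 * P) * (√Λ / √|n|)) with hκ
  have hκ0 : 0 ≤ κ := by positivity
  have hfix : ∀ {A R : ℝ} {β : ℝ → ℝ} {c : ℝ → ℝ → ℝ}, A ∈ Icc (89/100:ℝ) (61/10) →
      IsSlowAmplitude P β → IsMixedAmplitude R c → ‖∫ S in (-3:ℝ)..3, ∫ u in (-3:ℝ)..3,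
      (c S u : ℂ) * slowOsc B Λ n β (mixPhase a n T Y A (launchPhase X S u A))‖ ≤ κ * R * ε ^ 2 :=
    fun hA hβ hc => norm_launch_integral_slowOsc_le hB hβ hΛ hn hε hεΛ hA hc
  have hI0 : Icc (89/100:ℝ) (61/10) ⊆ Ioi 0 := fun A hA => by
    have := hA.1
    show 0 < A
    linarith
  have hab : (89/100:ℝ) ≤ 61/10 := by norm_num
  obtain ⟨A₀, hA₀, hk⟩ := exists_center_of_deriv (m := |T| / 8) hab
    (fun A hA => hasDerivAt_restSlope (T := T) (Y := Y) ha (hI0 hA)) (by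
      rcases le_total 0 T with h | h
      · refine Or.inr fun A hA => ?_
        have hr := (slopeRate_bounds ha ha' (hI0 hA) (by linarith [hA.2])).1
        rw [abs_of_nonneg h] at hT ⊢
        nlinarith
      · refine Or.inl fun A hA => ?_
        have hr := (slopeRate_bounds ha ha' (hI0 hA) (by linarith [hA.2])).1
        rw [abs_of_nonpos h] at hT ⊢
        nlinarith)
  set q := √(Λ * |T|) with hqdef
  have hq : 0 < q := sqrt_pos.2 (by positivity)
  have hq2 : q ^ 2 = Λ * |T| := sq_sqrt (by positivity)
  have hqT : q ≤ 3 / 2 * |T| := abs_le_of_sq_le_sq' (by nlinarith) (by positivity) |>.2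
  set δ := 8000 / q with hδ
  have hδ0 : 0 < δ := by positivity
  have hδT : 300 ≤ |T| / 16 * δ := by
    rw [hδ, ← mul_div_assoc, le_div_iff₀ hq]
    linarith
  have hm : ∀ A ∈ Icc (89/100:ℝ) (61/10), δ ≤ |A - A₀| → 300 ≤ |T| / 16 * |A - A₀| ∧
      |T| / 16 * |A - A₀| + 300 ≤ |restSlope a T Y A| := fun A hA hd => by
    have h1 : |T| / 16 * δ ≤ |T| / 16 * |A - A₀| := by gcongr
    have h2 := hk A hA
    constructor <;> linarith
  set U : Set ℝ := Ioo 0 7 ∩ restSlope a T Y ⁻¹' {x | 300 < |x|} with hU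
  have hUo : IsOpen U := ContinuousOn.isOpen_inter_preimage (fun A hA =>
    (hasDerivAt_restSlope ha hA.1).continuousAt.continuousWithinAt) isOpen_Ioo
    (isOpen_lt continuous_const continuous_abs)
  have hsU : {A | A ∈ Icc (89/100:ℝ) (61/10) ∧ δ ≤ |A - A₀|} ⊆ U := fun A hA => by
    obtain ⟨h1, h2⟩ := hm A hA.1 hA.2
    exact ⟨⟨hI0 hA.1, by linarith [hA.1.2]⟩, show 300 < |restSlope a T Y A| by linarith⟩
  have hne : ∀ A ∈ U, ∀ S ∈ Ioo (-4:ℝ) 4, ∀ u ∈ Ioo (-4:ℝ) 4, mixSlope a T X Y S u A ≠ 0 :=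
    fun A hA S hS u hu h0 => by
      have h1 := abs_launchSlope_le hX hX' hS hu hA.1.1 hA.1.2
      have h2 : 300 < |restSlope a T Y A| := hA.2
      rw [mixSlope, sub_eq_zero] at h0
      rw [h0] at h2
      linarith
  have hI : Icc (-3:ℝ) 3 ⊆ Ioo (-4) 4 := Icc_subset_Ioo (by norm_num) (by norm_num)
  set V : (ℝ → ℝ → ℝ) → ℝ → ℝ → ℝ → ℂ := fun f A S u =>
    slowOsc B Λ n (f A) (mixPhase a n T Y A (launchPhase X S u A)) with hV
  have hVc : ∀ {f : ℝ → ℝ → ℝ}, ContinuousOn (uncurry f) (Ioi 0 ×ˢ Icc (2/5) 23) →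
      ContinuousOn (fun p : ℝ × ℝ × ℝ => V f p.1 p.2.1 p.2.2) (Ioi 0 ×ˢ Ioo (-4) 4 ×ˢ Ioo (-4) 4) :=
    fun hf => (continuousOn_slowOsc_mixPhase ha hΛ0 hB.continuousOn hf).mono fun p hp => hp.1
  have hχ3 : ∀ W : Set ℝ, ContinuousOn (fun p : ℝ × ℝ × ℝ => (χ p.2.1 p.2.2 : ℂ))
      (W ×ˢ Ioo (-4) 4 ×ˢ Ioo (-4) 4) := fun W =>
    continuous_ofReal.comp_continuousOn (hχc.comp (f := fun p : ℝ × ℝ × ℝ => p.2)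
      (by fun_prop) fun p hp => hp.2)
  have hUsub : U ×ˢ Ioo (-4:ℝ) 4 ×ˢ Ioo (-4:ℝ) 4 ⊆ Ioi 0 ×ˢ Ioo (-4) 4 ×ˢ Ioo (-4) 4 :=
    prod_mono_left fun A hA => hA.1.1
  have hθc : ContinuousOn (fun p : ℝ × ℝ × ℝ => (mixWeight a T X Y p.2.1 p.2.2 p.1 : ℂ))
      (U ×ˢ Ioo (-4) 4 ×ˢ Ioo (-4) 4) := continuous_ofReal.comp_continuousOn
    ((continuousOn_mixWeight ha).mono fun p hp => ⟨hp.1.1.1, hne _ hp.1 _ hp.2.1 _ hp.2.2⟩)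
  have hθ'c : ContinuousOn (fun p : ℝ × ℝ × ℝ => (mixWeight' a T X Y p.2.1 p.2.2 p.1 : ℂ))
      (U ×ˢ Ioo (-4) 4 ×ˢ Ioo (-4) 4) := continuous_ofReal.comp_continuousOn
    ((continuousOn_mixWeight' ha).mono fun p hp => ⟨hp.1.1.1, hne _ hp.1 _ hp.2.1 _ hp.2.2⟩)
  set f₀ : ℝ → ℝ → ℝ → ℂ := fun A S u => (χ S u : ℂ) * V (fun A v => v * e A v) A S u with hf₀
  set f₁ : ℝ → ℝ → ℝ → ℂ := fun A S u => ((χ S u * mixWeight a T X Y S u A : ℝ) : ℂ) * V e A S u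
    with hf₁
  set f₂ : ℝ → ℝ → ℝ → ℂ := fun A S u => ((χ S u * mixWeight a T X Y S u A : ℝ) : ℂ) * V e' A S u
    with hf₂
  set f₃ : ℝ → ℝ → ℝ → ℂ := fun A S u => ((χ S u * mixWeight' a T X Y S u A : ℝ) : ℂ) * V e A S u
    with hf₃
  have c0 : ContinuousOn (fun p : ℝ × ℝ × ℝ => f₀ p.1 p.2.1 p.2.2)
      (Ioi 0 ×ˢ Ioo (-4) 4 ×ˢ Ioo (-4) 4) := (hχ3 _).mul (hVc he.continuousOn_mul)
  have c1 : ContinuousOn (fun p : ℝ × ℝ × ℝ => f₁ p.1 p.2.1 p.2.2)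
      (U ×ˢ Ioo (-4) 4 ×ˢ Ioo (-4) 4) := by
    simp only [hf₁, Complex.ofReal_mul]
    exact ((hχ3 _).mul hθc).mul ((hVc he.continuousOn).mono hUsub)
  have c2 : ContinuousOn (fun p : ℝ × ℝ × ℝ => f₂ p.1 p.2.1 p.2.2)
      (U ×ˢ Ioo (-4) 4 ×ˢ Ioo (-4) 4) := by
    simp only [hf₂, Complex.ofReal_mul]
    exact ((hχ3 _).mul hθc).mul ((hVc he.continuousOn').mono hUsub)
  have c3 : ContinuousOn (fun p : ℝ × ℝ × ℝ => f₃ p.1 p.2.1 p.2.2)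
      (U ×ˢ Ioo (-4) 4 ×ˢ Ioo (-4) 4) := by
    simp only [hf₃, Complex.ofReal_mul]
    exact ((hχ3 _).mul hθ'c).mul ((hVc he.continuousOn).mono hUsub)
  have sec : ∀ {f : ℝ → ℝ → ℝ → ℂ} {W : Set ℝ} {A : ℝ}, ContinuousOn
      (fun p : ℝ × ℝ × ℝ => f p.1 p.2.1 p.2.2) (W ×ˢ Ioo (-4) 4 ×ˢ Ioo (-4) 4) → A ∈ W →
      ContinuousOn (uncurry (f A)) (Ioo (-4) 4 ×ˢ Ioo (-4) 4) := fun {f W A} hf hA =>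
    hf.comp (f := fun q : ℝ × ℝ => (A, q.1, q.2)) (by fun_prop) fun q hq => ⟨hA, hq.1, hq.2⟩
  set G : (ℝ → ℝ → ℝ → ℂ) → ℝ → ℂ := fun f A => ∫ S in (-3:ℝ)..3, ∫ u in (-3:ℝ)..3, f A S u with hG
  have hGc : ∀ {f : ℝ → ℝ → ℝ → ℂ} {W : Set ℝ}, IsOpen W → ContinuousOn
      (fun p : ℝ × ℝ × ℝ => f p.1 p.2.1 p.2.2) (W ×ˢ Ioo (-4) 4 ×ˢ Ioo (-4) 4) →
      ContinuousOn (G f) W := fun hW hf => (continuousOn_double_intervalIntegral_param hW hf).2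
  have hder : ∀ A ∈ U, HasDerivAt (G f₁) (I * Λ * G f₀ A + (G f₂ A + G f₃ A)) A := by
    intro A hA
    have hd := hasDerivAt_double_intervalIntegral_param (F := f₁)
      (F' := fun A S u => I * Λ * f₀ A S u + (f₂ A S u + f₃ A S u)) hUo hA c1
      ((continuousOn_const.mul (c0.mono hUsub)).add (c2.add c3)) (by
        intro A hA S hS u hu
        have h1 := he.hasDerivAt_mixWeight_mul (n := n) hΛ0 hB.continuousOn ha hA.1.1
          (hne A hA S (hI hS) u (hI hu))
        have h2 := h1.const_mul (χ S u : ℂ)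
        simp only [hf₁, Complex.ofReal_mul, mul_assoc]
        refine h2.congr_deriv ?_
        simp only [hf₀, hf₂, hf₃, hV, Complex.ofReal_mul]
        ring)
    refine hd.congr_deriv ?_
    have s0 := sec c0 hA.1.1
    have s2 := sec c2 hA
    have s3 := sec c3 hA
    rw [double_intervalIntegral_add (f := fun S u => I * Λ * f₀ A S u)
      (g := fun S u => f₂ A S u + f₃ A S u) (continuousOn_const.mul s0) (s2.add s3),
      double_intervalIntegral_add s2 s3]
    simp only [hG, intervalIntegral.integral_const_mul]
  have hIΛ : ‖-I / (Λ : ℂ)‖ = 1 / Λ := by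
    rw [norm_div, norm_neg, norm_I, norm_real, Real.norm_of_nonneg hΛ0.le]
  have hfin := norm_integral_le_of_singular_ibp (c := A₀) (δ := δ) (K := κ * Q * ε ^ 2)
    (M := 20000000 * (κ * Q * ε ^ 2) / (Λ * |T|)) (R₀ := G f₀)
    (R₁ := fun A => -I / Λ * G f₁ A) (R₂ := fun A => -I / Λ * (G f₂ A + G f₃ A)) hab hδ0
    (by positivity) ((hGc isOpen_Ioi c0).mono hI0) (fun A hA => hfix hA (he.slow_mul A hA) hχ)
    ?_ ?_ ?_ ?_
  · refine hfin.trans ?_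
    have e1 : 6 * (20000000 * (κ * Q * ε ^ 2) / (Λ * |T|)) / δ = 15000 * (κ * Q * ε ^ 2) / q := by
      rw [hδ, ← hq2]
      field_simp
      ring
    have e2 : 2 * δ * (κ * Q * ε ^ 2) = 16000 * (κ * Q * ε ^ 2) / q := by
      rw [hδ]
      ring
    rw [e1, e2, ← add_div]
    gcongr
    have : 0 ≤ κ * Q * ε ^ 2 := by positivity
    linarith
  · intro A hA hd
    refine ((hder A (hsU ⟨hA, hd⟩)).const_mul (-I / (Λ:ℂ))).congr_deriv ?_
    have hΛc : (Λ : ℂ) ≠ 0 := Complex.ofReal_ne_zero.2 hΛ0.ne'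
    field_simp
    linear_combination (-(Λ : ℂ) * G f₀ A) * Complex.I_sq
  · exact continuousOn_const.mul (((hGc hUo c2).add (hGc hUo c3)).mono hsU)
  · intro A hA hd
    have h0 : 0 < |A - A₀| := hδ0.trans_le hd
    obtain ⟨m1, m2⟩ := hm A hA hd
    rw [norm_mul, hIΛ]
    have hb := hfix hA (he.slow A hA) (hχ.mul (isMixedAmplitude_mixWeight (X := X) hX hX' hA m1 m2))
    calc 1 / Λ * ‖G f₁ A‖ ≤ 1 / Λ * (κ * (4 * Q * (196 / (|T| / 16 * |A - A₀|))) * ε ^ 2) := by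
          gcongr
      _ = 12544 * (κ * Q * ε ^ 2) / (Λ * |T|) / |A - A₀| := by field_simp; ring
      _ ≤ _ := by gcongr; norm_num
  · intro A hA hd
    have h0 : 0 < |A - A₀| := hδ0.trans_le hd
    have h6 : |A - A₀| ≤ 6 := abs_le.2 ⟨by linarith [hA.1, hA₀.2], by linarith [hA.2, hA₀.1]⟩
    obtain ⟨m1, m2⟩ := hm A hA hd
    have hb2 := hfix hA (he.slow' A hA) (hχ.mul (isMixedAmplitude_mixWeight (X := X) hX hX' hA m1 m2))
    have hb3 := hfix hA (he.slow A hA) (hχ.mul (isMixedAmplitude_mixWeight' (X := X) ha ha'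
      (by linarith) hX hX' hA m1 m2))
    rw [norm_mul, hIΛ]
    calc 1 / Λ * ‖G f₂ A + G f₃ A‖ ≤ 1 / Λ * (κ * (4 * Q * (196 / (|T| / 16 * |A - A₀|))) * ε ^ 2 +
          κ * (4 * Q * (80 / (|T| / 16 * |A - A₀|) +
            12800 * |T| / (|T| / 16 * |A - A₀|) ^ 2)) * ε ^ 2) := by
          refine mul_le_mul_of_nonneg_left ((norm_add_le _ _).trans (add_le_add hb2 hb3))
            (by positivity)
      _ = (17664 * |A - A₀| + 13107200) * (κ * Q * ε ^ 2) / (Λ * |T|) / |A - A₀| ^ 2 := by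
          field_simp
          ring
      _ ≤ _ := by gcongr; linarith

theorem IsSlowAmplitude.id_mul {P : ℝ} {β : ℝ → ℝ} (h : IsSlowAmplitude P β) :
    IsSlowAmplitude (24 * P) fun v => v * β v := by
  have hβc := h.continuousOn
  obtain ⟨β', hc, hb⟩ := h
  refine ⟨fun v => β v + v * β' v, hβc.add (continuousOn_id.mul hc), fun v hv => ?_⟩
  obtain ⟨d, b, b'⟩ := hb v hv
  have hP : 0 ≤ P := (abs_nonneg _).trans b
  have hv0 : |v| ≤ 23 := abs_le.2 ⟨by linarith [hv.1], hv.2⟩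
  refine ⟨((hasDerivAt_id v).mul d).congr_deriv (by simp), ?_, ?_⟩
  · rw [abs_mul]
    nlinarith [abs_nonneg v, abs_nonneg (β v)]
  · refine (abs_add_le _ _).trans ?_
    rw [abs_mul]
    nlinarith [abs_nonneg (β' v), abs_nonneg v]

/-- The amplitude produced by one integration by parts in the launching variable, when the slope
`u² + X - A` is bounded below. -/
noncomputable def farWeight (χ χu : ℝ → ℝ → ℝ) (X S u A : ℝ) : ℝ :=
  A ^ ((3:ℝ)/2) * (χu S u * (u ^ 2 + X - A)⁻¹ - 2 * u * χ S u * (u ^ 2 + X - A)⁻¹ ^ 2)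

noncomputable def farWeight' (χ χu : ℝ → ℝ → ℝ) (X S u A : ℝ) : ℝ :=
  3 / 2 * √A * (χu S u * (u ^ 2 + X - A)⁻¹ - 2 * u * χ S u * (u ^ 2 + X - A)⁻¹ ^ 2) +
    A ^ ((3:ℝ)/2) *
      (χu S u * (u ^ 2 + X - A)⁻¹ ^ 2 - 4 * u * χ S u * (u ^ 2 + X - A)⁻¹ ^ 3)

theorem hasDerivAt_farWeight {χ χu : ℝ → ℝ → ℝ} {X S u A : ℝ} (hA : 0 < A)
    (hw : u ^ 2 + X - A ≠ 0) :
    HasDerivAt (farWeight χ χu X S u) (farWeight' χ χu X S u A) A := by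
  have h1 : HasDerivAt (fun A => (u ^ 2 + X - A)⁻¹) ((u ^ 2 + X - A)⁻¹ ^ 2) A :=
    (((hasDerivAt_id' A).const_sub (u ^ 2 + X)).fun_inv hw).congr_deriv (by field_simp)
  refine ((hasDerivAt_rpow_three_halves hA).mul ((h1.const_mul (χu S u)).sub
    ((h1.fun_pow 2).const_mul (2 * u * χ S u)))).congr_deriv ?_
  unfold farWeight'
  simp only [Pi.sub_apply]
  push_cast
  ring

theorem abs_farWeight_le {χ χu : ℝ → ℝ → ℝ} {X S u A M : ℝ} (hA : A ∈ Icc (89/100:ℝ) (61/10))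
    (hX : 20 ≤ X) (hu : |u| ≤ 3) (b : |χ S u| ≤ M) (bu : |χu S u| ≤ M) :
    |farWeight χ χu X S u A| ≤ 2 * M ∧ |farWeight' χ χu X S u A| ≤ 2 * M := by
  obtain ⟨s1, s2⟩ := rpow_three_halves_bounds hA.1 hA.2
  have hM : 0 ≤ M := (abs_nonneg _).trans b
  have hA2 : √A ≤ 5 / 2 := Real.sqrt_le_iff.2 ⟨by norm_num, by linarith [hA.2]⟩
  have hq0 : 0 < u ^ 2 + X - A := by nlinarith [sq_nonneg u, hA.2]
  have hq : (u ^ 2 + X - A)⁻¹ ≤ 1 / 13 := by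
    rw [← one_div]
    exact one_div_le_one_div_of_le (by norm_num) (by nlinarith [sq_nonneg u, hA.2])
  unfold farWeight farWeight'
  have hq1 := inv_pos.2 hq0
  generalize (u ^ 2 + X - A)⁻¹ = q at *
  generalize A ^ ((3:ℝ)/2) = σ at *
  have e1 : ∀ k : ℕ, ∀ r : ℝ, 0 ≤ r → |χu S u * q ^ k - r * u * χ S u * q ^ (k + 1)| ≤
      M * (1 / 13) ^ k + r * 3 * M * (1 / 13) ^ (k + 1) := fun k r hr => by
    refine (abs_sub _ _).trans ?_
    rw [abs_mul, abs_mul, abs_mul, abs_mul, abs_pow, abs_pow, abs_of_pos hq1, abs_of_nonneg hr]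
    gcongr
  have f1 := e1 1 2 (by norm_num)
  have f2 := e1 2 4 (by norm_num)
  norm_num at f1 f2
  constructor
  · rw [abs_mul, abs_of_pos (by linarith)]
    calc _ ≤ 16 * (M * (1 / 13) + 6 * M * (1 / 169)) := by gcongr
      _ ≤ _ := by linarith
  · refine (abs_add_le _ _).trans ?_
    rw [abs_mul, abs_mul σ, abs_of_pos (by linarith : 0 < σ),
      abs_of_nonneg (by positivity : 0 ≤ 3 / 2 * √A)]
    calc _ ≤ 3 / 2 * (5 / 2) * (M * (1 / 13) + 6 * M * (1 / 169)) +
          16 * (M * (1 / 169) + 12 * M * (1 / 2197)) := by gcongr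
      _ ≤ _ := by linarith

theorem norm_far_launch_integral_le {c₀ P M Λ n a T X Y : ℝ} {B B₁ B₂ : ℝ → ℝ}
    {e e' : ℝ → ℝ → ℝ} {χ χu : ℝ → ℝ → ℝ} (hB : IsSlowlyConvex c₀ B B₁ B₂)
    (he : IsSlowFamily P e e') (hΛ : 3 ≤ Λ) (hn : n ≠ 0) (ha : 0 < a) (ha' : a ≤ 1 / 200)
    (hT : 50 ≤ |T|) (hX : 20 ≤ X) (hχ : Continuous (uncurry χ))
    (hχu : Continuous (uncurry χu)) (hd : ∀ S u, HasDerivAt (χ S) (χu S u) u)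
    (b : ∀ S u, |χ S u| ≤ M) (bu : ∀ S u, |χu S u| ≤ M) (h₀ : ∀ S, χ S (-3) = 0)
    (h₁ : ∀ S, χ S 3 = 0) :
    ‖∫ A in (89/100:ℝ)..(61/10), ∫ S in (-3:ℝ)..3, ∫ u in (-3:ℝ)..3,
      (χ S u : ℂ) * slowOsc B Λ n (fun v => v * (v * e A v))
        (mixPhase a n T Y A (launchPhase X S u A))‖ ≤
      36 / Λ * (500000 * (2 * M * (30000 / √c₀ * P * (√Λ / √|n|))) / √(Λ * |T|)) := by
  have hΛ0 : 0 < Λ := by linarith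
  have hI0 : ∀ A ∈ Icc (89/100:ℝ) (61/10), 0 < A := fun A hA => by linarith [hA.1]
  have hI : Icc (89/100:ℝ) (61/10) ⊆ Ioo 0 7 := fun A hA => ⟨hI0 A hA, by linarith [hA.2]⟩
  have hJ : Icc (-3:ℝ) 3 ⊆ Ioo (-4) 4 := Icc_subset_Ioo (by norm_num) (by norm_num)
  have hab : (89/100:ℝ) ≤ 61/10 := by norm_num
  have h33 : (-3:ℝ) ≤ 3 := by norm_num
  set F : ℝ → ℝ → ℝ → ℂ := fun A S u => (farWeight χ χu X S u A : ℂ) *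
    slowOsc B Λ n (fun v => v * e A v) (mixPhase a n T Y A (launchPhase X S u A)) with hF
  have hinvc : ∀ {s : Set (ℝ × ℝ × ℝ)}, (∀ p ∈ s, p.1 < 7) →
      ContinuousOn (fun p : ℝ × ℝ × ℝ => (p.2.2 ^ 2 + X - p.1)⁻¹) s := fun hs =>
    ContinuousOn.inv₀ (by fun_prop) fun p hp => by nlinarith [sq_nonneg p.2.2, hs p hp]
  have hc1 : Continuous fun p : ℝ × ℝ × ℝ => χ p.2.1 p.2.2 :=
    hχ.comp (f := fun p : ℝ × ℝ × ℝ => (p.2.1, p.2.2)) (by fun_prop)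
  have hc2 : Continuous fun p : ℝ × ℝ × ℝ => χu p.2.1 p.2.2 :=
    hχu.comp (f := fun p : ℝ × ℝ × ℝ => (p.2.1, p.2.2)) (by fun_prop)
  have hFc : ContinuousOn (fun p : ℝ × ℝ × ℝ => F p.1 p.2.1 p.2.2)
      (Ioo 0 7 ×ˢ Ioo (-4) 4 ×ˢ Ioo (-4) 4) := by
    have hq := hinvc (s := Ioo 0 7 ×ˢ Ioo (-4) 4 ×ˢ Ioo (-4) 4) fun p hp => hp.1.2
    refine (continuous_ofReal.comp_continuousOn ?_).mul
      ((continuousOn_slowOsc_mixPhase ha hΛ0 hB.continuousOn he.continuousOn_mul).mono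
        fun p hp => hp.1.1)
    exact (continuousOn_fst.rpow_const fun p hp => Or.inr (by norm_num)).mul
      ((hc2.continuousOn.mul hq).sub (((continuousOn_const.mul (by fun_prop)).mul
        hc1.continuousOn).mul (hq.pow 2)))
  have hibp : ∀ A ∈ Icc (89/100:ℝ) (61/10), ∀ S, ∫ u in (-3:ℝ)..3,
      (χ S u : ℂ) * slowOsc B Λ n (fun v => v * (v * e A v))
        (mixPhase a n T Y A (launchPhase X S u A)) =
      -((1 / Λ : ℝ) / I) * ∫ u in (-3:ℝ)..3, F A S u := by
    intro A hA S
    have hA0 := hI0 A hA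
    have hβ := (he.slow_mul A hA).id_mul
    have hw : ∀ u : ℝ, u ^ 2 + X - A ≠ 0 := fun u => by nlinarith [sq_nonneg u, hA.2]
    have hdiv : ∀ M, slowOsc B Λ n (fun v => v * (v * e A v) / v) M =
        slowOsc B Λ n (fun v => v * e A v) M := fun M => by
      refine integral_congr fun v hv => ?_
      rw [uIcc_of_le (by norm_num)] at hv
      have hv0 : v ≠ 0 := by linarith [hv.1]
      simp only
      rw [mul_div_cancel_left₀ _ hv0]
    have hV : ∀ {f : ℝ → ℝ → ℝ}, ContinuousOn (uncurry f) (Ioi 0 ×ˢ Icc (2/5) 23) →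
        Continuous fun u => slowOsc B Λ n (f A) (mixPhase a n T Y A (launchPhase X S u A)) :=
      fun hf => continuousOn_univ.1 <| (continuousOn_slowOsc_mixPhase ha hΛ0 hB.continuousOn
        hf).comp (f := fun u => (A, S, u)) (by fun_prop) fun u _ => hA0
    have hcu1 : Continuous (χ S) := hχ.comp (f := fun u => (S, u)) (by fun_prop)
    have hcu2 : Continuous (χu S) := hχu.comp (f := fun u => (S, u)) (by fun_prop)
    have hqc : Continuous fun u : ℝ => (u ^ 2 + X - A)⁻¹ := Continuous.inv₀ (by fun_prop) hw
    have d1 : ∀ u, HasDerivAt (fun u => ((χ S u * (u ^ 2 + X - A)⁻¹ : ℝ) : ℂ))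
        ((χu S u * (u ^ 2 + X - A)⁻¹ - 2 * u * χ S u * (u ^ 2 + X - A)⁻¹ ^ 2 : ℝ) : ℂ) u :=
      fun u => by
      have hp : HasDerivAt (fun u : ℝ => u ^ 2 + X - A) (2 * u) u :=
        (((hasDerivAt_pow 2 u).add_const X).sub_const A).congr_deriv (by simp)
      refine (((hd S u).mul (hp.fun_inv (hw u))).congr_deriv ?_).ofReal_comp
      field_simp
      ring
    have d2 : ∀ u, HasDerivAt (fun u => ((A ^ ((3:ℝ)/2) / Λ : ℝ) : ℂ) / I *
          slowOsc B Λ n (fun v => v * e A v) (mixPhase a n T Y A (launchPhase X S u A)))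
        (((u ^ 2 + X - A : ℝ) : ℂ) * slowOsc B Λ n (fun v => v * (v * e A v))
          (mixPhase a n T Y A (launchPhase X S u A))) u := fun u => by
      have hl : HasDerivAt (fun u => launchPhase X S u A) (u ^ 2 + X - A) u := by
        unfold launchPhase
        refine ((((hasDerivAt_pow 3 u).div_const 3).const_add _).add
          ((hasDerivAt_id u).mul_const (X - A))).congr_deriv ?_
        push_cast
        ring
      have h := (hasDerivAt_slowOsc_div_id (Λ := Λ) (n := n) (a := a) (T := T) (Y := Y)
        (y := launchPhase X S u A) hβ hΛ0 hB.continuousOn hA0).scomp u hl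
      simp only [hdiv] at h
      refine h.congr_deriv ?_
      rw [Complex.real_smul]
    have key := intervalIntegral.integral_mul_deriv_eq_deriv_mul (a := (-3:ℝ)) (b := 3)
      (fun u _ => d1 u) (fun u _ => d2 u)
      (Continuous.intervalIntegrable (by fun_prop) _ _)
      (Continuous.intervalIntegrable ((by fun_prop : Continuous fun u : ℝ =>
        ((u ^ 2 + X - A : ℝ) : ℂ)).mul (hV (f := fun A v => v * (v * e A v))
          (continuousOn_snd.mul he.continuousOn_mul))) _ _)
    rw [h₀, h₁] at key
    simp only [zero_mul, Complex.ofReal_zero, sub_self, zero_sub] at key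
    rw [neg_mul, ← intervalIntegral.integral_const_mul]
    refine Eq.trans (integral_congr fun u _ => ?_) (key.trans (congrArg _
      (integral_congr fun u _ => ?_)))
    · rw [← mul_assoc, ← Complex.ofReal_mul, mul_assoc (χ S u), inv_mul_cancel₀ (hw u), mul_one]
    · simp only [hF, farWeight]
      push_cast
      ring
  have hred : (∫ A in (89/100:ℝ)..(61/10), ∫ S in (-3:ℝ)..3, ∫ u in (-3:ℝ)..3,
      (χ S u : ℂ) * slowOsc B Λ n (fun v => v * (v * e A v))
        (mixPhase a n T Y A (launchPhase X S u A))) =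
      -((1 / Λ : ℝ) / I) * ∫ S in (-3:ℝ)..3, ∫ u in (-3:ℝ)..3,
        ∫ A in (89/100:ℝ)..(61/10), F A S u := by
    have hG := (continuousOn_double_intervalIntegral_param isOpen_Ioo hFc).1
    have e1 : (∫ S in (-3:ℝ)..3, ∫ u in (-3:ℝ)..3, ∫ A in (89/100:ℝ)..(61/10), F A S u) =
        ∫ S in (-3:ℝ)..3, ∫ A in (89/100:ℝ)..(61/10), ∫ u in (-3:ℝ)..3, F A S u := by
      refine integral_congr fun S hS => ?_
      rw [uIcc_of_le h33] at hS
      have hs : ContinuousOn (uncurry fun A u => F A S u)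
          (Icc (89/100) (61/10) ×ˢ Icc (-3) 3) :=
        hFc.comp (f := fun p : ℝ × ℝ => (p.1, S, p.2)) (by fun_prop)
          fun p hp => ⟨hI hp.1, hJ hS, hJ hp.2⟩
      exact (intervalIntegral_swap_of_continuousOn hab h33 hs).symm
    rw [e1, ← intervalIntegral_swap_of_continuousOn hab h33 (hG.mono (prod_mono hI hJ)),
      ← intervalIntegral.integral_const_mul]
    refine integral_congr fun A hA => ?_
    rw [uIcc_of_le hab] at hA
    rw [← intervalIntegral.integral_const_mul]
    exact integral_congr fun S _ => hibp A hA S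
  rw [hred, norm_mul, norm_neg, norm_div, norm_I, div_one, norm_real,
    Real.norm_of_nonneg (by positivity)]
  set R := 500000 * (2 * M * (30000 / √c₀ * P * (√Λ / √|n|))) / √(Λ * |T|)
  have hin : ∀ S ∈ uIoc (-3:ℝ) 3, ∀ u ∈ uIoc (-3:ℝ) 3,
      ‖∫ A in (89/100:ℝ)..(61/10), F A S u‖ ≤ R := fun S hS u hu => by
    rw [uIoc_of_le h33] at hS hu
    have hS' : |S| ≤ 3 := abs_le.2 ⟨hS.1.le, hS.2⟩
    have hu' : |u| ≤ 3 := abs_le.2 ⟨hu.1.le, hu.2⟩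
    refine norm_fixed_launch_integral_le (P' := 2 * M) hB he hΛ hn ha ha' hT hS' hu'
      (fun A hA => hasDerivAt_farWeight (hI0 A hA) (by nlinarith [sq_nonneg u, hA.2])) ?_
      (fun A hA => (abs_farWeight_le hA hX hu' (b S u) (bu S u)).1)
      fun A hA => (abs_farWeight_le hA hX hu' (b S u) (bu S u)).2
    have hq : ContinuousOn (fun A : ℝ => (u ^ 2 + X - A)⁻¹) (Icc (89/100) (61/10)) :=
      ContinuousOn.inv₀ (by fun_prop) fun A hA => by nlinarith [sq_nonneg u, hA.2]
    unfold farWeight'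
    exact ((continuousOn_const.mul Real.continuous_sqrt.continuousOn).mul
      ((continuousOn_const.mul hq).sub (continuousOn_const.mul (hq.pow 2)))).add
      ((continuousOn_id.rpow_const fun p hp => Or.inr (by norm_num)).mul
        ((continuousOn_const.mul (hq.pow 2)).sub (continuousOn_const.mul (hq.pow 3))))
  have h2 := intervalIntegral.norm_integral_le_of_norm_le_const fun S hS =>
    intervalIntegral.norm_integral_le_of_norm_le_const (hin S hS)
  norm_num at h2
  calc _ ≤ 1 / Λ * (R * 6 * 6) := by gcongr
    _ = _ := by ring

theorem exists_isSlowFamily {E : ℝ × ℝ → ℝ}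
    (hE : ∀ p : ℝ × ℝ, 0 < p.1 → 0 < p.2 → ContDiffAt ℝ ∞ E p) :
    ∃ P, IsSlowFamily P (fun A v => E (A, v)) fun A v => dirDeriv (1, 0) E (A, v) := by
  have h0 : ∀ {v : ℝ}, v ∈ Icc (2/5:ℝ) 23 → 0 < v := fun hv => by linarith [hv.1]
  have hK : ∀ p ∈ Icc (89/100:ℝ) (61/10) ×ˢ Icc (2/5:ℝ) 23, 0 < p.1 ∧ 0 < p.2 := fun p hp =>
    ⟨by linarith [hp.1.1], h0 hp.2⟩
  have hbd : ∀ {f : ℝ × ℝ → ℝ}, (∀ p : ℝ × ℝ, 0 < p.1 → 0 < p.2 → ContDiffAt ℝ ∞ f p) →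
      ∃ C, 0 < C ∧ ∀ p ∈ Icc (89/100:ℝ) (61/10) ×ˢ Icc (2/5:ℝ) 23, |f p| ≤ C := fun hf =>
    IsCompact.exists_abs_bound (isCompact_Icc.prod isCompact_Icc) fun p hp =>
      hf p (hK p hp).1 (hK p hp).2
  have hslow : ∀ {f : ℝ × ℝ → ℝ}, (∀ p : ℝ × ℝ, 0 < p.1 → 0 < p.2 → ContDiffAt ℝ ∞ f p) →
      ∃ C, 0 < C ∧ ∀ A ∈ Icc (89/100:ℝ) (61/10), IsSlowAmplitude C fun v => f (A, v) := by
    intro f hf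
    have hf' : ∀ p : ℝ × ℝ, 0 < p.1 → 0 < p.2 → ContDiffAt ℝ ∞ (dirDeriv (0, 1) f) p :=
      fun p h1 h2 => (hf p h1 h2).dirDeriv _
    obtain ⟨C₁, p1, b1⟩ := hbd hf
    obtain ⟨C₂, p2, b2⟩ := hbd hf'
    refine ⟨C₁ + C₂, by positivity, fun A hA => ⟨fun v => dirDeriv (0, 1) f (A, v), ?_, ?_⟩⟩
    · intro v hv
      exact ((hf' (A, v) (hK _ ⟨hA, hv⟩).1 (h0 hv)).continuousAt.comp
        (f := fun v => (A, v)) (by fun_prop)).continuousWithinAt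
    · refine fun v hv => ⟨?_, (b1 (A, v) ⟨hA, hv⟩).trans (by linarith),
        (b2 (A, v) ⟨hA, hv⟩).trans (by linarith)⟩
      exact ContDiffAt.hasDerivAt_comp_line (c := fun v => (A, v))
        (hf (A, v) (hK _ ⟨hA, hv⟩).1 (h0 hv)) ((hasDerivAt_const v A).prodMk (hasDerivAt_id v))
  have hE' : ∀ p : ℝ × ℝ, 0 < p.1 → 0 < p.2 → ContDiffAt ℝ ∞ (dirDeriv (1, 0) E) p :=
    fun p h1 h2 => (hE p h1 h2).dirDeriv _
  obtain ⟨C₁, p1, s1⟩ := hslow hE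
  obtain ⟨C₂, p2, s2⟩ := hslow hE'
  have mono : ∀ {P : ℝ} {β : ℝ → ℝ}, P ≤ 24 * (C₁ + C₂) → IsSlowAmplitude P β →
      IsSlowAmplitude (24 * (C₁ + C₂)) β := fun h ⟨β', hc, hb⟩ =>
    ⟨β', hc, fun v hv => ⟨(hb v hv).1, (hb v hv).2.1.trans h, (hb v hv).2.2.trans h⟩⟩
  refine ⟨24 * (C₁ + C₂), by positivity, ?_, ?_, ?_, ?_, ?_, ?_⟩
  · exact fun p hp => (hE p hp.1 (h0 hp.2)).continuousAt.continuousWithinAt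
  · exact fun p hp => (hE' p hp.1 (h0 hp.2)).continuousAt.continuousWithinAt
  · intro A hA v hv
    exact ContDiffAt.hasDerivAt_comp_line (c := fun A => (A, v)) (hE (A, v) hA (h0 hv))
      ((hasDerivAt_id A).prodMk (hasDerivAt_const A v))
  · exact fun A hA => mono (by linarith) (s1 A hA)
  · exact fun A hA => mono (by linarith) (s2 A hA)
  · exact fun A hA => mono (by linarith) (s1 A hA).id_mul

/-- The amplitude in the variables `(A, v)`, `v = η A^{3/2}`. -/
noncomputable def slowWeight (ψ ψ₃ : ℝ → ℝ) (A v : ℝ) : ℝ :=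
  (v / A ^ ((3:ℝ)/2)) ^ 2 * ψ (v / A ^ ((3:ℝ)/2)) * ψ₃ A / A ^ ((3:ℝ)/2)

theorem exists_isSlowFamily_slowWeight {ψ ψ₃ : ℝ → ℝ} (hψ : ContDiff ℝ ∞ ψ)
    (hψ₃ : ContDiff ℝ ∞ ψ₃) (k : ℕ) :
    ∃ P e', IsSlowFamily P (fun A v => slowWeight ψ ψ₃ A v / v ^ k) e' := by
  obtain ⟨P, h⟩ := exists_isSlowFamily (E := fun p => slowWeight ψ ψ₃ p.1 p.2 / p.2 ^ k)
    fun p h1 h2 => by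
      have hσ : ContDiffAt ℝ ∞ (fun p : ℝ × ℝ => p.1 ^ ((3:ℝ)/2)) p :=
        contDiffAt_fst.rpow_const_of_ne h1.ne'
      have hσ0 := (Real.rpow_pos_of_pos h1 ((3:ℝ)/2)).ne'
      have hv := contDiffAt_snd.div hσ hσ0
      unfold slowWeight
      exact (((((hv.pow 2).mul (hψ.contDiffAt.comp p hv)).mul
        (hψ₃.contDiffAt.comp p contDiffAt_fst)).div hσ hσ0).div
        (contDiffAt_snd.pow k) (pow_ne_zero k h2.ne'))
  exact ⟨P, _, h⟩

/-- Rescaling the frequency at fixed `A` turns the frequency integral into `slowOsc`. -/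
theorem frequency_integral_eq_slowOsc {ψ ψ₃ : ℝ → ℝ} (hψs : tsupport ψ ⊆ Icc (1/2) (3/2))
    (hψ₃s : tsupport ψ₃ ⊆ Icc (9/10) 6) {L : ℝ → ℝ} {a n lam T X Y S u A : ℝ} (hA : 0 < A) :
    ∫ η in (1/2:ℝ)..(3/2), cexp (I * ((η * lam * Y +
        frequencyPhase L a n (η * lam) T X S u A : ℝ) : ℂ)) * ((η ^ 2 * ψ η * ψ₃ A : ℝ) : ℂ) =
      slowOsc (Bfun L) lam n (slowWeight ψ ψ₃ A) (mixPhase a n T Y A (launchPhase X S u A)) := by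
  by_cases h3 : ψ₃ A = 0
  · simp [slowOsc, slowWeight, h3]
  have hA' : A ∈ Icc (9/10:ℝ) 6 := hψ₃s (subset_tsupport _ h3)
  have hσ : 0 < A ^ ((3:ℝ)/2) := Real.rpow_pos_of_pos hA _
  have hσ1 : 4 / 5 ≤ A ^ ((3:ℝ)/2) := (rpow_three_halves_bounds (by linarith [hA'.1])
    (by linarith [hA'.2])).1
  have hσ2 : A ^ ((3:ℝ)/2) ≤ 15 := by
    rw [rpow_three_halves_eq hA]
    have : √A ≤ 5 / 2 := Real.sqrt_le_iff.2 ⟨by norm_num, by linarith [hA'.2]⟩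
    nlinarith [hA'.2, Real.sqrt_nonneg A]
  set f : ℝ → ℂ := fun η => cexp (I * ((η * lam * Y +
    frequencyPhase L a n (η * lam) T X S u A : ℝ) : ℂ)) * ((η ^ 2 * ψ η * ψ₃ A : ℝ) : ℂ) with hf
  have hz : ∀ {η : ℝ}, η ∉ Icc (1/2:ℝ) (3/2) → ψ η = 0 := fun h =>
    image_eq_zero_of_notMem_tsupport fun h' => h (hψs h')
  have key := intervalIntegral.integral_comp_div (a := (1/2:ℝ) * A ^ ((3:ℝ)/2))
    (b := 3/2 * A ^ ((3:ℝ)/2)) f hσ.ne'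
  rw [mul_div_cancel_right₀ _ hσ.ne', mul_div_cancel_right₀ _ hσ.ne'] at key
  rw [← inv_smul_eq_iff₀ hσ.ne'] at key
  rw [← key, ← intervalIntegral.integral_smul]
  unfold slowOsc
  rw [intervalIntegral.integral_of_le (by linarith), intervalIntegral.integral_of_le (by norm_num),
    ← integral_Icc_eq_integral_Ioc, ← integral_Icc_eq_integral_Ioc]
  have hsub : Icc (1/2 * A ^ ((3:ℝ)/2)) (3/2 * A ^ ((3:ℝ)/2)) ⊆ Icc (2/5) 23 :=
    Icc_subset_Icc (by linarith) (by linarith)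
  refine Eq.trans ?_ (setIntegral_eq_of_subset_of_forall_sdiff_eq_zero measurableSet_Icc hsub ?_).symm
  · refine setIntegral_congr_fun measurableSet_Icc fun v hv => ?_
    have hB : v / A ^ ((3:ℝ)/2) * lam * A ^ ((3:ℝ)/2) = lam * v := by field_simp
    simp only [hf, frequencyPhase, hB, mixPhase, launchPhase, slowWeight, Complex.real_smul]
    generalize A ^ ((3:ℝ)/2) = σ at *
    rw [mul_left_comm]
    congr 1
    · congr 3
      field_simp
      ring
    · push_cast
      field_simp
  · intro v hv
    have hψ0 : ψ (v / A ^ ((3:ℝ)/2)) = 0 := hz fun h => hv.2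
      ⟨by linarith [(le_div_iff₀ hσ).1 h.1], by linarith [(div_le_iff₀ hσ).1 h.2]⟩
    simp [slowWeight, hψ0]

/-- The `A`-derivative of `frequencyPhase`, divided by `Λ n`. -/
noncomputable def earlySlope (B₁ : ℝ → ℝ) (a n Λ T S y A : ℝ) : ℝ :=
  -((S + y) / n) + T / n * (√(1 + a) / (2 * √(1 + a * A))) - 2 * √A +
    3 / 2 * (B₁ (Λ * A ^ ((3:ℝ)/2)) * √A)

noncomputable def earlySlope' (B₁ B₂ : ℝ → ℝ) (a n Λ T A : ℝ) : ℝ :=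
  T / n * -(√(1 + a) * a / (4 * √(1 + a * A) ^ 3)) - 2 * (1 / (2 * √A)) +
    3 / 2 * (B₂ (Λ * A ^ ((3:ℝ)/2)) * (Λ * (3 / 2 * √A)) * √A +
      B₁ (Λ * A ^ ((3:ℝ)/2)) * (1 / (2 * √A)))

theorem hasDerivAt_frequencyPhase {L B₁ : ℝ → ℝ} {a n Λ T X S y A : ℝ}
    (hB1 : ∀ u, 0 < u → HasDerivAt (Bfun L) (B₁ u) u) (ha : 0 < a) (hn : n ≠ 0) (hΛ : 0 < Λ)
    (hA : 0 < A) : HasDerivAt (fun A => frequencyPhase L a n Λ T X S y A)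
      (Λ * n * earlySlope B₁ a n Λ T S y A) A := by
  have hσ := hasDerivAt_rpow_three_halves hA
  have hB := (hB1 (Λ * A ^ ((3:ℝ)/2)) (mul_pos hΛ (Real.rpow_pos_of_pos hA _))).comp A
    (hσ.const_mul Λ)
  have h1 : ∀ c : ℝ, HasDerivAt (fun A => c - A) (-1) A := fun c => by
    simpa using (hasDerivAt_id A).const_sub c
  refine ((((((((h1 X).const_mul y).const_add (y ^ 3 / 3)).add_const (S ^ 3 / 3)).add
    ((h1 1).const_mul S)).add ((hasDerivAt_travelTime ha hA).const_mul T)).sub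
    (hσ.const_mul (4 / 3 * n))).const_mul Λ |>.add (hB.const_mul n)).congr_deriv ?_
  unfold earlySlope
  have hρ := one_lt_sqrt_one_add_mul ha hA
  field_simp
  ring

theorem hasDerivAt_earlySlope {B₁ B₂ : ℝ → ℝ} {a n Λ T S y A : ℝ}
    (hB2 : ∀ u, 0 < u → HasDerivAt B₁ (B₂ u) u) (ha : 0 < a) (hΛ : 0 < Λ) (hA : 0 < A) :
    HasDerivAt (earlySlope B₁ a n Λ T S y) (earlySlope' B₁ B₂ a n Λ T A) A := by
  have hB := (hB2 (Λ * A ^ ((3:ℝ)/2)) (mul_pos hΛ (Real.rpow_pos_of_pos hA _))).comp A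
    ((hasDerivAt_rpow_three_halves hA).const_mul Λ)
  exact ((((hasDerivAt_travelTime_deriv ha hA).const_mul (T / n)).const_add _).sub
    ((hasDerivAt_sqrt_self hA).const_mul 2)).add
    ((hB.mul (hasDerivAt_sqrt_self hA)).const_mul (3 / 2))

theorem continuousOn_earlySlope' {B₁ B₂ : ℝ → ℝ} {a n Λ T : ℝ}
    (hB2 : ∀ u, 0 < u → HasDerivAt B₁ (B₂ u) u) (hB2c : ContinuousOn B₂ (Ioi 0)) (ha : 0 < a)
    (hΛ : 0 < Λ) : ContinuousOn (earlySlope' B₁ B₂ a n Λ T) (Ioi 0) := by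
  have hu : ContinuousOn (fun A : ℝ => Λ * A ^ ((3:ℝ)/2)) (Ioi 0) :=
    continuousOn_const.mul (continuousOn_id.rpow_const fun _ _ => Or.inr (by norm_num))
  have hm : MapsTo (fun A : ℝ => Λ * A ^ ((3:ℝ)/2)) (Ioi 0) (Ioi 0) := fun A hA =>
    mul_pos hΛ (Real.rpow_pos_of_pos hA _)
  have h1 : ContinuousOn B₁ (Ioi 0) := fun u hu => (hB2 u hu).continuousAt.continuousWithinAt
  have hs := Real.continuous_sqrt.continuousOn (s := Ioi 0)
  have hi : ContinuousOn (fun A : ℝ => 1 / (2 * √A)) (Ioi 0) :=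
    continuousOn_const.div (continuousOn_const.mul hs) fun A hA =>
      (mul_pos two_pos (sqrt_pos.2 hA)).ne'
  unfold earlySlope'
  refine ((continuousOn_const.mul ?_).sub (continuousOn_const.mul hi)).add
    (continuousOn_const.mul ((((hB2c.comp hu hm).mul (by fun_prop)).mul hs).add
      ((h1.comp hu hm).mul hi)))
  refine (continuousOn_const.div (by fun_prop) fun A hA => ?_).neg
  have := one_lt_sqrt_one_add_mul ha hA
  positivity

theorem earlySlope_bounds {B₁ B₂ : ℝ → ℝ} {C a n Λ T S y A : ℝ} (hC : 0 ≤ C)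
    (hBb : ∀ u, 1 ≤ u → |B₁ u| ≤ C / u ^ 2 ∧ |B₂ u| ≤ C / u ^ 3) (ha : 0 < a) (ha' : a ≤ 1 / 200)
    (hn : 1000 ≤ |n|) (hΛ : 200 * (C + 1) ≤ Λ) (hT : |T| ≤ |n| / 2) (hS : |S| ≤ 3) (hy : |y| ≤ 3)
    (hA : A ∈ Icc (89/100:ℝ) (61/10)) :
    earlySlope B₁ a n Λ T S y A ≤ -1 ∧ earlySlope' B₁ B₂ a n Λ T A ≤ 0 := by
  obtain ⟨s1, s2⟩ := rpow_three_halves_bounds hA.1 hA.2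
  have hA0 : 0 < A := by linarith [hA.1]
  obtain ⟨k1, k2, k3, k4⟩ := sqrt_one_add_bounds ha ha' hA0 (by linarith [hA.2])
  have hr := (sqrt_one_add_div_bounds ha ha' hA0 (by linarith [hA.2])).2.1
  have q1 : 94 / 100 ≤ √A := Real.le_sqrt_of_sq_le (by linarith [hA.1])
  have q2 : √A ≤ 5 / 2 := Real.sqrt_le_iff.2 ⟨by norm_num, by linarith [hA.2]⟩
  have q3 : √A * √A = A := Real.mul_self_sqrt hA0.le
  have hn0 : 0 < |n| := by linarith
  have hτ : |T / n| ≤ 1 / 2 := by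
    rw [abs_div, div_le_iff₀ hn0]
    linarith
  have hπ : |(S + y) / n| ≤ 6 / 1000 := by
    rw [abs_div, div_le_iff₀ hn0]
    linarith [abs_add_le S y]
  set u := Λ * A ^ ((3:ℝ)/2) with hu
  have hΛ0 : 0 < Λ := by linarith
  have hu1 : 4 / 5 * Λ ≤ u := by
    rw [hu, mul_comm]
    gcongr
  have hu0 : 160 * (C + 1) ≤ u := by linarith
  have hupos : 0 < u := by linarith
  obtain ⟨b1, b2⟩ := hBb u (by linarith)
  have hu2 : 25600 * C ≤ u ^ 2 := by nlinarith
  have c1 : |B₁ u| ≤ 1 / 25600 := b1.trans (by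
    rw [div_le_div_iff₀ (by positivity) (by norm_num)]
    linarith)
  have c2 : Λ * |B₂ u| ≤ 1 / 20480 := by
    calc Λ * |B₂ u| ≤ (5 / 4 * u) * (C / u ^ 3) := by
          gcongr
          linarith
      _ = 5 / 4 * (C / u ^ 2) := by field_simp
      _ ≤ 5 / 4 * (1 / 25600) := by
          gcongr ?_ * ?_
          rw [div_le_div_iff₀ (by positivity) (by norm_num)]
          linarith
      _ = _ := by norm_num
  have c1' := abs_le.1 c1
  constructor
  · have h1 : |T / n * (√(1 + a) / (2 * √(1 + a * A)))| ≤ 1 / 2 * (201 / 400) := by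
      rw [abs_mul]
      have : |√(1 + a) / (2 * √(1 + a * A))| ≤ 201 / 400 := by
        rw [abs_of_pos (by positivity)]
        have : √(1 + a) / (2 * √(1 + a * A)) = √(1 + a) / √(1 + a * A) / 2 := by field_simp
        linarith
      gcongr
    have h2 : B₁ u * √A ≤ 1 / 1000 :=
      (mul_le_mul_of_nonneg_right c1'.2 (by positivity)).trans (by linarith)
    unfold earlySlope
    rw [← hu]
    linarith [(abs_le.1 hπ).1, (abs_le.1 h1).2]
  · have h1 : |T / n * -(√(1 + a) * a / (4 * √(1 + a * A) ^ 3))| ≤ 1 / 2 * (1 / 400) := by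
      rw [abs_mul, abs_neg, abs_of_pos (by positivity : 0 < √(1 + a) * a / (4 * √(1 + a * A) ^ 3))]
      have : √(1 + a) * a / (4 * √(1 + a * A) ^ 3) ≤ 1 / 400 := by
        rw [div_le_iff₀ (by positivity)]
        nlinarith [one_le_pow₀ k3.le (n := 3)]
      gcongr
    have hi : 2 / 5 ≤ 1 / √A := by
      rw [le_div_iff₀ (by linarith)]
      linarith
    have hi' : 1 / √A ≤ 2 := by
      rw [div_le_iff₀ (by linarith)]
      linarith
    have hhalf : 1 / (2 * √A) = 1 / √A / 2 := by
      field_simp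
    have h2 : B₂ u * (Λ * (3 / 2 * √A)) * √A ≤ 1 / 1000 := by
      have e : B₂ u * (Λ * (3 / 2 * √A)) * √A = 3 / 2 * A * (Λ * B₂ u) := by
        linear_combination (3 / 2 * Λ * B₂ u) * q3
      have : Λ * B₂ u ≤ 1 / 20480 :=
        (mul_le_mul_of_nonneg_left (le_abs_self _) hΛ0.le).trans c2
      rw [e]
      exact (mul_le_mul_of_nonneg_left this (by positivity)).trans (by linarith [hA.2])
    unfold earlySlope'
    rw [← hu, hhalf]
    have h3 : B₁ u * (1 / √A / 2) ≤ 1 / 1000 :=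
      (mul_le_mul_of_nonneg_right c1'.2 (by positivity)).trans (by linarith)
    linarith [(abs_le.1 h1).2]

theorem norm_early_time_integral_le {L B₁ B₂ : ℝ → ℝ} {C M P a n Λ T X : ℝ} {χ₂ : ℝ × ℝ → ℝ}
    {ψ₃ : ℝ → ℝ} (hC : 0 ≤ C) (hB1 : ∀ u, 0 < u → HasDerivAt (Bfun L) (B₁ u) u)
    (hB2 : ∀ u, 0 < u → HasDerivAt B₁ (B₂ u) u) (hB2c : ContinuousOn B₂ (Ioi 0))
    (hBb : ∀ u, 1 ≤ u → |B₁ u| ≤ C / u ^ 2 ∧ |B₂ u| ≤ C / u ^ 3) (bχ : ∀ p, |χ₂ p| ≤ M)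
    (hψ₃ : ContDiff ℝ ∞ ψ₃) (bψ : ∀ A, |ψ₃ A| ≤ P ∧ |dirDeriv 1 ψ₃ A| ≤ P) (ha : 0 < a)
    (ha' : a ≤ 1 / 200) (hn : 1000 ≤ |n|) (hΛ : 200 * (C + 1) ≤ Λ) (hT : |T| ≤ |n| / 2) :
    ‖∫ S in (-3:ℝ)..3, ∫ y in (-3:ℝ)..3, ∫ A in (89/100:ℝ)..(61/10),
      cexp (I * (frequencyPhase L a n Λ T X S y A : ℂ)) * ((χ₂ (S, y) * ψ₃ A : ℝ) : ℂ)‖ ≤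
      36 * (3 / (Λ * |n|) * (7 * (M * P))) := by
  have hab : (89/100:ℝ) ≤ 61/10 := by norm_num
  have h33 : (-3:ℝ) ≤ 3 := by norm_num
  have hΛ0 : 0 < Λ := by linarith
  have hn0 : 0 < |n| := by linarith
  have hn1 : n ≠ 0 := abs_pos.1 hn0
  have hpos : ∀ A ∈ Icc (89/100:ℝ) (61/10), 0 < A := fun A hA => by linarith [hA.1]
  have hM : 0 ≤ M := (abs_nonneg _).trans (bχ 0)
  have hP : 0 ≤ P := (abs_nonneg _).trans (bψ 0).1
  have hin : ∀ S ∈ uIoc (-3:ℝ) 3, ∀ y ∈ uIoc (-3:ℝ) 3, ‖∫ A in (89/100:ℝ)..(61/10),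
      cexp (I * (frequencyPhase L a n Λ T X S y A : ℂ)) * ((χ₂ (S, y) * ψ₃ A : ℝ) : ℂ)‖ ≤
      3 / (Λ * |n|) * (7 * (M * P)) := fun S hS y hy => by
    rw [uIoc_of_le h33] at hS hy
    have hS' : |S| ≤ 3 := abs_le.2 ⟨hS.1.le, hS.2⟩
    have hy' : |y| ≤ 3 := abs_le.2 ⟨hy.1.le, hy.2⟩
    have hb := fun A hA => earlySlope_bounds (B₁ := B₁) (B₂ := B₂) (A := A) hC hBb ha ha' hn hΛ hT
      hS' hy' hA
    have hd := fun A hA => hasDerivAt_frequencyPhase (X := X) (S := S) (y := y) (T := T) hB1 ha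
      hn1 hΛ0 (hpos A hA)
    refine (norm_integral_mul_le_const (K := 3 / (Λ * |n|)) (W₀ := M * P) (W₁ := M * P)
      (w' := fun A => ((χ₂ (S, y) * dirDeriv 1 ψ₃ A : ℝ) : ℂ)) hab ?_
      (fun A _ => ((hψ₃.hasDerivAt_dirDeriv_one A).const_mul _).ofReal_comp) ?_ (fun x hx => ?_)
      (fun A _ => ?_) fun A _ => ?_).trans ?_
    · exact fun A hA => ((hd A hA).ofReal_comp.const_mul I).cexp.continuousAt.continuousWithinAt
    · have := (hψ₃.dirDeriv 1).continuous
      fun_prop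
    · have hsub : Icc (89/100) x ⊆ Icc (89/100:ℝ) (61/10) := Icc_subset_Icc_right hx.2
      refine vdC_one hx.1 (by positivity) (fun A hA => hd A (hsub hA)) (fun A hA =>
        (hasDerivAt_earlySlope hB2 ha hΛ0 (hpos A (hsub hA))).const_mul (Λ * n)) ?_ ?_ ?_
      · exact continuousOn_const.mul ((continuousOn_earlySlope' hB2 hB2c ha hΛ0).mono
          fun A hA => hpos A (hsub hA))
      all_goals rcases lt_or_gt_of_ne hn1 with h | h
      · refine Or.inl fun A hA => ?_
        have := (hb A (hsub hA)).1
        rw [abs_of_neg h]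
        nlinarith [mul_neg_of_pos_of_neg hΛ0 h]
      · refine Or.inr fun A hA => ?_
        have := (hb A (hsub hA)).1
        rw [abs_of_pos h]
        nlinarith [mul_pos hΛ0 h]
      · exact Or.inl fun A hA => mul_nonneg_of_nonpos_of_nonpos
          (mul_neg_of_pos_of_neg hΛ0 h).le (hb A (hsub hA)).2
      · exact Or.inr fun A hA => mul_nonpos_of_nonneg_of_nonpos
          (mul_pos hΛ0 h).le (hb A (hsub hA)).2
    · rw [norm_real, Real.norm_eq_abs, abs_mul]
      exact mul_le_mul (bχ _) (bψ A).1 (abs_nonneg _) hM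
    · rw [norm_real, Real.norm_eq_abs, abs_mul]
      exact mul_le_mul (bχ _) (bψ A).2 (abs_nonneg _) hM
    · have : 0 ≤ M * P := by positivity
      gcongr
      linarith
  have h2 := intervalIntegral.norm_integral_le_of_norm_le_const fun S hS =>
    intervalIntegral.norm_integral_le_of_norm_le_const (hin S hS)
  refine h2.trans (le_of_eq ?_)
  rw [show |(3:ℝ) - -3| = 6 by norm_num]
  ring

theorem setIntegral_Icc_prod {E : Type*} [TopologicalSpace E] [T2Space E] [SecondCountableTopology E]
    [MeasureSpace E] [OpensMeasurableSpace E] [SFinite (volume : Measure E)]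
    [IsFiniteMeasureOnCompacts ((volume : Measure ℝ).prod (volume : Measure E))]
    {f : ℝ × E → ℂ} {a b : ℝ} {K : Set E} (hab : a ≤ b) (hK : IsCompact K) (hf : Continuous f) :
    ∫ z in Icc a b ×ˢ K, f z = ∫ x in a..b, ∫ y in K, f (x, y) := by
  rw [intervalIntegral.integral_of_le hab, ← integral_Icc_eq_integral_Ioc]
  exact setIntegral_prod _ (hf.continuousOn.integrableOn_compact (isCompact_Icc.prod hK))

/-- The integral of a continuous function supported in a box, as an iterated integral. -/
theorem integral_eq_iterated_of_box {f : ℝ × ℝ × ℝ × ℝ → ℂ} {a b a' b' : ℝ} (hab : a ≤ b)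
    (hab' : a' ≤ b') (hf : Continuous f) (h₀ : ∀ v, f v ≠ 0 → v.1 ∈ Icc a b ∧
      v.2.1 ∈ Icc (-3) 3 ∧ v.2.2.1 ∈ Icc (-3) 3 ∧ v.2.2.2 ∈ Icc a' b') :
    ∫ v, f v = ∫ x in a..b, ∫ S in (-3:ℝ)..3, ∫ u in (-3:ℝ)..3, ∫ y in a'..b', f (x, S, u, y) := by
  have h3 : (-3:ℝ) ≤ 3 := by norm_num
  have hK : IsCompact (Icc (-3:ℝ) 3 ×ˢ Icc a' b') := isCompact_Icc.prod isCompact_Icc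
  rw [← setIntegral_eq_integral_of_forall_compl_eq_zero
    (s := Icc a b ×ˢ Icc (-3) 3 ×ˢ Icc (-3) 3 ×ˢ Icc a' b') fun v hv => not_not.1 fun h => hv (h₀ v h),
    setIntegral_Icc_prod hab (isCompact_Icc.prod hK) hf]
  refine integral_congr fun x _ => ?_
  refine (setIntegral_Icc_prod h3 hK (f := fun z => f (x, z)) (by fun_prop)).trans
    (integral_congr fun S _ => ?_)
  refine (setIntegral_Icc_prod h3 isCompact_Icc (f := fun z => f (x, S, z)) (by fun_prop)).trans
    (integral_congr fun u _ => ?_)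
  simp only [intervalIntegral.integral_of_le hab', integral_Icc_eq_integral_Ioc]

theorem integral_comp_last_first (f : ℝ × ℝ × ℝ × ℝ → ℂ) :
    ∫ v : ℝ × ℝ × ℝ × ℝ, f (v.2.2.2, v.1, v.2.1, v.2.2.1) = ∫ w, f w := by
  have h : MeasurePreserving ((MeasurableEquiv.prodAssoc (α := ℝ) (β := ℝ) (γ := ℝ × ℝ)).symm.trans
      (MeasurableEquiv.prodAssoc.symm.trans (MeasurableEquiv.prodComm.trans
        (MeasurableEquiv.prodCongr (.refl ℝ) (MeasurableEquiv.prodAssoc (β := ℝ)))))) :=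
    ((((MeasurePreserving.id volume).prod volume_preserving_prodAssoc).comp
      Measure.measurePreserving_swap).comp volume_preserving_prodAssoc.symm).comp
      volume_preserving_prodAssoc.symm
  exact h.integral_comp' f

theorem integral_comp_swap_last (f : ℝ × ℝ × ℝ × ℝ → ℂ) :
    ∫ v : ℝ × ℝ × ℝ × ℝ, f (v.1, v.2.1, v.2.2.2, v.2.2.1) = ∫ w, f w := by
  have h : MeasurePreserving (MeasurableEquiv.prodCongr (.refl ℝ) (MeasurableEquiv.prodCongr
      (.refl ℝ) (MeasurableEquiv.prodComm (α := ℝ) (β := ℝ)))) :=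
    (MeasurePreserving.id volume).prod ((MeasurePreserving.id volume).prod
      Measure.measurePreserving_swap)
  exact h.integral_comp' f

/-- The oscillatory integral in `Wtan`, without its prefactor. -/
noncomputable def waveIntegral (L ψ : ℝ → ℝ) (χ₂ : ℝ × ℝ → ℝ) (ψ₃ : ℝ → ℝ) (a n lam T X Y : ℝ) :
    ℂ :=
  ∫ v : ℝ × ℝ × ℝ × ℝ, cexp (I * ((v.2.2.2 * lam * Y +
    frequencyPhase L a n (v.2.2.2 * lam) T X v.1 v.2.1 v.2.2.1 : ℝ) : ℂ)) *
      ((v.2.2.2 ^ 2 * ψ v.2.2.2 * χ₂ (v.1, v.2.1) * ψ₃ v.2.2.1 : ℝ) : ℂ)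

theorem Wtan_eq_waveIntegral {L ψ ψ₃ : ℝ → ℝ} {χ₂ : ℝ × ℝ → ℝ} {h a T X Y : ℝ} {N : ℤ} (hh : 0 < h)
    (ha : 0 < a) : Wtan L ψ χ₂ ψ₃ h a N T X Y = ((a ^ 2 / (2 * π * h) ^ 3 : ℝ) : ℂ) *
      waveIntegral L ψ χ₂ ψ₃ a N (a ^ ((3:ℝ)/2) / h) T X Y := by
  have : 0 < a ^ ((3:ℝ)/2) / h := div_pos (Real.rpow_pos_of_pos ha _) hh
  unfold Wtan waveIntegral
  congr 1
  refine integral_congr_ae (Eventually.of_forall fun v => ?_)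
  dsimp only
  congr 4
  unfold PsiTan frequencyPhase travelTime
  field_simp
  ring

section Orders

variable {L ψ ψ₃ : ℝ → ℝ} {χ₂ : ℝ × ℝ → ℝ} {a n lam T X Y : ℝ}

theorem continuous_waveIntegrand (hL : Continuous L) (hψ : Continuous ψ) (hχ₂ : Continuous χ₂)
    (hψ₃ : Continuous ψ₃) (ha : 0 < a) : Continuous fun v : ℝ × ℝ × ℝ × ℝ =>
      cexp (I * ((v.2.2.2 * lam * Y +
        frequencyPhase L a n (v.2.2.2 * lam) T X v.1 v.2.1 v.2.2.1 : ℝ) : ℂ)) *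
      ((v.2.2.2 ^ 2 * ψ v.2.2.2 * χ₂ (v.1, v.2.1) * ψ₃ v.2.2.1 : ℝ) : ℂ) := by
  have hσ : Continuous fun A : ℝ => A ^ ((3:ℝ)/2) := Real.continuous_rpow_const (by norm_num)
  have hB : Continuous (Bfun L) := by
    have := hL.comp (Real.continuous_rpow_const (q := 2 / 3) (by norm_num))
    exact ((continuous_const.mul continuous_id).add continuous_const).sub this
  have ht : Continuous (travelTime a) := by
    unfold travelTime
    exact Continuous.div (by fun_prop) (by fun_prop) fun A => by positivity
  unfold frequencyPhase
  fun_prop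

theorem waveIntegrand_support (hψs : tsupport ψ ⊆ Icc (1/2) (3/2))
    (hψ₃s : tsupport ψ₃ ⊆ Icc (9/10) 6) (hχ₂s : tsupport χ₂ ⊆ {p : ℝ × ℝ | |p.1| < 3 ∧ |p.2| < 3})
    {z : ℂ} {S u A η : ℝ} (h : z * ((η ^ 2 * ψ η * χ₂ (S, u) * ψ₃ A : ℝ) : ℂ) ≠ 0) :
    (S ∈ Icc (-3) 3 ∧ u ∈ Icc (-3) 3) ∧ A ∈ Icc (89/100:ℝ) (61/10) ∧ η ∈ Icc (1/2) (3/2) := by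
  have h' : η ^ 2 * ψ η * χ₂ (S, u) * ψ₃ A ≠ 0 := fun h0 => h (by rw [h0]; simp)
  obtain ⟨⟨⟨-, h1⟩, h2⟩, h3⟩ := by simpa only [mul_ne_zero_iff] using h'
  obtain ⟨hS, hu⟩ := hχ₂s (subset_tsupport _ h2)
  have hA := hψ₃s (subset_tsupport _ h3)
  exact ⟨⟨abs_le.1 hS.le, abs_le.1 hu.le⟩, ⟨by linarith [hA.1], by linarith [hA.2]⟩,
    hψs (subset_tsupport _ h1)⟩

theorem waveIntegral_eq_frequency_outside (hL : Continuous L) (hψ : Continuous ψ)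
    (hχ₂ : Continuous χ₂) (hψ₃ : Continuous ψ₃) (ha : 0 < a) (hψs : tsupport ψ ⊆ Icc (1/2) (3/2))
    (hψ₃s : tsupport ψ₃ ⊆ Icc (9/10) 6)
    (hχ₂s : tsupport χ₂ ⊆ {p : ℝ × ℝ | |p.1| < 3 ∧ |p.2| < 3}) :
    waveIntegral L ψ χ₂ ψ₃ a n lam T X Y = ∫ η in (1/2:ℝ)..(3/2),
      cexp (I * ((η * lam * Y : ℝ) : ℂ)) * ((η ^ 2 * ψ η : ℝ) : ℂ) *
        ∫ S in (-3:ℝ)..3, ∫ u in (-3:ℝ)..3, ∫ A in (89/100:ℝ)..(61/10),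
          cexp (I * (frequencyPhase L a n (η * lam) T X S u A : ℂ)) *
            ((χ₂ (S, u) * ψ₃ A : ℝ) : ℂ) := by
  refine (integral_comp_last_first fun w => cexp (I * ((w.1 * lam * Y +
    frequencyPhase L a n (w.1 * lam) T X w.2.1 w.2.2.1 w.2.2.2 : ℝ) : ℂ)) *
      ((w.1 ^ 2 * ψ w.1 * χ₂ (w.2.1, w.2.2.1) * ψ₃ w.2.2.2 : ℝ) : ℂ)).trans ?_
  have hc := continuous_waveIntegrand (n := n) (lam := lam) (T := T) (X := X) (Y := Y) hL hψ hχ₂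
    hψ₃ ha
  refine (integral_eq_iterated_of_box (a := 1 / 2) (b := 3 / 2) (a' := 89 / 100) (b' := 61 / 10)
    (by norm_num) (by norm_num)
    (hc.comp (f := fun w : ℝ × ℝ × ℝ × ℝ => (w.2.1, w.2.2.1, w.2.2.2, w.1)) (by fun_prop))
    fun w hw => by
      obtain ⟨⟨h1, h2⟩, h3, h4⟩ := waveIntegrand_support hψs hψ₃s hχ₂s hw
      exact ⟨h4, h1, h2, h3⟩).trans ?_
  simp only [← intervalIntegral.integral_const_mul]
  refine integral_congr fun η _ => integral_congr fun S _ =>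
    integral_congr fun u _ => integral_congr fun A _ => ?_
  simp only [Function.comp, Complex.ofReal_add, mul_add, Complex.exp_add]
  push_cast
  ring

theorem waveIntegral_eq_slowOsc (hL : Continuous L) (hψ : Continuous ψ)
    (hχ₂ : Continuous χ₂) (hψ₃ : Continuous ψ₃) (ha : 0 < a) (hψs : tsupport ψ ⊆ Icc (1/2) (3/2))
    (hψ₃s : tsupport ψ₃ ⊆ Icc (9/10) 6)
    (hχ₂s : tsupport χ₂ ⊆ {p : ℝ × ℝ | |p.1| < 3 ∧ |p.2| < 3}) :
    waveIntegral L ψ χ₂ ψ₃ a n lam T X Y = ∫ A in (89/100:ℝ)..(61/10), ∫ S in (-3:ℝ)..3,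
      ∫ u in (-3:ℝ)..3, (χ₂ (S, u) : ℂ) * slowOsc (Bfun L) lam n (slowWeight ψ ψ₃ A)
        (mixPhase a n T Y A (launchPhase X S u A)) := by
  refine (integral_comp_swap_last fun w => cexp (I * ((w.2.2.1 * lam * Y +
    frequencyPhase L a n (w.2.2.1 * lam) T X w.1 w.2.1 w.2.2.2 : ℝ) : ℂ)) *
      ((w.2.2.1 ^ 2 * ψ w.2.2.1 * χ₂ (w.1, w.2.1) * ψ₃ w.2.2.2 : ℝ) : ℂ)).trans ?_
  refine (integral_comp_last_first fun w => cexp (I * ((w.2.2.2 * lam * Y +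
    frequencyPhase L a n (w.2.2.2 * lam) T X w.2.1 w.2.2.1 w.1 : ℝ) : ℂ)) *
      ((w.2.2.2 ^ 2 * ψ w.2.2.2 * χ₂ (w.2.1, w.2.2.1) * ψ₃ w.1 : ℝ) : ℂ)).trans ?_
  have hc := continuous_waveIntegrand (n := n) (lam := lam) (T := T) (X := X) (Y := Y) hL hψ hχ₂
    hψ₃ ha
  refine (integral_eq_iterated_of_box (a := 89 / 100) (b := 61 / 10) (a' := 1 / 2) (b' := 3 / 2)
    (by norm_num) (by norm_num)
    (hc.comp (f := fun w : ℝ × ℝ × ℝ × ℝ => (w.2.1, w.2.2.1, w.1, w.2.2.2)) (by fun_prop))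
    fun w hw => by
      obtain ⟨⟨h1, h2⟩, h3, h4⟩ := waveIntegrand_support hψs hψ₃s hχ₂s hw
      exact ⟨h3, h1, h2, h4⟩).trans ?_
  refine integral_congr fun A hA => integral_congr fun S _ =>
    integral_congr fun u _ => ?_
  rw [uIcc_of_le (by norm_num)] at hA
  rw [← frequency_integral_eq_slowOsc hψs hψ₃s (by linarith [hA.1] : 0 < A),
    ← intervalIntegral.integral_const_mul]
  refine integral_congr fun η _ => ?_
  simp only [Function.comp]
  push_cast
  ring

end Orders

theorem norm_waveIntegral_le {L ψ ψ₃ : ℝ → ℝ} {χ₂ : ℝ × ℝ → ℝ} {a n lam T X Y P R : ℝ}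
    (hL : Continuous L) (hψ : Continuous ψ)
    (hχ₂ : Continuous χ₂) (hψ₃ : Continuous ψ₃) (ha : 0 < a) (hψs : tsupport ψ ⊆ Icc (1/2) (3/2))
    (hψ₃s : tsupport ψ₃ ⊆ Icc (9/10) 6)
    (hχ₂s : tsupport χ₂ ⊆ {p : ℝ × ℝ | |p.1| < 3 ∧ |p.2| < 3}) (bψ : ∀ η, |ψ η| ≤ P)
    (hR : ∀ η ∈ Icc (1/2:ℝ) (3/2), ‖∫ S in (-3:ℝ)..3, ∫ u in (-3:ℝ)..3,
      ∫ A in (89/100:ℝ)..(61/10), cexp (I * (frequencyPhase L a n (η * lam) T X S u A : ℂ)) *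
        ((χ₂ (S, u) * ψ₃ A : ℝ) : ℂ)‖ ≤ R) :
    ‖waveIntegral L ψ χ₂ ψ₃ a n lam T X Y‖ ≤ 9 / 4 * P * R := by
  rw [waveIntegral_eq_frequency_outside hL hψ hχ₂ hψ₃ ha hψs hψ₃s hχ₂s]
  refine (intervalIntegral.norm_integral_le_of_norm_le_const (C := 9 / 4 * P * R)
    fun η hη => ?_).trans (by norm_num)
  rw [uIoc_of_le (by norm_num)] at hη
  rw [norm_mul, norm_mul, norm_exp_I_mul, one_mul, norm_real, Real.norm_eq_abs, abs_mul,
    abs_of_nonneg (sq_nonneg η)]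
  have h2 : η ^ 2 ≤ 9 / 4 := by nlinarith [hη.1, hη.2]
  have := (abs_nonneg _).trans (bψ η)
  exact mul_le_mul (mul_le_mul h2 (bψ η) (abs_nonneg _) (by norm_num)) (hR η ⟨hη.1.le, hη.2⟩)
    (norm_nonneg _) (by positivity)

/-- The weights in `exists_fixed_frequency_bound`, in terms of `m = λ ^ (1/6)` only. -/
theorem fixed_frequency_bookkeeping {R K T n m η q : ℝ} (hR : 0 ≤ R) (hm : 4 ≤ m)
    (hη : η ∈ Icc (1/2:ℝ) (3/2)) (hn : m ^ 2 ≤ |n|) (hq4 : q ^ 4 = |n| * |T - 4 * n|)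
    (h : ∀ ℓ, 2 ≤ ℓ → ℓ ^ 6 = η * m ^ 6 → ℓ ^ 2 / 2 ≤ |n| → R * (η * m ^ 6 * √|n| * ℓ) ≤ K ∧
      ∀ d, 0 ≤ d → d ^ 4 = |T / (4 * n) - 1| → R * (η * m ^ 6 * √|n| * ℓ ^ 2 * d) ≤ K) :
    R * (m ^ 8 * (√|n| / m + q)) ≤ 20 * K := by
  have hm0 : 0 < m := by linarith
  have hn0 : 0 < |n| := lt_of_lt_of_le (by positivity) hn
  have hη0 : 0 < η := by linarith [hη.1]
  have h6 : ((η * m ^ 6) ^ ((1:ℝ)/6)) ^ 6 = η * m ^ 6 := by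
    rw [← rpow_natCast, ← rpow_mul (by positivity)]
    norm_num
  set ℓ := (η * m ^ 6) ^ ((1:ℝ)/6)
  have hℓ0 : 0 ≤ ℓ := by positivity
  have hm6 : 0 < m ^ 6 := by positivity
  have hℓ : m / 2 ≤ ℓ := le_of_pow_le_pow_left₀ (by norm_num : 6 ≠ 0) hℓ0 (by
    rw [h6, div_pow]
    nlinarith [hη.1])
  have hℓ2 : ℓ ^ 2 ≤ 2 * m ^ 2 := le_of_pow_le_pow_left₀ (by norm_num : 3 ≠ 0) (by positivity) (by
    rw [← pow_mul, h6, mul_pow, ← pow_mul]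
    norm_num
    nlinarith [hη.2])
  obtain ⟨h1, h2⟩ := h ℓ (by linarith) h6 (by linarith)
  set d := |T / (4 * n) - 1| ^ ((1:ℝ)/4)
  have hd4 : d ^ 4 = |T / (4 * n) - 1| := by
    rw [← rpow_natCast, ← rpow_mul (abs_nonneg _)]
    norm_num
  have hd0 : 0 ≤ d := by positivity
  have hqd : q ≤ 2 * (√|n| * d) := by
    refine le_of_pow_le_pow_left₀ (by norm_num : 4 ≠ 0) (by positivity) ?_
    have e : T - 4 * n = (T / (4 * n) - 1) * (4 * n) := by
      have := abs_pos.1 hn0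
      field_simp
    have e4 : √|n| ^ 4 = |n| ^ 2 := by rw [show 4 = 2 * 2 from rfl, pow_mul, sq_sqrt hn0.le]
    rw [hq4, e, abs_mul, abs_mul, ← hd4, mul_pow, mul_pow, e4, abs_of_pos (four_pos (α := ℝ))]
    nlinarith [show 0 ≤ |n| ^ 2 * d ^ 4 by positivity]
  have k1 : R * (m ^ 8 * (√|n| / m)) ≤ 4 * K :=
    calc R * (m ^ 8 * (√|n| / m)) = 4 * (R * (1 / 2 * m ^ 6 * √|n| * (m / 2))) := by
          field_simp
          ring
      _ ≤ 4 * (R * (η * m ^ 6 * √|n| * ℓ)) := by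
          gcongr
          exact hη.1
      _ ≤ _ := by linarith
  have k2 : R * (m ^ 8 * q) ≤ 16 * K :=
    calc R * (m ^ 8 * q) ≤ R * (m ^ 8 * (2 * (√|n| * d))) := by gcongr
      _ = 16 * (R * (1 / 2 * m ^ 6 * √|n| * (m / 2) ^ 2 * d)) := by ring
      _ ≤ 16 * (R * (η * m ^ 6 * √|n| * ℓ ^ 2 * d)) := by
          gcongr
          exact hη.1
      _ ≤ _ := by linarith [h2 d hd0 hd4]
  linarith

theorem exists_late_time_bound {L ψ ψ₃ B₁ B₂ : ℝ → ℝ} {χ₂ : ℝ × ℝ → ℝ} {c₀ : ℝ} (hL : Continuous L)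
    (hB : IsSlowlyConvex c₀ (Bfun L) B₁ B₂) (hψ : ContDiff ℝ ∞ ψ)
    (hχ₂ : ContDiff ℝ ∞ χ₂) (hχ₂c : HasCompactSupport χ₂) (hψ₃ : ContDiff ℝ ∞ ψ₃)
    (hψs : tsupport ψ ⊆ Icc (1/2) (3/2)) (hψ₃s : tsupport ψ₃ ⊆ Icc (9/10) 6)
    (hχ₂s : tsupport χ₂ ⊆ {p : ℝ × ℝ | |p.1| < 3 ∧ |p.2| < 3}) :
    ∃ K, 0 ≤ K ∧ ∀ a T X Y n m : ℝ, 0 < a → a ≤ 1 / 200 → 3 ≤ m → m ^ 6 ≤ 2 * |T| →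
      |n| ≤ 2 * |T| → n ≠ 0 → 0 ≤ X →
      ‖waveIntegral L ψ χ₂ ψ₃ a n (m ^ 6) T X Y‖ * (m ^ 4 * |n|) ≤ K := by
  obtain ⟨Q, hQ, hq⟩ := hχ₂.isMixedAmplitude hχ₂c
  obtain ⟨M₀, hM₀, b₀⟩ := hχ₂c.exists_abs_bound hχ₂.continuous
  obtain ⟨M₁, hM₁, b₁⟩ := (hχ₂c.dirDeriv (0, 1)).exists_abs_bound (hχ₂.dirDeriv (0, 1)).continuous
  obtain ⟨P, e', he⟩ := exists_isSlowFamily_slowWeight hψ hψ₃ 1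
  obtain ⟨P', f', hf⟩ := exists_isSlowFamily_slowWeight hψ hψ₃ 2
  simp only [pow_one] at he
  simp only [pow_two] at hf
  have hP := he.nonneg
  have hP' := hf.nonneg
  have hc := hB.pos
  set K₁ := 40000 * 784 * (30000 / √c₀) * (81 * P) * Q with hK₁
  set K₂ := 36 * 500000 * 2 * (M₀ + M₁) * (30000 / √c₀) * P' with hK₂
  refine ⟨18 * K₁ + 2 * K₂, by positivity, fun a T X Y n m ha ha' hm hmT hnT hn hX => ?_⟩
  have hm0 : 0 < m := by linarith
  have hm6 : 3 ^ 6 ≤ m ^ 6 := pow_le_pow_left₀ (by norm_num) hm 6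
  have hT : 50 ≤ |T| := by linarith
  have hn0 : 0 < |n| := abs_pos.2 hn
  have hr : √(m ^ 6) / √|n| / √(m ^ 6 * |T|) * |n| ≤ 2 := by
    have hT0 : 0 < |T| := by linarith
    rw [Real.sqrt_mul (by positivity)]
    have h1 : √|n| ≤ 2 * √|T| := Real.sqrt_le_iff.2 ⟨by positivity, by
      rw [mul_pow, sq_sqrt (abs_nonneg _)]
      linarith⟩
    have h2 : √(m ^ 6) / √|n| / (√(m ^ 6) * √|T|) * |n| = √|n| / √|T| := by
      nth_rewrite 2 [← Real.mul_self_sqrt hn0.le]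
      field_simp
    rw [h2]
    exact (div_le_iff₀ (sqrt_pos.2 hT0)).2 h1
  rw [waveIntegral_eq_slowOsc hL hψ.continuous hχ₂.continuous hψ₃.continuous ha hψs hψ₃s hχ₂s]
  set r := √(m ^ 6) / √|n| / √(m ^ 6 * |T|) with hrd
  have hr0 : 0 ≤ r := by positivity
  have e : ∀ (k : ℕ) A M, slowOsc (Bfun L) (m ^ 6) n (slowWeight ψ ψ₃ A) M =
      slowOsc (Bfun L) (m ^ 6) n (fun v => v ^ k * (slowWeight ψ ψ₃ A v / v ^ k)) M :=
    fun k A M => integral_congr fun v hv => by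
      rw [uIcc_of_le (by norm_num)] at hv
      have : v ≠ 0 := by linarith [hv.1]
      simp only [mul_div_cancel₀ _ (pow_ne_zero k this)]
  rcases le_total X 20 with hX' | hX'
  · simp only [e 1, pow_one]
    have hk3 : ((16:ℝ) ^ ((1:ℝ)/3)) ^ 3 = 16 := by
      rw [← rpow_natCast, ← rpow_mul (by norm_num)]
      norm_num
    set k := (16:ℝ) ^ ((1:ℝ)/3)
    have hk0 : 0 < k := by positivity
    have hk : k ≤ 3 := le_of_pow_le_pow_left₀ (by norm_num : 3 ≠ 0) (by norm_num) (by
      rw [hk3]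
      norm_num)
    have key := norm_mixed_launch_integral_le (Y := Y) (ε := k / m ^ 2) hB he (by linarith) hn
      (by positivity) (by rw [div_pow, hk3]; field_simp) ha ha' hT hmT hX hX' hq
    refine (mul_le_mul_of_nonneg_right key (by positivity)).trans ?_
    have : 40000 * (784 * (30000 / √c₀ * (81 * P) * (√(m ^ 6) / √|n|)) * Q * (k / m ^ 2) ^ 2) /
        √(m ^ 6 * |T|) * (m ^ 4 * |n|) = K₁ * k ^ 2 * (r * |n|) := by
      rw [hK₁, hrd]
      field_simp
    rw [this]
    calc K₁ * k ^ 2 * (r * |n|) ≤ K₁ * 3 ^ 2 * 2 := by gcongr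
      _ ≤ _ := by
        have : 0 ≤ K₂ := by positivity
        linarith
  · simp only [e 2, pow_two, mul_assoc]
    have key := norm_far_launch_integral_le (Λ := m ^ 6) (Y := Y) (M := M₀ + M₁) (χ := fun s u => χ₂ (s, u))
      (χu := fun s u => dirDeriv (0, 1) χ₂ (s, u)) hB hf (by linarith) hn ha ha' hT hX'
      hχ₂.continuous (hχ₂.dirDeriv (0, 1)).continuous
      (fun s u => hχ₂.contDiffAt.hasDerivAt_comp_line (c := fun u => (s, u))
        ((hasDerivAt_const u s).prodMk (hasDerivAt_id u)))
      (fun s u => by linarith [b₀ (s, u)]) (fun s u => by linarith [b₁ (s, u)])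
      (fun s => eq_zero_of_three_le hχ₂s (Or.inr (by norm_num)))
      (fun s => eq_zero_of_three_le hχ₂s (Or.inr (by norm_num)))
    refine (mul_le_mul_of_nonneg_right key (by positivity)).trans ?_
    have : 36 / m ^ 6 * (500000 * (2 * (M₀ + M₁) * (30000 / √c₀ * P' * (√(m ^ 6) / √|n|))) /
        √(m ^ 6 * |T|)) * (m ^ 4 * |n|) = K₂ * (1 / m ^ 2) * (r * |n|) := by
      rw [hK₂, hrd]
      field_simp
    rw [this]
    calc K₂ * (1 / m ^ 2) * (r * |n|) ≤ K₂ * 1 * 2 := by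
          gcongr
          rw [div_le_one (by positivity)]
          nlinarith
      _ ≤ _ := by
        have : 0 ≤ K₁ := by positivity
        linarith

theorem norm_Wtan_le {L ψ ψ₃ : ℝ → ℝ} {χ₂ : ℝ × ℝ → ℝ} {h a T X Y : ℝ} {N : ℤ} (hh : 0 < h)
    (ha : 0 < a) : ‖Wtan L ψ χ₂ ψ₃ h a N T X Y‖ ≤
      h ^ ((1:ℝ)/3) / h ^ 2 * (((a ^ ((3:ℝ)/2) / h) ^ ((1:ℝ)/3)) ^ 4 *
        ‖waveIntegral L ψ χ₂ ψ₃ a N (a ^ ((3:ℝ)/2) / h) T X Y‖) := by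
  rw [Wtan_eq_waveIntegral hh ha, norm_mul, norm_real, Real.norm_of_nonneg (by positivity),
    ← mul_assoc, Real.div_rpow (by positivity) hh.le, ← rpow_mul ha.le,
    show (3:ℝ) / 2 * (1 / 3) = 1 / 2 by norm_num, ← Real.sqrt_eq_rpow]
  gcongr
  have hg : (h ^ ((1:ℝ)/3)) ^ 3 = h := by
    rw [← rpow_natCast, ← rpow_mul hh.le]
    norm_num
  set g := h ^ ((1:ℝ)/3)
  have hg0 : 0 < g := by positivity
  rw [div_pow, show √a ^ 4 = a ^ 2 by rw [show 4 = 2 * 2 from rfl, pow_mul, sq_sqrt ha.le],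
    show g / h ^ 2 * (a ^ 2 / g ^ 4) = a ^ 2 / h ^ 3 by rw [← hg]; field_simp]
  gcongr
  nlinarith [Real.pi_gt_three]

end Estimates

/-- dispersive bounds for `W_{N,a}` for large `N`:
(i) `λ^{1/3} ≤ |N| ≤ λ`; (ii) `λ ≤ |N| ≤ 2a^{−1/2}`. -/
theorem dispersion_tangential_largeN
    (Ai : ℂ → ℂ)
    (hAi_diff : Differentiable ℂ Ai)
    (hAi_diff' : Differentiable ℂ (deriv Ai))
    (hAi_ode : ∀ z : ℂ, deriv (deriv Ai) z = z * Ai z)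
    (hAi_zero : Ai 0 = (3 : ℂ) ^ (-(2 : ℂ)/3) / Complex.Gamma (2/3))
    (hAi_zero' : deriv Ai 0 = -((3 : ℂ) ^ (-(1 : ℂ)/3)) / Complex.Gamma (1/3))
    (hAi_real : ∀ x : ℝ, (Ai x).im = 0)
    (L : ℝ → ℝ)
    (hL_cont : Continuous L)
    (hL_zero : L 0 = Real.pi / 3)
    (hAp_ne : ∀ w : ℝ, Aplus Ai w ≠ 0)
    (hL_char : ∀ w : ℝ, Complex.exp (-(L w : ℂ) * Complex.I) = -(Aminus Ai w) / (Aplus Ai w))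
    (ψ : ℝ → ℝ) (hψ : ContDiff ℝ (⊤ : ℕ∞) ψ) (hψs : tsupport ψ ⊆ Set.Icc (1/2 : ℝ) (3/2))
    (χ₂ : ℝ × ℝ → ℝ) (hχ₂ : ContDiff ℝ (⊤ : ℕ∞) χ₂) (hχ₂c : HasCompactSupport χ₂)
    (hχ₂s : tsupport χ₂ ⊆ {p : ℝ × ℝ | |p.1| < 3 ∧ |p.2| < 3})
    (ψ₃ : ℝ → ℝ) (hψ₃ : ContDiff ℝ (⊤ : ℕ∞) ψ₃) (hψ₃s : tsupport ψ₃ ⊆ Set.Icc (9/10 : ℝ) 6)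
    : ∃ a₀ ∈ Set.Ioo (0:ℝ) 1, ∃ lam₀ : ℝ, 8 ≤ lam₀ ∧ ∃ C : ℝ,
      ∀ h a : ℝ, 0 < h → h ≤ 1 → 0 < a → a ≤ a₀ → lam₀ ≤ a ^ ((3:ℝ)/2) / h →
      ∀ X : ℝ, 0 ≤ X → ∀ Y T : ℝ, |T| ≤ 2 / Real.sqrt a →
        -- (i)  λ^{1/3} ≤ |N| ≤ λ
        (∀ N : ℤ, (a ^ ((3:ℝ)/2) / h) ^ ((1:ℝ)/3) ≤ |(N : ℝ)| →
          |(N : ℝ)| ≤ a ^ ((3:ℝ)/2) / h →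
          ‖Wtan L ψ χ₂ ψ₃ h a N T X Y‖
            ≤ C * (h ^ ((1:ℝ)/3) / h ^ 2) /
              ((|(N : ℝ)| / (a ^ ((3:ℝ)/2) / h) ^ ((1:ℝ)/3)) ^ ((1:ℝ)/2)
                + (|(N : ℝ)| * |T - 4 * (N : ℝ)|) ^ ((1:ℝ)/4))) ∧
        -- (ii)  λ ≤ |N| ≤ 2a^{−1/2}
        (∀ N : ℤ, a ^ ((3:ℝ)/2) / h ≤ |(N : ℝ)| → |(N : ℝ)| ≤ 2 / Real.sqrt a →
          ‖Wtan L ψ χ₂ ψ₃ h a N T X Y‖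
            ≤ C * h ^ ((1:ℝ)/3) * (a ^ ((3:ℝ)/2) / h) ^ ((2:ℝ)/3)
              / (h ^ 2 * |(N : ℝ)|)) := by
  obtain ⟨B₁, B₂, c, C, hc, hC, hB1, hB2, hB2c, hb⟩ := exists_Bfun_derivatives hAi_diff hAi_diff'
    hAi_ode hAi_zero hAi_zero' hL_cont hAp_ne hL_char
  have hBb : ∀ u, 1 ≤ u → |B₁ u| ≤ C / u ^ 2 ∧ |B₂ u| ≤ C / u ^ 3 := fun u hu => by
    obtain ⟨h1, h2, h3⟩ := hb u hu
    have : 0 ≤ c / u ^ 3 := by positivity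
    exact ⟨h1, abs_le.2 ⟨by linarith, h3⟩⟩
  obtain ⟨K, hK, hKb⟩ := exists_fixed_frequency_bound hC.le hB1 hB2 hB2c hBb hχ₂ hχ₂c hχ₂s hψ₃ hψ₃s
  obtain ⟨K', hK', hKb'⟩ := exists_late_time_bound hL_cont
    ⟨hc, hB1, hB2, hB2c, fun u hu => (hb u hu).2.1⟩ hψ hχ₂ hχ₂c hψ₃ hψs hψ₃s hχ₂s
  obtain ⟨M, hM, bχ⟩ := hχ₂c.exists_abs_bound hχ₂.continuous
  obtain ⟨P, hP, bψ⟩ := exists_derivative_bounds_of_tsupport_subset hψ hψs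
  obtain ⟨P₃, hP₃, bψ₃⟩ := exists_derivative_bounds_of_tsupport_subset hψ₃ hψ₃s
  refine ⟨1 / 200, ⟨by norm_num, by norm_num⟩, 10 ^ 9 + 400 * (C + 1), by linarith,
    45 * P * K + K' + 3402 * P * (M * P₃), fun h a hh _ ha ha' hlam X hX Y T _ => ?_⟩
  have hW := fun N : ℤ => norm_Wtan_le (L := L) (ψ := ψ) (χ₂ := χ₂) (ψ₃ := ψ₃) (T := T) (X := X)
    (Y := Y) (N := N) hh ha
  have hJ := fun (n R : ℝ) => norm_waveIntegral_le (n := n) (lam := a ^ ((3:ℝ)/2) / h) (T := T)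
    (X := X) (Y := Y) (R := R) hL_cont hψ.continuous hχ₂.continuous hψ₃.continuous ha hψs hψ₃s hχ₂s
    fun η => (bψ η).1
  have hl0 : 0 < a ^ ((3:ℝ)/2) / h := by positivity
  set lam := a ^ ((3:ℝ)/2) / h
  have hr3 : (lam ^ ((1:ℝ)/3)) ^ 3 = lam := by
    rw [← Real.rpow_natCast, ← Real.rpow_mul hl0.le]
    norm_num
  have hr2 : lam ^ ((2:ℝ)/3) = (lam ^ ((1:ℝ)/3)) ^ 2 := by
    rw [← Real.rpow_natCast, ← Real.rpow_mul hl0.le]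
    norm_num
  rw [hr2]
  set r := lam ^ ((1:ℝ)/3)
  have hr : 1000 ≤ r := le_of_pow_le_pow_left₀ (by norm_num : 3 ≠ 0) (by positivity) (by linarith)
  obtain ⟨m, hm, hmr⟩ : ∃ m, 0 ≤ m ∧ m ^ 2 = r := ⟨√r, by positivity, Real.sq_sqrt (by linarith)⟩
  have hm4 : 4 ≤ m := by nlinarith
  have hm6 : m ^ 6 = lam := by rw [← hr3, ← hmr]; ring
  set g := h ^ ((1:ℝ)/3)
  have hg : 0 ≤ g := by positivity
  refine ⟨fun N h1 h2 => ?_, fun N h1 _ => ?_⟩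
  · have hN : 0 < |(N:ℝ)| := by linarith
    rw [Real.div_rpow hN.le (by linarith), ← Real.sqrt_eq_rpow, ← Real.sqrt_eq_rpow, ← hmr,
      Real.sqrt_sq hm]
    have hq4 : ((|(N:ℝ)| * |T - 4 * N|) ^ ((1:ℝ)/4)) ^ 4 = |(N:ℝ)| * |T - 4 * N| := by
      rw [← Real.rpow_natCast, ← Real.rpow_mul (by positivity)]
      norm_num
    have hq : 0 ≤ (|(N:ℝ)| * |T - 4 * N|) ^ ((1:ℝ)/4) := by positivity
    set q := (|(N:ℝ)| * |T - 4 * N|) ^ ((1:ℝ)/4)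
    have hD : 0 < √|(N:ℝ)| / m + q := by positivity
    have key := hJ N (20 * K / (m ^ 8 * (√|(N:ℝ)| / m + q))) fun η hη => by
      rw [le_div_iff₀ (by positivity)]
      refine fixed_frequency_bookkeeping (norm_nonneg _) hm4 hη (hmr ▸ h1) hq4 fun ℓ hℓ hℓ6 hℓn => ?_
      rw [hm6] at hℓ6 ⊢
      exact hKb a T X N (η * lam) ℓ ha ha' (by linarith) (by nlinarith [hη.1]) hℓ hℓ6 hℓn
    calc _ ≤ g / h ^ 2 * (m ^ 8 * (9 / 4 * P *
          (20 * K / (m ^ 8 * (√|(N:ℝ)| / m + q))))) := by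
          refine (hW N).trans ?_
          rw [← hmr, ← pow_mul]
          gcongr
      _ = 45 * P * K * (g / h ^ 2) / (√|(N:ℝ)| / m + q) := by
          field_simp
          ring
      _ ≤ _ := by
          gcongr
          linarith [show 0 ≤ 3402 * P * (M * P₃) by positivity]
  · have hN : 0 < |(N:ℝ)| := by linarith
    suffices key : ‖waveIntegral L ψ χ₂ ψ₃ a N lam T X Y‖ * (m ^ 4 * |(N:ℝ)|) ≤
        45 * P * K + K' + 3402 * P * (M * P₃) by
      rw [← le_div_iff₀ (by positivity)] at key
      refine (hW N).trans ((mul_le_mul_of_nonneg_left (mul_le_mul_of_nonneg_left key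
        (by positivity)) (by positivity)).trans (le_of_eq ?_))
      rw [← hmr]
      field_simp
    have hK0 : 0 ≤ 45 * P * K := by positivity
    rcases le_total |T| (|(N:ℝ)| / 2) with hT | hT
    · have := hJ N (36 * (3 / (1 / 2 * lam * |(N:ℝ)|) * (7 * (M * P₃)))) fun η hη => by
        have hη' : 1 / 2 * lam ≤ η * lam := by
          gcongr
          exact hη.1
        refine (norm_early_time_integral_le hC.le hB1 hB2 hB2c hBb bχ hψ₃
          (fun A => ⟨(bψ₃ A).1, (bψ₃ A).2.1⟩) ha ha' (by linarith) (by linarith) hT).trans ?_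
        gcongr
      calc _ ≤ _ := mul_le_mul_of_nonneg_right this (by positivity)
        _ = 3402 * P * (M * P₃) * (1 / r) := by
          rw [← hm6, ← hmr]
          field_simp
          norm_num
        _ ≤ 3402 * P * (M * P₃) * 1 := by
          gcongr
          rw [div_le_one (by linarith)]
          linarith
        _ ≤ _ := by linarith
    · rw [← hm6]
      linarith [hKb' a T X Y N m ha ha' (by linarith) (by linarith) (by linarith)
        (abs_pos.1 hN) hX, show 0 ≤ 3402 * P * (M * P₃) by positivity]
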